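/- Let n ≥ 1 and α ∈ (1,∞). For every p ∈ (1,∞) and r ∈ [2,∞) there is a constant C such that for every Schwartz function f on ℝ^n and every λ > 0 one has ‖λ [N^{dyad}_{λ/3}(ℋf)]^{1/r}‖_{L^p(ℝ^n)} ≤ C ‖f‖_{L^p(ℝ^n)}, uniformly in λ, where N^{dyad}_λ(ℋf)(x) = N_λ{ℋ^{(2^{jα})}f(x) : j ∈ ℤ}. -/

import Mathlib

open MeasureTheory Filter Set Metric
open scoped ENNReal NNReal RealInnerProductSpace Topology

noncomputable section

/-- The `r`-variation norm of a family of complex numbers indexed by `J ⊆ ι`. -/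
def vNorm {ι : Type*} [LinearOrder ι] (r : ℝ) (J : Set ι) (a : ι → ℂ) : ℝ≥0∞ :=
  ⨆ (k : ℕ) (u : Fin (k + 1) → ι) (_ : StrictMono u) (_ : ∀ i, u i ∈ J),
    (∑ i : Fin k, (‖a (u i.succ) - a (u i.castSucc)‖₊ : ℝ≥0∞) ^ r) ^ (1 / r)

/-- Euclidean space ℝ^n. -/
abbrev En (n : ℕ) := EuclideanSpace ℝ (Fin n)

/-- The kernel K(x) = Ω(x)/|x|^n. -/
def czKernel (n : ℕ) (Ω : En n → ℝ) (x : En n) : ℝ := Ω x / ‖x‖ ^ n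

/-- The modulated singular integral ℋ^{(u)}f(x) = p.v.∫ f(x−t) e^{iu|t|^α} K(t) dt. -/
def pvH (n : ℕ) (α : ℝ) (Ω : En n → ℝ) (f : En n → ℂ) (u : ℝ) (x : En n) : ℂ :=
  limUnder (𝓝[>] (0 : ℝ)) fun ε =>
    ∫ t in {t : En n | ε < ‖t‖},
      f (x - t) * Complex.exp (Complex.I * (u : ℂ) * ((‖t‖ ^ α : ℝ) : ℂ)) *
        (czKernel n Ω t : ℂ)

def jumpCount {ι : Type*} [LinearOrder ι] (lam : ℝ) (J : Set ι) (a : ι → ℂ) : ℝ≥0∞ :=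
  ⨆ (N : ℕ) (s : Fin N → ι) (t : Fin N → ι) (_ : ∀ i, s i ∈ J) (_ : ∀ i, t i ∈ J)
    (_ : ∀ i, s i < t i) (_ : ∀ i j, i < j → t i < s j)
    (_ : ∀ i, lam < ‖a (t i) - a (s i)‖), (N : ℝ≥0∞)

/-! ### Dyadic cubes -/

/-- The half-open dyadic cube of generation `j` (side length `2 ^ (-j)`) containing `x`. -/
def dyadicCube {n : ℕ} (j : ℤ) (x : En n) : Set (En n) :=
  {y | ∀ i, ⌊(2 : ℝ) ^ j * y i⌋ = ⌊(2 : ℝ) ^ j * x i⌋}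

/-- The reciprocal of the volume of a dyadic cube of generation `j`. -/
def cubeDensity (n : ℕ) (j : ℤ) : ℝ := ((2 : ℝ) ^ j) ^ n

lemma cubeDensity_pos (n : ℕ) (j : ℤ) : 0 < cubeDensity n j := by
  unfold cubeDensity; positivity

lemma cubeDensity_succ (n : ℕ) (j : ℤ) :
    cubeDensity n (j + 1) = 2 ^ n * cubeDensity n j := by
  unfold cubeDensity
  rw [zpow_add_one₀ (by norm_num), mul_pow, mul_comm]

section Cubes

variable {n : ℕ} {i j : ℤ} {x y : En n}

lemma mem_dyadicCube_self (j : ℤ) (x : En n) : x ∈ dyadicCube j x := fun _ => rfl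

lemma mem_dyadicCube_comm : y ∈ dyadicCube j x ↔ x ∈ dyadicCube j y :=
  ⟨fun h i => (h i).symm, fun h i => (h i).symm⟩

lemma dyadicCube_eq_of_mem (h : y ∈ dyadicCube j x) : dyadicCube j y = dyadicCube j x := by
  ext z
  exact ⟨fun hz i => (hz i).trans (h i), fun hz i => (hz i).trans (h i).symm⟩

lemma dyadicCube_subset (h : i ≤ j) (x : En n) : dyadicCube j x ⊆ dyadicCube i x := by
  intro y hy a
  obtain ⟨d, rfl⟩ := Int.le.dest h
  have key : ∀ t : ℝ, ⌊(2 : ℝ) ^ i * t⌋ = ⌊(2 : ℝ) ^ (i + (d : ℤ)) * t⌋ / ((2 ^ d : ℕ) : ℤ) := by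
    intro t
    rw [← Int.floor_div_natCast]
    congr 1
    rw [zpow_add₀ (by norm_num), zpow_natCast]
    push_cast
    field_simp
  rw [key, key, hy a]

lemma measurable_dyadic_index (j : ℤ) (a : Fin n) :
    Measurable fun x : En n => ⌊(2 : ℝ) ^ j * x a⌋ := by
  apply Int.measurable_floor.comp
  fun_prop

lemma measurableSet_dyadicCube_prod (j : ℤ) :
    MeasurableSet {p : En n × En n | p.2 ∈ dyadicCube j p.1} := by
  have : {p : En n × En n | p.2 ∈ dyadicCube j p.1} =
      ⋂ a : Fin n, {p : En n × En n | ⌊(2 : ℝ) ^ j * p.2 a⌋ = ⌊(2 : ℝ) ^ j * p.1 a⌋} := by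
    ext p; simp [dyadicCube]
  rw [this]
  refine MeasurableSet.iInter fun a => measurableSet_eq_fun ?_ ?_
  · exact (measurable_dyadic_index j a).comp measurable_snd
  · exact (measurable_dyadic_index j a).comp measurable_fst

lemma measurableSet_dyadicCube (j : ℤ) (x : En n) : MeasurableSet (dyadicCube j x) :=
  measurable_prodMk_left (measurableSet_dyadicCube_prod j)

lemma dyadicCube_eq_pi (j : ℤ) (x : En n) :
    dyadicCube j x = (MeasurableEquiv.toLp 2 (Fin n → ℝ)).symm ⁻¹' (Set.univ.pi fun a =>
      Ico ((⌊(2 : ℝ) ^ j * x a⌋ : ℝ) * ((2 : ℝ) ^ j)⁻¹)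
        ((⌊(2 : ℝ) ^ j * x a⌋ + 1 : ℝ) * ((2 : ℝ) ^ j)⁻¹)) := by
  ext y
  have h2 : (0 : ℝ) < 2 ^ j := by positivity
  simp only [dyadicCube, mem_ofPred_eq, mem_preimage, Set.mem_pi, mem_univ, true_imp_iff, mem_Ico,
    Int.floor_eq_iff, ← div_eq_mul_inv, div_le_iff₀ h2, lt_div_iff₀ h2]
  refine forall_congr' fun a => ?_
  rw [mul_comm _ (y a)]
  rfl

lemma volume_dyadicCube (j : ℤ) (x : En n) :
    volume (dyadicCube j x) = ENNReal.ofReal (cubeDensity n j)⁻¹ := by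
  rw [dyadicCube_eq_pi, (EuclideanSpace.volume_preserving_symm_measurableEquiv_toLp
    (Fin n)).measure_preimage (MeasurableSet.univ_pi fun _ => measurableSet_Ico).nullMeasurableSet,
    Real.volume_pi_Ico]
  have : ∀ a : Fin n, ENNReal.ofReal ((⌊(2 : ℝ) ^ j * x a⌋ + 1 : ℝ) * ((2 : ℝ) ^ j)⁻¹ -
      (⌊(2 : ℝ) ^ j * x a⌋ : ℝ) * ((2 : ℝ) ^ j)⁻¹) = ENNReal.ofReal ((2 : ℝ) ^ j)⁻¹ := by
    intro a; congr 1; ring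
  simp only [this, Finset.prod_const, Finset.card_univ, Fintype.card_fin]
  rw [← ENNReal.ofReal_pow (by positivity), cubeDensity, inv_pow]

lemma ofReal_cubeDensity_mul_volume (j : ℤ) (x : En n) :
    ENNReal.ofReal (cubeDensity n j) * volume (dyadicCube j x) = 1 := by
  rw [volume_dyadicCube, ← ENNReal.ofReal_mul (cubeDensity_pos n j).le,
    mul_inv_cancel₀ (cubeDensity_pos n j).ne', ENNReal.ofReal_one]

lemma norm_le_sum_abs (x : En n) : ‖x‖ ≤ ∑ a, |x a| := by
  rw [EuclideanSpace.norm_eq]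
  apply Real.sqrt_le_iff.2 ⟨Finset.sum_nonneg fun _ _ => abs_nonneg _, ?_⟩
  simp only [Real.norm_eq_abs]
  exact Finset.sum_sq_le_sq_sum_of_nonneg fun _ _ => abs_nonneg _

lemma norm_sub_le_of_mem_dyadicCube (h : y ∈ dyadicCube j x) :
    ‖x - y‖ ≤ n * ((2 : ℝ) ^ j)⁻¹ := by
  have h2 : (0 : ℝ) < 2 ^ j := by positivity
  refine (norm_le_sum_abs _).trans ?_
  have : ∀ a ∈ Finset.univ, |(x - y) a| ≤ ((2 : ℝ) ^ j)⁻¹ := by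
    intro a _
    have := Int.abs_sub_lt_one_of_floor_eq_floor (h a)
    rw [← mul_sub, abs_mul, abs_of_pos h2] at this
    rw [PiLp.sub_apply, abs_sub_comm, ← one_div, le_div_iff₀ h2, mul_comm]
    exact this.le
  simpa using Finset.sum_le_card_nsmul _ _ _ this

end Cubes

/-! ### Stopping regions -/

/-- A measurable union `carrier` of pairwise disjoint dyadic cubes, the cube through `x` having
generation `level x`. -/
structure Stopping (n : ℕ) where
  carrier : Set (En n)
  level : En n → ℤ
  measurableSet_carrier : MeasurableSet carrier
  measurable_level : Measurable level
  stable : ∀ x ∈ carrier, ∀ y ∈ dyadicCube (level x) x, y ∈ carrier ∧ level y = level x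

namespace Stopping

variable {n : ℕ} (σ : Stopping n)

open Classical in
/-- The averaging kernel over the cubes of a stopping region. -/
def ker (x y : En n) : ℝ :=
  if x ∈ σ.carrier ∧ y ∈ dyadicCube (σ.level x) x then cubeDensity n (σ.level x) else 0

lemma ker_nonneg (x y : En n) : 0 ≤ σ.ker x y := by
  unfold ker; split_ifs
  · exact (cubeDensity_pos _ _).le
  · exact le_rfl

lemma ker_of_notMem {x : En n} (hx : x ∉ σ.carrier) (y : En n) : σ.ker x y = 0 := by
  simp [ker, hx]

lemma ker_eq_indicator {x : En n} (hx : x ∈ σ.carrier) (y : En n) :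
    σ.ker x y = (dyadicCube (σ.level x) x).indicator (fun _ => cubeDensity n (σ.level x)) y := by
  by_cases hy : y ∈ dyadicCube (σ.level x) x
  · rw [ker, if_pos ⟨hx, hy⟩, indicator_of_mem hy]
  · rw [ker, if_neg (fun h => hy h.2), indicator_of_notMem hy]

lemma ker_comm (x y : En n) : σ.ker x y = σ.ker y x := by
  by_cases h : x ∈ σ.carrier ∧ y ∈ dyadicCube (σ.level x) x
  · obtain ⟨hy, hl⟩ := σ.stable x h.1 y h.2
    have : x ∈ dyadicCube (σ.level y) y := by rw [hl]; exact mem_dyadicCube_comm.1 h.2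
    rw [ker, ker, if_pos h, if_pos ⟨hy, this⟩, hl]
  · have h' : ¬ (y ∈ σ.carrier ∧ x ∈ dyadicCube (σ.level y) y) := by
      intro h2
      obtain ⟨hx, hl⟩ := σ.stable y h2.1 x h2.2
      exact h ⟨hx, by rw [hl]; exact mem_dyadicCube_comm.1 h2.2⟩
    simp only [ker, h, h', if_false]

lemma measurable_ker : Measurable (Function.uncurry σ.ker) := by
  classical
  unfold ker Function.uncurry
  refine Measurable.ite ?_ ?_ measurable_const
  · have : {p : En n × En n | p.1 ∈ σ.carrier ∧ p.2 ∈ dyadicCube (σ.level p.1) p.1} =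
        (Prod.fst ⁻¹' σ.carrier) ∩ ⋃ j : ℤ, (Prod.fst ⁻¹' (σ.level ⁻¹' {j})) ∩
          {p : En n × En n | p.2 ∈ dyadicCube j p.1} := by
      ext p; simp
    rw [this]
    refine (measurable_fst σ.measurableSet_carrier).inter (MeasurableSet.iUnion fun j => ?_)
    exact (measurable_fst (σ.measurable_level (measurableSet_singleton j))).inter
      (measurableSet_dyadicCube_prod j)
  · exact (measurable_from_top (f := cubeDensity n)).comp (σ.measurable_level.comp measurable_fst)

lemma lintegral_ker_le (x : En n) : ∫⁻ y, ENNReal.ofReal (σ.ker x y) ≤ 1 := by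
  by_cases hx : x ∈ σ.carrier
  · simp_rw [σ.ker_eq_indicator hx]
    have : ∀ y, ENNReal.ofReal ((dyadicCube (σ.level x) x).indicator
        (fun _ => cubeDensity n (σ.level x)) y) = (dyadicCube (σ.level x) x).indicator
        (fun _ => ENNReal.ofReal (cubeDensity n (σ.level x))) y := by
      intro y; by_cases hy : y ∈ dyadicCube (σ.level x) x <;> simp [hy]
    simp_rw [this]
    rw [lintegral_indicator (measurableSet_dyadicCube _ _), lintegral_const,
      Measure.restrict_apply_univ, ofReal_cubeDensity_mul_volume]
  · simp [σ.ker_of_notMem hx]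

lemma lintegral_ker_eq {x : En n} (hx : x ∈ σ.carrier) (F : En n → ℝ≥0∞) :
    ∫⁻ y, ENNReal.ofReal (σ.ker x y) * F y =
      ENNReal.ofReal (cubeDensity n (σ.level x)) * ∫⁻ y in dyadicCube (σ.level x) x, F y := by
  rw [← lintegral_const_mul' _ _ ENNReal.ofReal_ne_top,
    ← lintegral_indicator (measurableSet_dyadicCube _ _)]
  refine lintegral_congr fun y => ?_
  rw [σ.ker_eq_indicator hx]
  by_cases hy : y ∈ dyadicCube (σ.level x) x <;> simp [hy]

lemma ker_eq_of_mem {x x' : En n} (hx : x ∈ σ.carrier) (h : x' ∈ dyadicCube (σ.level x) x)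
    (y : En n) : σ.ker x' y = σ.ker x y := by
  obtain ⟨hx', hl⟩ := σ.stable x hx x' h
  rcases em (y ∈ dyadicCube (σ.level x) x) with hy | hy
  · rw [ker, ker, if_pos ⟨hx', by rwa [hl, dyadicCube_eq_of_mem h]⟩, if_pos ⟨hx, hy⟩, hl]
  · rw [ker, ker,
      if_neg fun h' => hy (by have := h'.2; rwa [hl, dyadicCube_eq_of_mem h] at this),
      if_neg fun h' => hy h'.2]

/-- Averaging over a stopping region preserves the integral over the region. -/
lemma lintegral_average (F : En n → ℝ≥0∞) (hF : AEMeasurable F) :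
    ∫⁻ x, ∫⁻ y, ENNReal.ofReal (σ.ker x y) * F y = ∫⁻ y in σ.carrier, F y := by
  rw [lintegral_lintegral_swap]
  · have : ∀ y, ∫⁻ x, ENNReal.ofReal (σ.ker x y) * F y = σ.carrier.indicator F y := by
      intro y
      by_cases hy : y ∈ σ.carrier
      · rw [lintegral_mul_const, indicator_of_mem hy]
        · simp_rw [σ.ker_comm _ y]
          have := σ.lintegral_ker_eq hy (fun _ => 1)
          simp only [mul_one, lintegral_const, Measure.restrict_apply_univ, one_mul] at this
          rw [this, ofReal_cubeDensity_mul_volume, one_mul]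
        · exact (σ.measurable_ker.of_uncurry_right).ennreal_ofReal
      · simp [σ.ker_comm _ y, σ.ker_of_notMem hy, hy]
    simp_rw [this]
    rw [lintegral_indicator σ.measurableSet_carrier]
  · exact (σ.measurable_ker.ennreal_ofReal.aemeasurable).mul hF.comp_snd

end Stopping

/-! ### Schur kernels -/

/-- Square integrable functions on `ℝⁿ`. -/
abbrev L2 (n : ℕ) (H : Type*) [NormedAddCommGroup H] := Lp H 2 (volume : Measure (En n))

/-- Measurable kernels with uniformly bounded row and column integrals. -/
structure SchurKernel (n : ℕ) where
  toFun : En n → En n → ℂ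
  measurable_toFun : Measurable (Function.uncurry toFun)
  bound : ℝ≥0
  row_le : ∀ x, ∫⁻ y, ‖toFun x y‖ₑ ≤ bound
  col_le : ∀ y, ∫⁻ x, ‖toFun x y‖ₑ ≤ bound

lemma sq_lintegral_mul_le {α : Type*} [MeasurableSpace α] {μ : Measure α} {k F : α → ℝ≥0∞}
    (hk : AEMeasurable k μ) (hF : AEMeasurable F μ) :
    (∫⁻ y, k y * F y ∂μ) ^ (2 : ℝ) ≤ (∫⁻ y, k y ∂μ) * ∫⁻ y, k y * F y ^ (2 : ℝ) ∂μ := by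
  have h := ENNReal.lintegral_mul_le_Lp_mul_Lq μ (p := 2) (q := 2) (by constructor <;> norm_num)
    (f := fun y => k y ^ (1 / 2 : ℝ)) (g := fun y => k y ^ (1 / 2 : ℝ) * F y)
    (hk.pow_const _) ((hk.pow_const _).mul hF)
  have e1 : ∀ y, ((fun y => k y ^ (1 / 2 : ℝ)) * fun y => k y ^ (1 / 2 : ℝ) * F y) y
      = k y * F y := by
    intro y
    simp only [Pi.mul_apply]
    rw [← mul_assoc, ← ENNReal.rpow_add_of_nonneg _ _ (by norm_num) (by norm_num)]
    norm_num
  simp_rw [e1] at h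
  have e2 : ∀ y, (k y ^ (1 / 2 : ℝ)) ^ (2 : ℝ) = k y := by
    intro y; rw [← ENNReal.rpow_mul]; norm_num
  have e3 : ∀ y, (k y ^ (1 / 2 : ℝ) * F y) ^ (2 : ℝ) = k y * F y ^ (2 : ℝ) := by
    intro y; rw [ENNReal.mul_rpow_of_nonneg _ _ (by norm_num), e2]
  simp_rw [e2, e3] at h
  calc _ ≤ ((∫⁻ y, k y ∂μ) ^ (1 / 2 : ℝ) * (∫⁻ y, k y * F y ^ (2 : ℝ) ∂μ) ^ (1 / 2 : ℝ)) ^ (2 : ℝ) :=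
        ENNReal.rpow_le_rpow h (by norm_num)
    _ = _ := by
        rw [ENNReal.mul_rpow_of_nonneg _ _ (by norm_num), ← ENNReal.rpow_mul, ← ENNReal.rpow_mul]
        norm_num

namespace SchurKernel

variable {n : ℕ} (κ : SchurKernel n)

/-- The integral operator with a given Schur kernel. -/
def op (f : En n → ℂ) (x : En n) : ℂ := ∫ y, κ.toFun x y * f y

lemma measurable_row (x : En n) : Measurable (κ.toFun x) :=
  κ.measurable_toFun.of_uncurry_left

lemma measurable_col (y : En n) : Measurable fun x => κ.toFun x y :=
  κ.measurable_toFun.of_uncurry_right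

lemma op_congr {f g : En n → ℂ} (h : f =ᵐ[volume] g) : κ.op f = κ.op g := by
  ext x
  refine integral_congr_ae ?_
  filter_upwards [h] with y hy
  rw [hy]

lemma aestronglyMeasurable_op {f : En n → ℂ} (hf : AEStronglyMeasurable f volume) :
    AEStronglyMeasurable (κ.op f) volume := by
  rw [κ.op_congr hf.ae_eq_mk]
  refine StronglyMeasurable.aestronglyMeasurable ?_
  refine StronglyMeasurable.integral_prod_right (f := fun x y => κ.toFun x y * hf.mk f y) ?_
  exact κ.measurable_toFun.stronglyMeasurable.mul
    (hf.stronglyMeasurable_mk.comp_measurable measurable_snd)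

lemma enorm_op_le (f : En n → ℂ) (x : En n) :
    ‖κ.op f x‖ₑ ≤ ∫⁻ y, ‖κ.toFun x y‖ₑ * ‖f y‖ₑ := by
  refine (enorm_integral_le_lintegral_enorm _).trans_eq ?_
  simp_rw [enorm_mul]

lemma lintegral_lintegral_le {C : ℝ≥0∞} (hC : ∀ y, ∫⁻ x, ‖κ.toFun x y‖ₑ ≤ C)
    {F : En n → ℝ≥0∞} (hF : AEMeasurable F) :
    ∫⁻ x, ∫⁻ y, ‖κ.toFun x y‖ₑ * F y ≤ C * ∫⁻ y, F y := by
  rw [lintegral_lintegral_swap]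
  · calc _ ≤ ∫⁻ y, C * F y := by
          refine lintegral_mono fun y => ?_
          rw [lintegral_mul_const _ (κ.measurable_col y).enorm]
          gcongr
          exact hC y
      _ = _ := lintegral_const_mul'' _ hF
  · exact κ.measurable_toFun.enorm.aemeasurable.mul hF.comp_snd

lemma lintegral_enorm_op_le {C : ℝ≥0∞} (hC : ∀ y, ∫⁻ x, ‖κ.toFun x y‖ₑ ≤ C)
    {f : En n → ℂ} (hf : AEStronglyMeasurable f volume) :
    ∫⁻ x, ‖κ.op f x‖ₑ ≤ C * ∫⁻ y, ‖f y‖ₑ :=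
  (lintegral_mono fun x => κ.enorm_op_le f x).trans (κ.lintegral_lintegral_le hC hf.enorm)

lemma lintegral_sq_le {C₁ C₂ : ℝ≥0∞} (h₁ : ∀ x, ∫⁻ y, ‖κ.toFun x y‖ₑ ≤ C₁)
    (h₂ : ∀ y, ∫⁻ x, ‖κ.toFun x y‖ₑ ≤ C₂) {F : En n → ℝ≥0∞} (hF : AEMeasurable F) :
    ∫⁻ x, (∫⁻ y, ‖κ.toFun x y‖ₑ * F y) ^ (2 : ℝ) ≤ C₁ * C₂ * ∫⁻ y, F y ^ (2 : ℝ) := by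
  calc _ ≤ ∫⁻ x, C₁ * ∫⁻ y, ‖κ.toFun x y‖ₑ * F y ^ (2 : ℝ) := by
        refine lintegral_mono fun x => ?_
        refine (sq_lintegral_mul_le (κ.measurable_row x).enorm.aemeasurable hF).trans ?_
        gcongr
        exact h₁ x
    _ = C₁ * ∫⁻ x, ∫⁻ y, ‖κ.toFun x y‖ₑ * F y ^ (2 : ℝ) := by
        refine lintegral_const_mul'' _ ?_
        exact (κ.measurable_toFun.enorm.aemeasurable.mul
          (hF.pow_const _).comp_snd).lintegral_prod_right'
    _ ≤ C₁ * (C₂ * ∫⁻ y, F y ^ (2 : ℝ)) := by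
        gcongr
        exact κ.lintegral_lintegral_le h₂ (hF.pow_const _)
    _ = _ := by rw [mul_assoc]

lemma eLpNorm_two_sq {H : Type*} [NormedAddCommGroup H] (f : En n → H) :
    eLpNorm f 2 volume ^ (2 : ℝ) = ∫⁻ x, ‖f x‖ₑ ^ (2 : ℝ) := by
  rw [eLpNorm_eq_lintegral_rpow_enorm_toReal (by norm_num) (by norm_num), ← ENNReal.rpow_mul]
  norm_num

lemma eLpNorm_op_sq_le {C₁ C₂ : ℝ≥0∞} (h₁ : ∀ x, ∫⁻ y, ‖κ.toFun x y‖ₑ ≤ C₁)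
    (h₂ : ∀ y, ∫⁻ x, ‖κ.toFun x y‖ₑ ≤ C₂) {f : En n → ℂ} (hf : AEStronglyMeasurable f volume) :
    eLpNorm (κ.op f) 2 volume ^ (2 : ℝ) ≤ C₁ * C₂ * eLpNorm f 2 volume ^ (2 : ℝ) := by
  rw [eLpNorm_two_sq, eLpNorm_two_sq]
  refine le_trans (lintegral_mono fun x => ?_) (κ.lintegral_sq_le h₁ h₂ hf.enorm)
  exact ENNReal.rpow_le_rpow (κ.enorm_op_le f x) (by norm_num)

lemma memLp_op {f : En n → ℂ} (hf : MemLp f 2 volume) : MemLp (κ.op f) 2 volume := by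
  refine ⟨κ.aestronglyMeasurable_op hf.1, ?_⟩
  have := κ.eLpNorm_op_sq_le κ.row_le κ.col_le hf.1
  have h2 : (κ.bound : ℝ≥0∞) * κ.bound * eLpNorm f 2 volume ^ (2 : ℝ) < ∞ :=
    ENNReal.mul_lt_top (ENNReal.mul_lt_top ENNReal.coe_lt_top ENNReal.coe_lt_top)
      (ENNReal.rpow_lt_top_of_nonneg (by norm_num) hf.2.ne)
  by_contra hcon
  rw [not_lt, top_le_iff] at hcon
  rw [hcon] at this
  simp only [Nat.ofNat_pos, ENNReal.top_rpow_of_pos, top_le_iff] at this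
  exact h2.ne this

lemma ae_integrable_L2 {f : En n → ℂ} (hf : MemLp f 2 volume) :
    ∀ᵐ x, Integrable fun y => κ.toFun x y * f y := by
  have h := κ.lintegral_sq_le κ.row_le κ.col_le hf.1.enorm
  rw [← eLpNorm_two_sq] at h
  have h2 : (κ.bound : ℝ≥0∞) * κ.bound * eLpNorm f 2 volume ^ (2 : ℝ) < ∞ :=
    ENNReal.mul_lt_top (ENNReal.mul_lt_top ENNReal.coe_lt_top ENNReal.coe_lt_top)
      (ENNReal.rpow_lt_top_of_nonneg (by norm_num) hf.2.ne)
  have hm : AEMeasurable (fun x => (∫⁻ y, ‖κ.toFun x y‖ₑ * ‖f y‖ₑ) ^ (2 : ℝ)) volume :=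
    ((κ.measurable_toFun.enorm.aemeasurable.mul hf.1.enorm.comp_snd).lintegral_prod_right').pow_const _
  filter_upwards [ae_lt_top' hm (h.trans_lt h2).ne] with x hx
  refine ⟨(κ.measurable_row x).aestronglyMeasurable.mul hf.1, ?_⟩
  rw [hasFiniteIntegral_iff_enorm]
  simp_rw [enorm_mul]
  by_contra hcon
  rw [not_lt, top_le_iff] at hcon
  simp [hcon] at hx

lemma ae_integrable_L1 {f : En n → ℂ} (hf : Integrable f) :
    ∀ᵐ x, Integrable fun y => κ.toFun x y * f y := by
  have h := κ.lintegral_lintegral_le κ.col_le hf.1.enorm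
  have hm : AEMeasurable (fun x => (∫⁻ y, ‖κ.toFun x y‖ₑ * ‖f y‖ₑ)) volume :=
    ((κ.measurable_toFun.enorm.aemeasurable.mul hf.1.enorm.comp_snd).lintegral_prod_right')
  have hfin := hf.2
  rw [hasFiniteIntegral_iff_enorm] at hfin
  filter_upwards [ae_lt_top' hm (h.trans_lt (ENNReal.mul_lt_top ENNReal.coe_lt_top hfin)).ne]
    with x hx
  refine ⟨(κ.measurable_row x).aestronglyMeasurable.mul hf.1, ?_⟩
  rw [hasFiniteIntegral_iff_enorm]
  simpa only [enorm_mul] using hx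

lemma integrable_op {f : En n → ℂ} (hf : Integrable f) : Integrable (κ.op f) := by
  refine ⟨κ.aestronglyMeasurable_op hf.1, ?_⟩
  have hfin := hf.2
  rw [hasFiniteIntegral_iff_enorm] at hfin ⊢
  exact (κ.lintegral_enorm_op_le κ.col_le hf.1).trans_lt
    (ENNReal.mul_lt_top ENNReal.coe_lt_top hfin)

/-- The operator of a Schur kernel on `L²`. -/
def clm : L2 n ℂ →L[ℂ] L2 n ℂ :=
  LinearMap.mkContinuous
    { toFun := fun f => (κ.memLp_op (Lp.memLp f)).toLp
      map_add' := by
        intro f g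
        rw [← MemLp.toLp_add, MemLp.toLp_eq_toLp_iff]
        rw [κ.op_congr (Lp.coeFn_add f g)]
        filter_upwards [κ.ae_integrable_L2 (Lp.memLp f), κ.ae_integrable_L2 (Lp.memLp g)]
          with x hf hg
        simp only [op, Pi.add_apply, mul_add]
        exact integral_add hf hg
      map_smul' := by
        intro c f
        rw [RingHom.id_apply, ← MemLp.toLp_const_smul, MemLp.toLp_eq_toLp_iff]
        rw [κ.op_congr (Lp.coeFn_smul c f)]
        refine Eventually.of_forall fun x => ?_
        simp only [op, Pi.smul_apply, smul_eq_mul]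
        rw [← integral_const_mul]
        congr 1; ext y; ring }
    κ.bound (by
      intro f
      have := κ.eLpNorm_op_sq_le κ.row_le κ.col_le (Lp.memLp f).1
      simp only [LinearMap.coe_mk, AddHom.coe_mk]
      rw [Lp.norm_toLp, Lp.norm_def, ← ENNReal.coe_toReal, ← ENNReal.toReal_mul]
      refine ENNReal.toReal_mono (ENNReal.mul_ne_top ENNReal.coe_ne_top (Lp.memLp f).2.ne) ?_
      rw [← ENNReal.rpow_le_rpow_iff (z := 2) (by norm_num),
        ENNReal.mul_rpow_of_nonneg _ _ (by norm_num)]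
      refine this.trans_eq ?_
      congr 1
      rw [ENNReal.rpow_two, sq])

lemma clm_ae (f : L2 n ℂ) : κ.clm f =ᵐ[volume] κ.op f :=
  MemLp.coeFn_toLp (κ.memLp_op (Lp.memLp f))

lemma norm_clm_sq_le {C₁ C₂ : ℝ≥0} (h₁ : ∀ x, ∫⁻ y, ‖κ.toFun x y‖ₑ ≤ C₁)
    (h₂ : ∀ y, ∫⁻ x, ‖κ.toFun x y‖ₑ ≤ C₂) : ‖κ.clm‖ ≤ Real.sqrt (C₁ * C₂) := by
  refine ContinuousLinearMap.opNorm_le_bound _ (Real.sqrt_nonneg _) fun f => ?_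
  have h := κ.eLpNorm_op_sq_le h₁ h₂ (Lp.memLp f).1
  rw [← eLpNorm_congr_ae (κ.clm_ae f)] at h
  have h3 : ‖κ.clm f‖ ^ 2 ≤ C₁ * C₂ * ‖f‖ ^ 2 := by
    rw [Lp.norm_def, Lp.norm_def, ← ENNReal.toReal_pow, ← ENNReal.toReal_pow,
      ← ENNReal.rpow_two, ← ENNReal.rpow_two]
    refine (ENNReal.toReal_mono (ENNReal.mul_ne_top (ENNReal.mul_ne_top ENNReal.coe_ne_top
      ENNReal.coe_ne_top) (ENNReal.rpow_ne_top_of_nonneg (by norm_num) (Lp.memLp f).2.ne)) h).trans_eq ?_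
    simp
  rw [← Real.sqrt_sq (norm_nonneg f), ← Real.sqrt_mul (by positivity)]
  exact Real.le_sqrt_of_sq_le h3

/-- The adjoint kernel. -/
def adj : SchurKernel n where
  toFun x y := starRingEnd ℂ (κ.toFun y x)
  measurable_toFun :=
    Complex.continuous_conj.measurable.comp (κ.measurable_toFun.comp measurable_swap)
  bound := κ.bound
  row_le x := by
    refine le_trans (le_of_eq ?_) (κ.col_le x)
    refine lintegral_congr fun y => ?_
    exact RCLike.enorm_conj _
  col_le x := by
    refine le_trans (le_of_eq ?_) (κ.row_le x)
    refine lintegral_congr fun y => ?_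
    exact RCLike.enorm_conj _

lemma integral_op_mul {f g : En n → ℂ} (hf : MemLp f 2 volume) (hg : MemLp g 2 volume) :
    ∫ x, κ.op f x * g x = ∫ y, f y * ∫ x, κ.toFun x y * g x := by
  have hInt : Integrable (fun p : En n × En n => κ.toFun p.1 p.2 * f p.2 * g p.1)
      (volume.prod volume) := by
    refine ⟨((κ.measurable_toFun.aestronglyMeasurable).mul hf.1.comp_snd).mul hg.1.comp_fst, ?_⟩
    rw [hasFiniteIntegral_iff_enorm, lintegral_prod]
    · simp_rw [enorm_mul]
      have hk : MemLp (fun x => (∫⁻ y, ‖κ.toFun x y‖ₑ * ‖f y‖ₑ).toReal) 2 (volume : Measure (En n)) := by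
        have hm : AEMeasurable (fun x => (∫⁻ y, ‖κ.toFun x y‖ₑ * ‖f y‖ₑ)) volume :=
          ((κ.measurable_toFun.enorm.aemeasurable.mul hf.1.enorm.comp_snd).lintegral_prod_right')
        refine ⟨hm.ennreal_toReal.aestronglyMeasurable, ?_⟩
        have h := κ.lintegral_sq_le κ.row_le κ.col_le hf.1.enorm
        rw [← eLpNorm_two_sq] at h
        have h2 : (κ.bound : ℝ≥0∞) * κ.bound * eLpNorm f 2 volume ^ (2 : ℝ) < ∞ :=
          ENNReal.mul_lt_top (ENNReal.mul_lt_top ENNReal.coe_lt_top ENNReal.coe_lt_top)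
            (ENNReal.rpow_lt_top_of_nonneg (by norm_num) hf.2.ne)
        have h3 : eLpNorm (fun x => (∫⁻ y, ‖κ.toFun x y‖ₑ * ‖f y‖ₑ).toReal) 2 volume ^ (2 : ℝ)
            < ∞ := by
          rw [eLpNorm_two_sq]
          refine lt_of_le_of_lt (lintegral_mono fun x => ?_) (h.trans_lt h2)
          refine ENNReal.rpow_le_rpow ?_ (by norm_num)
          rw [Real.enorm_of_nonneg ENNReal.toReal_nonneg]
          exact ENNReal.ofReal_toReal_le
        by_contra hcon
        rw [not_lt, top_le_iff] at hcon
        simp [hcon] at h3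
      have hprod : Integrable (fun x => (∫⁻ y, ‖κ.toFun x y‖ₑ * ‖f y‖ₑ).toReal * ‖g x‖) volume :=
        hk.integrable_mul hg.norm
      have hfin := hprod.2
      rw [hasFiniteIntegral_iff_enorm] at hfin
      refine lt_of_le_of_lt (le_of_eq ?_) hfin
      refine lintegral_congr_ae ?_
      filter_upwards [κ.ae_integrable_L2 hf] with x hx
      have hx2 := hx.2
      rw [hasFiniteIntegral_iff_enorm] at hx2
      simp_rw [enorm_mul] at hx2
      rw [lintegral_mul_const' _ _ enorm_ne_top, enorm_mul,
        Real.enorm_of_nonneg ENNReal.toReal_nonneg, ENNReal.ofReal_toReal hx2.ne, enorm_norm]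
    · exact (((κ.measurable_toFun.aestronglyMeasurable).mul hf.1.comp_snd).mul hg.1.comp_fst).enorm
  have := integral_integral_swap (f := fun x y => κ.toFun x y * f y * g x) hInt
  simp only [op]
  calc _ = ∫ x, ∫ y, κ.toFun x y * f y * g x := by
        refine integral_congr_ae (Eventually.of_forall fun x => ?_)
        simp only
        rw [← integral_mul_const]
    _ = _ := this
    _ = _ := by
        refine integral_congr_ae (Eventually.of_forall fun y => ?_)
        simp only
        rw [← integral_const_mul]
        congr 1; ext x; ring

lemma adjoint_clm : ContinuousLinearMap.adjoint κ.clm = κ.adj.clm := by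
  symm
  rw [ContinuousLinearMap.eq_adjoint_iff]
  intro g f
  rw [MeasureTheory.L2.inner_def, MeasureTheory.L2.inner_def]
  have hc : ∀ {h : L2 n ℂ}, MemLp (fun x => starRingEnd ℂ (h x)) 2 volume := fun {h} =>
    (Lp.memLp h).star
  have h := κ.integral_op_mul (Lp.memLp f) (hc (h := g))
  simp only [RCLike.inner_apply]
  calc _ = ∫ y, f y * ∫ x, κ.toFun x y * starRingEnd ℂ (g x) := by
        refine integral_congr_ae ?_
        filter_upwards [κ.adj.clm_ae g] with y hy
        rw [hy, op, ← integral_conj]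
        simp [adj]
    _ = _ := h.symm
    _ = _ := by
        refine integral_congr_ae ?_
        filter_upwards [κ.clm_ae f] with x hx
        rw [hx]

end SchurKernel

/-! ### Calderón–Zygmund decomposition -/

/-- The average of `F` over the dyadic cube of generation `j` through `x`. -/
def cubeAvg {n : ℕ} (F : En n → ℝ≥0∞) (j : ℤ) (x : En n) : ℝ≥0∞ :=
  ENNReal.ofReal (cubeDensity n j) * ∫⁻ y in dyadicCube j x, F y

/-- The stopping region given by all cubes of generation `j`. -/
def Stopping.const (n : ℕ) (j : ℤ) : Stopping n where
  carrier := univ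
  level _ := j
  measurableSet_carrier := MeasurableSet.univ
  measurable_level := measurable_const
  stable _ _ _ _ := ⟨mem_univ _, rfl⟩

section CubeAvg

variable {n : ℕ} {F : En n → ℝ≥0∞}

lemma cubeAvg_eq (F : En n → ℝ≥0∞) (j : ℤ) (x : En n) :
    cubeAvg F j x = ∫⁻ y, ENNReal.ofReal ((Stopping.const n j).ker x y) * F y :=
  ((Stopping.const n j).lintegral_ker_eq (mem_univ x) F).symm

lemma measurable_cubeAvg (hF : Measurable F) (j : ℤ) : Measurable (cubeAvg F j) := by
  have : cubeAvg F j = fun x => ∫⁻ y, ENNReal.ofReal ((Stopping.const n j).ker x y) * F y :=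
    funext (cubeAvg_eq F j)
  rw [this]
  exact Measurable.lintegral_prod_right' (f := fun p : En n × En n =>
    ENNReal.ofReal ((Stopping.const n j).ker p.1 p.2) * F p.2)
    ((Stopping.const n j).measurable_ker.ennreal_ofReal.mul (hF.comp measurable_snd))

lemma cubeAvg_eq_of_mem {i j : ℤ} (h : i ≤ j) {x y : En n} (hy : y ∈ dyadicCube j x) :
    cubeAvg F i y = cubeAvg F i x := by
  rw [cubeAvg, cubeAvg, dyadicCube_eq_of_mem (dyadicCube_subset h x hy)]

lemma cubeAvg_succ_le (j : ℤ) (x : En n) : cubeAvg F (j + 1) x ≤ 2 ^ n * cubeAvg F j x := by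
  rw [cubeAvg, cubeAvg, cubeDensity_succ, ENNReal.ofReal_mul (by positivity), ← mul_assoc]
  gcongr
  · rw [ENNReal.ofReal_pow (by norm_num)]; simp
  · exact dyadicCube_subset (by omega) x

lemma exists_cubeAvg_le (hn : 1 ≤ n) (hF : ∫⁻ y, F y ≠ ∞) {β : ℝ≥0∞} (hβ : 0 < β) :
    ∃ j₀ : ℤ, ∀ j ≤ j₀, ∀ x, cubeAvg F j x ≤ β := by
  obtain ⟨j₀, h₀⟩ : ∃ j₀ : ℤ, ∀ j ≤ j₀, ENNReal.ofReal (cubeDensity n j) * ∫⁻ y, F y ≤ β := by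
    have ht : Tendsto (fun j : ℕ => ENNReal.ofReal (cubeDensity n (-(j : ℤ))) * ∫⁻ y, F y) atTop
        (𝓝 0) := by
      rw [show (0 : ℝ≥0∞) = ENNReal.ofReal 0 * ∫⁻ y, F y by simp]
      refine ENNReal.Tendsto.mul_const (ENNReal.tendsto_ofReal ?_) (Or.inr hF)
      have : ∀ j : ℕ, cubeDensity n (-(j : ℤ)) = ((1 / 2 : ℝ) ^ n) ^ j := by
        intro j
        rw [cubeDensity, zpow_neg, zpow_natCast, ← inv_pow, ← pow_mul, ← pow_mul, mul_comm]
        norm_num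
      simp_rw [this]
      apply tendsto_pow_atTop_nhds_zero_of_lt_one (by positivity)
      exact pow_lt_one₀ (by norm_num) (by norm_num) (by omega)
    obtain ⟨N, hN⟩ := (ht.eventually (ge_mem_nhds hβ)).exists
    refine ⟨-(N : ℤ), fun j hj => le_trans ?_ hN⟩
    gcongr
    unfold cubeDensity
    gcongr
    norm_num
  refine ⟨j₀, fun j hj x => le_trans ?_ (h₀ j hj)⟩
  unfold cubeAvg
  gcongr
  exact Measure.restrict_le_self

/-- The maximal dyadic cubes on which the average of `F` exceeds `β`. -/
def czStopping (hn : 1 ≤ n) (hF : Measurable F) (hfin : ∫⁻ y, F y ≠ ∞) {β : ℝ≥0∞} (hβ : 0 < β) :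
    Stopping n where
  carrier := {x | ∃ j : ℤ, β < cubeAvg F j x}
  level x := sInf {j : ℤ | β < cubeAvg F j x}
  measurableSet_carrier := by
    have : {x | ∃ j : ℤ, β < cubeAvg F j x} = ⋃ j : ℤ, {x | β < cubeAvg F j x} := by ext; simp
    rw [this]
    exact MeasurableSet.iUnion fun j => measurableSet_lt measurable_const (measurable_cubeAvg hF j)
  measurable_level := by
    obtain ⟨j₀, h₀⟩ := exists_cubeAvg_le hn hfin hβ
    have hb : ∀ x, BddBelow {j : ℤ | β < cubeAvg F j x} := fun x =>
      ⟨j₀, fun j hj => le_of_not_ge fun hle => (h₀ j hle x).not_gt hj⟩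
    refine measurable_of_Iio fun a => ?_
    have hm : ∀ j : ℤ, MeasurableSet {x | β < cubeAvg F j x} := fun j =>
      measurableSet_lt measurable_const (measurable_cubeAvg hF j)
    have : (fun x => sInf {j : ℤ | β < cubeAvg F j x}) ⁻¹' Iio a =
        (⋃ j : Iio a, {x | β < cubeAvg F j x}) ∪
        ({x | 0 < a} ∩ (⋃ j : ℤ, {x | β < cubeAvg F j x})ᶜ) := by
      ext x
      simp only [mem_preimage, mem_Iio, mem_union, mem_iUnion, mem_ofPred_eq, mem_inter_iff,
        mem_compl_iff, not_exists]
      by_cases hne : ∃ j : ℤ, β < cubeAvg F j x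
      · constructor
        · intro h
          exact Or.inl ⟨⟨_, h⟩, Int.csInf_mem hne (hb x)⟩
        · rintro (⟨⟨j, hj⟩, h⟩ | ⟨-, h⟩)
          · exact (csInf_le (hb x) h).trans_lt hj
          · exact absurd hne.choose_spec (h _)
      · have : {j : ℤ | β < cubeAvg F j x} = ∅ := by
          ext j; simpa using not_lt.1 (not_exists.1 hne j)
        rw [this, Int.csInf_empty]
        constructor
        · intro h
          exact Or.inr ⟨h, not_exists.1 hne⟩
        · rintro (⟨j, h⟩ | ⟨h, -⟩)
          · exact absurd ⟨_, h⟩ hne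
          · exact h
    rw [this]
    exact (MeasurableSet.iUnion fun j : Iio a => hm j).union
      ((MeasurableSet.const _).inter (MeasurableSet.iUnion hm).compl)
  stable := by
    obtain ⟨j₀, h₀⟩ := exists_cubeAvg_le hn hfin hβ
    have hb : ∀ x, BddBelow {j : ℤ | β < cubeAvg F j x} := fun x =>
      ⟨j₀, fun j hj => le_of_not_ge fun hle => (h₀ j hle x).not_gt hj⟩
    intro x hx y hy
    have h1 : β < cubeAvg F (sInf {j : ℤ | β < cubeAvg F j x}) x := Int.csInf_mem hx (hb x)
    have h2 : β < cubeAvg F (sInf {j : ℤ | β < cubeAvg F j x}) y := by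
      rwa [cubeAvg_eq_of_mem le_rfl hy]
    refine ⟨⟨_, h2⟩, le_antisymm (csInf_le (hb y) h2) (csInf_le (hb x) ?_)⟩
    have h3 : β < cubeAvg F (sInf {j : ℤ | β < cubeAvg F j y}) y := Int.csInf_mem ⟨_, h2⟩ (hb y)
    show β < _
    rwa [cubeAvg_eq_of_mem (csInf_le (hb y) h2) hy] at h3

variable (hn : 1 ≤ n) (hF : Measurable F) (hfin : ∫⁻ y, F y ≠ ∞) {β : ℝ≥0∞} (hβ : 0 < β)

lemma lt_cubeAvg_czStopping {x : En n} (hx : x ∈ (czStopping hn hF hfin hβ).carrier) :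
    β < cubeAvg F ((czStopping hn hF hfin hβ).level x) x := by
  obtain ⟨j₀, h₀⟩ := exists_cubeAvg_le hn hfin hβ
  exact Int.csInf_mem hx ⟨j₀, fun j hj => le_of_not_ge fun hle => (h₀ j hle x).not_gt hj⟩

lemma cubeAvg_czStopping_le (x : En n) :
    cubeAvg F ((czStopping hn hF hfin hβ).level x) x ≤ 2 ^ n * β := by
  obtain ⟨j₀, h₀⟩ := exists_cubeAvg_le hn hfin hβ
  have hb : BddBelow {j : ℤ | β < cubeAvg F j x} :=
    ⟨j₀, fun j hj => le_of_not_ge fun hle => (h₀ j hle x).not_gt hj⟩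
  by_cases hx : x ∈ (czStopping hn hF hfin hβ).carrier
  · set l := (czStopping hn hF hfin hβ).level x with hl
    have : ¬ β < cubeAvg F (l - 1) x := by
      intro h
      have : l ≤ l - 1 := csInf_le hb h
      omega
    have h2 := cubeAvg_succ_le (F := F) (l - 1) x
    rw [sub_add_cancel] at h2
    refine h2.trans ?_
    gcongr
    exact not_lt.1 this
  · refine le_trans (not_lt.1 fun h => hx ⟨_, h⟩) ?_
    exact le_mul_of_one_le_left (by positivity) (one_le_pow₀ (by norm_num))

lemma cubeAvg_le_of_notMem_czStopping {x : En n} (hx : x ∉ (czStopping hn hF hfin hβ).carrier)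
    (j : ℤ) : cubeAvg F j x ≤ β :=
  not_lt.1 fun h => hx ⟨j, h⟩

lemma setLIntegral_czStopping_le :
    ∫⁻ x in (czStopping hn hF hfin hβ).carrier, F x ≤
      2 ^ n * β * volume (czStopping hn hF hfin hβ).carrier := by
  set σ := czStopping hn hF hfin hβ with hσ
  rw [← σ.lintegral_average F hF.aemeasurable]
  calc _ ≤ ∫⁻ x, σ.carrier.indicator (fun _ => 2 ^ n * β) x := by
        refine lintegral_mono fun x => ?_
        by_cases hx : x ∈ σ.carrier
        · rw [indicator_of_mem hx, σ.lintegral_ker_eq hx]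
          exact cubeAvg_czStopping_le hn hF hfin hβ x
        · simp [σ.ker_of_notMem hx]
    _ = _ := by
        rw [lintegral_indicator σ.measurableSet_carrier, lintegral_const,
          Measure.restrict_apply_univ]

lemma volume_czStopping_le (hβt : β ≠ ∞) :
    β * volume (czStopping hn hF hfin hβ).carrier ≤ 2 * ∫⁻ x in {x | β / 2 < F x}, F x := by
  set σ := czStopping hn hF hfin hβ with hσ
  set G : En n → ℝ≥0∞ := {x | β / 2 < F x}.indicator F with hG
  have hmG : Measurable G := hF.indicator (measurableSet_lt measurable_const hF)
  have hFG : ∀ x, F x ≤ G x + β / 2 := by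
    intro x
    by_cases hx : β / 2 < F x
    · rw [hG, indicator_of_mem (by exact hx)]; exact le_self_add
    · exact (not_lt.1 hx).trans le_add_self
  have key : ∀ x ∈ σ.carrier, β / 2 ≤ ∫⁻ y, ENNReal.ofReal (σ.ker x y) * G y := by
    intro x hx
    have h1 : β < cubeAvg F (σ.level x) x := lt_cubeAvg_czStopping hn hF hfin hβ hx
    have h2 : cubeAvg F (σ.level x) x ≤ (∫⁻ y, ENNReal.ofReal (σ.ker x y) * G y) + β / 2 := by
      have := σ.lintegral_ker_eq hx F
      rw [cubeAvg, ← this]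
      calc _ ≤ ∫⁻ y, (ENNReal.ofReal (σ.ker x y) * G y + ENNReal.ofReal (σ.ker x y) * (β / 2)) := by
            refine lintegral_mono fun y => ?_
            rw [← mul_add]
            gcongr
            exact hFG y
        _ = _ := lintegral_add_right _
            (σ.measurable_ker.of_uncurry_left.ennreal_ofReal.mul_const _)
        _ ≤ _ := by
            gcongr
            rw [lintegral_mul_const _ σ.measurable_ker.of_uncurry_left.ennreal_ofReal]
            exact mul_le_of_le_one_left (by positivity) (σ.lintegral_ker_le x)
    have h3 := h1.le.trans h2
    have hh : β / 2 ≠ ∞ := ENNReal.div_ne_top hβt (by norm_num)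
    nth_rewrite 1 [← ENNReal.add_halves β] at h3
    exact (ENNReal.add_le_add_iff_right hh).1 h3
  have h4 : β / 2 * volume σ.carrier ≤ ∫⁻ x in {x | β / 2 < F x}, F x := by
    calc β / 2 * volume σ.carrier = ∫⁻ x in σ.carrier, β / 2 := by simp
      _ ≤ ∫⁻ x in σ.carrier, ∫⁻ y, ENNReal.ofReal (σ.ker x y) * G y :=
          setLIntegral_mono' σ.measurableSet_carrier key
      _ ≤ ∫⁻ x, ∫⁻ y, ENNReal.ofReal (σ.ker x y) * G y := setLIntegral_le_lintegral _ _
      _ = ∫⁻ y in σ.carrier, G y := σ.lintegral_average G hmG.aemeasurable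
      _ ≤ ∫⁻ y, G y := setLIntegral_le_lintegral _ _
      _ = _ := lintegral_indicator (measurableSet_lt measurable_const hF) _
  calc β * volume σ.carrier = 2 * (β / 2 * volume σ.carrier) := by
        rw [← mul_assoc, ENNReal.mul_div_cancel (by norm_num) (by norm_num)]
    _ ≤ _ := by gcongr

end CubeAvg

lemma cubeDensity_mul_volume_closedBall {n : ℕ} (j : ℤ) (x : En n) {c : ℝ} (hc : 0 ≤ c) :
    ENNReal.ofReal (cubeDensity n j) * volume (closedBall x (c * ((2 : ℝ) ^ j)⁻¹)) =
      volume (closedBall (0 : En n) c) := by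
  have h2 : (0 : ℝ) < 2 ^ j := by positivity
  rw [Measure.addHaar_closedBall _ _ (by positivity), Measure.addHaar_closedBall _ _ hc,
    finrank_euclideanSpace_fin, ← mul_assoc, ← ENNReal.ofReal_mul (cubeDensity_pos n j).le]
  congr 2
  rw [cubeDensity, ← mul_pow]
  congr 1
  field_simp

/-- Lebesgue differentiation along dyadic cubes, in the form of a one-sided bound. -/
lemma ae_enorm_le_of_cubeAvg_le {n : ℕ} {H : Type*} [NormedAddCommGroup H] {f : En n → H}
    (hf : Integrable f) :
    ∀ᵐ x, ∀ β : ℝ≥0∞, (∀ j, cubeAvg (fun y => ‖f y‖ₑ) j x ≤ β) → ‖f x‖ₑ ≤ β := by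
  filter_upwards [IsUnifLocDoublingMeasure.ae_tendsto_average_norm_sub volume
    hf.locallyIntegrable 1] with x hx β hβ
  have hδ : Tendsto (fun j : ℕ => ((n : ℝ) + 1) * ((2 : ℝ) ^ (j : ℤ))⁻¹) atTop (𝓝[>] 0) := by
    refine tendsto_nhdsWithin_iff.2 ⟨?_, Eventually.of_forall fun j => ?_⟩
    · have : Tendsto (fun j : ℕ => ((n : ℝ) + 1) * ((1 / 2 : ℝ) ^ j)) atTop (𝓝 (((n : ℝ) + 1) * 0)) :=
        (tendsto_pow_atTop_nhds_zero_of_lt_one (by norm_num) (by norm_num)).const_mul _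
      simpa using this
    · show (0 : ℝ) < _
      positivity
  have ht := hx (fun _ => x) _ hδ (Eventually.of_forall fun j => by
    apply mem_closedBall_self; positivity)
  set c := volume (closedBall (0 : En n) ((n : ℝ) + 1)) with hc
  have hct : c ≠ ∞ := measure_closedBall_lt_top.ne
  have key : ∀ j : ℕ, ‖f x‖ₑ ≤ β + c * ENNReal.ofReal
      (⨍ y in closedBall x (((n : ℝ) + 1) * ((2 : ℝ) ^ (j : ℤ))⁻¹), ‖f y - f x‖) := by
    intro j
    set B := closedBall x (((n : ℝ) + 1) * ((2 : ℝ) ^ (j : ℤ))⁻¹) with hB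
    have hBt : volume B ≠ ∞ := measure_closedBall_lt_top.ne
    have hInt : IntegrableOn (fun y => f y - f x) B :=
      hf.integrableOn.sub (integrableOn_const hBt)
    have hsub : dyadicCube (j : ℤ) x ⊆ B := by
      intro y hy
      rw [hB, mem_closedBall, dist_comm, dist_eq_norm]
      refine (norm_sub_le_of_mem_dyadicCube hy).trans ?_
      gcongr
      linarith
    have e1 : ENNReal.ofReal (cubeDensity n j) * ∫⁻ y in B, ‖f y - f x‖ₑ =
        c * ENNReal.ofReal (⨍ y in B, ‖f y - f x‖) := by
      rw [setAverage_eq, smul_eq_mul, ENNReal.ofReal_mul (by positivity),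
        ofReal_integral_norm_eq_lintegral_enorm hInt, ← mul_assoc, hc,
        ← cubeDensity_mul_volume_closedBall (j : ℤ) x (by positivity), mul_assoc]
      have hpos : volume B ≠ 0 := (measure_closedBall_pos _ _ (by positivity)).ne'
      rw [← hB, Measure.real, ENNReal.ofReal_inv_of_pos (ENNReal.toReal_pos hpos hBt),
        ENNReal.ofReal_toReal hBt, mul_assoc, ← mul_assoc (volume B),
        ENNReal.mul_inv_cancel hpos hBt, one_mul]
    rw [← e1]
    calc ‖f x‖ₑ = ENNReal.ofReal (cubeDensity n j) * ∫⁻ y in dyadicCube (j : ℤ) x, ‖f x‖ₑ := by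
          rw [lintegral_const, Measure.restrict_apply_univ, mul_comm ‖f x‖ₑ, ← mul_assoc,
            ofReal_cubeDensity_mul_volume, one_mul]
      _ ≤ ENNReal.ofReal (cubeDensity n j) *
            ∫⁻ y in dyadicCube (j : ℤ) x, (‖f y‖ₑ + ‖f y - f x‖ₑ) := by
          gcongr with y
          have := enorm_sub_le (a := f y) (b := f y - f x)
          simpa using this
      _ = cubeAvg (fun y => ‖f y‖ₑ) j x + ENNReal.ofReal (cubeDensity n j) *
            ∫⁻ y in dyadicCube (j : ℤ) x, ‖f y - f x‖ₑ := by
          rw [lintegral_add_left' hf.1.enorm.restrict, mul_add, cubeAvg]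
      _ ≤ _ := by
          gcongr
          exact hβ j
  have hlim : Tendsto (fun j : ℕ => β + c * ENNReal.ofReal
      (⨍ y in closedBall x (((n : ℝ) + 1) * ((2 : ℝ) ^ (j : ℤ))⁻¹), ‖f y - f x‖)) atTop
      (𝓝 (β + c * ENNReal.ofReal 0)) :=
    (ENNReal.Tendsto.const_mul (ENNReal.tendsto_ofReal ht) (Or.inr hct)).const_add β
  simpa using ge_of_tendsto' hlim key

section Decomposition

variable {n : ℕ} {H : Type*} [NormedAddCommGroup H] [NormedSpace ℝ H] [CompleteSpace H]

/-- The conditional expectation with respect to a stopping region. -/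
def Stopping.avg (σ : Stopping n) (f : En n → H) (x : En n) : H := ∫ y, σ.ker x y • f y

namespace Stopping

variable (σ : Stopping n)

lemma avg_eq {f : En n → H} {x : En n} (hx : x ∈ σ.carrier) :
    σ.avg f x = cubeDensity n (σ.level x) • ∫ y in dyadicCube (σ.level x) x, f y := by
  rw [avg, ← integral_smul, ← integral_indicator (measurableSet_dyadicCube _ _)]
  congr 1
  ext y
  rw [σ.ker_eq_indicator hx]
  by_cases hy : y ∈ dyadicCube (σ.level x) x <;> simp [hy]

lemma avg_eq_of_mem {f : En n → H} {x y : En n} (hx : x ∈ σ.carrier)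
    (hy : y ∈ dyadicCube (σ.level x) x) : σ.avg f y = σ.avg f x := by
  simp only [avg, σ.ker_eq_of_mem hx hy]

lemma enorm_avg_le (f : En n → H) (x : En n) :
    ‖σ.avg f x‖ₑ ≤ ∫⁻ y, ENNReal.ofReal (σ.ker x y) * ‖f y‖ₑ := by
  refine (enorm_integral_le_lintegral_enorm _).trans_eq ?_
  refine lintegral_congr fun y => ?_
  rw [enorm_smul, Real.enorm_of_nonneg (σ.ker_nonneg x y)]

lemma stronglyMeasurable_avg {f : En n → H} (hf : StronglyMeasurable f) :
    StronglyMeasurable (σ.avg f) :=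
  StronglyMeasurable.integral_prod_right (f := fun x y => σ.ker x y • f y)
    (σ.measurable_ker.stronglyMeasurable.smul (hf.comp_measurable measurable_snd))

lemma setIntegral_avg {f : En n → H} {x : En n} (hx : x ∈ σ.carrier) :
    ∫ y in dyadicCube (σ.level x) x, σ.avg f y = ∫ y in dyadicCube (σ.level x) x, f y := by
  rw [setIntegral_congr_fun (measurableSet_dyadicCube _ _) (g := fun _ => σ.avg f x)
    fun y hy => σ.avg_eq_of_mem hx hy, setIntegral_const, σ.avg_eq hx, smul_smul, Measure.real,
    volume_dyadicCube, ENNReal.toReal_ofReal (by have := cubeDensity_pos n (σ.level x); positivity),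
    inv_mul_cancel₀ (cubeDensity_pos _ _).ne', one_smul]

/-- The mean zero functions living on the cubes of a stopping region. -/
structure IsBad (b : En n → H) : Prop where
  integrable : Integrable b
  ae_eq_zero : ∀ᵐ x, x ∉ σ.carrier → b x = 0
  integral_eq_zero : ∀ x ∈ σ.carrier, ∫ y in dyadicCube (σ.level x) x, b y = 0

end Stopping

open Classical in
theorem exists_cz_decomposition (hn : 1 ≤ n) {f : En n → H} (hfm : StronglyMeasurable f)
    (hf : Integrable f) (hf2 : MemLp f 2 volume) {β : ℝ≥0} (hβ : 0 < β) :
    ∃ (σ : Stopping n) (g b : En n → H), (∀ x, f x = g x + b x) ∧ MemLp g 2 volume ∧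
      MemLp b 2 volume ∧ Integrable g ∧ σ.IsBad b ∧
      β * volume σ.carrier ≤ 2 * ∫⁻ x in {x | (β : ℝ≥0∞) / 2 < ‖f x‖ₑ}, ‖f x‖ₑ ∧
      ∫⁻ x, ‖b x‖ₑ ≤ 2 * (2 ^ n * β * volume σ.carrier) ∧
      ∫⁻ x, ‖g x‖ₑ ^ (2 : ℝ) ≤ (2 ^ n * β) ^ (2 : ℝ) * volume σ.carrier +
        ∫⁻ x in {x | ‖f x‖ₑ ≤ β}, ‖f x‖ₑ ^ (2 : ℝ) := by
  have hF : Measurable fun x => ‖f x‖ₑ := hfm.enorm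
  have hfin : ∫⁻ x, ‖f x‖ₑ ≠ ∞ := by
    have := hf.2; rw [hasFiniteIntegral_iff_enorm] at this; exact this.ne
  have hβ' : (0 : ℝ≥0∞) < β := by exact_mod_cast hβ
  set σ := czStopping hn hF hfin hβ' with hσ
  have hS := σ.measurableSet_carrier
  set g : En n → H := fun x => if x ∈ σ.carrier then σ.avg f x else f x with hg
  have hgm : StronglyMeasurable g := StronglyMeasurable.ite hS (σ.stronglyMeasurable_avg hfm) hfm
  have hvol := volume_czStopping_le hn hF hfin hβ' ENNReal.coe_ne_top
  have hS1 := setLIntegral_czStopping_le hn hF hfin hβ'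
  rw [← hσ] at hvol hS1
  have hSfin : volume σ.carrier < ∞ := by
    have h1 : 2 * ∫⁻ x in {x | (β : ℝ≥0∞) / 2 < ‖f x‖ₑ}, ‖f x‖ₑ < ∞ :=
      ENNReal.mul_lt_top (by norm_num) ((setLIntegral_le_lintegral _ _).trans_lt hfin.lt_top)
    by_contra hcon
    rw [not_lt, top_le_iff] at hcon
    rw [hcon, ENNReal.mul_top hβ'.ne', top_le_iff] at hvol
    exact h1.ne hvol
  have havg : ∀ x ∈ σ.carrier, ‖σ.avg f x‖ₑ ≤ 2 ^ n * β := by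
    intro x hx
    refine (σ.enorm_avg_le f x).trans ?_
    rw [σ.lintegral_ker_eq hx]
    exact cubeAvg_czStopping_le hn hF hfin hβ' x
  have hg2 : ∫⁻ x, ‖g x‖ₑ ^ (2 : ℝ) ≤ (2 ^ n * β) ^ (2 : ℝ) * volume σ.carrier +
        ∫⁻ x in {x | ‖f x‖ₑ ≤ β}, ‖f x‖ₑ ^ (2 : ℝ) := by
    rw [← lintegral_add_compl _ hS]
    refine add_le_add ?_ ?_
    · rw [← setLIntegral_const]
      refine setLIntegral_mono' hS fun x hx => ?_
      rw [hg]; simp only [hx, if_true]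
      exact ENNReal.rpow_le_rpow (havg x hx) (by norm_num)
    · rw [← lintegral_indicator hS.compl,
        ← lintegral_indicator (measurableSet_le hF measurable_const)]
      refine lintegral_mono_ae ?_
      filter_upwards [ae_enorm_le_of_cubeAvg_le hf] with x hx
      by_cases hxS : x ∈ σ.carrier
      · simp [hxS]
      · have : ‖f x‖ₑ ≤ β := hx β fun j => cubeAvg_le_of_notMem_czStopping hn hF hfin hβ' hxS j
        rw [indicator_of_mem (by exact hxS), indicator_of_mem (by exact this), hg]
        simp [hxS]
  have hcoe : ((2 : ℝ≥0∞) ^ n * β) < ∞ :=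
    ENNReal.mul_lt_top (ENNReal.pow_lt_top (by norm_num)) ENNReal.coe_lt_top
  have hgmem : MemLp g 2 volume := by
    refine ⟨hgm.aestronglyMeasurable, ?_⟩
    have h3 : eLpNorm g 2 volume ^ (2 : ℝ) < ∞ := by
      rw [SchurKernel.eLpNorm_two_sq]
      refine hg2.trans_lt (ENNReal.add_lt_top.2 ⟨ENNReal.mul_lt_top
        (ENNReal.rpow_lt_top_of_nonneg (by norm_num) hcoe.ne) hSfin, ?_⟩)
      refine (setLIntegral_le_lintegral _ _).trans_lt ?_
      rw [← SchurKernel.eLpNorm_two_sq]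
      exact ENNReal.rpow_lt_top_of_nonneg (by norm_num) hf2.2.ne
    by_contra hcon
    rw [not_lt, top_le_iff] at hcon
    simp [hcon] at h3
  have hgS : ∫⁻ x in σ.carrier, ‖g x‖ₑ ≤ 2 ^ n * β * volume σ.carrier := by
    rw [← setLIntegral_const]
    refine setLIntegral_mono' hS fun x hx => ?_
    rw [hg]; simp only [hx, if_true]
    exact havg x hx
  have hgi : Integrable g := by
    refine ⟨hgm.aestronglyMeasurable, ?_⟩
    rw [hasFiniteIntegral_iff_enorm, ← lintegral_add_compl _ hS]
    refine ENNReal.add_lt_top.2 ⟨hgS.trans_lt (ENNReal.mul_lt_top hcoe hSfin), ?_⟩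
    rw [setLIntegral_congr_fun (g := fun x => ‖f x‖ₑ) hS.compl fun x hx => by
      simp only [hg, if_neg (show x ∉ σ.carrier from hx)]]
    exact (setLIntegral_le_lintegral _ _).trans_lt hfin.lt_top
  refine ⟨σ, g, fun x => f x - g x, fun x => (add_sub_cancel _ _).symm, hgmem, hf2.sub hgmem, hgi,
    ⟨hf.sub hgi, Eventually.of_forall fun x hx => by simp [hg, hx], ?_⟩, hvol, ?_, hg2⟩
  · intro x hx
    rw [integral_sub hf.integrableOn hgi.integrableOn, sub_eq_zero, ← σ.setIntegral_avg hx]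
    refine setIntegral_congr_fun (measurableSet_dyadicCube _ _) fun y hy => ?_
    simp [hg, (σ.stable x hx y hy).1]
  · rw [← lintegral_add_compl _ hS]
    have h0 : ∫⁻ x in σ.carrierᶜ, ‖f x - g x‖ₑ = 0 := by
      rw [setLIntegral_congr_fun (g := fun x => 0) hS.compl fun x hx => by
        simp only [hg, if_neg (show x ∉ σ.carrier from hx), sub_self, enorm_zero]]
      simp
    rw [h0, add_zero, two_mul]
    calc _ ≤ ∫⁻ x in σ.carrier, (‖f x‖ₑ + ‖g x‖ₑ) := lintegral_mono fun x => enorm_sub_le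
      _ = _ := lintegral_add_left hF _
      _ ≤ _ := add_le_add hS1 hgS

end Decomposition

/-! ### Enlarged stopping regions and the weak type estimate -/

namespace Stopping

variable {n : ℕ} (σ : Stopping n) (R : ℝ)

/-- A weighted count of the enlarged cubes covering `x`. -/
def cover (x : En n) : ℝ≥0∞ :=
  ∫⁻ z in σ.carrier, ENNReal.ofReal (cubeDensity n (σ.level z)) *
    (closedBall z ((R + n) * ((2 : ℝ) ^ σ.level z)⁻¹)).indicator (fun _ => 1) x

/-- A measurable set containing all the cubes of a stopping region, enlarged by the factor `R`. -/
def star : Set (En n) := {x | 1 ≤ σ.cover R x}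

lemma measurable_zpow_level : Measurable fun z => ((2 : ℝ) ^ σ.level z) :=
  (measurable_from_top (f := fun j : ℤ => (2 : ℝ) ^ j)).comp σ.measurable_level

lemma measurable_density_level : Measurable fun z => cubeDensity n (σ.level z) :=
  (measurable_from_top (f := cubeDensity n)).comp σ.measurable_level

lemma measurable_cover_aux : Measurable fun p : En n × En n =>
    ENNReal.ofReal (cubeDensity n (σ.level p.2)) *
    (closedBall p.2 ((R + n) * ((2 : ℝ) ^ σ.level p.2)⁻¹)).indicator (fun _ => (1 : ℝ≥0∞)) p.1 := by
  refine (σ.measurable_density_level.comp measurable_snd).ennreal_ofReal.mul ?_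
  have : (fun p : En n × En n => (closedBall p.2 ((R + n) * ((2 : ℝ) ^ σ.level p.2)⁻¹)).indicator
      (fun _ => (1 : ℝ≥0∞)) p.1) = {p : En n × En n | dist p.1 p.2 ≤
        (R + n) * ((2 : ℝ) ^ σ.level p.2)⁻¹}.indicator fun _ => 1 := by
    ext p; simp only [indicator, mem_closedBall, mem_ofPred_eq]
  rw [this]
  refine measurable_const.indicator (measurableSet_le measurable_dist ?_)
  exact (σ.measurable_zpow_level.comp measurable_snd).inv.const_mul _

lemma measurable_cover : Measurable (σ.cover R) :=
  Measurable.lintegral_prod_right' (σ.measurable_cover_aux R)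

lemma measurableSet_star : MeasurableSet (σ.star R) :=
  measurableSet_le measurable_const (σ.measurable_cover R)

variable {R}

lemma volume_star_le (hR : 0 ≤ R) :
    volume (σ.star R) ≤ volume (closedBall (0 : En n) (R + n)) * volume σ.carrier := by
  calc volume (σ.star R) = 1 * volume (σ.star R) := (one_mul _).symm
    _ ≤ ∫⁻ x, σ.cover R x := mul_meas_ge_le_lintegral (σ.measurable_cover R) 1
    _ = ∫⁻ z in σ.carrier, ∫⁻ x, ENNReal.ofReal (cubeDensity n (σ.level z)) *
          (closedBall z ((R + n) * ((2 : ℝ) ^ σ.level z)⁻¹)).indicator (fun _ => 1) x :=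
        lintegral_lintegral_swap (σ.measurable_cover_aux R).aemeasurable
    _ = ∫⁻ z in σ.carrier, volume (closedBall (0 : En n) (R + n)) := by
        refine lintegral_congr fun z => ?_
        rw [lintegral_const_mul' _ _ ENNReal.ofReal_ne_top,
          lintegral_indicator measurableSet_closedBall, setLIntegral_const, one_mul,
          cubeDensity_mul_volume_closedBall _ _ (by positivity)]
    _ = _ := by rw [setLIntegral_const]

lemma lt_norm_sub_of_notMem_star {x y : En n} (hx : x ∉ σ.star R) (hy : y ∈ σ.carrier) :
    R * ((2 : ℝ) ^ σ.level y)⁻¹ < ‖x - y‖ := by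
  by_contra hcon
  rw [not_lt] at hcon
  apply hx
  show 1 ≤ σ.cover R x
  calc (1 : ℝ≥0∞) = ∫⁻ z in dyadicCube (σ.level y) y, ENNReal.ofReal (cubeDensity n (σ.level y)) := by
        rw [setLIntegral_const, ofReal_cubeDensity_mul_volume]
    _ = ∫⁻ z in dyadicCube (σ.level y) y, ENNReal.ofReal (cubeDensity n (σ.level z)) *
        (closedBall z ((R + n) * ((2 : ℝ) ^ σ.level z)⁻¹)).indicator (fun _ => 1) x := by
        refine setLIntegral_congr_fun (measurableSet_dyadicCube _ _) fun z hz => ?_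
        have hl := (σ.stable y hy z hz).2
        simp only [hl]
        rw [indicator_of_mem, mul_one]
        rw [mem_closedBall, dist_eq_norm]
        have h1 := norm_sub_le_of_mem_dyadicCube hz
        calc ‖x - z‖ = ‖(x - y) + (y - z)‖ := by congr 1; abel
          _ ≤ _ := norm_add_le _ _
          _ ≤ _ := by rw [add_mul]; exact add_le_add hcon h1
    _ ≤ _ := lintegral_mono_set fun z hz => (σ.stable y hy z hz).1

lemma carrier_subset_star (hR : 0 ≤ R) : σ.carrier ⊆ σ.star R := by
  intro x hx
  by_contra hcon
  have := σ.lt_norm_sub_of_notMem_star hcon hx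
  rw [sub_self, norm_zero] at this
  have h2 : 0 ≤ R * ((2 : ℝ) ^ σ.level x)⁻¹ := by positivity
  linarith

end Stopping

section Weak

variable {n : ℕ} {H₁ H₂ : Type*} [NormedAddCommGroup H₁] [InnerProductSpace ℂ H₁]
  [CompleteSpace H₁] [NormedAddCommGroup H₂] [InnerProductSpace ℂ H₂] [CompleteSpace H₂]

/-- `T` maps mean zero functions on a stopping region to functions that are integrable away from
an enlargement of the region, with a uniform bound. -/
def AtomBound (T : L2 n H₁ →L[ℂ] L2 n H₂) (R : ℝ) (A : ℝ≥0) : Prop :=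
  ∀ (σ : Stopping n) (b : L2 n H₁), σ.IsBad (b : En n → H₁) →
    ∫⁻ x in (σ.star R)ᶜ, ‖T b x‖ₑ ≤ A * ∫⁻ x, ‖b x‖ₑ

lemma lintegral_sq_clm_le {T : L2 n H₁ →L[ℂ] L2 n H₂} (hT : ‖T‖ ≤ 1) (g : L2 n H₁) :
    ∫⁻ x, ‖T g x‖ₑ ^ (2 : ℝ) ≤ ∫⁻ x, ‖g x‖ₑ ^ (2 : ℝ) := by
  rw [← SchurKernel.eLpNorm_two_sq, ← SchurKernel.eLpNorm_two_sq]
  refine ENNReal.rpow_le_rpow ?_ (by norm_num)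
  rw [← Lp.enorm_def, ← Lp.enorm_def, enorm_le_iff_norm_le]
  exact (T.le_opNorm g).trans (mul_le_of_le_one_left (norm_nonneg _) hT)

/-- The constant in the weak type estimate. -/
def weakConst (n : ℕ) (R : ℝ) : ℝ≥0∞ :=
  2 * (volume (closedBall (0 : En n) (R + n)) + (2 ^ n) ^ (2 : ℝ) + 2 * 2 ^ n)

lemma weakConst_ne_top (n : ℕ) (R : ℝ) : weakConst n R ≠ ∞ := by
  refine ENNReal.mul_ne_top (by norm_num) (ENNReal.add_ne_top.2 ⟨ENNReal.add_ne_top.2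
    ⟨measure_closedBall_lt_top.ne, ENNReal.rpow_ne_top_of_nonneg (by norm_num) (by simp)⟩, ?_⟩)
  exact ENNReal.mul_ne_top (by norm_num) (by simp)

theorem weak_type_estimate (hn : 1 ≤ n) {R : ℝ} (hR : 0 ≤ R) {T : L2 n H₁ →L[ℂ] L2 n H₂}
    (hT : ‖T‖ ≤ 1) {A : ℝ≥0} (hA : 1 ≤ A) (hatom : AtomBound T R A) {f : L2 n H₁}
    (hf : Integrable (f : En n → H₁)) {β : ℝ≥0} (hβ : 0 < β) :
    volume {x | 2 * (β : ℝ≥0∞) < ‖T f x‖ₑ} ≤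
      weakConst n R * A * ((β : ℝ≥0∞)⁻¹ * ∫⁻ x in {x | (β : ℝ≥0∞) / 2 < ‖f x‖ₑ}, ‖f x‖ₑ) +
      ((β : ℝ≥0∞) ^ (2 : ℝ))⁻¹ * ∫⁻ x in {x | ‖f x‖ₑ ≤ β}, ‖f x‖ₑ ^ (2 : ℝ) := by
  obtain ⟨σ, g, b, hfgb, hg2, hb2, hgi, hbad, hvol, hb1, hgsq⟩ :=
    exists_cz_decomposition hn (Lp.stronglyMeasurable f) hf (Lp.memLp f) hβ
  have hβ0 : (β : ℝ≥0∞) ≠ 0 := by exact_mod_cast hβ.ne'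
  have hβt : (β : ℝ≥0∞) ≠ ∞ := ENNReal.coe_ne_top
  set J := ∫⁻ x in {x | ‖f x‖ₑ ≤ β}, ‖f x‖ₑ ^ (2 : ℝ)
  set I := ∫⁻ x in {x | (β : ℝ≥0∞) / 2 < ‖f x‖ₑ}, ‖f x‖ₑ
  set V := volume σ.carrier
  set c := volume (closedBall (0 : En n) (R + n))
  have hsum : f = hg2.toLp g + hb2.toLp b := by
    rw [← MemLp.toLp_add]
    conv_lhs => rw [← Lp.toLp_coeFn f (Lp.memLp f)]
    rw [MemLp.toLp_eq_toLp_iff]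
    exact Eventually.of_forall hfgb
  set g' := hg2.toLp g
  set b' := hb2.toLp b
  have hg' : g' =ᵐ[volume] g := hg2.coeFn_toLp
  have hb' : b' =ᵐ[volume] b := hb2.coeFn_toLp
  have hbad' : σ.IsBad (b' : En n → H₁) := by
    refine ⟨hbad.integrable.congr hb'.symm, ?_, fun x hx => ?_⟩
    · filter_upwards [hbad.ae_eq_zero, hb'] with x h1 h2 h3
      rw [h2, h1 h3]
    · rw [integral_congr_ae (ae_restrict_of_ae hb')]
      exact hbad.integral_eq_zero x hx
  have hTae : ∀ᵐ x, T f x = T g' x + T b' x := by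
    rw [hsum, map_add]
    exact Lp.coeFn_add _ _
  have hG : volume {x | (β : ℝ≥0∞) ≤ ‖T g' x‖ₑ} ≤
      (2 ^ n) ^ (2 : ℝ) * V + ((β : ℝ≥0∞) ^ (2 : ℝ))⁻¹ * J := by
    have hm : AEMeasurable (fun x => ‖T g' x‖ₑ ^ (2 : ℝ)) volume :=
      (Lp.aestronglyMeasurable _).enorm.pow_const _
    have h1 := meas_ge_le_lintegral_div hm (ε := (β : ℝ≥0∞) ^ (2 : ℝ))
      (by simp [hβ0]) (ENNReal.rpow_ne_top_of_nonneg (by norm_num) hβt)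
    have h2 : {x | (β : ℝ≥0∞) ^ (2 : ℝ) ≤ ‖T g' x‖ₑ ^ (2 : ℝ)} = {x | (β : ℝ≥0∞) ≤ ‖T g' x‖ₑ} := by
      ext x; exact ENNReal.rpow_le_rpow_iff (by norm_num)
    rw [h2] at h1
    refine h1.trans ?_
    have h3 : ∫⁻ x, ‖T g' x‖ₑ ^ (2 : ℝ) ≤ (2 ^ n * β) ^ (2 : ℝ) * V + J := by
      refine (lintegral_sq_clm_le hT g').trans (le_trans (le_of_eq ?_) hgsq)
      refine lintegral_congr_ae ?_
      filter_upwards [hg'] with x hx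
      rw [hx]
    calc _ ≤ ((2 ^ n * β) ^ (2 : ℝ) * V + J) / (β : ℝ≥0∞) ^ (2 : ℝ) := by gcongr
      _ = _ := by
        rw [ENNReal.add_div, ENNReal.mul_rpow_of_nonneg _ _ (by norm_num), ENNReal.div_eq_inv_mul,
          ENNReal.div_eq_inv_mul]
        congr 1
        rw [mul_comm ((2 ^ n : ℝ≥0∞) ^ (2 : ℝ)), mul_assoc, ← mul_assoc, ENNReal.inv_mul_cancel,
          one_mul]
        · simp [hβ0]
        · exact ENNReal.rpow_ne_top_of_nonneg (by norm_num) hβt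
  have hB : volume ({x | (β : ℝ≥0∞) ≤ ‖T b' x‖ₑ} ∩ (σ.star R)ᶜ) ≤ 2 * 2 ^ n * A * V := by
    have h1 := meas_ge_le_lintegral_div (μ := volume.restrict (σ.star R)ᶜ)
      (Lp.aestronglyMeasurable (T b')).enorm.restrict (ε := (β : ℝ≥0∞)) hβ0 hβt
    have h2 := hatom σ b' hbad'
    have h3 : ∫⁻ x, ‖b' x‖ₑ = ∫⁻ x, ‖b x‖ₑ := by
      refine lintegral_congr_ae ?_
      filter_upwards [hb'] with x hx
      rw [hx]
    rw [h3] at h2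
    rw [Measure.restrict_apply' (σ.measurableSet_star R).compl] at h1
    refine h1.trans ?_
    calc _ ≤ (A * (2 * (2 ^ n * β * V))) / β := by
          gcongr
          exact h2.trans (by gcongr)
      _ = _ := by
        rw [show (A : ℝ≥0∞) * (2 * (2 ^ n * β * V)) = (2 * 2 ^ n * A * V) * β by ring,
          ENNReal.mul_div_cancel_right hβ0 hβt]
  have hcov : volume {x | 2 * (β : ℝ≥0∞) < ‖T f x‖ₑ} ≤ volume (σ.star R) +
      (volume {x | (β : ℝ≥0∞) ≤ ‖T g' x‖ₑ} +
        volume ({x | (β : ℝ≥0∞) ≤ ‖T b' x‖ₑ} ∩ (σ.star R)ᶜ)) := by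
    refine le_trans (measure_mono_ae ?_) ((measure_union_le _ _).trans
      (add_le_add le_rfl (measure_union_le _ _)))
    filter_upwards [hTae] with x hx h
    have h' : 2 * (β : ℝ≥0∞) < ‖T f x‖ₑ := h
    show x ∈ σ.star R ∪ ({x | (β : ℝ≥0∞) ≤ ‖T g' x‖ₑ} ∪
        ({x | (β : ℝ≥0∞) ≤ ‖T b' x‖ₑ} ∩ (σ.star R)ᶜ))
    by_cases h1 : x ∈ σ.star R
    · exact Or.inl h1
    · right
      by_cases h2 : (β : ℝ≥0∞) ≤ ‖T g' x‖ₑ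
      · exact Or.inl h2
      · right
        refine ⟨?_, h1⟩
        show (β : ℝ≥0∞) ≤ ‖T b' x‖ₑ
        by_contra h3
        rw [not_le] at h2 h3
        rw [hx, two_mul] at h'
        exact absurd h' (not_lt.2 ((enorm_add_le _ _).trans (add_le_add h2.le h3.le)))
  have hV : V ≤ 2 * ((β : ℝ≥0∞)⁻¹ * I) := by
    calc V = (β : ℝ≥0∞)⁻¹ * (β * V) := by
          rw [← mul_assoc, ENNReal.inv_mul_cancel hβ0 hβt, one_mul]
      _ ≤ (β : ℝ≥0∞)⁻¹ * (2 * I) := by gcongr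
      _ = _ := by ring
  have hA' : (1 : ℝ≥0∞) ≤ A := by exact_mod_cast hA
  calc _ ≤ c * V + (((2 ^ n) ^ (2 : ℝ) * V + ((β : ℝ≥0∞) ^ (2 : ℝ))⁻¹ * J) + 2 * 2 ^ n * A * V) :=
        hcov.trans (add_le_add (σ.volume_star_le hR) (add_le_add hG hB))
    _ = (c + (2 ^ n) ^ (2 : ℝ) + 2 * 2 ^ n * A) * V + ((β : ℝ≥0∞) ^ (2 : ℝ))⁻¹ * J := by ring
    _ ≤ (c * A + (2 ^ n) ^ (2 : ℝ) * A + 2 * 2 ^ n * A) * (2 * ((β : ℝ≥0∞)⁻¹ * I)) +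
          ((β : ℝ≥0∞) ^ (2 : ℝ))⁻¹ * J := by
        gcongr
        · exact le_mul_of_one_le_right (by positivity) hA'
        · exact le_mul_of_one_le_right (by positivity) hA'
    _ = _ := by rw [weakConst]; ring

end Weak

/-! ### Strong type estimates -/

lemma lintegral_Ioo_rpow {q : ℝ} (hq : -1 < q) {a : ℝ} (ha : 0 ≤ a) :
    ∫⁻ t in Ioo 0 a, ENNReal.ofReal (t ^ q) = ENNReal.ofReal (a ^ (q + 1) / (q + 1)) := by
  have h : IntegrableOn (fun t : ℝ => t ^ q) (Ioc 0 a) := by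
    rw [← intervalIntegrable_iff_integrableOn_Ioc_of_le ha]
    exact intervalIntegral.intervalIntegrable_rpow' hq
  rw [restrict_Ioo_eq_restrict_Ioc, ← ofReal_integral_eq_lintegral_ofReal h]
  · rw [← intervalIntegral.integral_of_le ha, integral_rpow (Or.inl hq),
      Real.zero_rpow (by linarith), sub_zero]
  · filter_upwards [ae_restrict_mem measurableSet_Ioc] with t ht
    exact Real.rpow_nonneg ht.1.le _

lemma lintegral_Ici_rpow {q : ℝ} (hq : q < -1) {a : ℝ} (ha : 0 < a) :
    ∫⁻ t in Ici a, ENNReal.ofReal (t ^ q) = ENNReal.ofReal (-a ^ (q + 1) / (q + 1)) := by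
  rw [← Measure.restrict_congr_set Ioi_ae_eq_Ici,
    ← ofReal_integral_eq_lintegral_ofReal (integrableOn_Ioi_rpow_of_lt hq ha),
    integral_Ioi_rpow_of_lt hq ha]
  filter_upwards [ae_restrict_mem measurableSet_Ioi] with t ht
  exact Real.rpow_nonneg (ha.trans ht).le _

lemma enorm_rpow_eq_ofReal {H : Type*} [NormedAddCommGroup H] (v : H) {q : ℝ} (hq : 0 ≤ q) :
    ‖v‖ₑ ^ q = ENNReal.ofReal (‖v‖ ^ q) := by
  rw [← ofReal_norm, ENNReal.ofReal_rpow_of_nonneg (norm_nonneg _) hq]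

section Layer

variable {n : ℕ} {F : En n → ℝ}

lemma layer_large (hF : Measurable F) (hF0 : ∀ x, 0 ≤ F x) {p : ℝ} (hp : 1 < p) :
    ∫⁻ t in Ioi (0 : ℝ), (ENNReal.ofReal (t ^ (p - 2)) *
        ∫⁻ x in {x | t / 4 < F x}, ENNReal.ofReal (F x)) =
      ENNReal.ofReal (4 ^ (p - 1) / (p - 1)) * ∫⁻ x, ENNReal.ofReal (F x ^ p) := by
  have hset : MeasurableSet {q : ℝ × En n | q.1 / 4 < F q.2} :=
    measurableSet_lt (measurable_fst.div_const _) (hF.comp measurable_snd)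
  calc _ = ∫⁻ t in Ioi (0 : ℝ), ∫⁻ x, ENNReal.ofReal (t ^ (p - 2)) *
        {q : ℝ × En n | q.1 / 4 < F q.2}.indicator (fun q => ENNReal.ofReal (F q.2)) (t, x) := by
        refine lintegral_congr fun t => ?_
        rw [lintegral_const_mul' _ _ ENNReal.ofReal_ne_top,
          ← lintegral_indicator (measurableSet_lt measurable_const hF)]
        rfl
    _ = ∫⁻ x, ∫⁻ t in Ioi (0 : ℝ), ENNReal.ofReal (t ^ (p - 2)) *
        {q : ℝ × En n | q.1 / 4 < F q.2}.indicator (fun q => ENNReal.ofReal (F q.2)) (t, x) := by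
        refine lintegral_lintegral_swap (Measurable.aemeasurable ?_)
        refine (measurable_fst.pow_const _).ennreal_ofReal.mul ?_
        exact ((hF.comp measurable_snd).ennreal_ofReal).indicator hset
    _ = ∫⁻ x, ENNReal.ofReal (4 ^ (p - 1) / (p - 1)) * ENNReal.ofReal (F x ^ p) := by
        refine lintegral_congr fun x => ?_
        have : ∀ t, ENNReal.ofReal (t ^ (p - 2)) *
            {q : ℝ × En n | q.1 / 4 < F q.2}.indicator (fun q => ENNReal.ofReal (F q.2)) (t, x) =
            (Iio (4 * F x)).indicator (fun t => ENNReal.ofReal (t ^ (p - 2)) *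
              ENNReal.ofReal (F x)) t := by
          intro t
          by_cases h : t / 4 < F x
          · rw [indicator_of_mem (by exact h), indicator_of_mem (by rw [mem_Iio]; linarith)]
          · rw [indicator_of_notMem (by exact h), indicator_of_notMem (by rw [mem_Iio]; linarith),
              mul_zero]
        simp_rw [this]
        rw [lintegral_indicator measurableSet_Iio, Measure.restrict_restrict measurableSet_Iio,
          lintegral_mul_const' _ _ ENNReal.ofReal_ne_top, inter_comm, Ioi_inter_Iio,
          lintegral_Ioo_rpow (by linarith) (by have := hF0 x; positivity),
          ← ENNReal.ofReal_mul, ← ENNReal.ofReal_mul]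
        · congr 1
          rw [Real.mul_rpow (by norm_num) (hF0 x)]
          rcases (hF0 x).eq_or_lt with h0 | h0
          · rw [← h0, Real.zero_rpow (by linarith : p ≠ 0)]; simp
          · rw [show p - 2 + 1 = p - 1 by ring, Real.rpow_sub_one h0.ne']
            field_simp
        · have : 0 < p - 1 := by linarith
          positivity
        · have := hF0 x
          have : 0 < p - 2 + 1 := by linarith
          positivity
    _ = _ := lintegral_const_mul' _ _ ENNReal.ofReal_ne_top

lemma layer_small (hF : Measurable F) (hF0 : ∀ x, 0 ≤ F x) {p : ℝ} (hp1 : 1 < p) (hp : p < 2) :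
    ∫⁻ t in Ioi (0 : ℝ), (ENNReal.ofReal (t ^ (p - 3)) *
        ∫⁻ x in {x | F x ≤ t / 2}, ENNReal.ofReal (F x ^ (2 : ℝ))) ≤
      ENNReal.ofReal (2 ^ (p - 2) / (2 - p)) * ∫⁻ x, ENNReal.ofReal (F x ^ p) := by
  have hset : MeasurableSet {q : ℝ × En n | F q.2 ≤ q.1 / 2} :=
    measurableSet_le (hF.comp measurable_snd) (measurable_fst.div_const _)
  calc _ = ∫⁻ t in Ioi (0 : ℝ), ∫⁻ x, ENNReal.ofReal (t ^ (p - 3)) *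
        {q : ℝ × En n | F q.2 ≤ q.1 / 2}.indicator
          (fun q => ENNReal.ofReal (F q.2 ^ (2 : ℝ))) (t, x) := by
        refine lintegral_congr fun t => ?_
        rw [lintegral_const_mul' _ _ ENNReal.ofReal_ne_top,
          ← lintegral_indicator (measurableSet_le hF measurable_const)]
        rfl
    _ = ∫⁻ x, ∫⁻ t in Ioi (0 : ℝ), ENNReal.ofReal (t ^ (p - 3)) *
        {q : ℝ × En n | F q.2 ≤ q.1 / 2}.indicator
          (fun q => ENNReal.ofReal (F q.2 ^ (2 : ℝ))) (t, x) := by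
        refine lintegral_lintegral_swap (Measurable.aemeasurable ?_)
        refine (measurable_fst.pow_const _).ennreal_ofReal.mul ?_
        exact (((hF.comp measurable_snd).pow_const _).ennreal_ofReal).indicator hset
    _ ≤ ∫⁻ x, ENNReal.ofReal (2 ^ (p - 2) / (2 - p)) * ENNReal.ofReal (F x ^ p) := by
        refine lintegral_mono fun x => ?_
        have : ∀ t, ENNReal.ofReal (t ^ (p - 3)) *
            {q : ℝ × En n | F q.2 ≤ q.1 / 2}.indicator
              (fun q => ENNReal.ofReal (F q.2 ^ (2 : ℝ))) (t, x) =
            (Ici (2 * F x)).indicator (fun t => ENNReal.ofReal (t ^ (p - 3)) *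
              ENNReal.ofReal (F x ^ (2 : ℝ))) t := by
          intro t
          by_cases h : F x ≤ t / 2
          · rw [indicator_of_mem (by exact h), indicator_of_mem (by rw [mem_Ici]; linarith)]
          · rw [indicator_of_notMem (by exact h), indicator_of_notMem (by rw [mem_Ici]; linarith),
              mul_zero]
        simp_rw [this]
        rw [lintegral_indicator measurableSet_Ici, Measure.restrict_restrict measurableSet_Ici,
          lintegral_mul_const' _ _ ENNReal.ofReal_ne_top]
        rcases (hF0 x).eq_or_lt with h0 | h0
        · rw [← h0]; simp
        · have hpos : 0 < 2 * F x := by linarith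
          have hsub : Ici (2 * F x) ⊆ Ioi 0 := fun t ht => hpos.trans_le ht
          rw [inter_eq_left.2 hsub,
            lintegral_Ici_rpow (by linarith) hpos, ← ENNReal.ofReal_mul, ← ENNReal.ofReal_mul]
          · apply le_of_eq
            congr 1
            rw [Real.mul_rpow (by norm_num) (hF0 x), show p - 3 + 1 = p - 2 by ring,
              Real.rpow_sub h0 p 2]
            have : p - 2 ≠ 0 := by linarith
            have : 2 - p ≠ 0 := by linarith
            have : F x ^ (2 : ℝ) ≠ 0 := by positivity
            field_simp
            ring
          · have : 0 < 2 - p := by linarith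
            positivity
          · rw [neg_div, ← div_neg]
            have : 0 < -(p - 3 + 1) := by linarith
            positivity
    _ = _ := lintegral_const_mul' _ _ ENNReal.ofReal_ne_top

end Layer

section Strong

variable {n : ℕ} {H₁ H₂ : Type*} [NormedAddCommGroup H₁] [InnerProductSpace ℂ H₁]
  [CompleteSpace H₁] [NormedAddCommGroup H₂] [InnerProductSpace ℂ H₂] [CompleteSpace H₂]

/-- The constant in the strong type estimate for `1 < p < 2`. -/
def strongConst (n : ℕ) (R p : ℝ) : ℝ≥0∞ :=
  ENNReal.ofReal p * (weakConst n R * 2 * ENNReal.ofReal (4 ^ (p - 1) / (p - 1)) +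
    4 * ENNReal.ofReal (2 ^ (p - 2) / (2 - p)))

lemma strongConst_ne_top (n : ℕ) (R p : ℝ) : strongConst n R p ≠ ∞ := by
  have := weakConst_ne_top n R
  unfold strongConst
  finiteness

theorem strong_type_estimate (hn : 1 ≤ n) {R : ℝ} (hR : 0 ≤ R) {T : L2 n H₁ →L[ℂ] L2 n H₂}
    (hT : ‖T‖ ≤ 1) {A : ℝ≥0} (hA : 1 ≤ A) (hatom : AtomBound T R A) {f : L2 n H₁}
    (hf : Integrable (f : En n → H₁)) {p : ℝ} (hp1 : 1 < p) (hp2 : p < 2) :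
    ∫⁻ x, ‖T f x‖ₑ ^ p ≤ strongConst n R p * A * ∫⁻ x, ‖f x‖ₑ ^ p := by
  have hp0 : 0 < p := by linarith
  have hFm : Measurable fun x => ‖f x‖ := (Lp.stronglyMeasurable f).norm.measurable
  have h1 : ∫⁻ x, ‖T f x‖ₑ ^ p = ENNReal.ofReal p *
      ∫⁻ t in Ioi (0 : ℝ), volume {x | t < ‖T f x‖} * ENNReal.ofReal (t ^ (p - 1)) := by
    simp_rw [enorm_rpow_eq_ofReal _ hp0.le]
    exact lintegral_rpow_eq_lintegral_meas_lt_mul volume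
      (Eventually.of_forall fun x => norm_nonneg _)
      (Lp.aestronglyMeasurable (T f)).norm.aemeasurable hp0
  have h2 : ∀ t ∈ Ioi (0 : ℝ), volume {x | t < ‖T f x‖} * ENNReal.ofReal (t ^ (p - 1)) ≤
      weakConst n R * 2 * A * (ENNReal.ofReal (t ^ (p - 2)) *
        ∫⁻ x in {x | t / 4 < ‖f x‖}, ENNReal.ofReal ‖f x‖) +
      4 * (ENNReal.ofReal (t ^ (p - 3)) *
        ∫⁻ x in {x | ‖f x‖ ≤ t / 2}, ENNReal.ofReal (‖f x‖ ^ (2 : ℝ))) := by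
    intro t ht
    have ht0 : 0 < t := ht
    set β : ℝ≥0 := Real.toNNReal (t / 2) with hβ
    have hβ0 : 0 < β := Real.toNNReal_pos.2 (by positivity)
    have hβe : (β : ℝ≥0∞) = ENNReal.ofReal (t / 2) := rfl
    have hβ2 : 2 * (β : ℝ≥0∞) = ENNReal.ofReal t := by
      rw [hβe, show (2 : ℝ≥0∞) = ENNReal.ofReal 2 by simp, ← ENNReal.ofReal_mul (by norm_num),
        mul_div_cancel₀ _ (by norm_num)]
    have hβ4 : (β : ℝ≥0∞) / 2 = ENNReal.ofReal (t / 4) := by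
      rw [hβe, show (2 : ℝ≥0∞) = ENNReal.ofReal 2 by simp, ← ENNReal.ofReal_div_of_pos (by norm_num),
        show t / 2 / 2 = t / 4 by ring]
    have hw := weak_type_estimate hn hR hT hA hatom hf hβ0
    have s1 : {x | 2 * (β : ℝ≥0∞) < ‖T f x‖ₑ} = {x | t < ‖T f x‖} := by
      ext x
      show 2 * (β : ℝ≥0∞) < ‖T f x‖ₑ ↔ t < ‖T f x‖
      rw [hβ2, ← ofReal_norm, ENNReal.ofReal_lt_ofReal_iff_of_nonneg ht0.le]
    have s2 : {x | (β : ℝ≥0∞) / 2 < ‖f x‖ₑ} = {x | t / 4 < ‖f x‖} := by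
      ext x
      show (β : ℝ≥0∞) / 2 < ‖f x‖ₑ ↔ t / 4 < ‖f x‖
      rw [hβ4, ← ofReal_norm, ENNReal.ofReal_lt_ofReal_iff_of_nonneg (by positivity)]
    have s3 : {x | ‖f x‖ₑ ≤ β} = {x | ‖f x‖ ≤ t / 2} := by
      ext x
      show ‖f x‖ₑ ≤ β ↔ ‖f x‖ ≤ t / 2
      rw [hβe, ← ofReal_norm, ENNReal.ofReal_le_ofReal_iff (by positivity)]
    rw [s1, s2, s3] at hw
    simp_rw [enorm_rpow_eq_ofReal _ zero_le_two, ← ofReal_norm] at hw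
    have c1 : (β : ℝ≥0∞)⁻¹ * ENNReal.ofReal (t ^ (p - 1)) = 2 * ENNReal.ofReal (t ^ (p - 2)) := by
      rw [hβe, ← ENNReal.ofReal_inv_of_pos (by positivity), ← ENNReal.ofReal_mul (by positivity),
        show (2 : ℝ≥0∞) = ENNReal.ofReal 2 by simp, ← ENNReal.ofReal_mul (by norm_num)]
      congr 1
      rw [show p - 1 = (p - 2) + 1 by ring, Real.rpow_add_one ht0.ne']
      field_simp
    have c2 : ((β : ℝ≥0∞) ^ (2 : ℝ))⁻¹ * ENNReal.ofReal (t ^ (p - 1)) =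
        4 * ENNReal.ofReal (t ^ (p - 3)) := by
      rw [hβe, ENNReal.ofReal_rpow_of_pos (by positivity),
        ← ENNReal.ofReal_inv_of_pos (by positivity), ← ENNReal.ofReal_mul (by positivity),
        show (4 : ℝ≥0∞) = ENNReal.ofReal 4 by simp, ← ENNReal.ofReal_mul (by norm_num)]
      congr 1
      rw [show p - 1 = (p - 3) + 2 by ring, Real.rpow_add ht0, Real.rpow_two, Real.rpow_two]
      field_simp
      norm_num
    calc _ ≤ _ := mul_le_mul_left hw _
      _ = weakConst n R * A * ((β : ℝ≥0∞)⁻¹ * ENNReal.ofReal (t ^ (p - 1)) *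
          ∫⁻ x in {x | t / 4 < ‖f x‖}, ENNReal.ofReal ‖f x‖) +
          ((β : ℝ≥0∞) ^ (2 : ℝ))⁻¹ * ENNReal.ofReal (t ^ (p - 1)) *
          ∫⁻ x in {x | ‖f x‖ ≤ t / 2}, ENNReal.ofReal (‖f x‖ ^ (2 : ℝ)) := by ring
      _ = _ := by rw [c1, c2]; ring
  have hA' : (1 : ℝ≥0∞) ≤ A := by exact_mod_cast hA
  have hne : weakConst n R * 2 * A ≠ ∞ := by
    have := weakConst_ne_top n R
    finiteness
  have hm : Measurable fun t : ℝ => 4 * (ENNReal.ofReal (t ^ (p - 3)) *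
        ∫⁻ x in {x | ‖f x‖ ≤ t / 2}, ENNReal.ofReal (‖f x‖ ^ (2 : ℝ))) := by
    refine ((measurable_id.pow_const _).ennreal_ofReal.mul ?_).const_mul _
    refine Monotone.measurable fun s t hst => lintegral_mono_set fun x hx => ?_
    have hx' : ‖f x‖ ≤ s / 2 := hx
    show ‖f x‖ ≤ t / 2
    linarith
  calc _ = _ := h1
    _ ≤ ENNReal.ofReal p * ∫⁻ t in Ioi (0 : ℝ), (weakConst n R * 2 * A *
        (ENNReal.ofReal (t ^ (p - 2)) * ∫⁻ x in {x | t / 4 < ‖f x‖}, ENNReal.ofReal ‖f x‖) +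
        4 * (ENNReal.ofReal (t ^ (p - 3)) *
        ∫⁻ x in {x | ‖f x‖ ≤ t / 2}, ENNReal.ofReal (‖f x‖ ^ (2 : ℝ)))) := by
      gcongr 1
      exact setLIntegral_mono' measurableSet_Ioi h2
    _ ≤ ENNReal.ofReal p * (weakConst n R * 2 * A * (ENNReal.ofReal (4 ^ (p - 1) / (p - 1)) *
          ∫⁻ x, ENNReal.ofReal (‖f x‖ ^ p)) + 4 * (ENNReal.ofReal (2 ^ (p - 2) / (2 - p)) *
          ∫⁻ x, ENNReal.ofReal (‖f x‖ ^ p))) := by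
      rw [lintegral_add_right _ hm, lintegral_const_mul' _ _ hne,
        lintegral_const_mul' _ _ (by norm_num), layer_large hFm (fun x => norm_nonneg _) hp1]
      gcongr
      exact layer_small hFm (fun x => norm_nonneg _) hp1 hp2
    _ = ENNReal.ofReal p * (weakConst n R * 2 * ENNReal.ofReal (4 ^ (p - 1) / (p - 1)) * A +
          4 * ENNReal.ofReal (2 ^ (p - 2) / (2 - p)) * 1) *
          ∫⁻ x, ENNReal.ofReal (‖f x‖ ^ p) := by ring
    _ ≤ ENNReal.ofReal p * (weakConst n R * 2 * ENNReal.ofReal (4 ^ (p - 1) / (p - 1)) * A +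
          4 * ENNReal.ofReal (2 ^ (p - 2) / (2 - p)) * A) *
          ∫⁻ x, ENNReal.ofReal (‖f x‖ ^ p) := by gcongr
    _ = _ := by
      rw [strongConst]
      simp_rw [enorm_rpow_eq_ofReal _ hp0.le]
      ring

end Strong

/-! ### The `L^p` bound with interpolated constants -/

lemma eLpNorm_ofReal_eq {X H : Type*} [MeasurableSpace X] [NormedAddCommGroup H] (f : X → H)
    (μ : Measure X) {p : ℝ} (hp : 0 < p) :
    eLpNorm f (ENNReal.ofReal p) μ = (∫⁻ x, ‖f x‖ₑ ^ p ∂μ) ^ (1 / p) := by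
  rw [eLpNorm_eq_lintegral_rpow_enorm_toReal (by simpa using hp) ENNReal.ofReal_ne_top,
    ENNReal.toReal_ofReal hp.le]

lemma le_of_le_mul_rpow {I D : ℝ≥0∞} (hI : I ≠ ∞) {p q : ℝ} (hpq : p.HolderConjugate q)
    (h : I ≤ D * I ^ (1 / q)) : I ^ (1 / p) ≤ D := by
  rcases eq_or_ne I 0 with rfl | h0
  · rw [ENNReal.zero_rpow_of_pos (by have := hpq.pos; positivity)]; exact zero_le
  have h1 : I ^ (1 / q) ≠ 0 := by
    rw [Ne, ENNReal.rpow_eq_zero_iff]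
    rintro (⟨h, -⟩ | ⟨h, -⟩)
    · exact h0 h
    · exact hI h
  have h2 : I ^ (1 / q) ≠ ∞ :=
    ENNReal.rpow_ne_top_of_nonneg (by have := hpq.symm.pos; positivity) hI
  rw [← ENNReal.mul_le_mul_iff_left h1 h2]
  refine le_trans (le_of_eq ?_) h
  rw [← ENNReal.rpow_add _ _ h0 hI, one_div, one_div, hpq.inv_add_inv_eq_one, ENNReal.rpow_one]

section Interpolate

variable {n : ℕ} {H₁ H₂ : Type*} [NormedAddCommGroup H₁] [InnerProductSpace ℂ H₁]
  [CompleteSpace H₁] [NormedAddCommGroup H₂] [InnerProductSpace ℂ H₂] [CompleteSpace H₂]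

lemma AtomBound.smul {T : L2 n H₁ →L[ℂ] L2 n H₂} {R : ℝ} {A : ℝ≥0} (h : AtomBound T R A) (c : ℝ≥0) :
    AtomBound ((c : ℂ) • T) R (c * A) := by
  intro σ b hb
  have h1 := h σ b hb
  calc _ = ∫⁻ x in (σ.star R)ᶜ, c * ‖T b x‖ₑ := by
        refine lintegral_congr_ae (ae_restrict_of_ae ?_)
        have : ((c : ℂ) • T) b = (c : ℂ) • T b := rfl
        rw [this]
        filter_upwards [Lp.coeFn_smul (c : ℂ) (T b)] with x hx
        rw [hx, Pi.smul_apply, enorm_smul]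
        congr 1
        rw [← ofReal_norm]
        simp
    _ = c * ∫⁻ x in (σ.star R)ᶜ, ‖T b x‖ₑ := lintegral_const_mul' _ _ ENNReal.coe_ne_top
    _ ≤ c * (A * ∫⁻ x, ‖b x‖ₑ) := by gcongr
    _ = _ := by push_cast; ring

theorem eLpNorm_clm_le_of_lt_two (hn : 1 ≤ n) {R : ℝ} (hR : 0 ≤ R) {T : L2 n H₁ →L[ℂ] L2 n H₂}
    {A B : ℝ≥0} (hT : ‖T‖ ≤ B) (hB : 0 < B) (hA : B ≤ A) (hatom : AtomBound T R A) {f : L2 n H₁}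
    (hf : Integrable (f : En n → H₁)) {p : ℝ} (hp1 : 1 < p) (hp2 : p < 2) :
    eLpNorm (T f) (ENNReal.ofReal p) volume ≤ strongConst n R p ^ (1 / p) *
      ((B ^ (1 - 1 / p) * A ^ (1 / p) : ℝ≥0) : ℝ≥0∞) * eLpNorm f (ENNReal.ofReal p) volume := by
  have hp0 : 0 < p := by linarith
  have hB' : (B : ℂ) ≠ 0 := by exact_mod_cast hB.ne'
  set S := ((B⁻¹ : ℝ≥0) : ℂ) • T with hS
  have hTS : T f = (B : ℂ) • S f := by
    rw [hS]
    show T f = (B : ℂ) • (((B⁻¹ : ℝ≥0) : ℂ) • T f)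
    rw [smul_smul]
    push_cast
    rw [mul_inv_cancel₀ hB', one_smul]
  have hSn : ‖S‖ ≤ 1 := by
    refine ContinuousLinearMap.opNorm_le_bound _ zero_le_one fun x => ?_
    show ‖((B⁻¹ : ℝ≥0) : ℂ) • T x‖ ≤ _
    have : ‖((B⁻¹ : ℝ≥0) : ℂ)‖ = (B : ℝ)⁻¹ := by simp
    rw [norm_smul, this, inv_mul_le_iff₀ (by exact_mod_cast hB), one_mul]
    exact (T.le_opNorm x).trans (by gcongr)
  have hA1 : 1 ≤ B⁻¹ * A := by
    rw [← div_eq_inv_mul, one_le_div hB]; exact hA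
  have h := strong_type_estimate hn hR hSn hA1 (hatom.smul _) hf hp1 hp2
  have h2 : eLpNorm (T f) (ENNReal.ofReal p) volume =
      B * eLpNorm (S f) (ENNReal.ofReal p) volume := by
    rw [hTS, eLpNorm_congr_ae (Lp.coeFn_smul _ _), eLpNorm_const_smul]
    congr 1
    rw [← ofReal_norm]; simp
  rw [h2, eLpNorm_ofReal_eq _ _ hp0, eLpNorm_ofReal_eq _ _ hp0]
  calc _ ≤ B * (strongConst n R p * ((B⁻¹ * A : ℝ≥0) : ℝ≥0∞) * ∫⁻ x, ‖f x‖ₑ ^ p) ^ (1 / p) := by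
        gcongr
    _ = strongConst n R p ^ (1 / p) * (B * ((B⁻¹ * A : ℝ≥0) : ℝ≥0∞) ^ (1 / p)) *
        (∫⁻ x, ‖f x‖ₑ ^ p) ^ (1 / p) := by
        rw [ENNReal.mul_rpow_of_nonneg _ _ (by positivity),
          ENNReal.mul_rpow_of_nonneg _ _ (by positivity)]
        ring
    _ = _ := by
        congr 2
        rw [← ENNReal.coe_rpow_of_nonneg _ (by positivity), ← ENNReal.coe_mul]
        congr 1
        rw [NNReal.mul_rpow, ← mul_assoc]
        congr 1
        rw [NNReal.rpow_sub hB.ne', NNReal.rpow_one, NNReal.inv_rpow]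
        rfl

lemma enorm_inner_le_eLpNorm (u f : L2 n H₁) {p q : ℝ} (hpq : p.HolderConjugate q) :
    ‖inner ℂ u f‖ₑ ≤
      eLpNorm u (ENNReal.ofReal p) volume * eLpNorm f (ENNReal.ofReal q) volume := by
  rw [eLpNorm_ofReal_eq _ _ hpq.pos, eLpNorm_ofReal_eq _ _ hpq.symm.pos, L2.inner_def]
  refine (enorm_integral_le_lintegral_enorm _).trans (le_trans (lintegral_mono fun x => ?_)
    (ENNReal.lintegral_mul_le_Lp_mul_Lq volume hpq
      (Lp.aestronglyMeasurable _).enorm (Lp.aestronglyMeasurable _).enorm))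
  rw [← ofReal_norm, Pi.mul_apply, ← ofReal_norm (u x), ← ofReal_norm (f x),
    ← ENNReal.ofReal_mul (norm_nonneg _)]
  exact ENNReal.ofReal_le_ofReal (norm_inner_le_norm _ _)

set_option maxHeartbeats 800000 in
theorem eLpNorm_clm_le_of_adjoint {T : L2 n H₁ →L[ℂ] L2 n H₂} {p q : ℝ}
    (hpq : p.HolderConjugate q) (hp : 2 < p) {D : ℝ≥0∞}
    (hD : ∀ g : L2 n H₂, Integrable (g : En n → H₂) →
      eLpNorm (ContinuousLinearMap.adjoint T g) (ENNReal.ofReal q) volume ≤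
        D * eLpNorm g (ENNReal.ofReal q) volume) (f : L2 n H₁) :
    eLpNorm (T f) (ENNReal.ofReal p) volume ≤ D * eLpNorm f (ENNReal.ofReal p) volume := by
  have hp0 := hpq.pos
  have hq0 := hpq.symm.pos
  set F : En n → H₂ := (T f : En n → H₂) with hF
  have hFm : StronglyMeasurable F := Lp.stronglyMeasurable _
  let S : ℕ → Set (En n) := fun N => {x | ((N : ℝ) + 1)⁻¹ ≤ ‖F x‖ ∧ ‖F x‖ ≤ N}
  have hSm : ∀ N, MeasurableSet (S N) := fun N =>
    (measurableSet_le measurable_const hFm.norm.measurable).inter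
      (measurableSet_le hFm.norm.measurable measurable_const)
  have hSfin : ∀ N, volume (S N) < ∞ := by
    intro N
    refine lt_of_le_of_lt (measure_mono (t := {x | ((N : ℝ) + 1)⁻¹ ≤ ‖F x‖}) fun x hx => hx.1) ?_
    have h1 : (((N : ℝ) + 1)⁻¹).toNNReal ≠ 0 := by
      rw [Ne, Real.toNNReal_eq_zero, not_le]; positivity
    have := (Lp.memLp (T f)).meas_ge_lt_top (by norm_num) (by norm_num) h1
    refine lt_of_le_of_lt (measure_mono fun x hx => ?_) this
    have hx' : ((N : ℝ) + 1)⁻¹ ≤ ‖F x‖ := hx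
    show (((N : ℝ) + 1)⁻¹).toNNReal ≤ ‖F x‖₊
    rw [Real.toNNReal_le_iff_le_coe]
    exact hx'
  have key : ∀ N, (∫⁻ x in S N, ‖F x‖ₑ ^ p) ^ (1 / p) ≤
      D * eLpNorm f (ENNReal.ofReal p) volume := by
    intro N
    set I := ∫⁻ x in S N, ‖F x‖ₑ ^ p with hI
    let g : En n → H₂ := (S N).indicator fun x => ((‖F x‖ ^ (p - 2) : ℝ) : ℂ) • F x
    have hgm : StronglyMeasurable g :=
      ((Complex.continuous_ofReal.comp_stronglyMeasurable
        ((hFm.norm.measurable.pow_const _).stronglyMeasurable)).smul hFm).indicator (hSm N)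
    have hgn : ∀ x, ‖g x‖ = (S N).indicator (fun x => ‖F x‖ ^ (p - 1)) x := by
      intro x
      by_cases hx : x ∈ S N
      · simp only [g, indicator_of_mem hx]
        have h0 : 0 < ‖F x‖ := lt_of_lt_of_le (by positivity) hx.1
        rw [norm_smul, Complex.norm_real, Real.norm_of_nonneg (by positivity),
          show p - 1 = p - 2 + 1 by ring, Real.rpow_add_one h0.ne']
      · simp only [g, indicator_of_notMem hx, norm_zero]
    have hgb : ∀ x, ‖g x‖ ≤ (S N).indicator (fun _ => (N : ℝ) ^ (p - 1)) x := by
      intro x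
      rw [hgn]
      refine indicator_le_indicator' fun hx => ?_
      exact Real.rpow_le_rpow (norm_nonneg _) hx.2 (by linarith)
    have hg2 : ∀ e : ℝ≥0∞, MemLp g e := by
      intro e
      refine MemLp.of_le (g := (S N).indicator fun _ => (N : ℝ) ^ (p - 1)) ?_
        hgm.aestronglyMeasurable (Eventually.of_forall fun x => ?_)
      · exact memLp_indicator_const e (hSm N) _ (Or.inr (hSfin N).ne)
      · exact (hgb x).trans (Real.le_norm_self _)
    let G : L2 n H₂ := (hg2 2).toLp g
    have hG : G =ᵐ[volume] g := (hg2 2).coeFn_toLp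
    have hGi : Integrable (G : En n → H₂) := (memLp_one_iff_integrable.1 (hg2 1)).congr hG.symm
    have hgq : ∫⁻ x, ‖g x‖ₑ ^ q = I := by
      rw [hI, ← lintegral_indicator (hSm N)]
      refine lintegral_congr fun x => ?_
      rw [← ofReal_norm, hgn]
      by_cases hx : x ∈ S N
      · rw [indicator_of_mem hx, indicator_of_mem hx, enorm_rpow_eq_ofReal _ hp0.le,
          ENNReal.ofReal_rpow_of_nonneg (by positivity) hq0.le, ← Real.rpow_mul (norm_nonneg _),
          hpq.sub_one_mul_conj]
      · rw [indicator_of_notMem hx, indicator_of_notMem hx, ENNReal.ofReal_zero,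
          ENNReal.zero_rpow_of_pos hq0]
    have hItop : I ≠ ∞ := by
      rw [← hgq]
      have h1 := (hg2 (ENNReal.ofReal q)).2
      rw [eLpNorm_ofReal_eq _ _ hq0] at h1
      exact ((ENNReal.rpow_lt_top_iff_of_pos (by positivity)).1 h1).ne
    have hinner : I ≤ ‖inner ℂ G (T f)‖ₑ := by
      rw [L2.inner_def]
      have e1 : ∫ x, inner ℂ (G x) (T f x) = ∫ x, (((S N).indicator (fun x => ‖F x‖ ^ p) x : ℝ) : ℂ) := by
        refine integral_congr_ae ?_
        filter_upwards [hG] with x hx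
        rw [hx]
        by_cases h : x ∈ S N
        · simp only [g, indicator_of_mem h]
          have h0 : 0 < ‖F x‖ := lt_of_lt_of_le (by positivity) h.1
          rw [inner_smul_left, inner_self_eq_norm_sq_to_K, Complex.conj_ofReal]
          show _ * (‖F x‖ : ℂ) ^ 2 = _
          rw [← Complex.ofReal_pow, ← Complex.ofReal_mul]
          congr 1
          rw [← Real.rpow_two, ← Real.rpow_add h0]
          congr 1; ring
        · simp only [g, indicator_of_notMem h]
          simp
      rw [e1, integral_complex_ofReal, ← ofReal_norm, Complex.norm_real, ofReal_norm,
        Real.enorm_of_nonneg (integral_nonneg fun x => indicator_nonneg (fun _ _ => by positivity) _),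
        ofReal_integral_eq_lintegral_ofReal]
      · rw [hI, ← lintegral_indicator (hSm N)]
        refine lintegral_mono fun x => ?_
        by_cases h : x ∈ S N
        · rw [indicator_of_mem h, indicator_of_mem h, enorm_rpow_eq_ofReal _ hp0.le]
        · rw [indicator_of_notMem h]; exact zero_le
      · refine Integrable.mono' (g := (S N).indicator fun _ => (N : ℝ) ^ p) ?_ ?_ ?_
        · exact (integrable_indicator_iff (hSm N)).2 (integrableOn_const (hSfin N).ne)
        · exact ((hFm.norm.measurable.pow_const _).indicator (hSm N)).aestronglyMeasurable
        · refine Eventually.of_forall fun x => ?_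
          rw [Real.norm_of_nonneg (indicator_nonneg (fun _ _ => by positivity) _)]
          exact indicator_le_indicator' fun hx => Real.rpow_le_rpow (norm_nonneg _) hx.2 hp0.le
      · exact Eventually.of_forall fun x => indicator_nonneg (fun _ _ => by positivity) _
    have hle : I ≤ (D * eLpNorm f (ENNReal.ofReal p) volume) * I ^ (1 / q) := by
      calc I ≤ ‖inner ℂ G (T f)‖ₑ := hinner
        _ = ‖inner ℂ (ContinuousLinearMap.adjoint T G) f‖ₑ := by
            rw [ContinuousLinearMap.adjoint_inner_left]
        _ ≤ eLpNorm (ContinuousLinearMap.adjoint T G) (ENNReal.ofReal q) volume *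
            eLpNorm f (ENNReal.ofReal p) volume := enorm_inner_le_eLpNorm _ _ hpq.symm
        _ ≤ (D * I ^ (1 / q)) * eLpNorm f (ENNReal.ofReal p) volume := by
            gcongr
            have := hD G hGi
            rwa [eLpNorm_congr_ae hG, eLpNorm_ofReal_eq g _ hq0, hgq] at this
        _ = _ := by ring
    exact le_of_le_mul_rpow hItop hpq hle
  have hmono : ∫⁻ x, ‖F x‖ₑ ^ p = ⨆ N, ∫⁻ x in S N, ‖F x‖ₑ ^ p := by
    have hSmono : Monotone S := by
      intro N M hNM x hx
      have : (N : ℝ) ≤ M := by exact_mod_cast hNM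
      refine ⟨le_trans ?_ hx.1, hx.2.trans this⟩
      gcongr
    rw [← setLIntegral_iUnion_of_directed _ (directed_of_isDirected_le hSmono)]
    rw [← lintegral_indicator (MeasurableSet.iUnion hSm)]
    refine lintegral_congr fun x => ?_
    by_cases h : F x = 0
    · have h0 : ‖F x‖ₑ ^ p = 0 := by simp [h, hp0]
      rw [h0, eq_comm]
      exact indicator_apply_eq_zero.2 fun _ => h0
    · rw [indicator_of_mem]
      have h0 : 0 < ‖F x‖ := norm_pos_iff.2 h
      obtain ⟨N, hN⟩ := exists_nat_ge (max ‖F x‖ ‖F x‖⁻¹)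
      refine mem_iUnion.2 ⟨N, ?_, (le_max_left _ _).trans hN⟩
      rw [inv_le_comm₀ (by positivity) h0]
      exact ((le_max_right _ _).trans hN).trans (by linarith)
  rw [eLpNorm_ofReal_eq _ _ hp0, hmono]
  rw [one_div, ENNReal.rpow_inv_le_iff hp0]
  refine iSup_le fun N => ?_
  have := key N
  rwa [one_div, ENNReal.rpow_inv_le_iff hp0] at this

/-- The interpolation exponent. -/
def interpExp (p : ℝ) : ℝ := max (1 / p) (1 - 1 / p)

lemma interpExp_lt_one {p : ℝ} (hp : 1 < p) : interpExp p < 1 := by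
  have h0 : 0 < p := by linarith
  refine max_lt ?_ ?_
  · rw [div_lt_one h0]; exact hp
  · have : 0 < 1 / p := by positivity
    linarith

/-- The constant in the `L^p` bound. -/
def masterConst (n : ℕ) (R p : ℝ) : ℝ≥0∞ :=
  1 + strongConst n R p ^ (1 / p) + strongConst n R (p / (p - 1)) ^ (1 / (p / (p - 1)))

lemma masterConst_ne_top (n : ℕ) (R : ℝ) {p : ℝ} (hp : 1 < p) : masterConst n R p ≠ ∞ := by
  have h0 : 0 < p := by linarith
  have h1 : 0 < p - 1 := by linarith
  refine ENNReal.add_ne_top.2 ⟨ENNReal.add_ne_top.2 ⟨by norm_num, ?_⟩, ?_⟩ <;>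
  exact ENNReal.rpow_ne_top_of_nonneg (by positivity) (strongConst_ne_top _ _ _)

theorem eLpNorm_clm_le (hn : 1 ≤ n) {R : ℝ} (hR : 0 ≤ R) {T : L2 n H₁ →L[ℂ] L2 n H₂}
    {A B : ℝ≥0} (hT : ‖T‖ ≤ B) (hB : 0 < B) (hA : B ≤ A) (hatom : AtomBound T R A)
    (hatom' : AtomBound (ContinuousLinearMap.adjoint T) R A) {f : L2 n H₁}
    (hf : Integrable (f : En n → H₁)) {p : ℝ} (hp1 : 1 < p) :
    eLpNorm (T f) (ENNReal.ofReal p) volume ≤ masterConst n R p *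
      ((B ^ (1 - interpExp p) * A ^ interpExp p : ℝ≥0) : ℝ≥0∞) *
        eLpNorm f (ENNReal.ofReal p) volume := by
  have hp0 : 0 < p := by linarith
  rcases lt_trichotomy p 2 with h | h | h
  · have h1 : interpExp p = 1 / p := by
      refine max_eq_left ?_
      have : 1 / 2 ≤ 1 / p := one_div_le_one_div_of_le hp0 h.le
      linarith
    rw [h1]
    refine (eLpNorm_clm_le_of_lt_two hn hR hT hB hA hatom hf hp1 h).trans ?_
    gcongr
    exact le_add_right (le_add_left le_rfl)
  · have h1 : interpExp p = 1 / 2 := by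
      rw [interpExp, h]; norm_num
    have h3 : B ≤ B ^ (1 - interpExp p) * A ^ interpExp p := by
      rw [h1]
      calc B = B ^ (1 - 1 / 2 : ℝ) * B ^ (1 / 2 : ℝ) := by
            rw [← NNReal.rpow_add hB.ne']; norm_num
        _ ≤ _ := by gcongr
    have h2 : eLpNorm (T f) 2 volume ≤ B * eLpNorm f 2 volume := by
      rw [← Lp.enorm_def, ← Lp.enorm_def, ← ofReal_norm, ← ofReal_norm, ← ENNReal.ofReal_coe_nnreal,
        ← ENNReal.ofReal_mul (NNReal.coe_nonneg B)]
      exact ENNReal.ofReal_le_ofReal ((T.le_opNorm f).trans (by gcongr))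
    have h4 : ENNReal.ofReal p = 2 := by rw [h]; simp
    rw [h4]
    refine h2.trans ?_
    gcongr
    calc (B : ℝ≥0∞) = 1 * B := (one_mul _).symm
      _ ≤ _ := by
        gcongr
        rw [masterConst, add_assoc]
        exact le_self_add
  · have hpq : p.HolderConjugate (p / (p - 1)) := Real.HolderConjugate.conjExponent hp1
    have hp1' : 0 < p - 1 := by linarith
    have hinv : 1 / (p / (p - 1)) = 1 - 1 / p := by field_simp
    have h1 : interpExp p = 1 / (p / (p - 1)) := by
      rw [hinv]
      refine max_eq_right ?_
      have : 1 / p ≤ 1 / 2 := one_div_le_one_div_of_le (by norm_num) h.le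
      linarith
    rw [h1]
    refine (eLpNorm_clm_le_of_adjoint hpq h (fun g hg => eLpNorm_clm_le_of_lt_two hn hR
      (by rwa [LinearIsometryEquiv.norm_map]) hB hA hatom' hg hpq.symm.lt ?_) f).trans ?_
    · rw [div_lt_iff₀ hp1']; linarith
    · gcongr
      exact le_add_left le_rfl

end Interpolate

/-! ### Almost orthogonality and square functions -/

section AlmostOrthogonal

variable {ι E F : Type*} [Fintype ι] [NormedAddCommGroup E] [InnerProductSpace ℂ E]
  [CompleteSpace E] [NormedAddCommGroup F] [InnerProductSpace ℂ F] [CompleteSpace F]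

lemma sum_mul_mul_le_of_row_col {c : ι → ι → ℝ} {D : ℝ} (hc0 : ∀ i j, 0 ≤ c i j)
    (hrow : ∀ i, ∑ j, c i j ≤ D) (hcol : ∀ j, ∑ i, c i j ≤ D) (u : ι → ℝ) :
    ∑ i, ∑ j, c i j * (u i * u j) ≤ D * ∑ i, u i ^ 2 := by
  have h1 : ∑ i, ∑ j, c i j * (u i * u j) ≤
      ∑ i, ∑ j, (c i j * u i ^ 2 / 2 + c i j * u j ^ 2 / 2) := by
    refine Finset.sum_le_sum fun i _ => Finset.sum_le_sum fun j _ => ?_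
    nlinarith [mul_nonneg (hc0 i j) (sq_nonneg (u i - u j))]
  refine h1.trans ?_
  simp_rw [Finset.sum_add_distrib]
  have h2 : ∑ i, ∑ j, c i j * u i ^ 2 / 2 ≤ ∑ i, D * u i ^ 2 / 2 := by
    refine Finset.sum_le_sum fun i _ => ?_
    rw [← Finset.sum_div, ← Finset.sum_mul]
    have := mul_le_mul_of_nonneg_right (hrow i) (sq_nonneg (u i))
    linarith
  have h3 : ∑ i, ∑ j, c i j * u j ^ 2 / 2 ≤ ∑ i, D * u i ^ 2 / 2 := by
    rw [Finset.sum_comm]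
    refine Finset.sum_le_sum fun i _ => ?_
    rw [← Finset.sum_div, ← Finset.sum_mul]
    have := mul_le_mul_of_nonneg_right (hcol i) (sq_nonneg (u i))
    linarith
  rw [Finset.mul_sum]
  calc _ ≤ ∑ i, D * u i ^ 2 / 2 + ∑ i, D * u i ^ 2 / 2 := add_le_add h2 h3
    _ = _ := by rw [← Finset.sum_add_distrib]; exact Finset.sum_congr rfl fun i _ => by ring

lemma norm_sum_adjoint_sq_le {A : ι → E →L[ℂ] F} {c : ι → ι → ℝ} {D : ℝ}
    (hc : ∀ i j, ‖(A i).comp (ContinuousLinearMap.adjoint (A j))‖ ≤ c i j)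
    (hrow : ∀ i, ∑ j, c i j ≤ D) (hcol : ∀ j, ∑ i, c i j ≤ D) (g : ι → F) :
    ‖∑ i, ContinuousLinearMap.adjoint (A i) (g i)‖ ^ 2 ≤ D * ∑ i, ‖g i‖ ^ 2 := by
  have hc0 : ∀ i j, 0 ≤ c i j := fun i j => (norm_nonneg _).trans (hc i j)
  refine le_trans ?_ (sum_mul_mul_le_of_row_col hc0 hrow hcol fun i => ‖g i‖)
  have h1 : ((‖∑ i, ContinuousLinearMap.adjoint (A i) (g i)‖ ^ 2 : ℝ) : ℂ) =
      ∑ i, ∑ j, inner ℂ (g i) ((A i).comp (ContinuousLinearMap.adjoint (A j)) (g j)) := by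
    rw [Complex.ofReal_pow]
    refine (inner_self_eq_norm_sq_to_K (𝕜 := ℂ)
      (∑ i, ContinuousLinearMap.adjoint (A i) (g i))).symm.trans ?_
    rw [sum_inner]
    refine Finset.sum_congr rfl fun i _ => ?_
    rw [inner_sum]
    refine Finset.sum_congr rfl fun j _ => ?_
    rw [ContinuousLinearMap.adjoint_inner_left]
    rfl
  have h2 : ‖∑ i, ContinuousLinearMap.adjoint (A i) (g i)‖ ^ 2 =
      ‖∑ i, ∑ j, inner ℂ (g i) ((A i).comp (ContinuousLinearMap.adjoint (A j)) (g j))‖ := by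
    rw [← h1, Complex.norm_real, Real.norm_of_nonneg (by positivity)]
  rw [h2]
  refine (norm_sum_le _ _).trans (Finset.sum_le_sum fun i _ => (norm_sum_le _ _).trans
    (Finset.sum_le_sum fun j _ => ?_))
  calc _ ≤ ‖g i‖ * ‖(A i).comp (ContinuousLinearMap.adjoint (A j)) (g j)‖ := norm_inner_le_norm _ _
    _ ≤ ‖g i‖ * (c i j * ‖g j‖) := by
        gcongr
        exact (ContinuousLinearMap.le_opNorm _ _).trans (by gcongr; exact hc i j)
    _ = _ := by ring

/-- A family with summable interactions is bounded from `E` to `ℓ²(F)`. -/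
theorem sum_norm_sq_le_of_almost_orthogonal {A : ι → E →L[ℂ] F} {c : ι → ι → ℝ} {D : ℝ} (hD : 0 ≤ D)
    (hc : ∀ i j, ‖(A i).comp (ContinuousLinearMap.adjoint (A j))‖ ≤ c i j)
    (hrow : ∀ i, ∑ j, c i j ≤ D) (hcol : ∀ j, ∑ i, c i j ≤ D) (f : E) :
    ∑ i, ‖A i f‖ ^ 2 ≤ D * ‖f‖ ^ 2 := by
  set S := ∑ i, ‖A i f‖ ^ 2 with hS
  have hS0 : 0 ≤ S := Finset.sum_nonneg fun i _ => by positivity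
  have h1 := norm_sum_adjoint_sq_le hc hrow hcol fun i => A i f
  set v := ∑ i, ContinuousLinearMap.adjoint (A i) (A i f)
  have h2 : (S : ℂ) = inner ℂ v f := by
    rw [hS, sum_inner]
    push_cast
    refine Finset.sum_congr rfl fun i _ => ?_
    rw [ContinuousLinearMap.adjoint_inner_left]
    exact (inner_self_eq_norm_sq_to_K (𝕜 := ℂ) (A i f)).symm
  have h3 : S ≤ ‖v‖ * ‖f‖ := by
    have h4 := norm_inner_le_norm (𝕜 := ℂ) v f
    rwa [← h2, Complex.norm_real, Real.norm_of_nonneg hS0] at h4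
  rcases hS0.eq_or_lt with h | h
  · rw [← h]
    positivity
  · have h5 : S ^ 2 ≤ (D * S) * ‖f‖ ^ 2 := by
      calc S ^ 2 ≤ (‖v‖ * ‖f‖) ^ 2 := by gcongr
        _ = ‖v‖ ^ 2 * ‖f‖ ^ 2 := by ring
        _ ≤ _ := by gcongr
    nlinarith

end AlmostOrthogonal

section SquareFunction

variable {n : ℕ} {ι : Type} [Fintype ι]

/-- The vector valued operator attached to a finite family. -/
def familyCLM (A : ι → L2 n ℂ →L[ℂ] L2 n ℂ) : L2 n ℂ →L[ℂ] L2 n (EuclideanSpace ℂ ι) := by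
  classical exact
  ∑ i, ((ContinuousLinearMap.toSpanSingleton ℂ (EuclideanSpace.single i (1 : ℂ))).compLpL 2
    (volume : Measure (En n))).comp (A i)

lemma familyCLM_ae (A : ι → L2 n ℂ →L[ℂ] L2 n ℂ) (f : L2 n ℂ) :
    ∀ᵐ x, ∀ i, (familyCLM A f x : EuclideanSpace ℂ ι) i = A i f x := by
  classical
  have h1 : familyCLM A f = ∑ i, ((ContinuousLinearMap.toSpanSingleton ℂ
      (EuclideanSpace.single i (1 : ℂ))).compLpL 2 (volume : Measure (En n))) (A i f) := by
    unfold familyCLM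
    rw [ContinuousLinearMap.sum_apply]
    rfl
  have h2 : ∀ᵐ x : En n, ∀ i, ((ContinuousLinearMap.toSpanSingleton ℂ
      (EuclideanSpace.single i (1 : ℂ))).compLpL 2 (volume : Measure (En n))) (A i f) x =
      (A i f x) • EuclideanSpace.single i (1 : ℂ) := by
    rw [ae_all_iff]
    intro i
    exact (ContinuousLinearMap.toSpanSingleton ℂ
      (EuclideanSpace.single i (1 : ℂ))).coeFn_compLpL (A i f)
  rw [h1]
  filter_upwards [Lp.coeFn_finsetSum Finset.univ fun i => ((ContinuousLinearMap.toSpanSingleton ℂ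
      (EuclideanSpace.single i (1 : ℂ))).compLpL 2 (volume : Measure (En n))) (A i f), h2]
    with x hx hx2 j
  rw [hx]
  simp only [Finset.sum_apply, hx2, WithLp.ofLp_sum, WithLp.ofLp_smul, Pi.smul_apply,
    PiLp.ofLp_single, smul_eq_mul]
  rw [Finset.sum_eq_single j (fun i _ hij => by simp [Pi.single_apply, hij.symm]) (by simp)]
  simp

/-- The coordinate functionals. -/
abbrev coordCLM (i : ι) : EuclideanSpace ℂ ι →L[ℂ] ℂ := EuclideanSpace.proj i

lemma enorm_euclidean_sq (v : EuclideanSpace ℂ ι) :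
    ‖v‖ₑ ^ (2 : ℝ) = ∑ i, ‖v i‖ₑ ^ (2 : ℝ) := by
  have h1 : ‖v‖ ^ (2 : ℝ) = ∑ i, ‖v i‖ ^ (2 : ℝ) := by
    simp_rw [Real.rpow_two]
    exact EuclideanSpace.norm_sq_eq v
  rw [enorm_rpow_eq_ofReal _ (by norm_num), h1, ENNReal.ofReal_sum_of_nonneg fun _ _ => by positivity]
  exact Finset.sum_congr rfl fun i _ => (enorm_rpow_eq_ofReal _ (by norm_num)).symm

lemma enorm_euclidean_le_sum (v : EuclideanSpace ℂ ι) : ‖v‖ₑ ≤ ∑ i, ‖v i‖ₑ := by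
  have h1 : ‖v‖ ≤ ∑ i, ‖v i‖ := by
    rw [EuclideanSpace.norm_eq]
    refine Real.sqrt_le_iff.2 ⟨Finset.sum_nonneg fun _ _ => norm_nonneg _, ?_⟩
    exact Finset.sum_sq_le_sq_sum_of_nonneg fun _ _ => norm_nonneg _
  rw [← ofReal_norm]
  refine (ENNReal.ofReal_le_ofReal h1).trans (le_of_eq ?_)
  rw [ENNReal.ofReal_sum_of_nonneg fun _ _ => norm_nonneg _]
  exact Finset.sum_congr rfl fun i _ => ofReal_norm _

lemma enorm_apply_le_euclidean (v : EuclideanSpace ℂ ι) (i : ι) : ‖v i‖ₑ ≤ ‖v‖ₑ := by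
  rw [enorm_le_iff_norm_le]
  exact PiLp.norm_apply_le v i

lemma norm_L2_sq {H : Type*} [NormedAddCommGroup H] (f : L2 n H) :
    ENNReal.ofReal (‖f‖ ^ 2) = ∫⁻ x, ‖f x‖ₑ ^ (2 : ℝ) := by
  rw [← SchurKernel.eLpNorm_two_sq, ← Lp.enorm_def, enorm_rpow_eq_ofReal _ (by norm_num),
    Real.rpow_two]

lemma norm_familyCLM_le {A : ι → L2 n ℂ →L[ℂ] L2 n ℂ} {B : ℝ≥0}
    (h : ∀ f, ∑ i, ‖A i f‖ ^ 2 ≤ B ^ 2 * ‖f‖ ^ 2) : ‖familyCLM A‖ ≤ B := by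
  refine ContinuousLinearMap.opNorm_le_bound _ B.2 fun f => ?_
  have h1 : ENNReal.ofReal (‖familyCLM A f‖ ^ 2) = ENNReal.ofReal (∑ i, ‖A i f‖ ^ 2) := by
    rw [norm_L2_sq, ENNReal.ofReal_sum_of_nonneg fun _ _ => by positivity]
    simp_rw [norm_L2_sq]
    rw [← lintegral_finsetSum' _ fun i _ => ((Lp.aestronglyMeasurable _).enorm.pow_const _)]
    refine lintegral_congr_ae ?_
    filter_upwards [familyCLM_ae A f] with x hx
    rw [enorm_euclidean_sq]
    simp_rw [hx]
  rw [ENNReal.ofReal_eq_ofReal_iff (by positivity)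
    (Finset.sum_nonneg fun _ _ => by positivity)] at h1
  refine abs_le_of_sq_le_sq' ?_ (by positivity) |>.2
  rw [h1, mul_pow]
  exact h f

lemma adjoint_familyCLM (A : ι → L2 n ℂ →L[ℂ] L2 n ℂ) (g : L2 n (EuclideanSpace ℂ ι)) :
    ContinuousLinearMap.adjoint (familyCLM A) g = ∑ i, ContinuousLinearMap.adjoint (A i)
      ((coordCLM i).compLp g) := by
  refine ext_inner_right ℂ fun f => ?_
  rw [ContinuousLinearMap.adjoint_inner_left, sum_inner]
  simp_rw [ContinuousLinearMap.adjoint_inner_left, L2.inner_def]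
  rw [← integral_finsetSum _ fun i _ => L2.integrable_inner _ _]
  refine integral_congr_ae ?_
  have h2 : ∀ᵐ x : En n, ∀ i, (coordCLM i).compLp g x =
      (g x : EuclideanSpace ℂ ι) i := by
    rw [ae_all_iff]
    exact fun i => (coordCLM i).coeFn_compLp g
  filter_upwards [familyCLM_ae A f, h2] with x hx hx2
  rw [PiLp.inner_apply]
  simp_rw [hx, hx2]

/-- The integral of a square function, raised to the power `1 / p`. -/
def squareLp (A : ι → L2 n ℂ →L[ℂ] L2 n ℂ) (f : L2 n ℂ) (p : ℝ) : ℝ≥0∞ :=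
  (∫⁻ x, (∑ i, ‖A i f x‖ₑ ^ (2 : ℝ)) ^ (p / 2)) ^ (1 / p)

lemma squareLp_eq (A : ι → L2 n ℂ →L[ℂ] L2 n ℂ) (f : L2 n ℂ) {p : ℝ} (hp : 0 < p) :
    squareLp A f p = eLpNorm (familyCLM A f) (ENNReal.ofReal p) volume := by
  rw [eLpNorm_ofReal_eq _ _ hp, squareLp]
  congr 1
  refine lintegral_congr_ae ?_
  filter_upwards [familyCLM_ae A f] with x hx
  simp_rw [← hx]
  rw [← enorm_euclidean_sq, ← ENNReal.rpow_mul]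
  congr 1
  ring

/-- Atomic estimates for a finite family and its adjoints. -/
structure FamilyAtomBound (A : ι → L2 n ℂ →L[ℂ] L2 n ℂ) (R : ℝ) (D : ℝ≥0) : Prop where
  direct : ∀ (σ : Stopping n) (b : L2 n ℂ), σ.IsBad (b : En n → ℂ) →
    ∑ i, ∫⁻ x in (σ.star R)ᶜ, ‖A i b x‖ₑ ≤ D * ∫⁻ x, ‖b x‖ₑ
  adjoint : ∀ (σ : Stopping n) (b : ι → L2 n ℂ) (w : En n → ℝ≥0∞),
    (∀ i, σ.IsBad (b i : En n → ℂ)) → (∀ i, ∀ᵐ x, ‖b i x‖ₑ ≤ w x) →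
    ∑ i, ∫⁻ x in (σ.star R)ᶜ, ‖ContinuousLinearMap.adjoint (A i) (b i) x‖ₑ ≤ D * ∫⁻ x, w x

theorem squareLp_le (hn : 1 ≤ n) {R : ℝ} (hR : 0 ≤ R) {A : ι → L2 n ℂ →L[ℂ] L2 n ℂ} {B D : ℝ≥0}
    (h2 : ∀ f, ∑ i, ‖A i f‖ ^ 2 ≤ B ^ 2 * ‖f‖ ^ 2) (hB : 0 < B) (hBD : B ≤ D)
    (hatom : FamilyAtomBound A R D) {f : L2 n ℂ} (hf : Integrable (f : En n → ℂ)) {p : ℝ}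
    (hp : 1 < p) :
    squareLp A f p ≤ masterConst n R p *
      ((B ^ (1 - interpExp p) * D ^ interpExp p : ℝ≥0) : ℝ≥0∞) *
        eLpNorm f (ENNReal.ofReal p) volume := by
  rw [squareLp_eq _ _ (by linarith)]
  refine eLpNorm_clm_le hn hR (norm_familyCLM_le h2) hB hBD ?_ ?_ hf hp
  · intro σ b hb
    refine le_trans ?_ (hatom.direct σ b hb)
    rw [← lintegral_finsetSum' _ fun i _ => (Lp.aestronglyMeasurable _).enorm.restrict]
    refine lintegral_mono_ae (ae_restrict_of_ae ?_)
    filter_upwards [familyCLM_ae A b] with x hx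
    refine (enorm_euclidean_le_sum _).trans (le_of_eq ?_)
    simp_rw [hx]
  · intro σ b hb
    have hc : ∀ i, ((coordCLM i).compLp b : En n → ℂ)
        =ᵐ[volume] fun x => (b x : EuclideanSpace ℂ ι) i := fun i =>
      (coordCLM i).coeFn_compLp b
    refine le_trans ?_ (hatom.adjoint σ
      (fun i => (coordCLM i).compLp b)
      (fun x => ‖b x‖ₑ) (fun i => ?_) fun i => ?_)
    · rw [adjoint_familyCLM, ← lintegral_finsetSum' _ fun i _ =>
        (Lp.aestronglyMeasurable _).enorm.restrict]
      refine lintegral_mono_ae (ae_restrict_of_ae ?_)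
      filter_upwards [Lp.coeFn_finsetSum Finset.univ fun i => ContinuousLinearMap.adjoint (A i)
        ((coordCLM i).compLp b)] with x hx
      rw [hx, Finset.sum_apply]
      exact enorm_sum_le _ _
    · refine ⟨?_, ?_, fun x hx => ?_⟩
      · exact (((coordCLM i).integrable_comp
          hb.integrable).congr (hc i).symm)
      · filter_upwards [hb.ae_eq_zero, hc i] with x h1 h2 h3
        rw [h2, h1 h3]
        rfl
      · rw [integral_congr_ae (ae_restrict_of_ae (hc i))]
        have := (coordCLM i).integral_comp_comm
          (μ := volume.restrict (dyadicCube (σ.level x) x)) hb.integrable.restrict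
        rw [hb.integral_eq_zero x hx, map_zero] at this
        exact this
    · filter_upwards [hc i] with x hx
      rw [hx]
      exact enorm_apply_le_euclidean _ _

end SquareFunction

/-! ### Composition of kernels and atomic estimates -/

namespace SchurKernel

variable {n : ℕ} (κ κ₁ κ₂ : SchurKernel n)

lemma lintegral_mul_le_col (y : En n) :
    ∫⁻ x, ∫⁻ z, ‖κ₁.toFun x z‖ₑ * ‖κ₂.toFun z y‖ₑ ≤ κ₁.bound * κ₂.bound := by
  refine (κ₁.lintegral_lintegral_le κ₁.col_le (κ₂.measurable_col y).enorm.aemeasurable).trans ?_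
  gcongr
  exact κ₂.col_le y

lemma lintegral_mul_le_row (x : En n) :
    ∫⁻ y, ∫⁻ z, ‖κ₁.toFun x z‖ₑ * ‖κ₂.toFun z y‖ₑ ≤ κ₁.bound * κ₂.bound := by
  rw [lintegral_lintegral_swap]
  · calc _ = ∫⁻ z, ‖κ₁.toFun x z‖ₑ * ∫⁻ y, ‖κ₂.toFun z y‖ₑ := by
          refine lintegral_congr fun z => lintegral_const_mul' _ _ enorm_ne_top
      _ ≤ ∫⁻ z, ‖κ₁.toFun x z‖ₑ * κ₂.bound := by gcongr; exact κ₂.row_le _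
      _ = (∫⁻ z, ‖κ₁.toFun x z‖ₑ) * κ₂.bound := lintegral_mul_const' _ _ ENNReal.coe_ne_top
      _ ≤ _ := by gcongr; exact κ₁.row_le x
  · exact (((κ₁.measurable_row x).comp measurable_snd).enorm.mul
      (κ₂.measurable_toFun.comp measurable_swap).enorm).aemeasurable

/-- Composition of kernels. -/
def comp : SchurKernel n where
  toFun x y := ∫ z, κ₁.toFun x z * κ₂.toFun z y
  measurable_toFun := by
    refine StronglyMeasurable.measurable ?_
    refine StronglyMeasurable.integral_prod_right
      (f := fun (p : En n × En n) z => κ₁.toFun p.1 z * κ₂.toFun z p.2) ?_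
    refine Measurable.stronglyMeasurable ?_
    exact (κ₁.measurable_toFun.comp ((measurable_fst.comp measurable_fst).prodMk measurable_snd)).mul
      (κ₂.measurable_toFun.comp (measurable_snd.prodMk (measurable_snd.comp measurable_fst)))
  bound := κ₁.bound * κ₂.bound
  row_le x := by
    push_cast
    refine le_trans (lintegral_mono fun y => ?_) (lintegral_mul_le_row κ₁ κ₂ x)
    refine (enorm_integral_le_lintegral_enorm _).trans_eq ?_
    simp_rw [enorm_mul]
  col_le y := by
    push_cast
    refine le_trans (lintegral_mono fun y => ?_) (lintegral_mul_le_col κ₁ κ₂ y)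
    refine (enorm_integral_le_lintegral_enorm _).trans_eq ?_
    simp_rw [enorm_mul]

lemma comp_toFun (x y : En n) :
    (κ₁.comp κ₂).toFun x y = ∫ z, κ₁.toFun x z * κ₂.toFun z y := rfl

lemma comp_bound : (κ₁.comp κ₂).bound = κ₁.bound * κ₂.bound := rfl

/-- Difference of kernels. -/
def sub : SchurKernel n where
  toFun x y := κ₁.toFun x y - κ₂.toFun x y
  measurable_toFun := κ₁.measurable_toFun.sub κ₂.measurable_toFun
  bound := κ₁.bound + κ₂.bound
  row_le x := by
    push_cast
    calc _ ≤ ∫⁻ y, (‖κ₁.toFun x y‖ₑ + ‖κ₂.toFun x y‖ₑ) := lintegral_mono fun y => enorm_sub_le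
      _ = _ := lintegral_add_left (κ₁.measurable_row x).enorm _
      _ ≤ _ := add_le_add (κ₁.row_le x) (κ₂.row_le x)
  col_le y := by
    push_cast
    calc _ ≤ ∫⁻ x, (‖κ₁.toFun x y‖ₑ + ‖κ₂.toFun x y‖ₑ) := lintegral_mono fun y => enorm_sub_le
      _ = _ := lintegral_add_left (κ₁.measurable_col y).enorm _
      _ ≤ _ := add_le_add (κ₁.col_le y) (κ₂.col_le y)

lemma sub_toFun (x y : En n) : (κ₁.sub κ₂).toFun x y = κ₁.toFun x y - κ₂.toFun x y := rfl

lemma op_comp_of_finite {f : En n → ℂ} (hf : AEStronglyMeasurable f volume) {x : En n}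
    (hx : ∫⁻ z, ‖κ₁.toFun x z‖ₑ * ∫⁻ y, ‖κ₂.toFun z y‖ₑ * ‖f y‖ₑ ≠ ∞) :
    (κ₁.comp κ₂).op f x = κ₁.op (κ₂.op f) x := by
  have hInt : Integrable (fun q : En n × En n => κ₁.toFun x q.2 * κ₂.toFun q.2 q.1 * f q.1)
      (volume.prod volume) := by
    refine ⟨(((κ₁.measurable_row x).comp measurable_snd).mul
      (κ₂.measurable_toFun.comp measurable_swap)).aestronglyMeasurable.mul hf.comp_fst, ?_⟩
    rw [hasFiniteIntegral_iff_enorm, lintegral_prod_symm]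
    · refine lt_of_le_of_lt (le_of_eq (lintegral_congr fun z => ?_)) hx.lt_top
      rw [← lintegral_const_mul' _ _ enorm_ne_top]
      refine lintegral_congr fun y => ?_
      rw [enorm_mul, enorm_mul, mul_assoc]
    · exact ((((κ₁.measurable_row x).comp measurable_snd).mul
        (κ₂.measurable_toFun.comp measurable_swap)).aestronglyMeasurable.mul hf.comp_fst).enorm
  have h := integral_integral_swap (f := fun y z => κ₁.toFun x z * κ₂.toFun z y * f y) hInt
  calc _ = ∫ y, ∫ z, κ₁.toFun x z * κ₂.toFun z y * f y := by
        refine integral_congr_ae (Eventually.of_forall fun y => ?_)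
        show (∫ z, κ₁.toFun x z * κ₂.toFun z y) * f y = _
        rw [← integral_mul_const]
    _ = _ := h
    _ = _ := by
        refine integral_congr_ae (Eventually.of_forall fun z => ?_)
        show _ = κ₁.toFun x z * ∫ y, κ₂.toFun z y * f y
        rw [← integral_const_mul]
        simp_rw [mul_assoc]

lemma aemeasurable_lintegral_mul {F : En n → ℝ≥0∞} (hF : AEMeasurable F) :
    AEMeasurable fun x => ∫⁻ y, ‖κ.toFun x y‖ₑ * F y :=
  (κ.measurable_toFun.enorm.aemeasurable.mul hF.comp_snd).lintegral_prod_right'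

lemma op_comp_L1 {f : En n → ℂ} (hf : Integrable f) :
    (κ₁.comp κ₂).op f =ᵐ[volume] κ₁.op (κ₂.op f) := by
  have hF := κ₂.aemeasurable_lintegral_mul hf.1.enorm
  have h1 : ∫⁻ x, ∫⁻ z, ‖κ₁.toFun x z‖ₑ * ∫⁻ y, ‖κ₂.toFun z y‖ₑ * ‖f y‖ₑ ≠ ∞ := by
    refine ne_top_of_le_ne_top ?_ (κ₁.lintegral_lintegral_le κ₁.col_le hF)
    refine ENNReal.mul_ne_top ENNReal.coe_ne_top
      (ne_top_of_le_ne_top ?_ (κ₂.lintegral_lintegral_le κ₂.col_le hf.1.enorm))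
    have hfin := hf.2
    rw [hasFiniteIntegral_iff_enorm] at hfin
    exact ENNReal.mul_ne_top ENNReal.coe_ne_top hfin.ne
  filter_upwards [ae_lt_top' (κ₁.aemeasurable_lintegral_mul hF) h1] with x hx
  exact op_comp_of_finite κ₁ κ₂ hf.1 hx.ne

lemma op_comp_L2 {f : En n → ℂ} (hf : MemLp f 2 volume) :
    (κ₁.comp κ₂).op f =ᵐ[volume] κ₁.op (κ₂.op f) := by
  have hF := κ₂.aemeasurable_lintegral_mul hf.1.enorm
  have h1 : ∫⁻ x, (∫⁻ z, ‖κ₁.toFun x z‖ₑ * ∫⁻ y, ‖κ₂.toFun z y‖ₑ * ‖f y‖ₑ) ^ (2 : ℝ) ≠ ∞ := by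
    refine ne_top_of_le_ne_top ?_ (κ₁.lintegral_sq_le κ₁.row_le κ₁.col_le hF)
    refine ENNReal.mul_ne_top (ENNReal.mul_ne_top ENNReal.coe_ne_top ENNReal.coe_ne_top)
      (ne_top_of_le_ne_top ?_ (κ₂.lintegral_sq_le κ₂.row_le κ₂.col_le hf.1.enorm))
    rw [← eLpNorm_two_sq]
    exact ENNReal.mul_ne_top (ENNReal.mul_ne_top ENNReal.coe_ne_top ENNReal.coe_ne_top)
      (ENNReal.rpow_ne_top_of_nonneg (by norm_num) hf.2.ne)
  filter_upwards [ae_lt_top' ((κ₁.aemeasurable_lintegral_mul hF).pow_const _) h1] with x hx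
  exact op_comp_of_finite κ₁ κ₂ hf.1
    ((ENNReal.rpow_lt_top_iff_of_pos (by norm_num)).1 hx).ne

lemma clm_comp : (κ₁.comp κ₂).clm = κ₁.clm.comp κ₂.clm := by
  ext1 f
  refine Lp.ext ?_
  refine ((κ₁.comp κ₂).clm_ae f).trans ((op_comp_L2 κ₁ κ₂ (Lp.memLp f)).trans ?_)
  refine EventuallyEq.trans ?_ (κ₁.clm_ae (κ₂.clm f)).symm
  rw [κ₁.op_congr (κ₂.clm_ae f)]

lemma op_sub_ae {f : En n → ℂ} (h₁ : ∀ᵐ x, Integrable fun y => κ₁.toFun x y * f y)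
    (h₂ : ∀ᵐ x, Integrable fun y => κ₂.toFun x y * f y) :
    (κ₁.sub κ₂).op f =ᵐ[volume] fun x => κ₁.op f x - κ₂.op f x := by
  filter_upwards [h₁, h₂] with x h1 h2
  rw [op, op, op, ← integral_sub h1 h2]
  simp_rw [sub_toFun, sub_mul]

lemma clm_sub : (κ₁.sub κ₂).clm = κ₁.clm - κ₂.clm := by
  ext1 f
  refine Lp.ext ?_
  refine ((κ₁.sub κ₂).clm_ae f).trans ?_
  have h3 : (κ₁.clm - κ₂.clm) f = κ₁.clm f - κ₂.clm f := rfl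
  rw [h3]
  filter_upwards [op_sub_ae κ₁ κ₂ (κ₁.ae_integrable_L2 (Lp.memLp f))
    (κ₂.ae_integrable_L2 (Lp.memLp f)), κ₁.clm_ae f, κ₂.clm_ae f,
    Lp.coeFn_sub (κ₁.clm f) (κ₂.clm f)] with x h h1 h2 h3
  rw [h, h3, Pi.sub_apply, h1, h2]

lemma adj_toFun (x y : En n) : κ.adj.toFun x y = starRingEnd ℂ (κ.toFun y x) := rfl

lemma comp_adj_toFun (x y : En n) :
    (κ₁.comp κ₂).adj.toFun x y = (κ₂.adj.comp κ₁.adj).toFun x y := by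
  rw [adj_toFun, comp_toFun, comp_toFun, ← integral_conj]
  refine integral_congr_ae (Eventually.of_forall fun z => ?_)
  simp only [adj_toFun, map_mul]
  ring

lemma enorm_adj (x y : En n) : ‖κ.adj.toFun x y‖ₑ = ‖κ.toFun y x‖ₑ := by
  rw [adj_toFun, ← ofReal_norm, RCLike.norm_conj, ofReal_norm]

/-- Comparison of a composition with a multiple of one factor, along a column. -/
lemma lintegral_comp_sub_le {c : ℂ} {y : En n} (hc : ∫ z, κ₂.toFun z y = c) :
    ∫⁻ x, ‖(κ₁.comp κ₂).toFun x y - c * κ₁.toFun x y‖ₑ ≤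
      ∫⁻ z, ‖κ₂.toFun z y‖ₑ * ∫⁻ x, ‖κ₁.toFun x z - κ₁.toFun x y‖ₑ := by
  have hi2 : Integrable fun z => κ₂.toFun z y :=
    ⟨(κ₂.measurable_col y).aestronglyMeasurable, by
      rw [hasFiniteIntegral_iff_enorm]; exact (κ₂.col_le y).trans_lt ENNReal.coe_lt_top⟩
  have hae : ∀ᵐ x, Integrable fun z => κ₁.toFun x z * κ₂.toFun z y := κ₁.ae_integrable_L1 hi2
  calc _ ≤ ∫⁻ x, ∫⁻ z, ‖κ₂.toFun z y‖ₑ * ‖κ₁.toFun x z - κ₁.toFun x y‖ₑ := by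
        refine lintegral_mono_ae ?_
        filter_upwards [hae] with x hx
        have : (κ₁.comp κ₂).toFun x y - c * κ₁.toFun x y =
            ∫ z, κ₂.toFun z y * (κ₁.toFun x z - κ₁.toFun x y) := by
          rw [comp_toFun, ← hc, ← integral_mul_const, ← integral_sub hx (hi2.mul_const _)]
          refine integral_congr_ae (Eventually.of_forall fun z => ?_)
          ring
        rw [this]
        refine (enorm_integral_le_lintegral_enorm _).trans_eq ?_
        simp_rw [enorm_mul]
    _ = ∫⁻ z, ∫⁻ x, ‖κ₂.toFun z y‖ₑ * ‖κ₁.toFun x z - κ₁.toFun x y‖ₑ := by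
        refine lintegral_lintegral_swap (Measurable.aemeasurable ?_)
        exact ((κ₂.measurable_col y).comp measurable_snd).enorm.mul
          (κ₁.measurable_toFun.sub ((κ₁.measurable_col y).comp measurable_fst)).enorm
    _ = _ := lintegral_congr fun z => lintegral_const_mul' _ _ enorm_ne_top

end SchurKernel

namespace Stopping

variable {n : ℕ} (σ : Stopping n)

lemma enorm_ker (x y : En n) : ‖(σ.ker x y : ℂ)‖ₑ = ENNReal.ofReal (σ.ker x y) := by
  rw [← ofReal_norm, Complex.norm_real, Real.norm_of_nonneg (σ.ker_nonneg x y)]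

/-- The averaging kernel as a Schur kernel. -/
def schur : SchurKernel n where
  toFun x y := σ.ker x y
  measurable_toFun := Complex.measurable_ofReal.comp σ.measurable_ker
  bound := 1
  row_le x := by simp_rw [σ.enorm_ker]; exact_mod_cast σ.lintegral_ker_le x
  col_le y := by
    simp_rw [σ.enorm_ker, σ.ker_comm _ y]; exact_mod_cast σ.lintegral_ker_le y

lemma schur_toFun (x y : En n) : σ.schur.toFun x y = (σ.ker x y : ℂ) := rfl

lemma schur_bound : σ.schur.bound = 1 := rfl

lemma integral_schur_col {y : En n} (hy : y ∈ σ.carrier) : ∫ z, σ.schur.toFun z y = 1 := by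
  simp_rw [schur_toFun, σ.ker_comm _ y]
  rw [integral_complex_ofReal]
  have h := σ.lintegral_ker_eq hy (fun _ => 1)
  simp only [mul_one, lintegral_one, Measure.restrict_apply_univ] at h
  rw [ofReal_cubeDensity_mul_volume] at h
  rw [integral_eq_lintegral_of_nonneg_ae (Eventually.of_forall fun z => σ.ker_nonneg y z)
    (σ.measurable_ker.of_uncurry_left).aestronglyMeasurable, h]
  simp

/-- The part of a stopping region at levels above `i`. -/
def above (i : ℤ) : Stopping n where
  carrier := σ.carrier ∩ {x | i < σ.level x}
  level := σ.level
  measurableSet_carrier := σ.measurableSet_carrier.inter (σ.measurable_level measurableSet_Ioi)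
  measurable_level := σ.measurable_level
  stable x hx y hy := by
    obtain ⟨h1, h2⟩ := σ.stable x hx.1 y hy
    refine ⟨⟨h1, ?_⟩, h2⟩
    show i < σ.level y
    rw [h2]; exact hx.2

lemma IsBad.above {b : En n → ℂ} (hb : σ.IsBad b) (i : ℤ) :
    (σ.above i).IsBad ((σ.above i).carrier.indicator b) := by
  refine ⟨hb.integrable.indicator (σ.above i).measurableSet_carrier,
    Eventually.of_forall fun x hx => indicator_of_notMem hx _, fun x hx => ?_⟩
  rw [← hb.integral_eq_zero x hx.1]
  refine setIntegral_congr_fun (measurableSet_dyadicCube _ _) fun y hy => ?_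
  exact indicator_of_mem ((σ.above i).stable x hx y hy).1 _

lemma IsBad.schur_op {b : En n → ℂ} (hb : σ.IsBad b) (x : En n) : σ.schur.op b x = 0 := by
  rw [SchurKernel.op]
  by_cases hx : x ∈ σ.carrier
  · have : ∀ y, σ.schur.toFun x y * b y = (dyadicCube (σ.level x) x).indicator
        (fun y => (cubeDensity n (σ.level x) : ℂ) * b y) y := by
      intro y
      rw [schur_toFun, σ.ker_eq_indicator hx]
      by_cases hy : y ∈ dyadicCube (σ.level x) x
      · rw [indicator_of_mem hy, indicator_of_mem hy]
      · rw [indicator_of_notMem hy, indicator_of_notMem hy]; simp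
    simp_rw [this]
    rw [integral_indicator (measurableSet_dyadicCube _ _), integral_const_mul,
      hb.integral_eq_zero x hx, mul_zero]
  · simp [schur_toFun, σ.ker_of_notMem hx]

end Stopping

section Atom

variable {n : ℕ}

/-- Localisation and regularity of a kernel at scale `2 ^ (-i)`. -/
structure SchurKernel.IsAtomic (κ : SchurKernel n) (i : ℤ) (R : ℝ) (Λ M : ℝ≥0) : Prop where
  eq_zero : ∀ x y, R * ((2 : ℝ) ^ i)⁻¹ < ‖x - y‖ → κ.toFun x y = 0
  col_le : ∀ y, ∫⁻ x, ‖κ.toFun x y‖ₑ ≤ Λ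
  modulus : ∀ τ, i < τ → ∀ y, ∀ y' ∈ dyadicCube τ y,
    ∫⁻ x, ‖κ.toFun x y' - κ.toFun x y‖ₑ ≤ M * ENNReal.ofReal ((2 : ℝ) ^ (i - τ))

/-- The gain for an atom whose scale is `2 ^ (-d)` times the scale of the kernel. -/
def atomGain (Λ M : ℝ≥0) (d : ℤ) : ℝ≥0∞ :=
  if 0 < d then min (2 * Λ) (M * ENNReal.ofReal ((2 : ℝ) ^ (-d))) else 0

theorem SchurKernel.IsAtomic.lintegral_le {κ : SchurKernel n} {i : ℤ} {R : ℝ} {Λ M : ℝ≥0}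
    (hκ : κ.IsAtomic i R Λ M) (hR : 0 ≤ R) {σ : Stopping n} {b : En n → ℂ} (hb : σ.IsBad b) :
    ∫⁻ x in (σ.star R)ᶜ, ‖κ.op b x‖ₑ ≤ ∫⁻ y, atomGain Λ M (σ.level y - i) * ‖b y‖ₑ := by
  set ρ := σ.above i with hρ
  set b' := ρ.carrier.indicator b with hb'def
  have hb' : ρ.IsBad b' := hb.above σ i
  have h1 : ∀ x ∈ (σ.star R)ᶜ, κ.op b x = κ.op b' x := by
    intro x hx
    refine integral_congr_ae ?_
    filter_upwards [hb.ae_eq_zero] with y hy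
    by_cases hyc : y ∈ ρ.carrier
    · rw [hb'def, indicator_of_mem hyc]
    · rw [hb'def, indicator_of_notMem hyc, mul_zero]
      by_cases hyσ : y ∈ σ.carrier
      · have hl : ¬ i < σ.level y := fun h => hyc ⟨hyσ, h⟩
        rw [hκ.eq_zero x y, zero_mul]
        refine lt_of_le_of_lt ?_ (σ.lt_norm_sub_of_notMem_star hx hyσ)
        rw [not_lt] at hl
        gcongr
        norm_num
      · rw [hy hyσ, mul_zero]
  have h2 : κ.op b' =ᵐ[volume] (κ.sub (κ.comp ρ.schur)).op b' := by
    refine EventuallyEq.symm ((SchurKernel.op_sub_ae κ _ (κ.ae_integrable_L1 hb'.integrable)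
      ((κ.comp ρ.schur).ae_integrable_L1 hb'.integrable)).trans ?_)
    filter_upwards [κ.op_comp_L1 ρ.schur hb'.integrable] with x hx
    rw [hx]
    have : ρ.schur.op b' = fun _ => 0 := funext fun z => hb'.schur_op ρ z
    rw [this]
    simp [SchurKernel.op]
  have h3 : ∀ y ∈ ρ.carrier, ∫⁻ x, ‖(κ.sub (κ.comp ρ.schur)).toFun x y‖ₑ ≤
      atomGain Λ M (σ.level y - i) := by
    intro y hy
    have hl : i < σ.level y := hy.2
    have h4 := SchurKernel.lintegral_comp_sub_le κ ρ.schur (ρ.integral_schur_col hy)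
    have h5 : ∀ x, ‖(κ.sub (κ.comp ρ.schur)).toFun x y‖ₑ =
        ‖(κ.comp ρ.schur).toFun x y - 1 * κ.toFun x y‖ₑ := by
      intro x
      rw [SchurKernel.sub_toFun, one_mul, enorm_sub_rev]
    simp_rw [h5]
    refine h4.trans ?_
    have h6 : ∀ z, ‖ρ.schur.toFun z y‖ₑ * ∫⁻ x, ‖κ.toFun x z - κ.toFun x y‖ₑ ≤
        ENNReal.ofReal (ρ.ker y z) * atomGain Λ M (σ.level y - i) := by
      intro z
      rw [Stopping.schur_toFun, Stopping.enorm_ker, ρ.ker_comm z y]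
      by_cases hz : z ∈ dyadicCube (ρ.level y) y
      · gcongr
        rw [atomGain, if_pos (by omega)]
        refine le_min ?_ ?_
        · calc _ ≤ ∫⁻ x, (‖κ.toFun x z‖ₑ + ‖κ.toFun x y‖ₑ) := lintegral_mono fun y => enorm_sub_le
            _ = _ := lintegral_add_left (κ.measurable_col z).enorm _
            _ ≤ _ := add_le_add (hκ.col_le z) (hκ.col_le y)
            _ = _ := (two_mul _).symm
        · rw [neg_sub]
          exact hκ.modulus _ hl y z hz
      · rw [ρ.ker_eq_indicator hy, indicator_of_notMem hz]
        simp
    refine (lintegral_mono h6).trans ?_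
    have h7 : atomGain Λ M (σ.level y - i) ≠ ∞ := by
      unfold atomGain
      split_ifs
      · exact ne_top_of_le_ne_top (by finiteness) (min_le_left _ _)
      · exact ENNReal.zero_ne_top
    rw [lintegral_mul_const' _ _ h7]
    exact mul_le_of_le_one_left' (ρ.lintegral_ker_le y)
  calc _ = ∫⁻ x in (σ.star R)ᶜ, ‖κ.op b' x‖ₑ :=
        setLIntegral_congr_fun (σ.measurableSet_star R).compl fun x hx => by rw [h1 x hx]
    _ ≤ ∫⁻ x, ‖κ.op b' x‖ₑ := setLIntegral_le_lintegral _ _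
    _ = ∫⁻ x, ‖(κ.sub (κ.comp ρ.schur)).op b' x‖ₑ := by
        refine lintegral_congr_ae ?_
        filter_upwards [h2] with x hx
        rw [hx]
    _ ≤ ∫⁻ x, ∫⁻ y, ‖(κ.sub (κ.comp ρ.schur)).toFun x y‖ₑ * ‖b' y‖ₑ :=
        lintegral_mono fun x => SchurKernel.enorm_op_le _ _ x
    _ = ∫⁻ y, ∫⁻ x, ‖(κ.sub (κ.comp ρ.schur)).toFun x y‖ₑ * ‖b' y‖ₑ :=
        lintegral_lintegral_swap ((SchurKernel.measurable_toFun _).enorm.aemeasurable.mul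
          hb'.integrable.1.enorm.comp_snd)
    _ ≤ ∫⁻ y, atomGain Λ M (σ.level y - i) * ‖b y‖ₑ := by
        refine lintegral_mono fun y => ?_
        simp only
        rw [lintegral_mul_const' _ _ enorm_ne_top]
        by_cases hy : y ∈ ρ.carrier
        · rw [hb'def, indicator_of_mem hy]
          gcongr
          exact h3 y hy
        · rw [hb'def, indicator_of_notMem hy]
          simp

end Atom

/-! ### Square functions of families of atomic kernels -/

section Gain

/-- The interaction of two scales at distance `d`, saturated up to distance `L`. -/
def scaleGain (L : ℕ) (d : ℤ) : ℝ := min 1 ((2 : ℝ) ^ ((L : ℤ) - |d|))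

lemma scaleGain_nonneg (L : ℕ) (d : ℤ) : 0 ≤ scaleGain L d := le_min zero_le_one (by positivity)

lemma sum_range_scaleGain_le (L N : ℕ) : ∑ k ∈ Finset.range N, scaleGain L k ≤ L + 2 := by
  calc _ ≤ ∑ k ∈ Finset.range (L + N), scaleGain L k :=
        Finset.sum_le_sum_of_subset_of_nonneg (Finset.range_mono (by omega))
          fun _ _ _ => scaleGain_nonneg _ _
    _ = ∑ k ∈ Finset.range L, scaleGain L k +
          ∑ k ∈ Finset.range N, scaleGain L ((L + k : ℕ) : ℤ) := Finset.sum_range_add _ _ _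
    _ ≤ ∑ k ∈ Finset.range L, (1 : ℝ) + ∑ k ∈ Finset.range N, (1 / 2 : ℝ) ^ k := by
        gcongr with k _ k _
        · exact min_le_left _ _
        · refine (min_le_right _ _).trans (le_of_eq ?_)
          rw [abs_of_nonneg (by positivity)]
          push_cast
          rw [sub_add_cancel_left, zpow_neg, zpow_natCast, one_div, inv_pow]
    _ ≤ _ := by
        gcongr
        · simp
        · exact sum_geometric_two_le N

lemma sum_scaleGain_le (L : ℕ) (S : Finset ℤ) : ∑ d ∈ S, scaleGain L d ≤ 4 * (1 + L) := by
  have key : ∀ S' : Finset ℤ, Set.InjOn Int.natAbs S' →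
      ∑ d ∈ S', scaleGain L d ≤ L + 2 := by
    intro S' h
    have h1 : ∑ d ∈ S', scaleGain L d = ∑ k ∈ S'.image Int.natAbs, scaleGain L k := by
      rw [Finset.sum_image h]
      refine Finset.sum_congr rfl fun d _ => ?_
      simp [scaleGain]
    obtain ⟨N, hN⟩ := (S'.image Int.natAbs).bddAbove
    rw [h1]
    refine (Finset.sum_le_sum_of_subset_of_nonneg (fun k hk => ?_)
      fun _ _ _ => scaleGain_nonneg _ _).trans (sum_range_scaleGain_le L (N + 1))
    exact Finset.mem_range.2 (Nat.lt_succ_of_le (hN hk))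
  rw [← Finset.sum_filter_add_sum_filter_not S (fun d => 0 ≤ d)]
  have h1 := key (S.filter fun d => 0 ≤ d) (by
    intro a ha b hb hab
    have ha' := (Finset.mem_filter.1 ha).2
    have hb' := (Finset.mem_filter.1 hb).2
    omega)
  have h2 := key (S.filter fun d => ¬ 0 ≤ d) (by
    intro a ha b hb hab
    have ha' := (Finset.mem_filter.1 ha).2
    have hb' := (Finset.mem_filter.1 hb).2
    omega)
  have : (0 : ℝ) ≤ L := by positivity
  linarith

lemma sum_scaleGain_comp_le (L : ℕ) {ι : Type*} [Fintype ι] {s : ι → ℤ}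
    (hs : Function.Injective s) : ∑ j, scaleGain L (s j) ≤ 4 * (1 + L) := by
  classical
  rw [← Finset.sum_image (f := scaleGain L) (s := Finset.univ) (g := s) (fun a _ b _ h => hs h)]
  exact sum_scaleGain_le L _

lemma atomGain_le (Λ : ℝ≥0) (L : ℕ) (d : ℤ) :
    atomGain Λ (Λ * 2 ^ L) d ≤ 2 * Λ * ENNReal.ofReal (scaleGain L d) := by
  unfold atomGain
  split_ifs with h
  · rw [scaleGain, ENNReal.ofReal_mono.map_min, ENNReal.ofReal_one,
      (mul_right_mono : Monotone fun x => 2 * (Λ : ℝ≥0∞) * x).map_min, mul_one]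
    refine min_le_min le_rfl ?_
    rw [abs_of_pos h, sub_eq_add_neg, zpow_add₀ (by norm_num), ENNReal.ofReal_mul (by positivity)]
    push_cast
    rw [zpow_natCast, ENNReal.ofReal_pow (by norm_num), mul_assoc, mul_assoc]
    simp only [ENNReal.ofReal_ofNat]
    refine le_mul_of_one_le_left' (by norm_num)
  · exact zero_le

lemma sum_atomGain_le (Λ : ℝ≥0) (L : ℕ) {ι : Type*} [Fintype ι] {s : ι → ℤ}
    (hs : Function.Injective s) (d : ℤ) :
    ∑ j, atomGain Λ (Λ * 2 ^ L) (d - s j) ≤ ((8 * (1 + L) * Λ : ℝ≥0) : ℝ≥0∞) := by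
  calc _ ≤ ∑ j, 2 * Λ * ENNReal.ofReal (scaleGain L (d - s j)) :=
        Finset.sum_le_sum fun j _ => atomGain_le Λ L _
    _ = 2 * Λ * ENNReal.ofReal (∑ j, scaleGain L (d - s j)) := by
        rw [← Finset.mul_sum, ENNReal.ofReal_sum_of_nonneg fun _ _ => scaleGain_nonneg _ _]
    _ ≤ 2 * Λ * ENNReal.ofReal (4 * (1 + L)) := by
        gcongr
        exact sum_scaleGain_comp_le L (sub_right_injective.comp hs)
    _ = _ := by
        have : (4 * (1 + L) : ℝ) = ((4 * (1 + L) : ℝ≥0) : ℝ) := by push_cast; ring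
        rw [this, ENNReal.ofReal_coe_nnreal]
        rw [← ENNReal.coe_ofNat, ← ENNReal.coe_mul, ← ENNReal.coe_mul]
        congr 1
        ring

end Gain

section Family

variable {n : ℕ} {ι : Type} [Fintype ι]

lemma sum_lintegral_atomGain_le (Λ : ℝ≥0) (L : ℕ) {s : ι → ℤ} (hs : Function.Injective s)
    (σ : Stopping n) (w : En n → ℝ≥0∞) :
    ∑ j, ∫⁻ y, atomGain Λ (Λ * 2 ^ L) (σ.level y - s j) * w y ≤
      ((8 * (1 + L) * Λ : ℝ≥0) : ℝ≥0∞) * ∫⁻ y, w y := by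
  classical
  have key : ∀ S : Finset ι, ∑ j ∈ S, ∫⁻ y, atomGain Λ (Λ * 2 ^ L) (σ.level y - s j) * w y ≤
      ∫⁻ y, ∑ j ∈ S, atomGain Λ (Λ * 2 ^ L) (σ.level y - s j) * w y := by
    intro S
    induction S using Finset.induction_on with
    | empty => simp
    | insert a S ha ih =>
      simp_rw [Finset.sum_insert ha]
      exact (add_le_add le_rfl ih).trans (le_lintegral_add _ _)
  refine (key Finset.univ).trans ?_
  rw [← lintegral_const_mul' _ _ ENNReal.coe_ne_top]
  refine lintegral_mono fun y => ?_
  simp only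
  rw [← Finset.sum_mul]
  gcongr
  exact sum_atomGain_le Λ L hs _

/-- A family of kernels at distinct scales, with quantitative almost orthogonality. -/
structure ScaledFamily (κ : ι → SchurKernel n) (s : ι → ℤ) (R : ℝ) (Λ ε : ℝ≥0) (L : ℕ) : Prop where
  injective : Function.Injective s
  atomic : ∀ j, (κ j).IsAtomic (s j) R Λ (Λ * 2 ^ L)
  atomic_adj : ∀ j, (κ j).adj.IsAtomic (s j) R Λ (Λ * 2 ^ L)
  orthogonal : ∀ i j, ‖(κ i).clm.comp (ContinuousLinearMap.adjoint (κ j).clm)‖ ≤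
    ε ^ 2 * scaleGain L (s i - s j)

variable {κ : ι → SchurKernel n} {s : ι → ℤ} {R : ℝ} {Λ ε : ℝ≥0} {L : ℕ}

lemma ScaledFamily.familyAtomBound (h : ScaledFamily κ s R Λ ε L) (hR : 0 ≤ R) :
    FamilyAtomBound (fun j => (κ j).clm) R (8 * (1 + L) * Λ) where
  direct σ b hb := by
    refine le_trans (Finset.sum_le_sum fun j _ => ?_)
      (sum_lintegral_atomGain_le Λ L h.injective σ fun y => ‖b y‖ₑ)
    refine le_trans (le_of_eq (lintegral_congr_ae (ae_restrict_of_ae ?_)))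
      ((h.atomic j).lintegral_le hR hb)
    filter_upwards [(κ j).clm_ae b] with x hx
    rw [hx]
  adjoint σ b w hb hw := by
    refine le_trans (Finset.sum_le_sum fun j _ => ?_)
      (sum_lintegral_atomGain_le Λ L h.injective σ w)
    rw [SchurKernel.adjoint_clm]
    refine le_trans (le_of_eq (lintegral_congr_ae (ae_restrict_of_ae ?_)))
      (((h.atomic_adj j).lintegral_le hR (hb j)).trans (lintegral_mono_ae ?_))
    · filter_upwards [(κ j).adj.clm_ae (b j)] with x hx
      rw [hx]
    · filter_upwards [hw j] with x hx
      gcongr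

lemma ScaledFamily.sum_norm_sq_le (h : ScaledFamily κ s R Λ ε L) (f : L2 n ℂ) :
    ∑ j, ‖(κ j).clm f‖ ^ 2 ≤ ((8 * (1 + L) * ε : ℝ≥0) : ℝ) ^ 2 * ‖f‖ ^ 2 := by
  refine (sum_norm_sq_le_of_almost_orthogonal (D := ε ^ 2 * (4 * (1 + L))) (by positivity)
    h.orthogonal (fun i => ?_) (fun j => ?_) f).trans ?_
  · rw [← Finset.mul_sum]
    gcongr
    exact sum_scaleGain_comp_le L (sub_right_injective.comp h.injective)
  · rw [← Finset.mul_sum]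
    gcongr
    exact sum_scaleGain_comp_le L (sub_left_injective.comp h.injective)
  · push_cast
    have h1 : (0 : ℝ) ≤ L := by positivity
    gcongr
    rw [mul_pow, mul_pow, mul_comm _ ((ε : ℝ) ^ 2)]
    have : (0 : ℝ) ≤ (ε : ℝ) ^ 2 := by positivity
    nlinarith [mul_nonneg this h1, mul_nonneg this (mul_nonneg h1 h1)]

theorem ScaledFamily.squareLp_le (h : ScaledFamily κ s R Λ ε L) (hn : 1 ≤ n) (hR : 0 ≤ R)
    (hε : 0 < ε) (hεΛ : ε ≤ Λ) {f : L2 n ℂ} (hf : Integrable (f : En n → ℂ)) {p : ℝ} (hp : 1 < p) :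
    squareLp (fun j => (κ j).clm) f p ≤ masterConst n R p *
      ((8 * (1 + L) * (ε ^ (1 - interpExp p) * Λ ^ interpExp p) : ℝ≥0) : ℝ≥0∞) *
        eLpNorm f (ENNReal.ofReal p) volume := by
  refine (_root_.squareLp_le hn hR (B := 8 * (1 + L) * ε) (D := 8 * (1 + L) * Λ) h.sum_norm_sq_le
    (by positivity) (by gcongr) (h.familyAtomBound hR) hf hp).trans (le_of_eq ?_)
  congr 3
  have h0 : (8 * (1 + L) : ℝ≥0) ≠ 0 := by positivity
  generalize (8 * (1 + L) : ℝ≥0) = c at h0 ⊢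
  rw [NNReal.mul_rpow, NNReal.mul_rpow, mul_mul_mul_comm, ← NNReal.rpow_add h0, sub_add_cancel,
    NNReal.rpow_one]

end Family

/-! ### Convolution kernels and their dilations -/

namespace SchurKernel

variable {n : ℕ} {κ κ₁ κ₂ : SchurKernel n}

/-- Translation invariance of a kernel. -/
def Invariant (κ : SchurKernel n) : Prop := ∀ x y h, κ.toFun (x + h) (y + h) = κ.toFun x y

lemma Invariant.comp (h₁ : κ₁.Invariant) (h₂ : κ₂.Invariant) : (κ₁.comp κ₂).Invariant := by
  intro x y h
  rw [comp_toFun, comp_toFun,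
    ← integral_add_right_eq_self (fun z => κ₁.toFun (x + h) z * κ₂.toFun z (y + h)) h]
  simp_rw [h₁ x _ h, h₂ _ y h]

lemma Invariant.adj (h : κ.Invariant) : κ.adj.Invariant := fun x y v => by
  rw [adj_toFun, adj_toFun, h]

lemma Invariant.row_eq_col (h : κ.Invariant) (x y : En n) :
    ∫⁻ z, ‖κ.toFun x z‖ₑ = ∫⁻ z, ‖κ.toFun z y‖ₑ := by
  rw [← lintegral_sub_left_eq_self (fun z => ‖κ.toFun z y‖ₑ) (x + y)]
  refine lintegral_congr fun z => ?_
  rw [← h x z (y - z)]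
  congr 2
  · abel
  · abel

lemma Invariant.norm_clm_le (h : κ.Invariant) {C : ℝ≥0} (hC : ∀ y, ∫⁻ x, ‖κ.toFun x y‖ₑ ≤ C) :
    ‖κ.clm‖ ≤ C := by
  refine (κ.norm_clm_sq_le (fun x => (h.row_eq_col x 0).trans_le (hC 0)) hC).trans_eq ?_
  push_cast
  exact Real.sqrt_mul_self C.2

end SchurKernel

section Dilation

variable {n : ℕ}

/-- The `L¹`-normalised dilation of a function to scale `2 ^ (-i)`. -/
def dilate (k : En n → ℂ) (i : ℤ) (t : En n) : ℂ := (cubeDensity n i : ℂ) * k ((2 : ℝ) ^ i • t)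

lemma lintegral_comp_zpow_smul (F : En n → ℝ≥0∞) (i : ℤ) :
    ENNReal.ofReal (cubeDensity n i) * ∫⁻ t, F ((2 : ℝ) ^ i • t) = ∫⁻ t, F t := by
  have h2 : (2 : ℝ) ^ i ≠ 0 := by positivity
  have h := Measure.map_addHaar_smul (volume : Measure (En n)) h2
  have h3 : ∫⁻ t, F ((2 : ℝ) ^ i • t) = ∫⁻ t, F t ∂(Measure.map ((2 : ℝ) ^ i • ·) volume) := by
    exact ((Homeomorph.smulOfNeZero ((2 : ℝ) ^ i) h2).toMeasurableEquiv.measurableEmbedding.lintegral_map F).symm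
  rw [h3, h, lintegral_smul_measure, smul_eq_mul, ← mul_assoc,
    ← ENNReal.ofReal_mul (cubeDensity_pos n i).le, finrank_euclideanSpace_fin, abs_of_pos (by positivity),
    cubeDensity, mul_inv_cancel₀ (by positivity), ENNReal.ofReal_one, one_mul]

lemma enorm_dilate (k : En n → ℂ) (i : ℤ) (t : En n) :
    ‖dilate k i t‖ₑ = ENNReal.ofReal (cubeDensity n i) * ‖k ((2 : ℝ) ^ i • t)‖ₑ := by
  rw [dilate, enorm_mul, ← ofReal_norm, Complex.norm_real,
    Real.norm_of_nonneg (cubeDensity_pos n i).le]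

lemma lintegral_enorm_dilate (k : En n → ℂ) (i : ℤ) :
    ∫⁻ t, ‖dilate k i t‖ₑ = ∫⁻ t, ‖k t‖ₑ := by
  simp_rw [enorm_dilate]
  rw [lintegral_const_mul' _ _ ENNReal.ofReal_ne_top]
  exact lintegral_comp_zpow_smul (fun t => ‖k t‖ₑ) i

lemma integral_dilate (k : En n → ℂ) (i : ℤ) : ∫ t, dilate k i t = ∫ t, k t := by
  simp_rw [dilate]
  rw [integral_const_mul, Measure.integral_comp_smul, finrank_euclideanSpace_fin,
    abs_of_pos (by positivity), Complex.real_smul, ← mul_assoc, cubeDensity, ← Complex.ofReal_mul,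
    mul_inv_cancel₀ (by positivity), Complex.ofReal_one, one_mul]

lemma lintegral_dilate_add_sub (k : En n → ℂ) (i : ℤ) (h : En n) :
    ∫⁻ t, ‖dilate k i (t + h) - dilate k i t‖ₑ =
      ∫⁻ t, ‖k (t + (2 : ℝ) ^ i • h) - k t‖ₑ := by
  rw [← lintegral_enorm_dilate (fun t => k (t + (2 : ℝ) ^ i • h) - k t) i]
  refine lintegral_congr fun t => ?_
  rw [dilate, dilate, dilate, smul_add, mul_sub]

lemma lintegral_enorm_dilate_sub_comp (k : En n → ℂ) (i : ℤ) (z y : En n) :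
    ∫⁻ x, ‖dilate k i (x - z) - dilate k i (x - y)‖ₑ =
      ∫⁻ t, ‖k (t + (2 : ℝ) ^ i • (y - z)) - k t‖ₑ := by
  rw [← lintegral_dilate_add_sub,
    ← lintegral_sub_right_eq_self (fun x => ‖dilate k i (x + (y - z)) - dilate k i x‖ₑ) y]
  simp

/-- A bounded mean-zero profile supported in the ball of radius `2`, with an `L¹` modulus of
continuity. -/
structure IsProfile (k : En n → ℂ) (Λ M : ℝ≥0) : Prop where
  continuous : Continuous k
  eq_zero : ∀ t, 2 < ‖t‖ → k t = 0
  lintegral_le : ∫⁻ t, ‖k t‖ₑ ≤ Λ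
  modulus : ∀ h : En n, ∫⁻ t, ‖k (t + h) - k t‖ₑ ≤ M * ‖h‖ₑ
  integral_eq_zero : ∫ t, k t = 0

variable {k : En n → ℂ} {Λ M : ℝ≥0}

/-- Convolution with a dilated profile, as a Schur kernel. -/
def IsProfile.schur (hk : IsProfile k Λ M) (i : ℤ) : SchurKernel n where
  toFun x y := dilate k i (x - y)
  measurable_toFun := by
    have h : Continuous (dilate k i) :=
      continuous_const.mul (hk.continuous.comp (continuous_const_smul _))
    exact (h.comp (continuous_fst.sub continuous_snd)).measurable
  bound := Λ
  row_le x := by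
    rw [lintegral_sub_left_eq_self (fun t => ‖dilate k i t‖ₑ) x, lintegral_enorm_dilate]
    exact hk.lintegral_le
  col_le y := by
    rw [lintegral_sub_right_eq_self (fun t => ‖dilate k i t‖ₑ) y, lintegral_enorm_dilate]
    exact hk.lintegral_le

namespace IsProfile

variable (hk : IsProfile k Λ M) (i j : ℤ)

lemma schur_toFun (x y : En n) : (hk.schur i).toFun x y = dilate k i (x - y) := rfl

lemma invariant : (hk.schur i).Invariant := fun x y h => by
  rw [schur_toFun, schur_toFun, add_sub_add_right_eq_sub]

lemma schur_eq_zero {x y : En n} (h : 2 * ((2 : ℝ) ^ i)⁻¹ < ‖x - y‖) :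
    (hk.schur i).toFun x y = 0 := by
  rw [schur_toFun, dilate, hk.eq_zero, mul_zero]
  rw [norm_smul, Real.norm_of_nonneg (by positivity)]
  have h2 : (0 : ℝ) < 2 ^ i := by positivity
  rw [← div_eq_mul_inv, div_lt_iff₀ h2] at h
  linarith

lemma schur_modulus (y z : En n) :
    ∫⁻ x, ‖(hk.schur i).toFun x z - (hk.schur i).toFun x y‖ₑ ≤
      M * ENNReal.ofReal ((2 : ℝ) ^ i * ‖y - z‖) := by
  simp_rw [schur_toFun]
  rw [lintegral_enorm_dilate_sub_comp]
  refine (hk.modulus _).trans_eq ?_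
  rw [← ofReal_norm, norm_smul, Real.norm_of_nonneg (by positivity)]

lemma schur_modulus_row (x z : En n) :
    ∫⁻ y, ‖(hk.schur i).toFun z y - (hk.schur i).toFun x y‖ₑ ≤
      M * ENNReal.ofReal ((2 : ℝ) ^ i * ‖x - z‖) := by
  rw [norm_sub_rev]
  refine le_trans (le_of_eq ?_) (hk.schur_modulus i z x)
  simp_rw [schur_toFun]
  rw [← lintegral_sub_left_eq_self
    (fun y => ‖dilate k i (y - x) - dilate k i (y - z)‖ₑ) (x + z)]
  refine lintegral_congr fun y => ?_
  congr 3
  · abel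
  · abel

lemma integral_col (y : En n) : ∫ x, (hk.schur i).toFun x y = 0 := by
  simp_rw [schur_toFun]
  rw [integral_sub_right_eq_self, integral_dilate, hk.integral_eq_zero]

lemma integral_row (x : En n) : ∫ y, (hk.schur i).toFun x y = 0 := by
  simp_rw [schur_toFun]
  rw [integral_sub_left_eq_self (dilate k i), integral_dilate, hk.integral_eq_zero]

lemma lintegral_comp_adj_le (hij : i ≤ j) (y : En n) :
    ∫⁻ x, ‖((hk.schur i).comp (hk.schur j).adj).toFun x y‖ₑ ≤
      ((2 * Λ * M * 2 ^ (i - j) : ℝ≥0) : ℝ≥0∞) := by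
  have h0 : ∫ z, (hk.schur j).adj.toFun z y = 0 := by
    simp_rw [SchurKernel.adj_toFun]
    rw [integral_conj, hk.integral_row, map_zero]
  have h1 := SchurKernel.lintegral_comp_sub_le (hk.schur i) (hk.schur j).adj h0
  simp only [zero_mul, sub_zero] at h1
  refine h1.trans ?_
  calc _ ≤ ∫⁻ z, ‖(hk.schur j).adj.toFun z y‖ₑ * ((2 * M * 2 ^ (i - j) : ℝ≥0) : ℝ≥0∞) := by
        refine lintegral_mono fun z => ?_
        by_cases hz : 2 * ((2 : ℝ) ^ j)⁻¹ < ‖y - z‖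
        · rw [SchurKernel.enorm_adj, hk.schur_eq_zero j hz]
          simp
        · gcongr
          refine (hk.schur_modulus i y z).trans ?_
          rw [not_lt] at hz
          have : (2 : ℝ) ^ i * ‖y - z‖ ≤ ((2 * 2 ^ (i - j) : ℝ≥0) : ℝ) := by
            push_cast
            rw [zpow_sub₀ (by norm_num)]
            calc _ ≤ (2 : ℝ) ^ i * (2 * ((2 : ℝ) ^ j)⁻¹) := by gcongr
              _ = _ := by ring
          calc _ ≤ M * ENNReal.ofReal ((2 * 2 ^ (i - j) : ℝ≥0) : ℝ) := by gcongr
            _ = _ := by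
                rw [ENNReal.ofReal_coe_nnreal, ← ENNReal.coe_mul]
                congr 1
                ring
    _ = (∫⁻ z, ‖(hk.schur j).adj.toFun z y‖ₑ) * ((2 * M * 2 ^ (i - j) : ℝ≥0) : ℝ≥0∞) :=
        lintegral_mul_const' _ _ ENNReal.coe_ne_top
    _ ≤ Λ * ((2 * M * 2 ^ (i - j) : ℝ≥0) : ℝ≥0∞) := by
        gcongr
        exact (hk.schur j).adj.col_le y
    _ = _ := by
        rw [← ENNReal.coe_mul]
        congr 1
        ring

lemma norm_comp_adjoint_le_of_le (hij : i ≤ j) :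
    ‖(hk.schur i).clm.comp (ContinuousLinearMap.adjoint (hk.schur j).clm)‖ ≤
      2 * Λ * M * 2 ^ (-|i - j|) := by
  rw [SchurKernel.adjoint_clm, ← SchurKernel.clm_comp]
  refine (SchurKernel.Invariant.norm_clm_le ((hk.invariant i).comp (hk.invariant j).adj)
    (hk.lintegral_comp_adj_le i j hij)).trans_eq ?_
  rw [abs_of_nonpos (by omega), neg_neg]
  push_cast
  rfl

lemma norm_comp_adjoint_le :
    ‖(hk.schur i).clm.comp (ContinuousLinearMap.adjoint (hk.schur j).clm)‖ ≤
      2 * Λ * M * 2 ^ (-|i - j|) := by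
  rcases le_total i j with h | h
  · exact hk.norm_comp_adjoint_le_of_le i j h
  · rw [← LinearIsometryEquiv.norm_map ContinuousLinearMap.adjoint, ContinuousLinearMap.adjoint_comp,
      ContinuousLinearMap.adjoint_adjoint, abs_sub_comm]
    exact hk.norm_comp_adjoint_le_of_le j i h

lemma norm_clm_le : ‖(hk.schur i).clm‖ ≤ Λ :=
  (hk.invariant i).norm_clm_le (hk.schur i).col_le

end IsProfile

end Dilation

/-! ### Atomic estimates for dilated profiles and their conditional expectations -/

namespace SchurKernel

variable {n : ℕ} {κ κ₁ κ₂ κ' : SchurKernel n} {i : ℤ} {R R' : ℝ} {Λ Λ₁ Λ₂ Λ' M M₁ M₂ M' : ℝ≥0}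

lemma IsAtomic.congr (h : κ.IsAtomic i R Λ M) (h' : ∀ x y, κ'.toFun x y = κ.toFun x y) :
    κ'.IsAtomic i R Λ M := by
  have : κ'.toFun = κ.toFun := funext fun x => funext fun y => h' x y
  exact ⟨this ▸ h.eq_zero, this ▸ h.col_le, this ▸ h.modulus⟩

lemma IsAtomic.mono (h : κ.IsAtomic i R Λ M) (hR : R ≤ R') (hΛ : Λ ≤ Λ') (hM : M ≤ M') :
    κ.IsAtomic i R' Λ' M' where
  eq_zero x y hxy := h.eq_zero x y (lt_of_le_of_lt (by gcongr) hxy)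
  col_le y := (h.col_le y).trans (by gcongr)
  modulus τ hτ y y' hy := (h.modulus τ hτ y y' hy).trans (by gcongr)

lemma IsAtomic.sub (h₁ : κ₁.IsAtomic i R Λ₁ M₁) (h₂ : κ₂.IsAtomic i R Λ₂ M₂) :
    (κ₁.sub κ₂).IsAtomic i R (Λ₁ + Λ₂) (M₁ + M₂) where
  eq_zero x y hxy := by rw [sub_toFun, h₁.eq_zero x y hxy, h₂.eq_zero x y hxy, sub_zero]
  col_le y := by
    push_cast
    calc _ ≤ ∫⁻ x, (‖κ₁.toFun x y‖ₑ + ‖κ₂.toFun x y‖ₑ) := lintegral_mono fun x => enorm_sub_le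
      _ = _ := lintegral_add_left (κ₁.measurable_col y).enorm _
      _ ≤ _ := add_le_add (h₁.col_le y) (h₂.col_le y)
  modulus τ hτ y y' hy := by
    push_cast
    calc _ ≤ ∫⁻ x, (‖κ₁.toFun x y' - κ₁.toFun x y‖ₑ + ‖κ₂.toFun x y' - κ₂.toFun x y‖ₑ) := by
          refine lintegral_mono fun x => ?_
          simp only [sub_toFun]
          rw [sub_sub_sub_comm]
          exact enorm_sub_le
      _ = _ := lintegral_add_left ((κ₁.measurable_col y').sub (κ₁.measurable_col y)).enorm _
      _ ≤ _ := add_le_add (h₁.modulus τ hτ y y' hy) (h₂.modulus τ hτ y y' hy)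
      _ = _ := (add_mul _ _ _).symm

lemma enorm_adj_sub (x y y' : En n) :
    ‖κ.adj.toFun x y' - κ.adj.toFun x y‖ₑ = ‖κ.toFun y' x - κ.toFun y x‖ₑ := by
  rw [adj_toFun, adj_toFun, ← map_sub]
  exact RCLike.enorm_conj _

lemma adj_sub_toFun (x y : En n) :
    (κ₁.sub κ₂).adj.toFun x y = (κ₁.adj.sub κ₂.adj).toFun x y := by
  simp [adj_toFun, sub_toFun]

lemma integrable_col (κ : SchurKernel n) (y : En n) : Integrable fun x => κ.toFun x y :=
  ⟨(κ.measurable_col y).aestronglyMeasurable, by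
    rw [hasFiniteIntegral_iff_enorm]; exact (κ.col_le y).trans_lt ENNReal.coe_lt_top⟩

lemma lintegral_comp_col_sub_le (y y' : En n) :
    ∫⁻ x, ‖(κ₁.comp κ₂).toFun x y' - (κ₁.comp κ₂).toFun x y‖ₑ ≤
      κ₁.bound * ∫⁻ z, ‖κ₂.toFun z y' - κ₂.toFun z y‖ₑ := by
  refine le_trans (lintegral_mono_ae ?_) (κ₁.lintegral_enorm_op_le κ₁.col_le
    ((κ₂.integrable_col y').sub (κ₂.integrable_col y)).1)
  filter_upwards [κ₁.ae_integrable_L1 (κ₂.integrable_col y'),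
    κ₁.ae_integrable_L1 (κ₂.integrable_col y)] with x h1 h2
  rw [comp_toFun, comp_toFun, ← integral_sub h1 h2, op]
  simp only [Pi.sub_apply, mul_sub]
  exact le_rfl

end SchurKernel

lemma mul_ofReal_le_of_mem_dyadicCube {n : ℕ} (M : ℝ≥0) (i : ℤ) {τ : ℤ} {y y' : En n} (hy : y' ∈ dyadicCube τ y) :
    M * ENNReal.ofReal ((2 : ℝ) ^ i * ‖y - y'‖) ≤
      ((n * M : ℝ≥0) : ℝ≥0∞) * ENNReal.ofReal ((2 : ℝ) ^ (i - τ)) := by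
  have h := norm_sub_le_of_mem_dyadicCube hy
  calc _ ≤ M * ENNReal.ofReal (n * (2 : ℝ) ^ (i - τ)) := by
        refine mul_le_mul_right (ENNReal.ofReal_le_ofReal ?_) _
        rw [zpow_sub₀ (by norm_num)]
        calc _ ≤ (2 : ℝ) ^ i * (n * ((2 : ℝ) ^ τ)⁻¹) := by gcongr
          _ = _ := by ring
    _ = _ := by
        rw [ENNReal.ofReal_mul (by positivity), ENNReal.ofReal_natCast]
        push_cast
        ring

namespace IsProfile

variable {n : ℕ} {k : En n → ℂ} {Λ M : ℝ≥0} (hk : IsProfile k Λ M) (i j : ℤ)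

lemma isAtomic : (hk.schur i).IsAtomic i 2 Λ (n * M) where
  eq_zero x y h := hk.schur_eq_zero i h
  col_le y := (hk.schur i).col_le y
  modulus τ _ y y' hy := (hk.schur_modulus i y y').trans (mul_ofReal_le_of_mem_dyadicCube M i hy)

lemma isAtomic_adj : (hk.schur i).adj.IsAtomic i 2 Λ (n * M) where
  eq_zero x y h := by
    rw [norm_sub_rev] at h
    rw [SchurKernel.adj_toFun, hk.schur_eq_zero i h, map_zero]
  col_le y := (hk.schur i).adj.col_le y
  modulus τ _ y y' hy := by
    simp_rw [SchurKernel.enorm_adj_sub]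
    exact (hk.schur_modulus_row i y y').trans (mul_ofReal_le_of_mem_dyadicCube M i hy)

end IsProfile

/-- Conditional expectation on dyadic cubes of generation `j`. -/
def condKernel (n : ℕ) (j : ℤ) : SchurKernel n := (Stopping.const n j).schur

section Cond

variable {n : ℕ} {k : En n → ℂ} {Λ M : ℝ≥0} (hk : IsProfile k Λ M) (i j : ℤ)

lemma condKernel_bound : (condKernel n j).bound = 1 := rfl

lemma condKernel_toFun (x y : En n) : (condKernel n j).toFun x y =
    (dyadicCube j x).indicator (fun _ => (cubeDensity n j : ℂ)) y := by
  rw [condKernel, Stopping.schur_toFun, Stopping.ker_eq_indicator _ (mem_univ x)]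
  change (((dyadicCube j x).indicator (fun _ => cubeDensity n j) y : ℝ) : ℂ) = _
  by_cases h : y ∈ dyadicCube j x
  · rw [indicator_of_mem h, indicator_of_mem h]
  · rw [indicator_of_notMem h, indicator_of_notMem h]; simp

lemma condKernel_adj (x y : En n) : (condKernel n j).adj.toFun x y = (condKernel n j).toFun x y := by
  rw [SchurKernel.adj_toFun, condKernel, Stopping.schur_toFun, Stopping.schur_toFun,
    Complex.conj_ofReal, Stopping.ker_comm]

lemma condKernel_congr {x x' : En n} (h : x' ∈ dyadicCube j x) :
    (condKernel n j).toFun x' = (condKernel n j).toFun x := by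
  funext y
  rw [condKernel_toFun, condKernel_toFun, dyadicCube_eq_of_mem h]

lemma norm_condKernel_le : ‖(condKernel n j).clm‖ ≤ 1 := by
  have h := (condKernel n j).norm_clm_sq_le (condKernel n j).row_le (condKernel n j).col_le
  simpa [condKernel_bound] using h

lemma cond_comp_eq_zero {x y : En n} (h : n * ((2 : ℝ) ^ j)⁻¹ + 2 * ((2 : ℝ) ^ i)⁻¹ < ‖x - y‖) :
    ((condKernel n j).comp (hk.schur i)).toFun x y = 0 := by
  rw [SchurKernel.comp_toFun]
  refine integral_eq_zero_of_ae (Eventually.of_forall fun z => ?_)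
  show (condKernel n j).toFun x z * (hk.schur i).toFun z y = 0
  by_cases hz : z ∈ dyadicCube j x
  · rw [hk.schur_eq_zero, mul_zero]
    have h1 := norm_sub_le_of_mem_dyadicCube hz
    have h2 := norm_sub_le_norm_sub_add_norm_sub x z y
    linarith
  · rw [condKernel_toFun, indicator_of_notMem hz, zero_mul]

lemma cond_comp_col_le (y : En n) :
    ∫⁻ x, ‖((condKernel n j).comp (hk.schur i)).toFun x y‖ₑ ≤ Λ := by
  have h := ((condKernel n j).comp (hk.schur i)).col_le y
  rwa [SchurKernel.comp_bound, condKernel_bound, one_mul] at h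

lemma cond_comp_row_le (x : En n) :
    ∫⁻ y, ‖((condKernel n j).comp (hk.schur i)).toFun x y‖ₑ ≤ Λ := by
  have h := ((condKernel n j).comp (hk.schur i)).row_le x
  rwa [SchurKernel.comp_bound, condKernel_bound, one_mul] at h

lemma cond_comp_modulus {τ : ℤ} {y y' : En n} (hy : y' ∈ dyadicCube τ y) :
    ∫⁻ x, ‖((condKernel n j).comp (hk.schur i)).toFun x y' -
      ((condKernel n j).comp (hk.schur i)).toFun x y‖ₑ ≤
      ((n * M : ℝ≥0) : ℝ≥0∞) * ENNReal.ofReal ((2 : ℝ) ^ (i - τ)) := by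
  refine SchurKernel.lintegral_comp_col_sub_le _ _ |>.trans ?_
  rw [condKernel_bound, ENNReal.coe_one, one_mul]
  exact (hk.schur_modulus i y y').trans (mul_ofReal_le_of_mem_dyadicCube M i hy)

/-- Averaging at a finer scale changes a kernel little. -/
lemma cond_comp_sub_row_le (x : En n) :
    ∫⁻ y, ‖((condKernel n j).comp (hk.schur i)).toFun x y - (hk.schur i).toFun x y‖ₑ ≤
      ((n * M : ℝ≥0) : ℝ≥0∞) * ENNReal.ofReal ((2 : ℝ) ^ (i - j)) := by
  have h0 : ∫ z, (condKernel n j).adj.toFun z x = 1 := by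
    simp_rw [condKernel_adj]
    exact (Stopping.const n j).integral_schur_col (mem_univ x)
  have h1 := SchurKernel.lintegral_comp_sub_le (hk.schur i).adj (condKernel n j).adj h0
  have h2 : ∀ y, ‖((condKernel n j).comp (hk.schur i)).toFun x y - (hk.schur i).toFun x y‖ₑ =
      ‖((hk.schur i).adj.comp (condKernel n j).adj).toFun y x -
        1 * (hk.schur i).adj.toFun y x‖ₑ := by
    intro y
    rw [← SchurKernel.comp_adj_toFun, one_mul, SchurKernel.adj_toFun, SchurKernel.adj_toFun,
      ← map_sub]
    exact (RCLike.enorm_conj _).symm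
  simp_rw [h2]
  refine h1.trans ?_
  calc _ ≤ ∫⁻ z, ‖(condKernel n j).adj.toFun z x‖ₑ *
          (((n * M : ℝ≥0) : ℝ≥0∞) * ENNReal.ofReal ((2 : ℝ) ^ (i - j))) := by
        refine lintegral_mono fun z => ?_
        by_cases hz : z ∈ dyadicCube j x
        · gcongr
          simp_rw [SchurKernel.enorm_adj_sub]
          exact (hk.schur_modulus_row i x z).trans (mul_ofReal_le_of_mem_dyadicCube M i hz)
        · rw [SchurKernel.enorm_adj, condKernel_toFun, indicator_of_notMem hz]
          simp
    _ = _ := lintegral_mul_const' _ _ (by finiteness)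
    _ ≤ _ := mul_le_of_le_one_left' ((condKernel n j).adj.col_le x)

variable {i j}

lemma cond_comp_modulus_row {τ : ℤ} {x x' : En n} (hx : x' ∈ dyadicCube τ x) :
    ∫⁻ y, ‖((condKernel n j).comp (hk.schur i)).toFun x' y -
      ((condKernel n j).comp (hk.schur i)).toFun x y‖ₑ ≤
      ((3 * n * M : ℝ≥0) : ℝ≥0∞) * ENNReal.ofReal ((2 : ℝ) ^ (i - τ)) := by
  rcases le_or_gt j τ with h | h
  · have h1 : (condKernel n j).toFun x' = (condKernel n j).toFun x :=
      condKernel_congr j (dyadicCube_subset h x hx)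
    simp_rw [SchurKernel.comp_toFun, h1]
    simp
  · set κ := (condKernel n j).comp (hk.schur i)
    set κ₀ := hk.schur i
    set B := ((n * M : ℝ≥0) : ℝ≥0∞) * ENNReal.ofReal ((2 : ℝ) ^ (i - τ)) with hB
    have h1 : ∀ x, ∫⁻ y, ‖κ.toFun x y - κ₀.toFun x y‖ₑ ≤ B := fun x =>
      (cond_comp_sub_row_le hk i j x).trans (by
        rw [hB]
        gcongr
        norm_num)
    have h2 : ∫⁻ y, ‖κ₀.toFun x' y - κ₀.toFun x y‖ₑ ≤ B :=
      (hk.schur_modulus_row i x x').trans (mul_ofReal_le_of_mem_dyadicCube M i hx)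
    have hm : ∀ x, Measurable fun y => ‖κ.toFun x y - κ₀.toFun x y‖ₑ := fun x =>
      ((κ.measurable_row x).sub (κ₀.measurable_row x)).enorm
    calc _ ≤ ∫⁻ y, (‖κ.toFun x' y - κ₀.toFun x' y‖ₑ + (‖κ.toFun x y - κ₀.toFun x y‖ₑ +
          ‖κ₀.toFun x' y - κ₀.toFun x y‖ₑ)) := by
          refine lintegral_mono fun y => ?_
          have e : κ.toFun x' y - κ.toFun x y = (κ.toFun x' y - κ₀.toFun x' y) -
              ((κ.toFun x y - κ₀.toFun x y) - (κ₀.toFun x' y - κ₀.toFun x y)) := by ring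
          rw [e]
          exact enorm_sub_le.trans (add_le_add le_rfl enorm_sub_le)
      _ = _ := by rw [lintegral_add_left (hm x'), lintegral_add_left (hm x)]
      _ ≤ B + (B + B) := add_le_add (h1 x') (add_le_add (h1 x) h2)
      _ = _ := by
          rw [hB]
          push_cast
          ring

lemma isAtomic_cond_comp (hij : i ≤ j) :
    ((condKernel n j).comp (hk.schur i)).IsAtomic i (n + 2) Λ (3 * n * M) where
  eq_zero x y h := by
    refine cond_comp_eq_zero hk i j (lt_of_le_of_lt ?_ h)
    rw [add_mul]
    gcongr
    norm_num
  col_le := cond_comp_col_le hk i j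
  modulus τ _ y y' hy := (cond_comp_modulus hk i j hy).trans (by
    gcongr
    exact le_mul_of_one_le_left' (by norm_num))

lemma isAtomic_cond_comp_adj (hij : i ≤ j) :
    ((condKernel n j).comp (hk.schur i)).adj.IsAtomic i (n + 2) Λ (3 * n * M) where
  eq_zero x y h := by
    rw [SchurKernel.adj_toFun, cond_comp_eq_zero hk i j, map_zero]
    rw [norm_sub_rev] at h
    refine lt_of_le_of_lt ?_ h
    rw [add_mul]
    gcongr
    norm_num
  col_le y := by
    simp_rw [SchurKernel.enorm_adj]
    exact cond_comp_row_le hk i j y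
  modulus τ _ y y' hy := by
    simp_rw [SchurKernel.enorm_adj_sub]
    exact cond_comp_modulus_row hk hy

lemma isAtomic_cond_comp_of_le (hij : j ≤ i) :
    ((condKernel n j).comp (hk.schur i)).IsAtomic j (n + 2) Λ (n * M * 2 ^ (i - j)) where
  eq_zero x y h := by
    refine cond_comp_eq_zero hk i j (lt_of_le_of_lt ?_ h)
    rw [add_mul]
    gcongr
    norm_num
  col_le := cond_comp_col_le hk i j
  modulus τ _ y y' hy := (cond_comp_modulus hk i j hy).trans_eq (by
    have : ((2 : ℝ≥0) ^ (i - j) : ℝ≥0) = ENNReal.ofReal ((2 : ℝ) ^ (i - j)) := by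
      rw [← ENNReal.ofReal_coe_nnreal]
      push_cast
      rfl
    rw [ENNReal.coe_mul (n * M) (2 ^ (i - j)), this, mul_assoc, ← ENNReal.ofReal_mul (by positivity),
      ← zpow_add₀ (by norm_num), sub_add_sub_cancel])

lemma isAtomic_cond_comp_adj_of_le (hij : j ≤ i) :
    ((condKernel n j).comp (hk.schur i)).adj.IsAtomic j (n + 2) Λ (n * M * 2 ^ (i - j)) where
  eq_zero x y h := by
    rw [SchurKernel.adj_toFun, cond_comp_eq_zero hk i j, map_zero]
    rw [norm_sub_rev] at h
    refine lt_of_le_of_lt ?_ h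
    rw [add_mul]
    gcongr
    norm_num
  col_le y := by
    simp_rw [SchurKernel.enorm_adj]
    exact cond_comp_row_le hk i j y
  modulus τ hτ y y' hy := by
    simp_rw [SchurKernel.enorm_adj_sub]
    have h1 : (condKernel n j).toFun y' = (condKernel n j).toFun y :=
      condKernel_congr j (dyadicCube_subset hτ.le y hy)
    simp_rw [SchurKernel.comp_toFun, h1]
    simp

end Cond

/-! ### Averages of dilated profiles over larger cubes -/

section Shift

variable {n : ℕ}

lemma volume_Ico_inter_shift_le (c δ v : ℝ) :
    ∃ a, {u : ℝ | u ∈ Ico c (c + δ) ∧ u + v ∉ Ico c (c + δ)} ⊆ Ico a (a + |v|) := by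
  rcases le_total 0 v with h | h
  · refine ⟨c + δ - v, fun u hu => ?_⟩
    obtain ⟨⟨h1, h2⟩, h3⟩ := hu
    rw [abs_of_nonneg h]
    refine ⟨?_, by linarith⟩
    by_contra h4
    exact h3 ⟨by linarith, by linarith⟩
  · refine ⟨c, fun u hu => ?_⟩
    obtain ⟨⟨h1, h2⟩, h3⟩ := hu
    rw [abs_of_nonpos h]
    refine ⟨h1, ?_⟩
    by_contra h4
    exact h3 ⟨by linarith, by linarith⟩

lemma volume_dyadicCube_diff_shift_le (j : ℤ) (x w : En n) :
    volume {y | y ∈ dyadicCube j x ∧ y + w ∉ dyadicCube j x} ≤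
      ENNReal.ofReal (n * ((2 : ℝ) ^ j * ‖w‖) * (cubeDensity n j)⁻¹) := by
  classical
  set δ := ((2 : ℝ) ^ j)⁻¹ with hδ
  have hδ0 : 0 < δ := by positivity
  set c : Fin n → ℝ := fun a => (⌊(2 : ℝ) ^ j * x a⌋ : ℝ) * δ with hc
  have hmem : ∀ y : En n, y ∈ dyadicCube j x ↔ ∀ a, y a ∈ Ico (c a) (c a + δ) := by
    intro y
    rw [dyadicCube_eq_pi, mem_preimage, Set.mem_univ_pi]
    refine forall_congr' fun a => ?_
    rw [add_mul, one_mul]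
    rfl
  choose d hd using fun a => volume_Ico_inter_shift_le (c a) δ (w a)
  let lo : Fin n → Fin n → ℝ := fun a b => if b = a then d a else c b
  let len : Fin n → Fin n → ℝ := fun a b => if b = a then |w a| else δ
  have hsub : {y | y ∈ dyadicCube j x ∧ y + w ∉ dyadicCube j x} ⊆
      ⋃ a, (MeasurableEquiv.toLp 2 (Fin n → ℝ)).symm ⁻¹'
        (Set.univ.pi fun b => Ico (lo a b) (lo a b + len a b)) := by
    rintro y ⟨h1, h2⟩
    rw [hmem] at h1 h2
    push Not at h2
    obtain ⟨a, ha⟩ := h2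
    refine mem_iUnion.2 ⟨a, ?_⟩
    rw [mem_preimage, Set.mem_univ_pi]
    intro b
    show y b ∈ _
    by_cases hb : b = a
    · subst hb
      simp only [lo, len, if_true]
      exact hd b ⟨h1 b, ha⟩
    · simp only [lo, len, if_neg hb]
      exact h1 b
  have hvol : ∀ a, volume ((MeasurableEquiv.toLp 2 (Fin n → ℝ)).symm ⁻¹'
        (Set.univ.pi fun b => Ico (lo a b) (lo a b + len a b))) ≤
      ENNReal.ofReal ((2 : ℝ) ^ j * ‖w‖ * (cubeDensity n j)⁻¹) := by
    intro a
    rw [(EuclideanSpace.volume_preserving_symm_measurableEquiv_toLp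
      (Fin n)).measure_preimage (MeasurableSet.univ_pi fun _ => measurableSet_Ico).nullMeasurableSet,
      Real.volume_pi_Ico]
    simp only [add_sub_cancel_left]
    rw [← ENNReal.ofReal_prod_of_nonneg fun b _ => by
      simp only [len]; split_ifs <;> positivity]
    refine ENNReal.ofReal_le_ofReal ?_
    have h1 : ∏ b, len a b = |w a| * δ ^ (n - 1) := by
      rw [← Finset.mul_prod_erase _ _ (Finset.mem_univ a)]
      congr 1
      · simp [len]
      · rw [Finset.prod_congr rfl (g := fun _ => δ)]
        · simp
        · intro b hb
          simp [len, (Finset.mem_erase.1 hb).1]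
    have hn : n - 1 + 1 = n := by have := a.pos; omega
    have h2 : (2 : ℝ) ^ j * (cubeDensity n j)⁻¹ = δ ^ (n - 1) := by
      rw [cubeDensity, ← inv_pow, ← hδ]
      nth_rewrite 1 [← hn]
      rw [pow_succ, hδ]
      field_simp
    have h3 : |w a| ≤ ‖w‖ := by
      simpa using PiLp.norm_apply_le w a
    calc _ = |w a| * δ ^ (n - 1) := h1
      _ ≤ ‖w‖ * δ ^ (n - 1) := by gcongr
      _ = _ := by rw [← h2]; ring
  calc _ ≤ _ := measure_mono hsub
    _ ≤ _ := measure_iUnion_fintype_le _ _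
    _ ≤ ∑ _a : Fin n, ENNReal.ofReal ((2 : ℝ) ^ j * ‖w‖ * (cubeDensity n j)⁻¹) :=
        Finset.sum_le_sum fun a _ => hvol a
    _ = _ := by
        rw [Finset.sum_const, Finset.card_univ, Fintype.card_fin, nsmul_eq_mul,
          ← ENNReal.ofReal_natCast, ← ENNReal.ofReal_mul (by positivity)]
        congr 1
        ring

lemma lintegral_condKernel_shift_le (j : ℤ) (x w : En n) :
    ∫⁻ y, ‖(condKernel n j).toFun x (y + w) - (condKernel n j).toFun x y‖ₑ ≤
      ENNReal.ofReal (2 * n * ((2 : ℝ) ^ j * ‖w‖)) := by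
  set Q := dyadicCube j x
  have hQ : MeasurableSet Q := measurableSet_dyadicCube j x
  set ρ := ENNReal.ofReal (cubeDensity n j) with hρ
  set S₁ := {y | y ∈ Q ∧ y + w ∉ Q}
  set S₂ := {y | y ∈ Q ∧ y + (-w) ∉ Q}
  have hS₁ : MeasurableSet S₁ := hQ.inter (hQ.preimage (measurable_add_const w)).compl
  have hS₂ : MeasurableSet S₂ := hQ.inter (hQ.preimage (measurable_add_const (-w))).compl
  have h1 : ∀ y, ‖(condKernel n j).toFun x (y + w) - (condKernel n j).toFun x y‖ₑ ≤
      S₁.indicator (fun _ => ρ) y + S₂.indicator (fun _ => ρ) (y + w) := by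
    intro y
    have hd : ‖(cubeDensity n j : ℂ)‖ₑ = ρ := by
      rw [← ofReal_norm, Complex.norm_real, Real.norm_of_nonneg (cubeDensity_pos n j).le]
    rw [condKernel_toFun, condKernel_toFun]
    by_cases ha : y ∈ Q <;> by_cases hb : y + w ∈ Q
    · rw [indicator_of_mem ha, indicator_of_mem hb]; simp
    · rw [indicator_of_mem ha, indicator_of_notMem hb, zero_sub, enorm_neg, hd,
        indicator_of_mem (show y ∈ S₁ from ⟨ha, hb⟩)]
      exact le_self_add
    · rw [indicator_of_notMem ha, indicator_of_mem hb, sub_zero, hd,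
        indicator_of_mem (show y + w ∈ S₂ from ⟨hb, by rwa [add_neg_cancel_right]⟩)]
      exact le_add_self
    · rw [indicator_of_notMem ha, indicator_of_notMem hb]; simp
  have hv : ∀ w : En n, ρ * volume {y | y ∈ Q ∧ y + w ∉ Q} ≤
      ENNReal.ofReal (n * ((2 : ℝ) ^ j * ‖w‖)) := by
    intro w
    calc _ ≤ ρ * ENNReal.ofReal (n * ((2 : ℝ) ^ j * ‖w‖) * (cubeDensity n j)⁻¹) := by
          gcongr; exact volume_dyadicCube_diff_shift_le j x w
      _ = _ := by
          rw [hρ, ← ENNReal.ofReal_mul (cubeDensity_pos n j).le]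
          congr 1
          have := (cubeDensity_pos n j).ne'
          field_simp
  calc _ ≤ ∫⁻ y, (S₁.indicator (fun _ => ρ) y + S₂.indicator (fun _ => ρ) (y + w)) :=
        lintegral_mono h1
    _ = ρ * volume S₁ + ρ * volume S₂ := by
        rw [lintegral_add_left (measurable_const.indicator hS₁),
          lintegral_add_right_eq_self (fun y => S₂.indicator (fun _ => ρ) y),
          lintegral_indicator_const hS₁, lintegral_indicator_const hS₂]
    _ ≤ ENNReal.ofReal (n * ((2 : ℝ) ^ j * ‖w‖)) + ENNReal.ofReal (n * ((2 : ℝ) ^ j * ‖-w‖)) :=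
        add_le_add (hv w) (hv (-w))
    _ = _ := by
        rw [norm_neg, ← ENNReal.ofReal_add (by positivity) (by positivity)]
        congr 1
        ring

variable {k : En n → ℂ} {Λ M : ℝ≥0} (hk : IsProfile k Λ M) (i j : ℤ)

lemma cond_comp_row_le_of_le (x : En n) :
    ∫⁻ y, ‖((condKernel n j).comp (hk.schur i)).toFun x y‖ₑ ≤
      ((4 * n * Λ : ℝ≥0) : ℝ≥0∞) * ENNReal.ofReal ((2 : ℝ) ^ (j - i)) := by
  set e := condKernel n j
  set κ := hk.schur i
  have hkm : Measurable (dilate k i) := 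
    (continuous_const.mul (hk.continuous.comp (continuous_const_smul _))).measurable
  have h1 : ∀ y, ‖(e.comp κ).toFun x y‖ₑ ≤
      ∫⁻ w, ‖dilate k i w‖ₑ * ‖e.toFun x (y + w) - e.toFun x y‖ₑ := by
    intro y
    have hb : ∀ z, ‖e.toFun x z‖ ≤ cubeDensity n j := fun z => by
      rw [condKernel_toFun]
      refine (norm_indicator_le_norm_self _ _).trans ?_
      rw [Complex.norm_real, Real.norm_of_nonneg (cubeDensity_pos n j).le]
    have hi : Integrable fun z => e.toFun x z * κ.toFun z y :=
      (κ.integrable_col y).bdd_mul (e.measurable_row x).aestronglyMeasurable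
        (Eventually.of_forall hb)
    have h2 : (e.comp κ).toFun x y = ∫ z, (e.toFun x z - e.toFun x y) * κ.toFun z y := by
      simp_rw [sub_mul]
      rw [integral_sub hi ((κ.integrable_col y).const_mul _), integral_const_mul,
        hk.integral_col, mul_zero, sub_zero]
      rfl
    rw [h2]
    refine (enorm_integral_le_lintegral_enorm _).trans_eq ?_
    rw [← lintegral_add_right_eq_self _ y]
    refine lintegral_congr fun w => ?_
    rw [enorm_mul, mul_comm, hk.schur_toFun, add_sub_cancel_right, add_comm w y]
  calc _ ≤ ∫⁻ y, ∫⁻ w, ‖dilate k i w‖ₑ * ‖e.toFun x (y + w) - e.toFun x y‖ₑ := lintegral_mono h1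
    _ = ∫⁻ w, ∫⁻ y, ‖dilate k i w‖ₑ * ‖e.toFun x (y + w) - e.toFun x y‖ₑ := by
        refine lintegral_lintegral_swap (Measurable.aemeasurable ?_)
        exact (hkm.comp measurable_snd).enorm.mul
          (((e.measurable_row x).comp (measurable_fst.add measurable_snd)).sub
            ((e.measurable_row x).comp measurable_fst)).enorm
    _ ≤ ∫⁻ w, ‖dilate k i w‖ₑ * ENNReal.ofReal (4 * n * (2 : ℝ) ^ (j - i)) := by
        refine lintegral_mono fun w => ?_
        simp only
        rw [lintegral_const_mul' _ _ enorm_ne_top]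
        by_cases hw : 2 * ((2 : ℝ) ^ i)⁻¹ < ‖w‖
        · have := hk.schur_eq_zero i (x := w) (y := 0) (by rwa [sub_zero])
          rw [hk.schur_toFun, sub_zero] at this
          rw [this]
          simp
        · gcongr
          refine (lintegral_condKernel_shift_le j x w).trans (ENNReal.ofReal_le_ofReal ?_)
          rw [not_lt] at hw
          rw [zpow_sub₀ (by norm_num)]
          calc _ ≤ 2 * n * ((2 : ℝ) ^ j * (2 * ((2 : ℝ) ^ i)⁻¹)) := by gcongr
            _ = _ := by ring
    _ = (∫⁻ w, ‖dilate k i w‖ₑ) * ENNReal.ofReal (4 * n * (2 : ℝ) ^ (j - i)) :=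
        lintegral_mul_const' _ _ ENNReal.ofReal_ne_top
    _ ≤ Λ * ENNReal.ofReal (4 * n * (2 : ℝ) ^ (j - i)) := by
        rw [lintegral_enorm_dilate]
        gcongr
        exact hk.lintegral_le
    _ = _ := by
        rw [ENNReal.ofReal_mul (by positivity), ENNReal.ofReal_mul (by norm_num),
          ENNReal.ofReal_natCast, ENNReal.ofReal_ofNat]
        push_cast
        ring

end Shift

section Families

variable {n : ℕ} {ι : Type} [Fintype ι]

lemma ScaledFamily.of_bounds {κ : ι → SchurKernel n} {s : ι → ℤ} {R : ℝ} {Λ ε : ℝ≥0} {L : ℕ}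
    (hs : Function.Injective s) (ha : ∀ j, (κ j).IsAtomic (s j) R Λ (Λ * 2 ^ L))
    (ha' : ∀ j, (κ j).adj.IsAtomic (s j) R Λ (Λ * 2 ^ L)) (h1 : ∀ j, ‖(κ j).clm‖ ≤ ε)
    (h2 : ∀ i j, ‖(κ i).clm.comp (ContinuousLinearMap.adjoint (κ j).clm)‖ ≤
      ε ^ 2 * 2 ^ L * (2 : ℝ) ^ (-|s i - s j|)) : ScaledFamily κ s R Λ ε L where
  injective := hs
  atomic := ha
  atomic_adj := ha'
  orthogonal i j := by
    rw [scaleGain, mul_min_of_nonneg _ _ (by positivity), mul_one]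
    refine le_min ?_ ?_
    · refine (ContinuousLinearMap.opNorm_comp_le _ _).trans ?_
      rw [LinearIsometryEquiv.norm_map, sq]
      exact mul_le_mul (h1 i) (h1 j) (norm_nonneg _) (by positivity)
    · refine (h2 i j).trans (le_of_eq ?_)
      rw [sub_eq_add_neg (L : ℤ), zpow_add₀ two_ne_zero, zpow_natCast, mul_assoc]

variable {k : En n → ℂ} {Λ M P ε : ℝ≥0}

lemma IsProfile.scaledFamily (hk : IsProfile k Λ M) {s : ι → ℤ} (hs : Function.Injective s) {R : ℝ}
    (hR : 2 ≤ R) {L : ℕ} (hε : ∀ i, ‖(hk.schur i).clm‖ ≤ ε) (hL : 2 * Λ * M ≤ ε ^ 2 * 2 ^ L)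
    (hL' : n * M ≤ Λ * 2 ^ L) :
    ScaledFamily (fun j => hk.schur (s j)) s R Λ ε L := by
  refine .of_bounds hs (fun j => (hk.isAtomic _).mono hR le_rfl hL')
    (fun j => (hk.isAtomic_adj _).mono hR le_rfl hL') (fun j => hε _) fun i j => ?_
  refine (hk.norm_comp_adjoint_le _ _).trans ?_
  refine mul_le_mul_of_nonneg_right ?_ (by positivity)
  exact_mod_cast hL

/-- The part of a convolution kernel at scale `2 ^ (s - j)` that is lost by averaging over the
dyadic cubes of side `2 ^ (-j)`. -/
def fineKernel (hk : IsProfile k P P) (s : ℕ) (j : ℤ) : SchurKernel n :=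
  ((condKernel n j).comp (hk.schur (j - s))).sub (hk.schur (j - s))

/-- The average over the dyadic cubes of side `2 ^ (-j)` of a convolution kernel at the smaller
scale `2 ^ (-s - j)`. -/
def coarseKernel (hk : IsProfile k P P) (s : ℕ) (j : ℤ) : SchurKernel n :=
  (condKernel n j).comp (hk.schur (j + s))

/-- The gain in the `L²` bounds for `fineKernel` and `coarseKernel`. -/
def condGain (n : ℕ) (P : ℝ≥0) (s : ℕ) : ℝ≥0 := 4 * n * P * (NNReal.sqrt 2)⁻¹ ^ s

lemma condGain_sq (s : ℕ) : condGain n P s ^ 2 = (4 * n * P) ^ 2 * 2⁻¹ ^ s := by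
  rw [condGain, mul_pow, ← pow_mul, mul_comm s 2, pow_mul, inv_pow, NNReal.sq_sqrt]

lemma condGain_sq_mul (s : ℕ) : condGain n P s ^ 2 * 2 ^ s = (4 * n * P) ^ 2 := by
  rw [condGain_sq, mul_assoc, ← mul_pow, inv_mul_cancel₀ two_ne_zero, one_pow, mul_one]

lemma norm_clm_le_condGain (κ : SchurKernel n) (hn : 1 ≤ n) (s : ℕ) {a b : ℝ≥0}
    (hr : ∀ x, ∫⁻ y, ‖κ.toFun x y‖ₑ ≤ (a * 2⁻¹ ^ s : ℝ≥0))
    (hc : ∀ y, ∫⁻ x, ‖κ.toFun x y‖ₑ ≤ b) (hab : a * b ≤ (4 * n * P) ^ 2) :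
    ‖κ.clm‖ ≤ condGain n P s := by
  refine (κ.norm_clm_sq_le hr hc).trans (Real.sqrt_le_iff.2 ⟨by positivity, ?_⟩)
  norm_cast
  rw [condGain_sq, mul_right_comm]
  gcongr

lemma norm_cond_comp_adjoint_le (hk : IsProfile k P P) (hn : 1 ≤ n) (s : ℕ)
    {C D : L2 n ℂ →L[ℂ] L2 n ℂ} (hC : ‖C‖ ≤ 2) (hD : ‖D‖ ≤ 2) (i j : ℤ) :
    ‖(C.comp (hk.schur i).clm).comp (ContinuousLinearMap.adjoint (D.comp (hk.schur j).clm))‖ ≤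
      condGain n P s ^ 2 * 2 ^ s * (2 : ℝ) ^ (-|i - j|) := by
  have h := hk.norm_comp_adjoint_le i j
  have hn' : (1 : ℝ) ≤ n := by exact_mod_cast hn
  have h0 : (condGain n P s ^ 2 * 2 ^ s : ℝ) = (4 * n * P) ^ 2 := by
    exact_mod_cast condGain_sq_mul (n := n) (P := P) s
  rw [ContinuousLinearMap.adjoint_comp, h0]
  have e : (C.comp (hk.schur i).clm).comp ((ContinuousLinearMap.adjoint (hk.schur j).clm).comp
      (ContinuousLinearMap.adjoint D)) = (C.comp ((hk.schur i).clm.comp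
      (ContinuousLinearMap.adjoint (hk.schur j).clm))).comp (ContinuousLinearMap.adjoint D) := rfl
  rw [e]
  calc _ ≤ _ := ContinuousLinearMap.opNorm_comp_le _ _
    _ ≤ (2 * (2 * P * P * (2 : ℝ) ^ (-|i - j|))) * 2 := by
        rw [LinearIsometryEquiv.norm_map]
        refine mul_le_mul ?_ hD (norm_nonneg _) (by positivity)
        exact (ContinuousLinearMap.opNorm_comp_le _ _).trans
          (mul_le_mul hC h (norm_nonneg _) (by positivity))
    _ = 8 * (1 * 1) * P ^ 2 * (2 : ℝ) ^ (-|i - j|) := by ring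
    _ ≤ 16 * (n * n) * P ^ 2 * (2 : ℝ) ^ (-|i - j|) := by gcongr; norm_num
    _ = _ := by ring

lemma fineKernel_clm (hk : IsProfile k P P) (s : ℕ) (j : ℤ) :
    (fineKernel hk s j).clm = ((condKernel n j).clm - ContinuousLinearMap.id ℂ _).comp
      (hk.schur (j - s)).clm := by
  rw [fineKernel, SchurKernel.clm_sub, SchurKernel.clm_comp]
  rfl

lemma coarseKernel_clm (hk : IsProfile k P P) (s : ℕ) (j : ℤ) :
    (coarseKernel hk s j).clm = (condKernel n j).clm.comp (hk.schur (j + s)).clm :=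
  SchurKernel.clm_comp _ _

lemma norm_sub_id_le {T : L2 n ℂ →L[ℂ] L2 n ℂ} (hT : ‖T‖ ≤ 1) :
    ‖T - ContinuousLinearMap.id ℂ _‖ ≤ 2 :=
  (norm_sub_le _ _).trans (by linarith [ContinuousLinearMap.norm_id_le (𝕜 := ℂ) (E := L2 n ℂ)])

lemma scaledFamily_fine (hk : IsProfile k P P) (hn : 1 ≤ n) (s : ℕ) {J : ι → ℤ}
    (hJ : Function.Injective J) :
    ScaledFamily (fun i => fineKernel hk s (J i)) (fun i => J i - s) (n + 2) (4 * n * P)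
      (condGain n P s) s := by
  have hn' : (1 : ℝ≥0) ≤ n := by exact_mod_cast hn
  have hs : (1 : ℝ≥0) ≤ 2 ^ s := one_le_pow₀ (by norm_num)
  have h2 : P + P ≤ 4 * n * P := by
    calc P + P = 2 * 1 * P := by ring
      _ ≤ 4 * n * P := by gcongr; norm_num
  have hM : 3 * n * P + n * P ≤ 4 * n * P * 2 ^ s := by
    calc 3 * n * P + n * P = 4 * n * P * 1 := by ring
      _ ≤ _ := by gcongr
  refine .of_bounds (fun a b h => hJ (by simpa using h)) (fun j => ?_) (fun j => ?_) (fun j => ?_)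
    fun i j => ?_
  · exact ((isAtomic_cond_comp hk (by simp)).sub
      ((hk.isAtomic _).mono (by simp) le_rfl le_rfl)).mono le_rfl h2 hM
  · exact (((isAtomic_cond_comp_adj hk (by simp)).sub
      ((hk.isAtomic_adj _).mono (by simp) le_rfl le_rfl)).congr
      (SchurKernel.adj_sub_toFun)).mono le_rfl h2 hM
  · refine norm_clm_le_condGain _ hn s (a := n * P) (b := P + P) (fun x => ?_) (fun y => ?_) ?_
    · refine (cond_comp_sub_row_le hk _ _ x).trans (le_of_eq ?_)
      rw [ENNReal.coe_mul]
      congr 1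
      rw [← ENNReal.ofReal_coe_nnreal]
      simp
    · exact ((isAtomic_cond_comp hk (by simp)).sub
        ((hk.isAtomic _).mono (by simp) le_rfl le_rfl)).col_le y
    · calc n * P * (P + P) = 2 * (n * 1) * P ^ 2 := by ring
        _ ≤ 16 * (n * n) * P ^ 2 := by gcongr; norm_num
        _ = _ := by ring
  · rw [fineKernel_clm, fineKernel_clm]
    exact norm_cond_comp_adjoint_le hk hn s (norm_sub_id_le (norm_condKernel_le _))
      (norm_sub_id_le (norm_condKernel_le _)) _ _

lemma scaledFamily_coarse (hk : IsProfile k P P) (hn : 1 ≤ n) (s : ℕ) {J : ι → ℤ}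
    (hJ : Function.Injective J) :
    ScaledFamily (fun i => coarseKernel hk s (J i)) J (n + 2) (4 * n * P)
      (condGain n P s) s := by
  have hn' : (1 : ℝ≥0) ≤ n := by exact_mod_cast hn
  have h2 : P ≤ 4 * n * P := by
    calc P = 1 * 1 * P := by ring
      _ ≤ 4 * n * P := by gcongr; norm_num
  have hM (j : ℤ) : n * P * 2 ^ (j + s - j) ≤ 4 * n * P * 2 ^ s := by
    rw [add_sub_cancel_left, zpow_natCast]
    gcongr
    exact le_mul_of_one_le_left zero_le (by norm_num)
  refine .of_bounds hJ (fun j => ?_) (fun j => ?_) (fun j => ?_) fun i j => ?_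
  · exact (isAtomic_cond_comp_of_le hk (by simp)).mono le_rfl h2 (hM _)
  · exact (isAtomic_cond_comp_adj_of_le hk (by simp)).mono le_rfl h2 (hM _)
  · refine norm_clm_le_condGain _ hn s (a := 4 * n * P) (b := P) (fun x => ?_) (fun y => ?_) ?_
    · refine (cond_comp_row_le_of_le hk _ _ x).trans (le_of_eq ?_)
      rw [ENNReal.coe_mul]
      congr 1
      rw [← ENNReal.ofReal_coe_nnreal]
      simp
    · exact cond_comp_col_le hk _ _ y
    · calc 4 * n * P * P = 4 * (n * 1) * P ^ 2 := by ring
        _ ≤ 16 * (n * n) * P ^ 2 := by gcongr; norm_num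
        _ = _ := by ring
  · rw [coarseKernel_clm, coarseKernel_clm, show J i - J j = J i + s - (J j + s) by ring]
    exact norm_cond_comp_adjoint_le hk hn s ((norm_condKernel_le _).trans one_le_two)
      ((norm_condKernel_le _).trans one_le_two) _ _

end Families

/-! ### Fourier transform bounds for convolution operators -/

section Fourier

open scoped FourierTransform SchwartzMap

variable {n : ℕ}

lemma norm_le_of_fourier (T : L2 n ℂ →L[ℂ] L2 n ℂ) (g : 𝓢(En n, ℂ)) {B : ℝ≥0}
    (hg : ∀ ξ, ‖𝓕 (g : En n → ℂ) ξ‖ ≤ B)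
    (hT : ∀ f : 𝓢(En n, ℂ), T (f.toLp 2) =ᵐ[volume] fun x => ∫ y, g (x - y) * f y) : ‖T‖ ≤ B := by
  have hd : DenseRange (SchwartzMap.toLpCLM ℝ ℂ 2 (volume : Measure (En n))) :=
    SchwartzMap.denseRange_toLpCLM ENNReal.ofNat_ne_top
  have hcl : IsClosed {f : L2 n ℂ | ‖T f‖ ≤ B * ‖f‖} :=
    isClosed_le (continuous_norm.comp T.continuous) (continuous_const.mul continuous_norm)
  suffices h : ∀ f : 𝓢(En n, ℂ), ‖T (f.toLp 2)‖ ≤ B * ‖f.toLp 2‖ from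
    ContinuousLinearMap.opNorm_le_bound _ B.2 fun f => hd.induction_on f hcl h
  intro f
  set c := SchwartzMap.convolution (ContinuousLinearMap.mul ℂ ℂ) f g with hc
  have h1 : T (f.toLp 2) = c.toLp 2 := by
    refine Lp.ext ((hT f).trans ?_)
    filter_upwards [c.coeFn_toLp 2] with x hx
    rw [hx, hc, SchwartzMap.convolution_apply, convolution]
    exact integral_congr_ae (Eventually.of_forall fun y => mul_comm _ _)
  have hP (h : 𝓢(En n, ℂ)) : ‖h.toLp 2‖ = ‖(𝓕 h).toLp 2‖ := by
    rw [← Lp.norm_fourier_eq, SchwartzMap.toLp_fourier_eq]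
  rw [h1, hP c, hP f]
  refine Lp.norm_le_mul_norm_of_ae_le_mul ?_
  filter_upwards [(𝓕 c).coeFn_toLp 2, (𝓕 f).coeFn_toLp 2] with ξ h2 h3
  rw [h2, h3, hc, SchwartzMap.fourier_convolution_apply,
    Real.fourier_bilin_convolution_eq _ f.integrable g.integrable, ContinuousLinearMap.mul_apply',
    norm_mul, mul_comm]
  exact mul_le_mul_of_nonneg_right (hg ξ) (norm_nonneg _)

lemma fourier_dilate (k : En n → ℂ) (i : ℤ) (ξ : En n) :
    𝓕 (dilate k i) ξ = 𝓕 k (((2 : ℝ) ^ i)⁻¹ • ξ) := by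
  rw [Real.fourier_eq, Real.fourier_eq,
    ← integral_dilate (fun v => Real.fourierChar (-⟪v, ((2 : ℝ) ^ i)⁻¹ • ξ⟫) • k v) i]
  refine integral_congr_ae (Eventually.of_forall fun t => ?_)
  simp only [dilate, Circle.smul_def, smul_eq_mul]
  rw [real_inner_smul_left, real_inner_smul_right, ← mul_assoc ((2 : ℝ) ^ i),
    mul_inv_cancel₀ (by positivity), one_mul]
  ring

lemma IsProfile.hasCompactSupport {k : En n → ℂ} {Λ M : ℝ≥0} (hk : IsProfile k Λ M) (i : ℤ) :
    HasCompactSupport (dilate k i) := by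
  refine HasCompactSupport.intro (isCompact_closedBall 0 (2 * ((2 : ℝ) ^ i)⁻¹)) fun t ht => ?_
  rw [dilate, hk.eq_zero, mul_zero]
  rw [mem_closedBall_zero_iff, not_le] at ht
  rw [norm_smul, Real.norm_of_nonneg (by positivity)]
  rw [← div_eq_mul_inv, div_lt_iff₀ (by positivity)] at ht
  linarith

lemma contDiff_dilate {k : En n → ℂ} (hk : ContDiff ℝ (⊤ : ℕ∞) k) (i : ℤ) :
    ContDiff ℝ (⊤ : ℕ∞) (dilate k i) :=
  contDiff_const.mul (hk.comp (contDiff_const_smul _))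

/-- The dilate of a smooth profile, as a Schwartz function. -/
def IsProfile.toSchwartz {k : En n → ℂ} {Λ M : ℝ≥0} (hk : IsProfile k Λ M)
    (hs : ContDiff ℝ (⊤ : ℕ∞) k) (i : ℤ) : 𝓢(En n, ℂ) :=
  (hk.hasCompactSupport i).toSchwartzMap (contDiff_dilate hs i)

lemma IsProfile.norm_sum_clm_le {k : En n → ℂ} {Λ M : ℝ≥0} (hk : IsProfile k Λ M)
    (hs : ContDiff ℝ (⊤ : ℕ∞) k) (S : Finset ℤ) {B : ℝ≥0}
    (hB : ∀ ξ, ‖∑ i ∈ S, 𝓕 k (((2 : ℝ) ^ i)⁻¹ • ξ)‖ ≤ B) :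
    ‖∑ i ∈ S, (hk.schur i).clm‖ ≤ B := by
  refine norm_le_of_fourier _ (∑ i ∈ S, hk.toSchwartz hs i) (fun ξ => ?_) fun f => ?_
  · refine le_of_eq_of_le (congrArg _ ?_) (hB ξ)
    rw [← SchwartzMap.fourier_coe, FourierTransform.fourier_sum, SchwartzMap.sum_apply]
    refine Finset.sum_congr rfl fun i _ => ?_
    rw [SchwartzMap.fourier_coe, ← fourier_dilate]
    rfl
  · rw [ContinuousLinearMap.sum_apply]
    refine (Lp.coeFn_finsetSum _ _).trans ?_
    have h : ∀ i ∈ S, (hk.schur i).clm (f.toLp 2) =ᵐ[volume]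
        fun x => ∫ y, hk.toSchwartz hs i (x - y) * f y := by
      intro i _
      refine ((hk.schur i).clm_ae _).trans (Eventually.of_forall fun x => ?_)
      refine integral_congr_ae ?_
      filter_upwards [f.coeFn_toLp 2] with y hy
      rw [hy]
      rfl
    have h' := (ae_ball_iff S.countable_toSet).2 h
    filter_upwards [h'] with x hx
    rw [Finset.sum_apply, Finset.sum_congr rfl hx, ← integral_finsetSum]
    · simp_rw [SchwartzMap.sum_apply, Finset.sum_mul]
    · intro i _
      refine f.integrable.bdd_mul (c := ‖(hk.toSchwartz hs i).toBoundedContinuousFunction‖)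
        (by fun_prop) (Eventually.of_forall fun y => ?_)
      exact (hk.toSchwartz hs i).toBoundedContinuousFunction.norm_coe_le_norm _

lemma IsProfile.norm_clm_le_of_fourier {k : En n → ℂ} {Λ M : ℝ≥0} (hk : IsProfile k Λ M)
    (hs : ContDiff ℝ (⊤ : ℕ∞) k) (i : ℤ) {B : ℝ≥0} (hB : ∀ ξ, ‖𝓕 k ξ‖ ≤ B) :
    ‖(hk.schur i).clm‖ ≤ B := by
  simpa using hk.norm_sum_clm_le hs {i} (B := B) (fun ξ => by simpa using hB _)

lemma IsProfile.integrable {k : En n → ℂ} {Λ M : ℝ≥0} (hk : IsProfile k Λ M) : Integrable k :=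
  ⟨hk.continuous.aestronglyMeasurable, by
    rw [hasFiniteIntegral_iff_enorm]; exact hk.lintegral_le.trans_lt ENNReal.coe_lt_top⟩

lemma IsProfile.norm_fourier_le_mul {k : En n → ℂ} {Λ M : ℝ≥0} (hk : IsProfile k Λ M) (ξ : En n) :
    ‖𝓕 k ξ‖ ≤ 4 * Real.pi * Λ * ‖ξ‖ := by
  have h : 𝓕 k ξ = ∫ v, (Real.fourierChar (-⟪v, ξ⟫) • k v - k v) := by
    rw [integral_sub _ hk.integrable, hk.integral_eq_zero, sub_zero, Real.fourier_eq]
    exact (Real.fourierIntegral_convergent_iff ξ).2 hk.integrable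
  rw [h, ← ENNReal.ofReal_le_ofReal_iff (by positivity), ofReal_norm]
  refine (enorm_integral_le_lintegral_enorm _).trans ?_
  calc _ ≤ ∫⁻ v, ENNReal.ofReal (4 * Real.pi * ‖ξ‖) * ‖k v‖ₑ := by
        refine lintegral_mono fun v => ?_
        rcases le_or_gt ‖v‖ 2 with hv | hv
        · rw [Circle.smul_def, smul_eq_mul, ← sub_one_mul, enorm_mul]
          gcongr
          rw [← ofReal_norm]
          refine ENNReal.ofReal_le_ofReal ?_
          rw [Real.fourierChar_apply]
          have h1 := Real.norm_exp_I_mul_ofReal_sub_one_le (x := 2 * Real.pi * (-⟪v, ξ⟫))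
          rw [mul_comm Complex.I] at h1
          refine h1.trans ?_
          rw [norm_mul, norm_neg, Real.norm_of_nonneg (by positivity)]
          calc _ ≤ 2 * Real.pi * (‖v‖ * ‖ξ‖) := by gcongr; exact norm_inner_le_norm _ _
            _ ≤ 2 * Real.pi * (2 * ‖ξ‖) := by gcongr
            _ = _ := by ring
        · simp [hk.eq_zero v hv]
    _ = ENNReal.ofReal (4 * Real.pi * ‖ξ‖) * ∫⁻ v, ‖k v‖ₑ :=
        lintegral_const_mul' _ _ ENNReal.ofReal_ne_top
    _ ≤ ENNReal.ofReal (4 * Real.pi * ‖ξ‖) * Λ := by gcongr; exact hk.lintegral_le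
    _ = _ := by
        rw [← ENNReal.ofReal_coe_nnreal, ← ENNReal.ofReal_mul (by positivity)]
        congr 1; ring

lemma IsProfile.norm_fourier_le_div {k : En n → ℂ} {Λ M : ℝ≥0} (hk : IsProfile k Λ M) {ξ : En n}
    (hξ : ξ ≠ 0) : ‖𝓕 k ξ‖ ≤ M * ‖ξ‖⁻¹ := by
  have hξ' : 0 < ‖ξ‖ := norm_pos_iff.2 hξ
  rw [Real.fourier_eq, fourierIntegral_eq_half_sub_half_period_translate hξ hk.integrable,
    norm_smul]
  set w : En n := (1 / (2 * ‖ξ‖ ^ 2) : ℝ) • ξ with hw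
  have hwn : ‖w‖ ≤ ‖ξ‖⁻¹ := by
    rw [hw, norm_smul, Real.norm_of_nonneg (by positivity)]
    rw [show 1 / (2 * ‖ξ‖ ^ 2) * ‖ξ‖ = ‖ξ‖⁻¹ / 2 by field_simp]
    exact half_le_self (by positivity)
  have h1 : ‖∫ v, Real.fourierChar (-⟪v, ξ⟫) • (k v - k (v + w))‖ ≤ M * ‖ξ‖⁻¹ := by
    rw [← ENNReal.ofReal_le_ofReal_iff (by positivity), ofReal_norm]
    refine (enorm_integral_le_lintegral_enorm _).trans ?_
    calc _ = ∫⁻ v, ‖k (v + w) - k v‖ₑ := by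
          refine lintegral_congr fun v => ?_
          rw [Circle.smul_def, smul_eq_mul, enorm_mul, enorm_sub_rev]
          rw [← ofReal_norm (_ : ℂ), Circle.norm_coe, ENNReal.ofReal_one, one_mul]
      _ ≤ M * ‖w‖ₑ := hk.modulus w
      _ ≤ M * ENNReal.ofReal ‖ξ‖⁻¹ := by
          rw [← ofReal_norm]
          gcongr
      _ = _ := by rw [ENNReal.ofReal_mul (by positivity), ENNReal.ofReal_coe_nnreal]
  calc _ ≤ 1 * (M * ‖ξ‖⁻¹) := by
        refine mul_le_mul (by norm_num) h1 (norm_nonneg _) zero_le_one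
    _ = _ := one_mul _

end Fourier

/-! ### Truncated singular integrals -/

section Truncated

open scoped FourierTransform

variable {n : ℕ}

lemma lintegral_enorm_sum_le {ι : Type} (S : Finset ι) (F : ι → L2 n ℂ) (s : Set (En n)) :
    ∫⁻ x in s, ‖(∑ i ∈ S, F i : L2 n ℂ) x‖ₑ ≤ ∑ i ∈ S, ∫⁻ x in s, ‖F i x‖ₑ := by
  rw [← lintegral_finsetSum' _ fun i _ => (Lp.aestronglyMeasurable _).enorm.restrict]
  refine lintegral_mono_ae (ae_restrict_of_ae ?_)
  filter_upwards [Lp.coeFn_finsetSum S F] with x hx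
  rw [hx, Finset.sum_apply]
  exact enorm_sum_le _ _

lemma FamilyAtomBound.atomBound_sum {ι : Type} [Fintype ι] {A : ι → L2 n ℂ →L[ℂ] L2 n ℂ} {R : ℝ}
    {D : ℝ≥0} (h : FamilyAtomBound A R D) : AtomBound (∑ i, A i) R D := by
  intro σ b hb
  rw [ContinuousLinearMap.sum_apply]
  exact (lintegral_enorm_sum_le _ _ _).trans (h.direct σ b hb)

lemma FamilyAtomBound.atomBound_adjoint_sum {ι : Type} [Fintype ι] {A : ι → L2 n ℂ →L[ℂ] L2 n ℂ}
    {R : ℝ} {D : ℝ≥0} (h : FamilyAtomBound A R D) :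
    AtomBound (ContinuousLinearMap.adjoint (∑ i, A i)) R D := by
  intro σ b hb
  rw [map_sum, ContinuousLinearMap.sum_apply]
  exact (lintegral_enorm_sum_le _ _ _).trans (h.adjoint σ (fun _ => b) (fun x => ‖b x‖ₑ)
    (fun _ => hb) fun _ => Eventually.of_forall fun _ => le_rfl)

variable {k : En n → ℂ} {P : ℝ≥0}

lemma IsProfile.norm_fourier_smul_le (hk : IsProfile k P P) {ξ : En n} {a : ℤ}
    (h1 : (2 : ℝ) ^ a ≤ ‖ξ‖) (h2 : ‖ξ‖ < (2 : ℝ) ^ (a + 1)) (i : ℤ) :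
    ‖𝓕 k (((2 : ℝ) ^ i)⁻¹ • ξ)‖ ≤ 32 * P * scaleGain 0 (i - a) := by
  have hξ : 0 < ‖ξ‖ := lt_of_lt_of_le (by positivity) h1
  have hn : ‖((2 : ℝ) ^ i)⁻¹ • ξ‖ = (2 : ℝ) ^ (-i) * ‖ξ‖ := by
    rw [norm_smul, Real.norm_of_nonneg (by positivity), zpow_neg]
  have hg : scaleGain 0 (i - a) = (2 : ℝ) ^ (-|i - a|) := by
    rw [scaleGain, Nat.cast_zero, zero_sub, min_eq_right]
    exact zpow_le_one_of_nonpos₀ one_le_two (neg_nonpos.2 (abs_nonneg _))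
  rw [hg]
  have hP : (0 : ℝ) ≤ P := P.2
  rcases le_total a i with h | h
  · have := hk.norm_fourier_le_mul (((2 : ℝ) ^ i)⁻¹ • ξ)
    refine this.trans ?_
    rw [hn, abs_of_nonneg (by omega)]
    have hpi := Real.pi_le_four
    calc 4 * Real.pi * P * ((2 : ℝ) ^ (-i) * ‖ξ‖) ≤ 4 * 4 * P * ((2 : ℝ) ^ (-i) * (2 : ℝ) ^ (a + 1)) := by
          gcongr
      _ = _ := by
          rw [← zpow_add₀ two_ne_zero, show -i + (a + 1) = -(i - a) + 1 by ring,
            zpow_add_one₀ two_ne_zero]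
          ring
  · have := hk.norm_fourier_le_div (ξ := ((2 : ℝ) ^ i)⁻¹ • ξ)
      (by rw [← norm_pos_iff, hn]; positivity)
    refine this.trans ?_
    rw [hn, abs_of_nonpos (by omega), mul_inv, zpow_neg, inv_inv]
    calc P * ((2 : ℝ) ^ i * ‖ξ‖⁻¹) ≤ P * ((2 : ℝ) ^ i * ((2 : ℝ) ^ a)⁻¹) := by gcongr
      _ = 1 * P * (2 : ℝ) ^ (- -(i - a)) := by
          rw [neg_neg, zpow_sub₀ two_ne_zero, one_mul]
          rfl
      _ ≤ _ := by gcongr; norm_num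

lemma IsProfile.norm_sum_fourier_le (hk : IsProfile k P P) (S : Finset ℤ) (ξ : En n) :
    ‖∑ i ∈ S, 𝓕 k (((2 : ℝ) ^ i)⁻¹ • ξ)‖ ≤ 128 * P := by
  rcases eq_or_ne ξ 0 with rfl | hξ
  · have h0 : 𝓕 k 0 = 0 := by
      have := hk.norm_fourier_le_mul 0
      rw [norm_zero, mul_zero] at this
      exact norm_le_zero_iff.1 this
    simp [h0]
  · obtain ⟨a, h1, h2⟩ := exists_mem_Ico_zpow (norm_pos_iff.2 hξ) one_lt_two
    refine (norm_sum_le _ _).trans ((Finset.sum_le_sum fun i _ =>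
      hk.norm_fourier_smul_le h1 h2 i).trans ?_)
    rw [← Finset.mul_sum, ← Finset.sum_coe_sort]
    have h := sum_scaleGain_comp_le 0 (s := fun i : S => (i : ℤ) - a)
      (fun x y hxy => Subtype.ext (by simpa using hxy))
    have hP : (0 : ℝ) ≤ P := P.2
    calc _ ≤ 32 * (P : ℝ) * (4 * (1 + (0 : ℕ))) := by gcongr
      _ = _ := by norm_num; ring

theorem IsProfile.eLpNorm_sum_clm_le (hk : IsProfile k P P) (hs : ContDiff ℝ (⊤ : ℕ∞) k)
    (hP : 0 < P) (hn : 1 ≤ n) (S : Finset ℤ) {f : L2 n ℂ} (hf : Integrable (f : En n → ℂ)) {p : ℝ}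
    (hp : 1 < p) :
    eLpNorm ((∑ i ∈ S, (hk.schur i).clm) f) (ENNReal.ofReal p) volume ≤
      masterConst n (n + 2) p * ((128 * n * P : ℝ≥0) : ℝ≥0∞) *
        eLpNorm f (ENNReal.ofReal p) volume := by
  have hn' : (1 : ℝ≥0) ≤ n := by exact_mod_cast hn
  have hA0 : 0 < 128 * n * P := by positivity
  have hfam : ScaledFamily (fun i : S => hk.schur i) (fun i => (i : ℤ)) (n + 2) (16 * n * P)
      (2 * P) 0 := by
    have e1 : P ≤ 16 * n * P := by
      calc P = 1 * 1 * P := by ring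
        _ ≤ _ := by gcongr; norm_num
    have e2 : n * P ≤ 16 * n * P * 2 ^ 0 := by
      rw [pow_zero, mul_one, mul_assoc]
      exact le_mul_of_one_le_left zero_le (by norm_num)
    refine .of_bounds Subtype.val_injective
      (fun j => (hk.isAtomic _).mono (by simp) e1 e2)
      (fun j => (hk.isAtomic_adj _).mono (by simp) e1 e2)
      (fun j => (hk.norm_clm_le _).trans ?_)
      fun i j => (hk.norm_comp_adjoint_le _ _).trans ?_
    · push_cast
      linarith [P.2]
    · refine mul_le_mul_of_nonneg_right ?_ (by positivity)
      push_cast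
      nlinarith [sq_nonneg (P : ℝ)]
  have hb := hfam.familyAtomBound (by positivity)
  have hD : 8 * (1 + ((0 : ℕ) : ℝ≥0)) * (16 * n * P) = 128 * n * P := by push_cast; ring
  rw [hD] at hb
  have hT : ‖∑ i : S, (hk.schur i).clm‖ ≤ ((128 * n * P : ℝ≥0) : ℝ) := by
    rw [Finset.sum_coe_sort S fun i => (hk.schur i).clm]
    refine hk.norm_sum_clm_le hs S fun ξ => (hk.norm_sum_fourier_le S ξ).trans ?_
    have : (128 * P : ℝ≥0) ≤ 128 * n * P := by
      calc 128 * P = 128 * 1 * P := by ring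
        _ ≤ _ := by gcongr
    exact_mod_cast this
  have := eLpNorm_clm_le hn (R := n + 2) (by positivity) hT hA0 le_rfl hb.atomBound_sum
    hb.atomBound_adjoint_sum hf hp
  rwa [Finset.sum_coe_sort S fun i => (hk.schur i).clm, ← NNReal.rpow_add hA0.ne', sub_add_cancel,
    NNReal.rpow_one] at this

end Truncated

/-! ### Jumps of dyadic averages -/

section Greedy

variable {a : ℤ → ℂ} {τ : ℕ → ℤ} {K : ℕ} {lo hi : ℤ} {μ : ℝ}

lemma exists_greedy_jump (h0 : τ 0 ≤ lo) (hK : hi ≤ τ K)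
    (hA : ∀ i j, τ i ≤ j → j < τ (i + 1) → ‖a j - a (τ i)‖ ≤ μ)
    (hB : ∀ i, τ (i + 1) < hi → μ < ‖a (τ (i + 1)) - a (τ i)‖) (hle : ∀ i, τ i ≤ hi)
    {s t : ℤ} (hs : lo ≤ s) (ht : t ≤ hi) (hst : s < t) (hj : 2 * μ < ‖a t - a s‖) :
    ∃ k < K, μ < ‖a (τ (k + 1)) - a (τ k)‖ ∧ s < τ (k + 1) ∧ τ (k + 1) ≤ t := by
  classical
  have hex : ∃ i, s < τ i := ⟨K, by omega⟩
  obtain ⟨k, hk⟩ : ∃ k, Nat.find hex = k + 1 := by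
    refine Nat.exists_eq_succ_of_ne_zero fun h => ?_
    have := Nat.find_spec hex
    rw [h] at this
    omega
  have h1 : s < τ (k + 1) := hk ▸ Nat.find_spec hex
  have h2 : τ k ≤ s := not_lt.1 (Nat.find_min hex (by omega))
  have hkK : k < K := by
    have := Nat.find_min' hex (m := K) (by omega)
    omega
  have hsk := hA k s h2 h1
  have hbound (h : ‖a t - a (τ k)‖ ≤ μ) : False := by
    have := norm_sub_le_norm_sub_add_norm_sub (a t) (a (τ k)) (a s)
    rw [norm_sub_rev (a (τ k))] at this
    linarith
  have h3 : τ (k + 1) ≤ t := by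
    by_contra h
    exact hbound (hA k t (by omega) (by omega))
  refine ⟨k, hkK, ?_, h1, h3⟩
  rcases (hle (k + 1)).lt_or_eq with h | h
  · exact hB k h
  · by_contra h'
    have : t = τ (k + 1) := by omega
    exact hbound (this ▸ not_lt.1 h')

lemma jumpCount_le_card (h0 : τ 0 ≤ lo) (hK : hi ≤ τ K)
    (hA : ∀ i j, τ i ≤ j → j < τ (i + 1) → ‖a j - a (τ i)‖ ≤ μ)
    (hB : ∀ i, τ (i + 1) < hi → μ < ‖a (τ (i + 1)) - a (τ i)‖) (hle : ∀ i, τ i ≤ hi) :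
    jumpCount (2 * μ) (Icc lo hi) a ≤
      ((Finset.univ.filter fun i : Fin K => μ < ‖a (τ (i + 1)) - a (τ i)‖).card : ℝ≥0∞) := by
  refine iSup_le fun N => iSup_le fun s => iSup_le fun t => iSup_le fun hs => iSup_le fun ht =>
    iSup_le fun hst => iSup_le fun hd => iSup_le fun hj => ?_
  choose k hkK hk hk1 hk2 using fun q => exists_greedy_jump h0 hK hA hB hle (hs q).1 (ht q).2
    (hst q) (hj q)
  have hlt : ∀ q q', q < q' → k q ≠ k q' := by
    intro q q' hq h
    have h1 := hk2 q
    have h2 := hk1 q'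
    have h3 := hd q q' hq
    rw [← h] at h2
    omega
  have : N ≤ (Finset.univ.filter fun i : Fin K => μ < ‖a (τ (i + 1)) - a (τ i)‖).card := by
    calc N = (Finset.univ : Finset (Fin N)).card := (Finset.card_fin N).symm
      _ ≤ _ := Finset.card_le_card_of_injOn (fun q => ⟨k q, hkK q⟩)
        (fun q _ => by simpa using hk q) fun q _ q' _ h => by
          by_contra hne
          rcases lt_or_gt_of_ne hne with h' | h'
          · exact hlt q q' h' (by simpa using h)
          · exact hlt q' q h' (by simpa using h.symm)
  exact_mod_cast this

lemma mul_jumpCount_le_sum (hμ : 0 ≤ μ) (h0 : τ 0 ≤ lo) (hK : hi ≤ τ K)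
    (hA : ∀ i j, τ i ≤ j → j < τ (i + 1) → ‖a j - a (τ i)‖ ≤ μ)
    (hB : ∀ i, τ (i + 1) < hi → μ < ‖a (τ (i + 1)) - a (τ i)‖) (hle : ∀ i, τ i ≤ hi) :
    ENNReal.ofReal μ ^ (2 : ℝ) * jumpCount (2 * μ) (Icc lo hi) a ≤
      ∑ i : Fin K, ‖a (τ (i + 1)) - a (τ i)‖ₑ ^ (2 : ℝ) := by
  calc _ ≤ ENNReal.ofReal μ ^ (2 : ℝ) *
        ((Finset.univ.filter fun i : Fin K => μ < ‖a (τ (i + 1)) - a (τ i)‖).card : ℝ≥0∞) := by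
        gcongr; exact jumpCount_le_card h0 hK hA hB hle
    _ = ∑ i ∈ Finset.univ.filter fun i : Fin K => μ < ‖a (τ (i + 1)) - a (τ i)‖,
        ENNReal.ofReal μ ^ (2 : ℝ) := by rw [Finset.sum_const, nsmul_eq_mul, mul_comm]
    _ ≤ ∑ i ∈ Finset.univ.filter fun i : Fin K => μ < ‖a (τ (i + 1)) - a (τ i)‖,
        ‖a (τ (i + 1)) - a (τ i)‖ₑ ^ (2 : ℝ) := by
        refine Finset.sum_le_sum fun i hi => ?_
        rw [← ofReal_norm]
        gcongr
        exact (Finset.mem_filter.1 hi).2.le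
    _ ≤ _ := Finset.sum_le_sum_of_subset (Finset.filter_subset _ _)

end Greedy

namespace Stopping

variable {n : ℕ}

/-- A family of functions that are measurable and constant on the dyadic cubes of each level. -/
structure CubeAdapted (m : ℤ → En n → ℂ) : Prop where
  measurable : ∀ j, Measurable (m j)
  eq_of_mem : ∀ j x, ∀ y ∈ dyadicCube j x, m j y = m j x

/-- `d` steps after `σ`, either the level `N` is reached or there is a jump of size `μ`. -/
def IsJump (σ : Stopping n) (m : ℤ → En n → ℂ) (N : ℤ) (μ : ℝ) (x : En n) (d : ℕ) : Prop :=
  N ≤ σ.level x + d ∨ μ < ‖m (σ.level x + d) x - m (σ.level x) x‖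

lemma exists_isJump (σ : Stopping n) (m : ℤ → En n → ℂ) (N : ℤ) (μ : ℝ) (x : En n) :
    ∃ d, σ.IsJump m N μ x d := ⟨(N - σ.level x).toNat, Or.inl (by omega)⟩

variable {m : ℤ → En n → ℂ}

open Classical in
/-- The next jump time. -/
def next (σ : Stopping n) (hm : CubeAdapted m) (N : ℤ) (μ : ℝ) : Stopping n where
  carrier := σ.carrier
  level x := σ.level x + Nat.find (σ.exists_isJump m N μ x)
  measurableSet_carrier := σ.measurableSet_carrier
  measurable_level := by
    have hf : Measurable fun x => Nat.find (σ.exists_isJump m N μ x) := by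
      refine measurable_find _ fun d => ?_
      have hmm (d : ℕ) : Measurable fun x => m (σ.level x + d) x := by
        have : Measurable (fun q : ℤ × En n => m q.1 q.2) :=
          measurable_from_prod_countable_right hm.measurable
        exact this.comp ((σ.measurable_level.add_const _).prodMk measurable_id)
      have h1 := (hmm d).sub (hmm 0)
      simp only [Nat.cast_zero, add_zero] at h1
      exact (measurableSet_le measurable_const (σ.measurable_level.add_const _)).union
        (measurableSet_lt measurable_const h1.norm)
    exact σ.measurable_level.add ((measurable_of_countable (fun d : ℕ => (d : ℤ))).comp hf)
  stable x hx y hy := by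
    have hσ := σ.stable x hx y (dyadicCube_subset (by omega) x hy)
    refine ⟨hσ.1, ?_⟩
    have hd : ∀ d ≤ Nat.find (σ.exists_isJump m N μ x),
        (σ.IsJump m N μ y d ↔ σ.IsJump m N μ x d) := by
      intro d hd
      rw [IsJump, IsJump, hσ.2, hm.eq_of_mem _ x y (dyadicCube_subset (by omega) x hy),
        hm.eq_of_mem _ x y (dyadicCube_subset (by omega) x hy)]
    rw [hσ.2, (Nat.find_eq_iff (σ.exists_isJump m N μ y)).2
      ⟨(hd _ le_rfl).2 (Nat.find_spec (σ.exists_isJump m N μ x)),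
        fun d hd' h => Nat.find_min _ hd' ((hd _ hd'.le).1 h)⟩]

section Next

variable (σ : Stopping n) (hm : CubeAdapted m) (N : ℤ) {μ : ℝ} (x : En n)

lemma level_le_next : σ.level x ≤ (σ.next hm N μ).level x := by
  simp [next]

lemma next_level_le (h : σ.level x ≤ N) : (σ.next hm N μ).level x ≤ N := by
  classical
  have := Nat.find_min' (σ.exists_isJump m N μ x) (m := (N - σ.level x).toNat) (Or.inl (by omega))
  show σ.level x + _ ≤ N
  omega

lemma next_level_gt (hμ : 0 ≤ μ) (h : σ.level x < N) : σ.level x < (σ.next hm N μ).level x := by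
  classical
  have : Nat.find (σ.exists_isJump m N μ x) ≠ 0 := by
    intro h0
    have h1 := Nat.find_spec (σ.exists_isJump m N μ x)
    rw [h0] at h1
    rcases h1 with h1 | h1
    · omega
    · simp at h1; linarith
  show σ.level x < σ.level x + _
  omega

lemma norm_sub_le_of_lt_next {j : ℤ} (h1 : σ.level x ≤ j) (h2 : j < (σ.next hm N μ).level x) :
    ‖m j x - m (σ.level x) x‖ ≤ μ := by
  classical
  obtain ⟨d, rfl⟩ : ∃ d : ℕ, j = σ.level x + d := ⟨(j - σ.level x).toNat, by omega⟩
  have h3 : d < Nat.find (σ.exists_isJump m N μ x) := by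
    have : σ.level x + (d : ℤ) < σ.level x + (Nat.find (σ.exists_isJump m N μ x) : ℤ) := h2
    omega
  exact not_lt.1 fun h => Nat.find_min _ h3 (Or.inr h)

lemma lt_norm_sub_next (h : (σ.next hm N μ).level x < N) :
    μ < ‖m ((σ.next hm N μ).level x) x - m (σ.level x) x‖ := by
  classical
  rcases Nat.find_spec (σ.exists_isJump m N μ x) with h1 | h1
  · have : (σ.next hm N μ).level x = σ.level x + (Nat.find (σ.exists_isJump m N μ x) : ℤ) := rfl
    omega
  · exact h1

/-- The successive jump times. -/
def iter : ℕ → Stopping n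
  | 0 => Stopping.const n (-N)
  | i + 1 => (iter i).next hm N μ

variable (μ) in
lemma iter_carrier (i : ℕ) : (iter hm N i (μ := μ)).carrier = univ := by
  induction i with
  | zero => rfl
  | succ i ih => exact ih

lemma iter_level_le (hN : 0 ≤ N) (i : ℕ) : (iter hm N i (μ := μ)).level x ≤ N := by
  induction i with
  | zero => show -N ≤ N; omega
  | succ i ih => exact next_level_le _ _ _ _ ih

lemma le_iter_level (hμ : 0 ≤ μ) (i : ℕ) :
    min N (-N + i) ≤ (iter hm N i (μ := μ)).level x := by
  induction i with
  | zero => show _ ≤ -N; simp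
  | succ i ih =>
    rcases lt_or_ge ((iter hm N i (μ := μ)).level x) N with h | h
    · have := next_level_gt _ hm N x hμ h
      show _ ≤ ((iter hm N i (μ := μ)).next hm N μ).level x
      push_cast
      omega
    · have := level_le_next (iter hm N i (μ := μ)) hm N x (μ := μ)
      show _ ≤ ((iter hm N i (μ := μ)).next hm N μ).level x
      omega

lemma mul_jumpCount_le_sum_iter (hμ : 0 ≤ μ) (N : ℕ) :
    ENNReal.ofReal μ ^ (2 : ℝ) * jumpCount (2 * μ) (Icc (-N : ℤ) N) (fun j => m j x) ≤
      ∑ i : Fin (2 * N), ‖m ((iter hm N (i + 1) (μ := μ)).level x) x -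
        m ((iter hm N i (μ := μ)).level x) x‖ₑ ^ (2 : ℝ) := by
  refine mul_jumpCount_le_sum (a := fun j => m j x)
    (τ := fun i => (iter hm N i (μ := μ)).level x) hμ (le_refl (-N : ℤ)) ?_
    (fun i j h1 h2 => norm_sub_le_of_lt_next _ hm N x h1 h2)
    (fun i h => lt_norm_sub_next _ hm N x h) fun i => iter_level_le hm N x (by omega) i
  have := le_iter_level hm N x hμ (2 * N)
  push_cast at this
  omega

end Next

end Stopping

/-! ### Square functions of stopped dyadic averages -/

lemma SchurKernel.clm_congr {n : ℕ} {κ₁ κ₂ : SchurKernel n}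
    (h : ∀ x y, κ₁.toFun x y = κ₂.toFun x y) : κ₁.clm = κ₂.clm := by
  ext1 f
  refine Lp.ext ((κ₁.clm_ae f).trans (EventuallyEq.trans ?_ (κ₂.clm_ae f).symm))
  exact Eventually.of_forall fun x => by simp only [SchurKernel.op, h]

namespace Stopping

variable {n : ℕ} (σ τ : Stopping n)

lemma integral_schur_mul_of_const {y : En n} (hy : y ∈ σ.carrier) {φ : En n → ℂ}
    (hφ : ∀ z ∈ dyadicCube (σ.level y) y, φ z = φ y) :
    ∫ z, σ.schur.toFun z y * φ z = φ y := by
  have : ∀ z, σ.schur.toFun z y * φ z = σ.schur.toFun z y * φ y := by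
    intro z
    by_cases hz : z ∈ dyadicCube (σ.level y) y
    · rw [hφ z hz]
    · rw [schur_toFun, σ.ker_comm, σ.ker_eq_indicator hy, indicator_of_notMem hz]
      simp
  simp_rw [this]
  rw [integral_mul_const, σ.integral_schur_col hy, one_mul]

lemma adjoint_schur_clm : ContinuousLinearMap.adjoint σ.schur.clm = σ.schur.clm := by
  rw [SchurKernel.adjoint_clm]
  refine SchurKernel.clm_congr fun x y => ?_
  rw [SchurKernel.adj_toFun, schur_toFun, schur_toFun, σ.ker_comm, Complex.conj_ofReal]

variable {σ τ} in
lemma schur_clm_comp (hσ : σ.carrier = univ) (hτ : τ.carrier = univ)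
    (h : ∀ x, σ.level x ≤ τ.level x) : σ.schur.clm.comp τ.schur.clm = σ.schur.clm := by
  rw [← SchurKernel.clm_comp]
  refine SchurKernel.clm_congr fun x y => ?_
  rw [SchurKernel.comp_toFun]
  simp_rw [mul_comm (σ.schur.toFun x _)]
  refine τ.integral_schur_mul_of_const (φ := σ.schur.toFun x) (hτ ▸ mem_univ y) fun z hz => ?_
  rw [schur_toFun, schur_toFun, σ.ker_comm x, σ.ker_comm x,
    σ.ker_eq_of_mem (hσ ▸ mem_univ y) (dyadicCube_subset (h y) y hz)]

variable {σ τ} in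
lemma norm_schur_sub_sq (hσ : σ.carrier = univ) (hτ : τ.carrier = univ)
    (h : ∀ x, σ.level x ≤ τ.level x) (f : L2 n ℂ) :
    ‖τ.schur.clm f - σ.schur.clm f‖ ^ 2 = ‖τ.schur.clm f‖ ^ 2 - ‖σ.schur.clm f‖ ^ 2 := by
  have h1 : inner ℂ (σ.schur.clm f) (τ.schur.clm f) = (‖σ.schur.clm f‖ : ℂ) ^ 2 := by
    have e1 : inner ℂ (σ.schur.clm f) (τ.schur.clm f) =
        inner ℂ f (σ.schur.clm (τ.schur.clm f)) := by
      rw [← ContinuousLinearMap.adjoint_inner_right, adjoint_schur_clm]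
    have e2 : σ.schur.clm (τ.schur.clm f) = σ.schur.clm (σ.schur.clm f) := by
      rw [← ContinuousLinearMap.comp_apply, ← ContinuousLinearMap.comp_apply,
        schur_clm_comp hσ hτ h, schur_clm_comp hσ hσ fun _ => le_rfl]
    rw [e1, e2]
    nth_rewrite 1 [← adjoint_schur_clm]
    rw [ContinuousLinearMap.adjoint_inner_right]
    exact inner_self_eq_norm_sq_to_K (𝕜 := ℂ) _
  rw [norm_sub_sq (𝕜 := ℂ), ← inner_conj_symm, h1]
  rw [map_pow]
  simp only [Complex.conj_ofReal, ← Complex.ofReal_pow, RCLike.re_eq_complex_re, Complex.ofReal_re]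
  ring

variable {σ} in
lemma IsBad.schur_op_eq_zero {b : En n → ℂ} (hb : σ.IsBad b) (hb2 : MemLp b 2 volume)
    (hτ : τ.carrier = univ) {x : En n} (hx : x ∉ σ.carrier) : τ.schur.op b x = 0 := by
  have hxτ : x ∈ τ.carrier := hτ ▸ mem_univ x
  have hg : MemLp (τ.schur.toFun x) 2 volume := by
    have : τ.schur.toFun x = (dyadicCube (τ.level x) x).indicator
        fun _ => (cubeDensity n (τ.level x) : ℂ) := by
      ext y
      rw [schur_toFun, τ.ker_eq_indicator hxτ]
      by_cases hy : y ∈ dyadicCube (τ.level x) x <;> simp [hy]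
    rw [this]
    refine memLp_indicator_const _ (measurableSet_dyadicCube _ _) _ (Or.inr ?_)
    rw [volume_dyadicCube]
    exact ENNReal.ofReal_ne_top
  have h := σ.schur.integral_op_mul hb2 hg
  have h0 : ∀ z, σ.schur.op b z = 0 := hb.schur_op σ
  simp only [h0, zero_mul, integral_zero] at h
  rw [SchurKernel.op, h]
  refine integral_congr_ae ?_
  filter_upwards [hb.ae_eq_zero] with y hy
  by_cases hyc : y ∈ σ.carrier
  · rw [mul_comm, σ.integral_schur_mul_of_const (φ := τ.schur.toFun x) hyc]
    intro z hz
    rw [schur_toFun, schur_toFun, τ.ker_eq_indicator hxτ, τ.ker_eq_indicator hxτ]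
    have hmem : z ∈ dyadicCube (τ.level x) x ↔ y ∈ dyadicCube (τ.level x) x := by
      rcases le_or_gt (τ.level x) (σ.level y) with hl | hl
      · have hzy := dyadicCube_subset hl y hz
        rw [mem_dyadicCube_comm, dyadicCube_eq_of_mem hzy, mem_dyadicCube_comm]
      · have hno : ∀ w ∈ dyadicCube (σ.level y) y, w ∉ dyadicCube (τ.level x) x := by
          intro w hw hwx
          refine hx (σ.stable y hyc x ?_).1
          rw [← dyadicCube_eq_of_mem hw]
          exact dyadicCube_subset hl.le w (mem_dyadicCube_comm.1 hwx)
        exact iff_of_false (hno z hz) (hno y (mem_dyadicCube_self _ _))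
    by_cases hy' : y ∈ dyadicCube (τ.level x) x
    · rw [indicator_of_mem hy', indicator_of_mem (hmem.2 hy')]
    · rw [indicator_of_notMem hy', indicator_of_notMem fun h => hy' (hmem.1 h)]
  · rw [hy hyc, mul_zero, zero_mul]

variable {σ} in
lemma IsBad.lintegral_schur_sub {b : L2 n ℂ} (hb : σ.IsBad (b : En n → ℂ)) {τ' : Stopping n}
    (hτ : τ.carrier = univ) (hτ' : τ'.carrier = univ) {R : ℝ} (hR : 0 ≤ R) :
    ∫⁻ x in (σ.star R)ᶜ, ‖(τ.schur.clm - τ'.schur.clm) b x‖ₑ = 0 := by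
  rw [← lintegral_zero (μ := volume.restrict (σ.star R)ᶜ)]
  refine lintegral_congr_ae ?_
  have h1 := ae_restrict_of_ae (s := (σ.star R)ᶜ) (τ.schur.clm_ae b)
  have h2 := ae_restrict_of_ae (s := (σ.star R)ᶜ) (τ'.schur.clm_ae b)
  have h3 := ae_restrict_of_ae (s := (σ.star R)ᶜ) (Lp.coeFn_sub (τ.schur.clm b) (τ'.schur.clm b))
  filter_upwards [h1, h2, h3, ae_restrict_mem (σ.measurableSet_star R).compl] with x h1 h2 h3 hx
  have hx' : x ∉ σ.carrier := fun h => hx (σ.carrier_subset_star hR h)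
  rw [ContinuousLinearMap.sub_apply, h3, Pi.sub_apply, h1, h2,
    hb.schur_op_eq_zero τ (Lp.memLp b) hτ hx', hb.schur_op_eq_zero τ' (Lp.memLp b) hτ' hx']
  simp

section Chain

variable {τ : ℕ → Stopping n}

lemma sum_norm_schur_sub_sq_le (hτ : ∀ i, (τ i).carrier = univ)
    (hmono : ∀ i x, (τ i).level x ≤ (τ (i + 1)).level x) (K : ℕ) (f : L2 n ℂ) :
    ∑ i : Fin K, ‖((τ (i + 1)).schur.clm - (τ i).schur.clm) f‖ ^ 2 ≤ ‖f‖ ^ 2 := by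
  simp_rw [ContinuousLinearMap.sub_apply]
  rw [Fin.sum_univ_eq_sum_range
    (fun i => ‖(τ (i + 1)).schur.clm f - (τ i).schur.clm f‖ ^ 2) K]
  simp_rw [norm_schur_sub_sq (hτ _) (hτ _) (hmono _)]
  rw [Finset.sum_range_sub (fun i => ‖(τ i).schur.clm f‖ ^ 2)]
  have h1 : ‖(τ K).schur.clm‖ ≤ 1 := by
    have h := (τ K).schur.norm_clm_sq_le (τ K).schur.row_le (τ K).schur.col_le
    simpa [schur_bound] using h
  have h2 : ‖(τ K).schur.clm f‖ ≤ ‖f‖ := by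
    simpa using (τ K).schur.clm.le_of_opNorm_le h1 f
  nlinarith [sq_nonneg ‖(τ 0).schur.clm f‖, norm_nonneg ((τ K).schur.clm f), norm_nonneg f]

lemma familyAtomBound_chain (hτ : ∀ i, (τ i).carrier = univ)
    (K : ℕ) {R : ℝ} (hR : 0 ≤ R) :
    FamilyAtomBound (fun i : Fin K => (τ (i + 1)).schur.clm - (τ i).schur.clm) R 1 where
  direct σ b hb := by
    rw [Finset.sum_eq_zero fun i _ => hb.lintegral_schur_sub _ (hτ _) (hτ _) hR]
    exact zero_le
  adjoint σ b w hb _ := by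
    have : ∀ i : Fin K, ContinuousLinearMap.adjoint ((τ (i + 1)).schur.clm - (τ i).schur.clm) =
        (τ (i + 1)).schur.clm - (τ i).schur.clm := by
      intro i
      rw [map_sub, adjoint_schur_clm, adjoint_schur_clm]
    simp_rw [this]
    rw [Finset.sum_eq_zero fun i _ => (hb i).lintegral_schur_sub _ (hτ _) (hτ _) hR]
    exact zero_le

lemma squareLp_chain_le (hτ : ∀ i, (τ i).carrier = univ)
    (hmono : ∀ i x, (τ i).level x ≤ (τ (i + 1)).level x) (hn : 1 ≤ n) (K : ℕ) {R : ℝ} (hR : 0 ≤ R) {f : L2 n ℂ}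
    (hf : Integrable (f : En n → ℂ)) {p : ℝ} (hp : 1 < p) :
    squareLp (fun i : Fin K => (τ (i + 1)).schur.clm - (τ i).schur.clm) f p ≤
      masterConst n R p * eLpNorm f (ENNReal.ofReal p) volume := by
  have h := squareLp_le hn hR (B := 1) (D := 1) (f := f)
    (fun f => by simpa using sum_norm_schur_sub_sq_le hτ hmono K f) one_pos le_rfl
    (familyAtomBound_chain hτ K hR) hf hp
  simpa using h

end Chain

lemma cubeAdapted_condKernel {g : En n → ℂ} (hg : AEStronglyMeasurable g volume) :
    CubeAdapted fun j => (condKernel n j).op g where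
  measurable j := by
    obtain ⟨g', hg', he⟩ := hg
    rw [(condKernel n j).op_congr he]
    refine StronglyMeasurable.measurable ?_
    exact StronglyMeasurable.integral_prod_right
      ((condKernel n j).measurable_toFun.stronglyMeasurable.mul
        (hg'.comp_measurable measurable_snd))
  eq_of_mem j x y hy := by
    simp only [SchurKernel.op, condKernel_congr j hy]

lemma condKernel_op_level (hτ : τ.carrier = univ) (g : En n → ℂ) (x : En n) :
    (condKernel n (τ.level x)).op g x = τ.schur.op g x := by
  simp only [SchurKernel.op]
  refine integral_congr_ae (Eventually.of_forall fun y => ?_)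
  simp only [condKernel_toFun, schur_toFun, τ.ker_eq_indicator (hτ ▸ mem_univ x)]
  by_cases hy : y ∈ dyadicCube (τ.level x) x <;> simp [hy]

end Stopping

/-- The jump inequality for dyadic averages, with the jump function dominated by a measurable
function. -/
theorem exists_dominating_condKernel_jump {n : ℕ} (hn : 1 ≤ n) {R : ℝ} (hR : 0 ≤ R) {g : L2 n ℂ}
    (hg : Integrable (g : En n → ℂ)) {p : ℝ} (hp : 1 < p) {μ : ℝ} (hμ : 0 ≤ μ) (N : ℕ) :
    ∃ S : En n → ℝ≥0∞, AEMeasurable S ∧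
      (∀ᵐ x, ENNReal.ofReal μ ^ (2 : ℝ) *
        jumpCount (2 * μ) (Icc (-N : ℤ) N) (fun j => (condKernel n j).op g x) ≤ S x ^ (2 : ℝ)) ∧
      (∫⁻ x, S x ^ p) ^ (1 / p) ≤ masterConst n R p * eLpNorm g (ENNReal.ofReal p) volume := by
  have hm := Stopping.cubeAdapted_condKernel (Lp.aestronglyMeasurable g)
  set τ : ℕ → Stopping n := fun i => Stopping.iter hm N i (μ := μ) with hτdef
  have hτ : ∀ i, (τ i).carrier = univ := fun i => Stopping.iter_carrier hm N μ i
  have hmono : ∀ i x, (τ i).level x ≤ (τ (i + 1)).level x := fun i x =>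
    Stopping.level_le_next (τ i) hm N x
  set A : Fin (2 * N) → L2 n ℂ →L[ℂ] L2 n ℂ := fun i => (τ (i + 1)).schur.clm - (τ i).schur.clm
  refine ⟨fun x => (∑ i, ‖A i g x‖ₑ ^ (2 : ℝ)) ^ (1 / 2 : ℝ), ?_, ?_, ?_⟩
  · exact (Finset.aemeasurable_fun_sum _ fun i _ =>
      (Lp.aestronglyMeasurable _).enorm.pow_const _).pow_const _
  · have hA : ∀ᵐ x, ∀ i : Fin (2 * N), A i g x = (condKernel n ((τ (i + 1)).level x)).op g x -
        (condKernel n ((τ i).level x)).op g x := by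
      rw [ae_all_iff]
      intro i
      filter_upwards [(τ (i + 1)).schur.clm_ae g, (τ i).schur.clm_ae g,
        Lp.coeFn_sub ((τ (i + 1)).schur.clm g) ((τ i).schur.clm g)] with x h1 h2 h3
      rw [ContinuousLinearMap.sub_apply, h3, Pi.sub_apply, h1, h2,
        (τ (i + 1)).condKernel_op_level (hτ _), (τ i).condKernel_op_level (hτ _)]
    filter_upwards [hA] with x hx
    rw [← ENNReal.rpow_mul]
    norm_num
    simp_rw [hx]
    simpa using Stopping.mul_jumpCount_le_sum_iter hm x hμ N
  · refine le_trans (le_of_eq ?_) (Stopping.squareLp_chain_le hτ hmono hn (2 * N) hR hg hp)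
    rw [squareLp]
    congr 1
    refine lintegral_congr fun x => ?_
    rw [← ENNReal.rpow_mul]
    congr 1
    ring

/-! ### A second derivative test for oscillatory integrals -/

/-- The second derivative test, for amplitudes vanishing at the end points. -/
theorem norm_integral_exp_mul_le {a b : ℝ} (hab : a ≤ b) {φ g g' : ℝ → ℝ} {A A' : ℝ → ℂ}
    (hφ : ∀ r ∈ Icc a b, HasDerivAt φ (g r) r) (hg : ∀ r ∈ Icc a b, HasDerivAt g (g' r) r)
    (hg'c : ContinuousOn g' (Icc a b)) (hA : ∀ r ∈ Icc a b, HasDerivAt A (A' r) r)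
    (hA'c : ContinuousOn A' (Icc a b)) (ha : A a = 0) (hb : A b = 0) {δ S : ℝ} (hδ : 0 < δ)
    (hg' : ∀ r ∈ Icc a b, δ ^ 2 ≤ g' r) (hS : ∀ r ∈ Icc a b, ‖A r‖ ≤ S)
    (hS' : ∀ r ∈ Icc a b, ‖A' r‖ ≤ S) :
    ‖∫ r in a..b, Complex.exp (Complex.I * φ r) * A r‖ ≤ S * (2 * Real.pi + (b - a)) / δ := by
  have huI : uIcc a b = Icc a b := uIcc_of_le hab
  have hS0 : 0 ≤ S := (norm_nonneg _).trans (hS a (left_mem_Icc.2 hab))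
  have hgc : ContinuousOn g (Icc a b) := fun r hr => (hg r hr).continuousAt.continuousWithinAt
  have hφc : ContinuousOn φ (Icc a b) := fun r hr => (hφ r hr).continuousAt.continuousWithinAt
  have hAc : ContinuousOn A (Icc a b) := fun r hr => (hA r hr).continuousAt.continuousWithinAt
  have hpos : ∀ r, 0 < g r ^ 2 + δ ^ 2 := fun r => by positivity
  have hec : ContinuousOn (fun r => Complex.exp (Complex.I * φ r)) (Icc a b) :=
    (continuousOn_const.mul (Complex.continuous_ofReal.comp_continuousOn hφc)).cexp
  have hqc : ContinuousOn (fun r => (g r ^ 2 + δ ^ 2)⁻¹) (Icc a b) :=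
    ((hgc.pow 2).add continuousOn_const).inv₀ fun r _ => (hpos r).ne'
  set h : ℝ → ℝ := fun r => g r * (g r ^ 2 + δ ^ 2)⁻¹ with hh
  set h' : ℝ → ℝ := fun r => g' r * (δ ^ 2 - g r ^ 2) * ((g r ^ 2 + δ ^ 2)⁻¹) ^ 2 with hh'
  have hhd : ∀ r ∈ Icc a b, HasDerivAt h (h' r) r := by
    intro r hr
    have h1 := (hg r hr).fun_mul ((((hg r hr).fun_pow 2).add_const (δ ^ 2)).fun_inv (hpos r).ne')
    refine h1.congr_deriv ?_
    have := (hpos r).ne'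
    simp only [hh']
    field_simp
    ring
  have hhc : ContinuousOn h (Icc a b) := hgc.mul hqc
  have hh'c : ContinuousOn h' (Icc a b) :=
    (hg'c.mul (continuousOn_const.sub (hgc.pow 2))).mul (hqc.pow 2)
  set Q : ℝ → ℂ := fun r => Complex.exp (Complex.I * φ r) *
    ((δ ^ 2 * (g r ^ 2 + δ ^ 2)⁻¹ : ℝ) * A r + Complex.I * (h' r * A r + h r * A' r)) with hQ
  have hQc : ContinuousOn Q (Icc a b) := by
    refine hec.mul (ContinuousOn.add ?_ (continuousOn_const.mul (ContinuousOn.add ?_ ?_)))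
    · exact (Complex.continuous_ofReal.comp_continuousOn (continuousOn_const.mul hqc)).mul hAc
    · exact (Complex.continuous_ofReal.comp_continuousOn hh'c).mul hAc
    · exact (Complex.continuous_ofReal.comp_continuousOn hhc).mul hA'c
  have hprim : ∀ r ∈ Icc a b, HasDerivAt (fun r => Complex.exp (Complex.I * φ r) *
      (-Complex.I * (h r * A r))) (Complex.exp (Complex.I * φ r) * A r - Q r) r := by
    intro r hr
    have h1 : HasDerivAt (fun r => Complex.exp (Complex.I * φ r))
        (Complex.exp (Complex.I * φ r) * (Complex.I * g r)) r :=
      (((hφ r hr).ofReal_comp).const_mul Complex.I).cexp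
    have h2 := h1.fun_mul ((((hhd r hr).ofReal_comp).fun_mul (hA r hr)).const_mul (-Complex.I))
    refine h2.congr_deriv ?_
    have e : (g r : ℂ) * h r = 1 - (δ ^ 2 * (g r ^ 2 + δ ^ 2)⁻¹ : ℝ) := by
      rw [← Complex.ofReal_mul, ← Complex.ofReal_one, ← Complex.ofReal_sub]
      congr 1
      have := (hpos r).ne'
      simp only [hh]
      field_simp
      ring
    simp only [hQ]
    linear_combination (-Complex.exp (Complex.I * φ r) * A r * Complex.I * Complex.I) * e +
      (-Complex.exp (Complex.I * φ r) * A r * (1 - (δ ^ 2 * (g r ^ 2 + δ ^ 2)⁻¹ : ℝ))) *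
        Complex.I_mul_I
  have hftc : ∫ r in a..b, Complex.exp (Complex.I * φ r) * A r = ∫ r in a..b, Q r := by
    have h1 := intervalIntegral.integral_eq_sub_of_hasDerivAt
      (fun r hr => hprim r (huI ▸ hr)) (((hec.mul hAc).sub hQc).intervalIntegrable_of_Icc hab)
    rw [ha, hb] at h1
    simp only [mul_zero, sub_zero] at h1
    refine sub_eq_zero.1 ((intervalIntegral.integral_sub ?_ ?_).symm.trans h1)
    · exact (hec.mul hAc).intervalIntegrable_of_Icc hab
    · exact hQc.intervalIntegrable_of_Icc hab
  have harc : ∀ r ∈ Icc a b, HasDerivAt (fun r => 2 * S / δ * Real.arctan (g r / δ) + S / δ * r)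
      (2 * S * g' r * (g r ^ 2 + δ ^ 2)⁻¹ + S / δ) r := by
    intro r hr
    have h1 := ((((hg r hr).div_const δ).arctan).const_mul (2 * S / δ)).add
      ((hasDerivAt_id r).const_mul (S / δ))
    refine h1.congr_deriv ?_
    have := (hpos r).ne'
    have h2 : (1 + (g r / δ) ^ 2) ≠ 0 := by positivity
    have h3 : 1 / (1 + (g r / δ) ^ 2) = δ ^ 2 * (g r ^ 2 + δ ^ 2)⁻¹ := by
      field_simp
      ring
    rw [h3]
    field_simp
  have hGc : ContinuousOn (fun r => 2 * S * g' r * (g r ^ 2 + δ ^ 2)⁻¹ + S / δ) (Icc a b) :=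
    ((continuousOn_const.mul hg'c).mul hqc).add continuousOn_const
  have hbound : ∀ r ∈ Icc a b, ‖Q r‖ ≤ 2 * S * g' r * (g r ^ 2 + δ ^ 2)⁻¹ + S / δ := by
    intro r hr
    have hq : 0 < (g r ^ 2 + δ ^ 2)⁻¹ := inv_pos.2 (hpos r)
    have hg0 : 0 ≤ g' r := (sq_nonneg δ).trans (hg' r hr)
    have b1 : ‖((δ ^ 2 * (g r ^ 2 + δ ^ 2)⁻¹ : ℝ) : ℂ) * A r‖ ≤
        g' r * (g r ^ 2 + δ ^ 2)⁻¹ * S := by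
      rw [norm_mul, Complex.norm_real, Real.norm_of_nonneg (by positivity)]
      gcongr
      · exact hg' r hr
      · exact hS r hr
    have b2 : ‖(h' r : ℂ) * A r‖ ≤ g' r * (g r ^ 2 + δ ^ 2)⁻¹ * S := by
      rw [norm_mul, Complex.norm_real, Real.norm_eq_abs]
      refine mul_le_mul ?_ (hS r hr) (norm_nonneg _) (by positivity)
      simp only [hh']
      rw [abs_mul, abs_mul, abs_of_nonneg hg0, abs_of_nonneg (sq_nonneg (g r ^ 2 + δ ^ 2)⁻¹)]
      have h1 : |δ ^ 2 - g r ^ 2| ≤ g r ^ 2 + δ ^ 2 := by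
        rw [abs_le]; constructor <;> nlinarith [sq_nonneg (g r), sq_nonneg δ]
      calc g' r * |δ ^ 2 - g r ^ 2| * (g r ^ 2 + δ ^ 2)⁻¹ ^ 2
          ≤ g' r * (g r ^ 2 + δ ^ 2) * (g r ^ 2 + δ ^ 2)⁻¹ ^ 2 := by gcongr
        _ = _ := by field_simp
    have b3 : ‖(h r : ℂ) * A' r‖ ≤ S / δ := by
      rw [norm_mul, Complex.norm_real, Real.norm_eq_abs, div_eq_inv_mul]
      refine mul_le_mul ?_ (hS' r hr) (norm_nonneg _) (by positivity)
      simp only [hh]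
      rw [abs_mul, abs_of_pos hq, ← div_eq_mul_inv, div_le_iff₀ (hpos r), ← sq_abs (g r)]
      have : δ⁻¹ * (|g r| ^ 2 + δ ^ 2) = |g r| + δ⁻¹ * ((|g r| - δ) ^ 2 + |g r| * δ) := by
        field_simp
        ring
      rw [this]
      have : 0 ≤ δ⁻¹ * ((|g r| - δ) ^ 2 + |g r| * δ) := by positivity
      linarith
    simp only [hQ]
    rw [norm_mul, mul_comm Complex.I, Complex.norm_exp_ofReal_mul_I, one_mul]
    refine (norm_add_le _ _).trans ?_
    rw [norm_mul Complex.I, Complex.norm_I, one_mul]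
    have := norm_add_le ((h' r : ℂ) * A r) (h r * A' r)
    linarith
  rw [hftc]
  refine (intervalIntegral.norm_integral_le_of_norm_le hab
    (Eventually.of_forall fun r hr => hbound r ⟨hr.1.le, hr.2⟩)
    (hGc.intervalIntegrable_of_Icc hab)).trans ?_
  rw [intervalIntegral.integral_eq_sub_of_hasDerivAt (fun r hr => harc r (huI ▸ hr))
    (hGc.intervalIntegrable_of_Icc hab)]
  have p1 := Real.arctan_lt_pi_div_two (g b / δ)
  have p2 := Real.neg_pi_div_two_lt_arctan (g a / δ)
  have : 2 * S / δ * (Real.arctan (g b / δ) - Real.arctan (g a / δ)) ≤ 2 * S / δ * Real.pi := by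
    gcongr
    linarith
  calc _ = 2 * S / δ * (Real.arctan (g b / δ) - Real.arctan (g a / δ)) + S / δ * (b - a) := by ring
    _ ≤ 2 * S / δ * Real.pi + S / δ * (b - a) := by gcongr
    _ = _ := by ring

/-- The constant in the lower bound for the second derivative of `r ^ α` on `[1/2, 2]`. -/
def phaseConst (α : ℝ) : ℝ := α * (α - 1) * 2 ^ (-|α - 2|)

lemma phaseConst_pos {α : ℝ} (hα : 1 < α) : 0 < phaseConst α := by
  unfold phaseConst
  have : 0 < α - 1 := by linarith
  positivity

lemma two_rpow_neg_abs_le {r β : ℝ} (h1 : 1 / 2 ≤ r) (h2 : r ≤ 2) : (2 : ℝ) ^ (-|β|) ≤ r ^ β := by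
  have hr : 0 < r := by linarith
  have hl : |Real.log r| ≤ Real.log 2 := by
    rw [abs_le]
    constructor
    · rw [← Real.log_inv]
      exact Real.log_le_log (by norm_num) (by linarith)
    · exact Real.log_le_log hr h2
  rw [Real.rpow_def_of_pos hr, Real.rpow_def_of_pos two_pos]
  refine Real.exp_le_exp.2 ?_
  have h3 := neg_abs_le (Real.log r * β)
  rw [abs_mul] at h3
  have := mul_le_mul_of_nonneg_right hl (abs_nonneg β)
  linarith

theorem norm_integral_phase_le {α : ℝ} (hα : 1 < α) {A A' : ℝ → ℂ}
    (hA : ∀ r ∈ Icc (1 / 2 : ℝ) 2, HasDerivAt A (A' r) r)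
    (hA'c : ContinuousOn A' (Icc (1 / 2) 2)) (ha : A (1 / 2) = 0) (hb : A 2 = 0) {S : ℝ}
    (hS : ∀ r ∈ Icc (1 / 2 : ℝ) 2, ‖A r‖ ≤ S) (hS' : ∀ r ∈ Icc (1 / 2 : ℝ) 2, ‖A' r‖ ≤ S)
    {u : ℝ} (hu : 0 < u) (b : ℝ) :
    ‖∫ r in (1 / 2 : ℝ)..2, Complex.exp (Complex.I * ((u * r ^ α - b * r : ℝ) : ℂ)) * A r‖ ≤
      S * (2 * Real.pi + (2 - 1 / 2)) / √(u * phaseConst α) := by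
  have hpos : ∀ r ∈ Icc (1 / 2 : ℝ) 2, r ≠ 0 := fun r hr => by
    have := hr.1; positivity
  refine norm_integral_exp_mul_le (by norm_num) (g := fun r => u * (α * r ^ (α - 1)) - b)
    (g' := fun r => u * (α * ((α - 1) * r ^ (α - 2)))) (fun r hr => ?_) (fun r hr => ?_)
    ?_ hA hA'c ha hb (Real.sqrt_pos.2 (mul_pos hu (phaseConst_pos hα))) (fun r hr => ?_) hS hS'
  · have h1 := ((Real.hasDerivAt_rpow_const (p := α) (Or.inl (hpos r hr))).const_mul u).fun_sub
      ((hasDerivAt_id' r).const_mul b)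
    simpa using h1
  · have h1 := (((Real.hasDerivAt_rpow_const (p := α - 1)
      (Or.inl (hpos r hr))).const_mul α).const_mul u).sub_const b
    rw [show α - 1 - 1 = α - 2 by ring] at h1
    exact h1
  · refine continuousOn_const.mul (continuousOn_const.mul (continuousOn_const.mul ?_))
    exact fun r hr => (Real.continuousAt_rpow_const _ _ (Or.inl (hpos r hr))).continuousWithinAt
  · rw [Real.sq_sqrt (mul_pos hu (phaseConst_pos hα)).le, phaseConst]
    have : 0 < α - 1 := by linarith
    rw [← mul_assoc α]
    gcongr
    exact two_rpow_neg_abs_le hr.1 hr.2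

/-! ### Polar coordinates -/

section Polar

variable {n : ℕ}

lemma integral_polar (hn : 1 ≤ n) {F : En n → ℂ} (hF : Integrable F) :
    ∫ t, F t = ∫ θ : sphere (0 : En n) 1, (∫ r in Ioi (0 : ℝ),
      ((r ^ (n - 1) : ℝ) : ℂ) * F (r • (θ : En n))) ∂(volume : Measure (En n)).toSphere := by
  have : Nontrivial (En n) := by
    have : Nonempty (Fin n) := ⟨⟨0, hn⟩⟩
    infer_instance
  have hdim : Module.finrank ℝ (En n) = n := by simp
  have hmp := (volume : Measure (En n)).measurePreserving_homeomorphUnitSphereProd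
  rw [hdim] at hmp
  set G : sphere (0 : En n) 1 × Ioi (0 : ℝ) → ℂ := fun q => F ((q.2 : ℝ) • (q.1 : En n)) with hG
  have hcomp : ∀ x : ({0}ᶜ : Set (En n)), G (homeomorphUnitSphereProd (En n) x) = F x := by
    intro x
    have h := congrArg (Subtype.val) ((homeomorphUnitSphereProd (En n)).symm_apply_apply x)
    rw [homeomorphUnitSphereProd_symm_apply_coe] at h
    rw [hG]
    exact congrArg F h
  have hsub : ∫ t, F t = ∫ x : ({0}ᶜ : Set (En n)), F (x : En n)
      ∂((volume : Measure (En n)).comap Subtype.val) := by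
    rw [integral_subtype_comap (measurableSet_singleton _).compl, restrict_compl_singleton]
  have hInt : Integrable G ((volume : Measure (En n)).toSphere.prod
      (Measure.volumeIoiPow (n - 1))) := by
    rw [← hmp.integrable_comp_emb (Homeomorph.measurableEmbedding _)]
    have : G ∘ homeomorphUnitSphereProd (En n) = F ∘ (↑) := funext hcomp
    rw [this, ← integrableOn_iff_comap_subtypeVal (measurableSet_singleton _).compl]
    exact hF.integrableOn
  rw [hsub]
  have h1 := hmp.integral_comp (Homeomorph.measurableEmbedding _) G
  simp_rw [hcomp] at h1
  rw [h1, integral_prod _ hInt]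
  refine integral_congr_ae (Eventually.of_forall fun θ => ?_)
  simp only [Measure.volumeIoiPow, ENNReal.ofReal]
  rw [integral_withDensity_eq_integral_smul,
    integral_subtype_comap measurableSet_Ioi fun a : ℝ =>
      Real.toNNReal (a ^ (n - 1)) • F (a • (θ : En n))]
  · refine setIntegral_congr_fun measurableSet_Ioi fun x hx => ?_
    rw [NNReal.smul_def, Real.coe_toNNReal _ (pow_nonneg hx.out.le _), Complex.real_smul]
  · exact (measurable_subtype_coe.pow_const _).real_toNNReal

/-- The hypotheses on the angular part of the kernel. -/
structure IsAngular (Ω : En n → ℝ) : Prop where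
  contDiffOn : ContDiffOn ℝ (⊤ : ℕ∞) Ω {x : En n | x ≠ 0}
  homogeneous : ∀ c : ℝ, 0 < c → ∀ x : En n, Ω (c • x) = Ω x
  integral_eq_zero : ∫ x : sphere (0 : En n) 1, Ω x ∂((volume : Measure (En n)).toSphere) = 0

variable {Ω : En n → ℝ}

lemma pow_mul_czKernel_smul (hn : 1 ≤ n) (hΩ : IsAngular Ω) {r : ℝ} (hr : 0 < r)
    (θ : sphere (0 : En n) 1) :
    r ^ (n - 1) * czKernel n Ω (r • (θ : En n)) = r⁻¹ * Ω θ := by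
  have hθ : ‖(θ : En n)‖ = 1 := mem_sphere_zero_iff_norm.1 θ.2
  obtain ⟨m, rfl⟩ := Nat.exists_eq_add_of_le hn
  rw [czKernel, hΩ.homogeneous r hr, norm_smul, hθ, Real.norm_of_nonneg hr.le]
  simp only [Nat.add_sub_cancel_left, mul_one]
  field_simp
  ring

lemma integral_radial_mul_czKernel (hn : 1 ≤ n) (hΩ : IsAngular Ω) {G : En n → ℝ → ℂ}
    (hG : Integrable fun t : En n => G (‖t‖⁻¹ • t) ‖t‖ * (czKernel n Ω t : ℂ)) :
    ∫ t : En n, G (‖t‖⁻¹ • t) ‖t‖ * (czKernel n Ω t : ℂ) = ∫ θ : sphere (0 : En n) 1,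
      (Ω θ : ℂ) * (∫ r in Ioi (0 : ℝ), G θ r * (r⁻¹ : ℝ)) ∂(volume : Measure (En n)).toSphere := by
  rw [integral_polar hn hG]
  refine integral_congr_ae (Eventually.of_forall fun θ => ?_)
  simp only
  rw [← integral_const_mul]
  refine setIntegral_congr_fun measurableSet_Ioi fun r hr => ?_
  have hr' : (0 : ℝ) < r := hr
  have hθ : ‖(θ : En n)‖ = 1 := mem_sphere_zero_iff_norm.1 θ.2
  have hnr : ‖r • (θ : En n)‖ = r := by rw [norm_smul, hθ, mul_one, Real.norm_of_nonneg hr'.le]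
  rw [hnr, inv_smul_smul₀ hr'.ne']
  have h := congrArg (fun x : ℝ => (x : ℂ)) (pow_mul_czKernel_smul hn hΩ hr' θ)
  simp only [Complex.ofReal_mul] at h
  linear_combination (G θ r) * h

lemma integral_radial_mul_czKernel_eq_zero (hn : 1 ≤ n) (hΩ : IsAngular Ω) {G : ℝ → ℂ}
    (hG : Integrable fun t : En n => G ‖t‖ * (czKernel n Ω t : ℂ)) :
    ∫ t : En n, G ‖t‖ * (czKernel n Ω t : ℂ) = 0 := by
  rw [integral_radial_mul_czKernel hn hΩ (G := fun _ => G) hG, integral_mul_const,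
    integral_complex_ofReal, hΩ.integral_eq_zero]
  simp

lemma IsAngular.exists_bound (hΩ : IsAngular Ω) : ∃ W : ℝ, 0 ≤ W ∧ ∀ x, x ≠ 0 → |Ω x| ≤ W := by
  have hc : ContinuousOn Ω (sphere (0 : En n) 1) :=
    hΩ.contDiffOn.continuousOn.mono fun x hx => by
      have := mem_sphere_zero_iff_norm.1 hx
      rintro rfl
      simp at this
  obtain ⟨W, hW⟩ := (isCompact_sphere (0 : En n) 1).exists_bound_of_continuousOn hc
  refine ⟨max W 0, le_max_right _ _, fun x hx => ?_⟩
  have hx' : 0 < ‖x‖ := norm_pos_iff.2 hx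
  rw [← hΩ.homogeneous ‖x‖⁻¹ (inv_pos.2 hx') x]
  refine le_trans (hW _ ?_) (le_max_left _ _)
  rw [mem_sphere_zero_iff_norm, norm_smul, norm_inv, norm_norm, inv_mul_cancel₀ hx'.ne']

end Polar

/-! ### The truncated kernels -/

section Truncation

/-- A smooth cutoff, equal to `1` on `(-∞, 1]` and to `0` on `[2, ∞)`. -/
def cutoff (r : ℝ) : ℝ := Real.smoothTransition (2 - r)

lemma cutoff_of_le {r : ℝ} (h : r ≤ 1) : cutoff r = 1 :=
  Real.smoothTransition.one_of_one_le (by linarith)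

lemma cutoff_of_ge {r : ℝ} (h : 2 ≤ r) : cutoff r = 0 :=
  Real.smoothTransition.zero_of_nonpos (by linarith)

lemma cutoff_nonneg (r : ℝ) : 0 ≤ cutoff r := Real.smoothTransition.nonneg _

lemma cutoff_le_one (r : ℝ) : cutoff r ≤ 1 := Real.smoothTransition.le_one _

lemma contDiff_cutoff : ContDiff ℝ (⊤ : ℕ∞) cutoff :=
  Real.smoothTransition.contDiff.comp (contDiff_const.sub contDiff_id)

/-- A smooth function supported in `[1/2, 2]`, whose dyadic dilates sum to `1`. -/
def bump (r : ℝ) : ℝ := cutoff r - cutoff (2 * r)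

lemma bump_of_le {r : ℝ} (h : r ≤ 1 / 2) : bump r = 0 := by
  rw [bump, cutoff_of_le (by linarith), cutoff_of_le (by linarith), sub_self]

lemma bump_of_ge {r : ℝ} (h : 2 ≤ r) : bump r = 0 := by
  rw [bump, cutoff_of_ge h, cutoff_of_ge (by linarith), sub_self]

lemma contDiff_bump : ContDiff ℝ (⊤ : ℕ∞) bump :=
  contDiff_cutoff.sub (contDiff_cutoff.comp (contDiff_const.mul contDiff_id))

lemma sum_bump (L : ℕ) (r : ℝ) : ∑ i ∈ Finset.Icc (-L : ℤ) L, bump (2 ^ i * r) =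
    cutoff ((2 ^ L)⁻¹ * r) - cutoff (2 ^ (L + 1) * r) := by
  have key (m : ℕ) : ∀ a : ℤ, ∑ i ∈ Finset.Ico a (a + m), bump ((2 : ℝ) ^ i * r) =
      cutoff (2 ^ a * r) - cutoff (2 ^ (a + m) * r) := by
    induction m with
    | zero => intro a; simp
    | succ m ih =>
      intro a
      have h1 : Finset.Ico a (a + (m + 1 : ℕ)) =
          insert (a + (m : ℤ)) (Finset.Ico a (a + (m : ℤ))) := by
        ext x; simp only [Finset.mem_Ico, Finset.mem_insert]; push_cast; omega
      rw [h1, Finset.sum_insert (by simp), ih, bump]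
      have h2 : (2 : ℝ) ^ (a + ((m + 1 : ℕ) : ℤ)) * r = 2 * (2 ^ (a + (m : ℤ)) * r) := by
        push_cast
        rw [← add_assoc, zpow_add_one₀ (by norm_num)]
        ring
      rw [h2]
      ring
  have h3 : Finset.Icc (-L : ℤ) L = Finset.Ico (-L : ℤ) (-L + (2 * L + 1 : ℕ)) := by
    ext x; simp only [Finset.mem_Icc, Finset.mem_Ico]; push_cast; omega
  rw [h3, key, zpow_neg, zpow_natCast]
  congr 3
  rw [← zpow_natCast]
  congr 1
  push_cast
  ring

variable {n : ℕ} (Ω : En n → ℝ)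

/-- The kernel truncated to an annulus and multiplied by a radial function. -/
def ringKernel (w : ℝ → ℂ) (t : En n) : ℂ := w ‖t‖ * ((bump ‖t‖ * czKernel n Ω t : ℝ) : ℂ)

lemma ringKernel_of_ge (w : ℝ → ℂ) {t : En n} (h : 2 ≤ ‖t‖) : ringKernel Ω w t = 0 := by
  rw [ringKernel, bump_of_ge h]; simp

lemma ringKernel_of_le (w : ℝ → ℂ) {t : En n} (h : ‖t‖ ≤ 1 / 2) : ringKernel Ω w t = 0 := by
  rw [ringKernel, bump_of_le h]; simp

lemma ringKernel_eq (w : ℝ → ℂ) (t : En n) :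
    ringKernel Ω w t = w ‖t‖ * ringKernel Ω (fun _ => 1) t := by
  simp [ringKernel]

lemma hasCompactSupport_ringKernel (w : ℝ → ℂ) : HasCompactSupport (ringKernel Ω w) :=
  HasCompactSupport.of_support_subset_isCompact (isCompact_closedBall (0 : En n) 2) fun t ht => by
    rw [mem_closedBall_zero_iff]
    by_contra h
    exact ht (ringKernel_of_ge Ω w (not_le.1 h).le)

variable {Ω}

lemma contDiff_ringKernel (hΩ : IsAngular Ω) {w : ℝ → ℂ}
    (hw : ContDiffOn ℝ (⊤ : ℕ∞) w (Ioi 0)) : ContDiff ℝ (⊤ : ℕ∞) (ringKernel Ω w) := by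
  rw [contDiff_iff_contDiffAt]
  intro t
  rcases lt_or_ge ‖t‖ (1 / 2) with h | h
  · have : ringKernel Ω w =ᶠ[𝓝 t] fun _ => 0 := by
      filter_upwards [(continuous_norm.isOpen_preimage _ isOpen_Iio).mem_nhds h] with s hs
      exact ringKernel_of_le Ω w (le_of_lt hs)
    exact contDiffAt_const.congr_of_eventuallyEq this
  · have ht : t ≠ 0 := by
      rintro rfl; norm_num at h
    have h1 : ContDiffAt ℝ (⊤ : ℕ∞) (fun t : En n => ‖t‖) t := contDiffAt_norm ℝ ht
    have h2 : ContDiffAt ℝ (⊤ : ℕ∞) Ω t :=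
      hΩ.contDiffOn.contDiffAt (isOpen_ne.mem_nhds ht)
    have h3 : ContDiffAt ℝ (⊤ : ℕ∞) w ‖t‖ :=
      hw.contDiffAt (Ioi_mem_nhds (norm_pos_iff.2 ht))
    refine (h3.comp t h1).mul ?_
    refine Complex.ofRealCLM.contDiff.contDiffAt.comp t ?_
    refine (contDiff_bump.contDiffAt.comp t h1).mul (h2.div (h1.pow n) ?_)
    exact pow_ne_zero _ (norm_ne_zero_iff.2 ht)

end Truncation

/-! ### Profiles from truncated kernels -/

section RingProfile

variable {n : ℕ}

/-- The volume of the ball supporting a profile. -/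
def profileVolume (n : ℕ) : ℝ≥0 := (volume (closedBall (0 : En n) 2)).toNNReal

lemma coe_profileVolume : (profileVolume n : ℝ≥0∞) = volume (closedBall (0 : En n) 2) :=
  ENNReal.coe_toNNReal measure_closedBall_lt_top.ne

lemma isProfile_of_lipschitz {k : En n → ℂ} {Λ M : ℝ≥0} (h0 : ∀ t, 2 < ‖t‖ → k t = 0)
    (hb : ∀ t, ‖k t‖ₑ ≤ Λ) (hL : LipschitzWith M k) (hz : ∫ t, k t = 0) :
    IsProfile k (Λ * profileVolume n) (2 * M * profileVolume n) where
  continuous := hL.continuous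
  eq_zero := h0
  integral_eq_zero := hz
  lintegral_le := by
    have h : ∀ t, ‖k t‖ₑ ≤ (closedBall (0 : En n) 2).indicator (fun _ => (Λ : ℝ≥0∞)) t := by
      intro t
      by_cases ht : t ∈ closedBall (0 : En n) 2
      · rw [indicator_of_mem ht]; exact hb t
      · rw [h0 t (by simpa using ht)]; simp
    refine (lintegral_mono h).trans ?_
    rw [lintegral_indicator_const measurableSet_closedBall, ENNReal.coe_mul, coe_profileVolume]
  modulus h := by
    set S : Set (En n) := closedBall (0 : En n) 2
    set c : ℝ≥0∞ := M * ‖h‖ₑ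
    have hle : ∀ t, ‖k (t + h) - k t‖ₑ ≤
        S.indicator (fun _ => c) t + S.indicator (fun _ => c) (t + h) := by
      intro t
      have h1 : ‖k (t + h) - k t‖ₑ ≤ c := by
        have := hL (t + h) t
        rwa [edist_eq_enorm_sub, edist_eq_enorm_sub, add_sub_cancel_left] at this
      by_cases ht : t ∈ S
      · rw [indicator_of_mem ht]; exact h1.trans le_self_add
      by_cases ht' : t + h ∈ S
      · rw [indicator_of_mem ht']; exact h1.trans le_add_self
      · rw [h0 t (by simpa [S] using ht), h0 (t + h) (by simpa [S] using ht')]; simp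
    refine (lintegral_mono hle).trans ?_
    rw [lintegral_add_left (measurable_const.indicator measurableSet_closedBall),
      lintegral_add_right_eq_self (fun t => S.indicator (fun _ => c) t) h,
      lintegral_indicator_const measurableSet_closedBall, ← coe_profileVolume]
    push_cast
    apply le_of_eq
    ring

lemma IsProfile.mono {k : En n → ℂ} {a b c d : ℝ≥0} (hk : IsProfile k a b) (hac : a ≤ c)
    (hbd : b ≤ d) : IsProfile k c d :=
  ⟨hk.continuous, hk.eq_zero, hk.lintegral_le.trans (ENNReal.coe_le_coe.2 hac),
    fun v => (hk.modulus v).trans (by gcongr), hk.integral_eq_zero⟩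

variable {Ω : En n → ℝ}

lemma exists_isProfile_ringKernel (hn : 1 ≤ n) (hΩ : IsAngular Ω) : ∃ P : ℝ≥0, 0 < P ∧
    ∀ (w : ℝ → ℂ) (a b : ℝ≥0), (∀ r ∈ Icc (0 : ℝ) 2, ‖w r‖ ≤ a) →
      (∀ r ∈ Icc (0 : ℝ) 2, ∀ r' ∈ Icc (0 : ℝ) 2, ‖w r - w r'‖ ≤ b * |r - r'|) →
      IsProfile (ringKernel Ω w) (a * P) ((a + b) * P) := by
  set k := ringKernel Ω fun _ => 1
  have hsm : ContDiff ℝ (⊤ : ℕ∞) k := contDiff_ringKernel hΩ contDiffOn_const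
  have hcs : HasCompactSupport k := hasCompactSupport_ringKernel Ω _
  obtain ⟨B₁, hB₁⟩ := hcs.exists_bound_of_continuous hsm.continuous
  obtain ⟨B₂, hB₂⟩ := hsm.lipschitzWith_of_hasCompactSupport hcs (by simp)
  set B : ℝ≥0 := B₁.toNNReal + B₂ + 1
  have hB : ∀ t, ‖k t‖ ≤ B := fun t => (hB₁ t).trans <| (Real.le_coe_toNNReal _).trans <| by
    simp only [B, NNReal.coe_add, NNReal.coe_one]
    linarith [B₂.coe_nonneg]
  have hBL : ∀ s t, ‖k s - k t‖ ≤ B * ‖s - t‖ := fun s t => by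
    have h := hB₂.dist_le_mul s t
    rw [dist_eq_norm, dist_eq_norm] at h
    refine h.trans (mul_le_mul_of_nonneg_right ?_ (norm_nonneg _))
    simp only [B, NNReal.coe_add, NNReal.coe_one]
    linarith [(B₁.toNNReal).coe_nonneg]
  set V := profileVolume n
  refine ⟨2 * B * (V + 1), by positivity, fun w a b ha hb => ?_⟩
  have h0 : ∀ t : En n, 2 < ‖t‖ → ringKernel Ω w t = 0 := fun t ht => ringKernel_of_ge Ω w ht.le
  have hbd : ∀ t, ‖ringKernel Ω w t‖ ≤ a * B := fun t => by
    rcases lt_or_ge 2 ‖t‖ with ht | ht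
    · rw [h0 t ht, norm_zero]; positivity
    · rw [ringKernel_eq, norm_mul]
      exact mul_le_mul (ha _ ⟨norm_nonneg _, ht⟩) (hB t) (norm_nonneg _) a.coe_nonneg
  have hone : ∀ s t : En n, ‖s‖ ≤ 2 → ‖ringKernel Ω w s - ringKernel Ω w t‖ ≤
      ((a + b) * B : ℝ≥0) * ‖s - t‖ := fun s t hs => by
    rw [ringKernel_eq, ringKernel_eq (t := t)]
    have hws := ha _ ⟨norm_nonneg s, hs⟩
    have hst : ‖w ‖s‖ * (k s - k t)‖ ≤ a * (B * ‖s - t‖) := by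
      rw [norm_mul]
      exact mul_le_mul hws (hBL s t) (norm_nonneg _) a.coe_nonneg
    rcases lt_or_ge 2 ‖t‖ with ht | ht
    · have hkt : k t = 0 := ringKernel_of_ge Ω _ ht.le
      change ‖w ‖s‖ * k s - w ‖t‖ * k t‖ ≤ _
      rw [hkt, sub_zero] at hst
      rw [hkt, mul_zero, sub_zero]
      refine hst.trans ?_
      push_cast
      have : 0 ≤ (b : ℝ) * B * ‖s - t‖ := by positivity
      linarith
    · have h1 : w ‖s‖ * k s - w ‖t‖ * k t = w ‖s‖ * (k s - k t) + (w ‖s‖ - w ‖t‖) * k t := by ring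
      change ‖w ‖s‖ * k s - w ‖t‖ * k t‖ ≤ _
      rw [h1]
      refine (norm_add_le _ _).trans ?_
      have h2 : ‖(w ‖s‖ - w ‖t‖) * k t‖ ≤ b * ‖s - t‖ * B := by
        rw [norm_mul]
        refine mul_le_mul ((hb _ ⟨norm_nonneg s, hs⟩ _ ⟨norm_nonneg t, ht⟩).trans ?_) (hB t)
          (norm_nonneg _) (by positivity)
        exact mul_le_mul_of_nonneg_left (abs_norm_sub_norm_le s t) b.coe_nonneg
      push_cast
      linarith
  have hlip : LipschitzWith ((a + b) * B) (ringKernel Ω w) := LipschitzWith.of_dist_le_mul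
    fun s t => by
      rw [dist_eq_norm, dist_eq_norm]
      rcases le_or_gt ‖s‖ 2 with hs | hs
      · exact hone s t hs
      rcases le_or_gt ‖t‖ 2 with ht | ht
      · rw [norm_sub_rev, norm_sub_rev s]; exact hone t s ht
      · rw [h0 s hs, h0 t ht, sub_zero, norm_zero]; positivity
  have hform : ringKernel Ω w = fun t => (w ‖t‖ * bump ‖t‖) * (czKernel n Ω t : ℂ) := by
    funext t; simp only [ringKernel]; push_cast; ring
  have hz : ∫ t, ringKernel Ω w t = 0 := by
    have hInt : Integrable (ringKernel Ω w) :=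
      hlip.continuous.integrable_of_hasCompactSupport (hasCompactSupport_ringKernel Ω w)
    rw [hform] at hInt ⊢
    exact integral_radial_mul_czKernel_eq_zero hn hΩ (G := fun r => w r * bump r) hInt
  have hp := isProfile_of_lipschitz h0 (Λ := a * B) (fun t => by
    rw [← ofReal_norm, ← ENNReal.ofReal_coe_nnreal]
    exact ENNReal.ofReal_le_ofReal (by exact_mod_cast hbd t)) hlip hz
  have hV : V ≤ V + 1 := le_self_add
  refine ⟨hp.continuous, hp.eq_zero, hp.lintegral_le.trans ?_, fun h => (hp.modulus h).trans ?_, hz⟩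
  · refine ENNReal.coe_le_coe.2 ?_
    calc a * B * V ≤ a * (2 * B) * (V + 1) := by
          gcongr
          exact le_mul_of_one_le_left zero_le one_le_two
      _ = _ := by ring
  · refine mul_le_mul_left (ENNReal.coe_le_coe.2 ?_) _
    calc 2 * ((a + b) * B) * V ≤ 2 * ((a + b) * B) * (V + 1) := by gcongr
      _ = (a + b) * (2 * B * (V + 1)) := by ring

lemma abs_rpow_sub_rpow_le {α : ℝ} (hα : 1 < α) {r r' : ℝ} (hr : r ∈ Icc (0 : ℝ) 2)
    (hr' : r' ∈ Icc (0 : ℝ) 2) : |r ^ α - r' ^ α| ≤ α * 2 ^ (α - 1) * |r - r'| := by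
  have h := Convex.norm_image_sub_le_of_norm_hasDerivWithin_le (f := fun r : ℝ => r ^ α)
    (f' := fun r => α * r ^ (α - 1)) (s := Icc (0 : ℝ) 2) (C := α * 2 ^ (α - 1))
    (fun x _ => (Real.hasDerivAt_rpow_const (Or.inr hα.le)).hasDerivWithinAt)
    (fun x hx => by
      rw [Real.norm_of_nonneg (mul_nonneg (by linarith) (Real.rpow_nonneg hx.1 _))]
      exact mul_le_mul_of_nonneg_left (Real.rpow_le_rpow hx.1 hx.2 (by linarith)) (by linarith))
    (convex_Icc 0 2) hr' hr
  simpa [Real.norm_eq_abs] using h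

/-- The radial oscillating factor. -/
def osc (α u r : ℝ) : ℂ := Complex.exp (Complex.I * ((u * r ^ α : ℝ) : ℂ))

lemma norm_osc (α u r : ℝ) : ‖osc α u r‖ = 1 := by
  rw [osc, mul_comm, Complex.norm_exp_ofReal_mul_I]

lemma norm_osc_sub_osc_le {α u : ℝ} (hu : 0 ≤ u) (r r' : ℝ) :
    ‖osc α u r - osc α u r'‖ ≤ u * |r ^ α - r' ^ α| := by
  have h : osc α u r - osc α u r' =
      osc α u r' * (Complex.exp (Complex.I * ((u * r ^ α - u * r' ^ α : ℝ) : ℂ)) - 1) := by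
    rw [mul_sub, osc, osc, ← Complex.exp_add, mul_one]
    congr 2
    push_cast
    ring
  rw [h, norm_mul, norm_osc, one_mul]
  refine Real.norm_exp_I_mul_ofReal_sub_one_le.trans (le_of_eq ?_)
  rw [← mul_sub, Real.norm_eq_abs, abs_mul, abs_of_nonneg hu]

lemma contDiffOn_osc (α u : ℝ) : ContDiffOn ℝ (⊤ : ℕ∞) (osc α u) (Ioi 0) := by
  unfold osc
  refine (contDiffOn_const.mul (Complex.ofRealCLM.contDiff.comp_contDiffOn
    (contDiffOn_const.mul ?_))).cexp
  exact fun x hx => (Real.contDiffAt_rpow_const_of_ne (ne_of_gt hx)).contDiffWithinAt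

/-- The profile of the oscillating pieces, corrected at low frequencies. -/
def oscProfile (Ω : En n → ℝ) (α u c : ℝ) : En n → ℂ := ringKernel Ω fun r => osc α u r - c

lemma contDiff_oscProfile (hΩ : IsAngular Ω) (α u c : ℝ) :
    ContDiff ℝ (⊤ : ℕ∞) (oscProfile Ω α u c) :=
  contDiff_ringKernel hΩ ((contDiffOn_osc α u).sub contDiffOn_const)

lemma exists_isProfile_osc (hn : 1 ≤ n) (hΩ : IsAngular Ω) {α : ℝ} (hα : 1 < α) :
    ∃ P : ℝ≥0, 0 < P ∧ IsProfile (ringKernel Ω fun _ => 1) P P ∧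
      (∀ u : ℝ≥0, 1 ≤ u → IsProfile (oscProfile Ω α u 0) P (u * P)) ∧
      ∀ u : ℝ≥0, IsProfile (oscProfile Ω α u 1) (u * P) (u * P) := by
  obtain ⟨P, hP, h⟩ := exists_isProfile_ringKernel hn hΩ
  set D : ℝ≥0 := (α * 2 ^ (α - 1)).toNNReal
  set E : ℝ≥0 := (2 ^ α : ℝ).toNNReal
  have hD : (D : ℝ) = α * 2 ^ (α - 1) := Real.coe_toNNReal _ (by positivity)
  have hE : (E : ℝ) = 2 ^ α := Real.coe_toNNReal _ (by positivity)
  have hlip : ∀ (u : ℝ≥0) (c : ℝ), ∀ r ∈ Icc (0 : ℝ) 2, ∀ r' ∈ Icc (0 : ℝ) 2,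
      ‖(osc α u r - c) - (osc α u r' - c)‖ ≤ (u * D : ℝ≥0) * |r - r'| := fun u c r hr r' hr' => by
    rw [sub_sub_sub_cancel_right]
    refine (norm_osc_sub_osc_le u.coe_nonneg r r').trans ?_
    push_cast
    rw [hD, mul_assoc (u : ℝ)]
    exact mul_le_mul_of_nonneg_left (abs_rpow_sub_rpow_le hα hr hr') u.coe_nonneg
  have hone : (1 : ℝ≥0) ≤ 1 + D + E := by rw [add_assoc]; exact le_self_add
  have hP1 : P ≤ (1 + D + E) * P := le_mul_of_one_le_left zero_le hone
  refine ⟨(1 + D + E) * P, by positivity, ?_, fun u hu => ?_, fun u => ?_⟩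
  · refine IsProfile.mono (h _ 1 0 (by simp) (by simp)) (by simpa using hP1) (by simpa using hP1)
  · refine IsProfile.mono (h _ 1 (u * D) (fun r _ => by simp [norm_osc]) (hlip u 0)) (by simpa using hP1) ?_
    rw [← mul_assoc]
    gcongr
    calc 1 + u * D ≤ u * 1 + u * D := by gcongr; simpa using hu
      _ ≤ u * (1 + D + E) := by rw [← mul_add]; exact mul_le_mul_right le_self_add _
  · refine IsProfile.mono (h _ (u * E) (u * D) (fun r hr => ?_) (hlip u 1)) ?_ ?_
    · have h1 : osc α u r - (1 : ℝ) = osc α u r - osc α u 0 := by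
        rw [osc, osc, Real.zero_rpow (by linarith)]; simp
      rw [h1]
      refine (norm_osc_sub_osc_le u.coe_nonneg r 0).trans ?_
      push_cast
      rw [hE, Real.zero_rpow (by linarith), sub_zero, abs_of_nonneg (Real.rpow_nonneg hr.1 _)]
      exact mul_le_mul_of_nonneg_left (Real.rpow_le_rpow hr.1 hr.2 (by linarith)) u.coe_nonneg
    · rw [← mul_assoc]
      gcongr
      exact le_add_self
    · rw [← mul_assoc, ← mul_add]
      refine mul_le_mul_left (mul_le_mul_right ?_ _) _
      rw [add_comm E D, add_assoc]
      exact le_add_self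

end RingProfile

/-! ### Fourier decay of the oscillating profiles -/

section FourierDecay

open scoped FourierTransform

variable {n : ℕ} {Ω : En n → ℝ}

lemma exists_norm_integral_bump_le {α : ℝ} (hα : 1 < α) : ∃ S : ℝ, 0 ≤ S ∧ ∀ u : ℝ, 0 < u →
    ∀ b : ℝ, ‖∫ r in Ioi (0 : ℝ), Complex.exp (Complex.I * ((u * r ^ α - b * r : ℝ) : ℂ)) *
      ((bump r * r⁻¹ : ℝ) : ℂ)‖ ≤ S / √u := by
  set g : ℝ → ℝ := fun r => bump r * r⁻¹
  have hpos : ∀ r ∈ Icc (1 / 2 : ℝ) 2, r ∈ Ioi (0 : ℝ) := fun r hr =>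
    lt_of_lt_of_le (by norm_num) hr.1
  have hg : ContDiffOn ℝ (⊤ : ℕ∞) g (Ioi 0) :=
    contDiff_bump.contDiffOn.mul (contDiffOn_id.inv fun r hr => ne_of_gt hr)
  have hg' : ContinuousOn (deriv g) (Icc (1 / 2) 2) :=
    (hg.continuousOn_deriv_of_isOpen isOpen_Ioi (by simp)).mono hpos
  have hd : ∀ r ∈ Icc (1 / 2 : ℝ) 2, HasDerivAt (fun r => (g r : ℂ)) ((deriv g r : ℝ) : ℂ) r :=
    fun r hr => (((hg.differentiableOn (by simp)).differentiableAt
      (Ioi_mem_nhds (hpos r hr))).hasDerivAt).ofReal_comp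
  obtain ⟨S₁, hS₁⟩ := isCompact_Icc.exists_bound_of_continuousOn (hg.continuousOn.mono hpos)
  obtain ⟨S₂, hS₂⟩ := isCompact_Icc.exists_bound_of_continuousOn hg'
  set S := max (max S₁ S₂) 0
  have hS : 0 ≤ S := le_max_right _ _
  refine ⟨S * (2 * Real.pi + (2 - 1 / 2)) / √(phaseConst α), by positivity, fun u hu b => ?_⟩
  have h0 : ∫ r in Ioi (0 : ℝ), Complex.exp (Complex.I * ((u * r ^ α - b * r : ℝ) : ℂ)) *
      ((bump r * r⁻¹ : ℝ) : ℂ) = ∫ r in (1 / 2 : ℝ)..2,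
        Complex.exp (Complex.I * ((u * r ^ α - b * r : ℝ) : ℂ)) * (g r : ℂ) := by
    rw [intervalIntegral.integral_of_le (by norm_num)]
    refine setIntegral_eq_of_subset_of_forall_diff_eq_zero measurableSet_Ioi
      (fun r hr => lt_trans (by norm_num) hr.1) fun r hr => ?_
    rcases le_or_gt r (1 / 2) with h | h
    · rw [bump_of_le h]; simp
    · rw [bump_of_ge (le_of_lt (by by_contra h'; exact hr.2 ⟨h, not_lt.1 h'⟩))]; simp
  rw [h0]
  refine (norm_integral_phase_le hα hd (Complex.continuous_ofReal.comp_continuousOn hg')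
    (by simp [g, bump_of_le]) (by simp [g, bump_of_ge]) (S := S)
    (fun r hr => ?_) (fun r hr => ?_) hu b).trans (le_of_eq ?_)
  · rw [Complex.norm_real]
    exact (hS₁ r hr).trans ((le_max_left _ _).trans (le_max_left _ _))
  · rw [Complex.norm_real]
    exact (hS₂ r hr).trans ((le_max_right _ _).trans (le_max_left _ _))
  · rw [Real.sqrt_mul hu.le, div_div, mul_comm (√u)]

lemma exists_norm_fourier_oscProfile_le (hn : 1 ≤ n) (hΩ : IsAngular Ω) {α : ℝ} (hα : 1 < α) :
    ∃ B : ℝ≥0, ∀ u : ℝ, 0 < u → ∀ ξ : En n, ‖𝓕 (oscProfile Ω α u 0) ξ‖ ≤ B / √u := by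
  obtain ⟨S, hS, h⟩ := exists_norm_integral_bump_le hα
  obtain ⟨W, hW, hΩW⟩ := hΩ.exists_bound
  set σ := (volume : Measure (En n)).toSphere
  refine ⟨(W * S * σ.real univ).toNNReal, fun u hu ξ => ?_⟩
  rw [Real.coe_toNNReal _ (by positivity), Real.fourier_eq']
  set G : En n → ℝ → ℂ := fun θ r =>
    Complex.exp (Complex.I * ((u * r ^ α - 2 * Real.pi * ⟪θ, ξ⟫ * r : ℝ) : ℂ)) * (bump r : ℂ)
  have hform : ∀ t : En n, Complex.exp (((-2 * Real.pi * ⟪t, ξ⟫ : ℝ) : ℂ) * Complex.I) •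
      oscProfile Ω α u 0 t = G (‖t‖⁻¹ • t) ‖t‖ * (czKernel n Ω t : ℂ) := by
    intro t
    have h1 : ⟪‖t‖⁻¹ • t, ξ⟫ * ‖t‖ = ⟪t, ξ⟫ := by
      rcases eq_or_ne t 0 with rfl | ht
      · simp
      · rw [real_inner_smul_left]
        field_simp [norm_ne_zero_iff.2 ht]
    simp only [G, oscProfile, ringKernel, osc, smul_eq_mul]
    rw [mul_assoc (2 * Real.pi), h1]
    have h2 : Complex.exp (Complex.I * ((u * ‖t‖ ^ α - 2 * Real.pi * ⟪t, ξ⟫ : ℝ) : ℂ)) =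
        Complex.exp (((-2 * Real.pi * ⟪t, ξ⟫ : ℝ) : ℂ) * Complex.I) *
          Complex.exp (Complex.I * ((u * ‖t‖ ^ α : ℝ) : ℂ)) := by
      rw [← Complex.exp_add]
      congr 1
      push_cast
      ring
    rw [h2]
    push_cast
    ring
  have hInt : Integrable fun t : En n => G (‖t‖⁻¹ • t) ‖t‖ * (czKernel n Ω t : ℂ) := by
    have hk : Integrable (oscProfile Ω α u 0) :=
      (contDiff_oscProfile hΩ α u 0).continuous.integrable_of_hasCompactSupport
        (hasCompactSupport_ringKernel Ω _)
    refine (hk.bdd_mul (c := 1) (f := fun t : En n =>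
      Complex.exp (((-2 * Real.pi * ⟪t, ξ⟫ : ℝ) : ℂ) * Complex.I)) ?_ ?_).congr
      (Eventually.of_forall hform)
    · exact (Complex.continuous_exp.comp ((Complex.continuous_ofReal.comp
        (continuous_const.mul (continuous_id.inner continuous_const))).mul
          continuous_const)).aestronglyMeasurable
    · exact Eventually.of_forall fun t => (Complex.norm_exp_ofReal_mul_I _).le
  simp_rw [hform]
  rw [integral_radial_mul_czKernel hn hΩ hInt]
  refine (norm_integral_le_of_norm_le_const (C := W * (S / √u))
    (Eventually.of_forall fun θ => ?_)).trans (le_of_eq (by ring))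
  rw [norm_mul, Complex.norm_real]
  have hθ : (θ : En n) ≠ 0 := by
    have := mem_sphere_zero_iff_norm.1 θ.2
    intro h0
    rw [h0] at this
    simp at this
  refine mul_le_mul (hΩW _ hθ) ?_ (norm_nonneg _) hW
  have := h u hu (2 * Real.pi * ⟪(θ : En n), ξ⟫)
  refine le_trans (le_of_eq ?_) this
  congr 1
  refine setIntegral_congr_fun measurableSet_Ioi fun r _ => ?_
  simp only [G]
  push_cast
  ring

end FourierDecay

/-! ### Jumps of perturbed sequences -/

section JumpPerturb

variable {ι : Type*} [LinearOrder ι]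

lemma le_jumpCount {lam : ℝ} {J : Set ι} {a : ι → ℂ} {N : ℕ} {s t : Fin N → ι} (hs : ∀ i, s i ∈ J)
    (ht : ∀ i, t i ∈ J) (hst : ∀ i, s i < t i) (hd : ∀ i j, i < j → t i < s j)
    (hj : ∀ i, lam < ‖a (t i) - a (s i)‖) : (N : ℝ≥0∞) ≤ jumpCount lam J a :=
  le_iSup_of_le N <| le_iSup_of_le s <| le_iSup_of_le t <| le_iSup_of_le hs <| le_iSup_of_le ht <|
    le_iSup_of_le hst <| le_iSup_of_le hd <| le_iSup_of_le hj le_rfl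

lemma mul_jumpCount_le_of_perturb (J : Finset ι) (a b : ι → ℂ) (c : ℂ) {μ : ℝ} (hμ : 0 ≤ μ) :
    ENNReal.ofReal μ ^ (2 : ℝ) * jumpCount (4 * μ) J a ≤
      ENNReal.ofReal μ ^ (2 : ℝ) * jumpCount (2 * μ) J b +
        ∑ j ∈ J, ‖a j - (c - b j)‖ₑ ^ (2 : ℝ) := by
  classical
  set e : ι → ℂ := fun j => a j - (c - b j)
  rw [jumpCount, ENNReal.mul_iSup]
  refine iSup_le fun N => ?_
  simp only [ENNReal.mul_iSup]
  refine iSup_le fun s => iSup_le fun t => iSup_le fun hs => iSup_le fun ht =>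
    iSup_le fun hst => iSup_le fun hd => iSup_le fun hj => ?_
  set A : Finset (Fin N) := Finset.univ.filter fun i => 2 * μ < ‖b (t i) - b (s i)‖
  have hA : (A.card : ℝ≥0∞) ≤ jumpCount (2 * μ) J b := by
    set φ := A.orderEmbOfFin rfl
    refine le_jumpCount (s := fun i => s (φ i)) (t := fun i => t (φ i)) (fun i => hs _)
      (fun i => ht _) (fun i => hst _) (fun i j hij => hd _ _ (φ.strictMono hij)) fun i => ?_
    exact (Finset.mem_filter.1 (A.orderEmbOfFin_mem rfl i)).2
  have hpick : ∀ i, ∃ j, (j = s i ∨ j = t i) ∧ (i ∈ Aᶜ → μ < ‖e j‖) := fun i => by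
    by_cases hi : i ∈ Aᶜ
    swap
    · exact ⟨s i, Or.inl rfl, fun h => absurd h hi⟩
    have h1 : ‖b (t i) - b (s i)‖ ≤ 2 * μ := by
      simpa [A] using hi
    by_contra! hcon
    have h2 : a (t i) - a (s i) = e (t i) - e (s i) - (b (t i) - b (s i)) := by
      simp only [e]; ring
    have h3 := hj i
    rw [h2] at h3
    have h4 := norm_sub_le (e (t i) - e (s i)) (b (t i) - b (s i))
    have h5 := norm_sub_le (e (t i)) (e (s i))
    linarith [(hcon _ (Or.inl rfl)).2, (hcon _ (Or.inr rfl)).2]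
  choose g hg hge using hpick
  have hgle : ∀ i, s i ≤ g i ∧ g i ≤ t i ∧ g i ∈ J := fun i => by
    rcases hg i with h | h
    · rw [h]; exact ⟨le_rfl, (hst i).le, hs i⟩
    · rw [h]; exact ⟨(hst i).le, le_rfl, ht i⟩
  have hlt : ∀ i i', i < i' → g i ≠ g i' := fun i i' hii h => by
    have := hd i i' hii
    have h1 := (hgle i).2.1
    have h2 := (hgle i').1
    rw [h] at h1
    exact absurd (h1.trans_lt this) (not_lt.2 h2)
  have hinj : Set.InjOn g (Aᶜ : Finset (Fin N)) := fun i _ i' _ h => by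
    by_contra hne
    rcases lt_or_gt_of_ne hne with h' | h'
    · exact hlt i i' h' h
    · exact hlt i' i h' h.symm
  have hB : ENNReal.ofReal μ ^ (2 : ℝ) * (Aᶜ.card : ℝ≥0∞) ≤ ∑ j ∈ J, ‖e j‖ₑ ^ (2 : ℝ) := by
    calc _ = ∑ i ∈ Aᶜ, ENNReal.ofReal μ ^ (2 : ℝ) := by rw [Finset.sum_const, nsmul_eq_mul, mul_comm]
      _ ≤ ∑ i ∈ Aᶜ, ‖e (g i)‖ₑ ^ (2 : ℝ) := by
          refine Finset.sum_le_sum fun i hi => ?_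
          rw [← ofReal_norm]
          gcongr
          exact (hge i hi).le
      _ = ∑ j ∈ Aᶜ.image g, ‖e j‖ₑ ^ (2 : ℝ) :=
          (Finset.sum_image (f := fun j => ‖e j‖ₑ ^ (2 : ℝ)) hinj).symm
      _ ≤ _ := Finset.sum_le_sum_of_subset fun j hj' => by
          obtain ⟨i, hi, rfl⟩ := Finset.mem_image.1 hj'
          exact (hgle i).2.2
  have hN : (N : ℝ≥0∞) = A.card + Aᶜ.card := by
    have := Finset.card_add_card_compl A
    rw [Fintype.card_fin] at this
    exact_mod_cast this.symm
  rw [hN, mul_add]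
  gcongr

end JumpPerturb

/-! ### Sums of square functions -/

section SquareSum

variable {n : ℕ} {ι : Type} [Fintype ι]

lemma squareLp_mono {A B : ι → L2 n ℂ →L[ℂ] L2 n ℂ} {f : L2 n ℂ} {p : ℝ} (hp : 0 < p)
    (h : ∀ i, ‖A i f‖ₑ = 0 ∨ A i = B i) : squareLp A f p ≤ squareLp B f p := by
  have hae : ∀ᵐ x : En n, ∀ i, ‖A i f x‖ₑ ≤ ‖B i f x‖ₑ := by
    rw [ae_all_iff]
    intro i
    rcases h i with h | h
    · rw [enorm_eq_zero] at h
      rw [h]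
      filter_upwards [Lp.coeFn_zero ℂ 2 (volume : Measure (En n))] with x hx
      rw [hx]; simp
    · rw [h]; exact Eventually.of_forall fun x => le_rfl
  refine ENNReal.rpow_le_rpow (lintegral_mono_ae ?_) (by positivity)
  filter_upwards [hae] with x hx
  gcongr with i
  exact hx i

lemma squareLp_sum_le {T : Type*} (Q : Finset T) (A : T → ι → L2 n ℂ →L[ℂ] L2 n ℂ) (f : L2 n ℂ)
    {p : ℝ} (hp : 1 < p) :
    squareLp (fun i => ∑ q ∈ Q, A q i) f p ≤ ∑ q ∈ Q, squareLp (A q) f p := by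
  simp_rw [squareLp_eq _ f (zero_lt_one.trans hp)]
  have h : (familyCLM (fun i => ∑ q ∈ Q, A q i) f : En n → EuclideanSpace ℂ ι) =ᵐ[volume]
      ∑ q ∈ Q, (familyCLM (A q) f : En n → EuclideanSpace ℂ ι) := by
    have h1 : ∀ᵐ x : En n, ∀ q : Q, ∀ i, (familyCLM (A q) f x : EuclideanSpace ℂ ι) i = A q i f x := by
      rw [ae_all_iff]
      exact fun q => familyCLM_ae (A q) f
    have h2 : ∀ᵐ x : En n, ∀ i, ((∑ q ∈ Q, A q i) f : L2 n ℂ) x = ∑ q ∈ Q, A q i f x := by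
      rw [ae_all_iff]
      intro i
      rw [ContinuousLinearMap.sum_apply]
      filter_upwards [Lp.coeFn_finsetSum Q (fun q => A q i f)] with x hx
      rw [hx, Finset.sum_apply]
    filter_upwards [familyCLM_ae (fun i => ∑ q ∈ Q, A q i) f, h1, h2] with x hx h1x h2x
    ext i
    rw [hx, h2x, Finset.sum_apply]
    rw [WithLp.ofLp_sum, Finset.sum_apply]
    exact Finset.sum_congr rfl fun q hq => (h1x ⟨q, hq⟩ i).symm
  rw [eLpNorm_congr_ae h]
  refine eLpNorm_sum_le (fun q _ => Lp.aestronglyMeasurable _) ?_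
  rw [ENNReal.one_le_ofReal]
  exact hp.le

end SquareSum

/-! ### Summable bounds for the square functions -/

section SummableFamilies

variable {n : ℕ}

lemma summable_linear_mul_geometric (a b Q : ℝ≥0) {ρ : ℝ≥0} (hρ : ρ < 1) :
    Summable fun m : ℕ => 8 * (1 + (a * m + b)) * (Q * ρ ^ m) := by
  rw [← NNReal.summable_coe]
  have hρ' : ‖(ρ : ℝ)‖ < 1 := by simpa using hρ
  have h1 := (summable_pow_mul_geometric_of_norm_lt_one 1 hρ').mul_left (8 * a * Q : ℝ)
  have h0 := (summable_pow_mul_geometric_of_norm_lt_one 0 hρ').mul_left (8 * (1 + b) * Q : ℝ)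
  refine (h1.add h0).congr fun m => ?_
  push_cast
  ring

/-- A bound for the square functions formed from a family of operators on dyadic scales. -/
def HasSquareBound (A : ℤ → L2 n ℂ →L[ℂ] L2 n ℂ) (p : ℝ) (C : ℝ≥0) : Prop :=
  ∀ (ι : Type) [Fintype ι] (J : ι → ℤ), Function.Injective J → ∀ f : L2 n ℂ,
    Integrable (f : En n → ℂ) → squareLp (fun i => A (J i)) f p ≤
      masterConst n (n + 2) p * C * eLpNorm f (ENNReal.ofReal p) volume

lemma exists_hasSquareBound_cond {k : En n → ℂ} {P : ℝ≥0} (hk : IsProfile k P P) (hP : 0 < P)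
    (hn : 1 ≤ n) {p : ℝ} (hp : 1 < p) : ∃ C : ℕ → ℝ≥0, Summable C ∧
      (∀ s, HasSquareBound (fun j => (fineKernel hk s j).clm) p (C s)) ∧
      ∀ s, HasSquareBound (fun j => (coarseKernel hk s j).clm) p (C s) := by
  set θ := interpExp p
  have hθ : 0 < 1 - θ := sub_pos.2 (interpExp_lt_one hp)
  have hn' : (0 : ℝ≥0) < n := by exact_mod_cast hn
  set Q : ℝ≥0 := 4 * n * P
  have hQ : 0 < Q := by positivity
  have h2 : (NNReal.sqrt 2)⁻¹ < 1 := inv_lt_one_of_one_lt₀ (by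
    rw [← NNReal.sqrt_one]; exact NNReal.sqrt_lt_sqrt.2 one_lt_two)
  set ρ : ℝ≥0 := (NNReal.sqrt 2)⁻¹ ^ (1 - θ)
  have hρ : ρ < 1 := NNReal.rpow_lt_one h2 hθ
  have hgain : ∀ s, condGain n P s ^ (1 - θ) * Q ^ θ = Q * ρ ^ s := fun s => by
    rw [condGain, NNReal.mul_rpow, mul_right_comm, ← NNReal.rpow_add hQ.ne', sub_add_cancel,
      NNReal.rpow_one, ← NNReal.rpow_natCast, ← NNReal.rpow_mul, mul_comm (s : ℝ),
      NNReal.rpow_mul, NNReal.rpow_natCast]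
  have hpos : ∀ s, 0 < condGain n P s := fun s => by
    unfold condGain; positivity
  have hle : ∀ s, condGain n P s ≤ Q := fun s =>
    mul_le_of_le_one_right zero_le (pow_le_one₀ zero_le h2.le)
  have hR : (0 : ℝ) ≤ n + 2 := by positivity
  refine ⟨fun s => 8 * (1 + (1 * s + 0)) * (Q * ρ ^ s), summable_linear_mul_geometric 1 0 Q hρ,
    fun s ι _ J hJ f hf => ?_, fun s ι _ J hJ f hf => ?_⟩
  · refine ((scaledFamily_fine hk hn s hJ).squareLp_le hn hR (hpos s) (hle s) hf hp).trans
      (le_of_eq ?_)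
    beta_reduce
    rw [hgain, one_mul, add_zero]
  · refine ((scaledFamily_coarse hk hn s hJ).squareLp_le hn hR (hpos s) (hle s) hf hp).trans
      (le_of_eq ?_)
    beta_reduce
    rw [hgain, one_mul, add_zero]

variable {Ω : En n → ℝ}

/-- The oscillating profile at frequency `2 ^ (m α)`, corrected for negative `m`. -/
def oscPiece (Ω : En n → ℝ) (α : ℝ) (m : ℤ) : En n → ℂ :=
  oscProfile Ω α ((2 : ℝ) ^ ((m : ℝ) * α)) (if m < 0 then 1 else 0)

lemma exists_hasSquareBound_osc_nat (hn : 1 ≤ n) (hΩ : IsAngular Ω) {α : ℝ} (hα : 1 < α) {P : ℝ≥0}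
    (h : ∀ u : ℝ≥0, 1 ≤ u → IsProfile (oscProfile Ω α u 0) P (u * P)) {p : ℝ} (hp : 1 < p) :
    ∃ C : ℕ → ℝ≥0, Summable C ∧ ∀ m : ℕ, ∃ Λ M, ∃ hk : IsProfile (oscPiece Ω α m) Λ M,
      HasSquareBound (fun j => (hk.schur (j - m)).clm) p (C m) := by
  obtain ⟨B, hB⟩ := exists_norm_fourier_oscProfile_le hn hΩ hα
  set θ := interpExp p
  have hθ : 0 < 1 - θ := sub_pos.2 (interpExp_lt_one hp)
  set Q : ℝ≥0 := P + B + 1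
  have hQ : 0 < Q := by positivity
  have hPQ : P ≤ Q := by rw [show Q = P + (B + 1) from add_assoc _ _ _]; exact le_self_add
  have hBQ : B ≤ Q := (le_add_self (a := B) (b := P)).trans le_self_add
  set ρ : ℝ≥0 := 2 ^ (-(α / 2) * (1 - θ))
  have hρ : ρ < 1 := NNReal.rpow_lt_one_of_one_lt_of_neg (by norm_num)
    (mul_neg_of_neg_of_pos (by linarith) hθ)
  set A := ⌈α⌉₊
  refine ⟨fun m => 8 * (1 + ((2 * A : ℕ) * m + (n + 1 : ℕ))) * (Q * ρ ^ m),
    summable_linear_mul_geometric _ _ Q hρ, fun m => ?_⟩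
  set u : ℝ≥0 := 2 ^ ((m : ℝ) * α)
  have hu1 : 1 ≤ u := NNReal.one_le_rpow (by norm_num) (by positivity)
  have hu0 : 0 < u := zero_lt_one.trans_le hu1
  have hpiece : oscPiece Ω α m = oscProfile Ω α u 0 := by
    rw [oscPiece, if_neg (by omega)]
    simp [u]
  have huA : u ≤ 2 ^ (A * m) := by
    rw [← NNReal.rpow_natCast]
    refine NNReal.rpow_le_rpow_of_exponent_le (by norm_num) ?_
    push_cast
    rw [mul_comm]
    exact mul_le_mul_of_nonneg_right (Nat.le_ceil α) (by positivity)
  have hk : IsProfile (oscPiece Ω α m) Q (u * Q) := by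
    rw [hpiece]
    exact (h u hu1).mono hPQ (by gcongr)
  set ε : ℝ≥0 := Q * u ^ (-(1 / 2) : ℝ)
  have hu2 : u ^ (-(1 / 2) : ℝ) ≤ 1 := NNReal.rpow_le_one_of_one_le_of_nonpos hu1 (by norm_num)
  have hε0 : 0 < ε := mul_pos hQ (NNReal.rpow_pos hu0)
  have hεΛ : ε ≤ Q := mul_le_of_le_one_right zero_le hu2
  have hclm : ∀ i, ‖(hk.schur i).clm‖ ≤ ε := fun i => by
    refine hk.norm_clm_le_of_fourier (contDiff_oscProfile hΩ _ _ _) i fun ξ => ?_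
    rw [hpiece]
    refine (hB u (by exact_mod_cast hu0) ξ).trans ?_
    simp only [ε]
    push_cast
    rw [Real.rpow_neg u.coe_nonneg, ← Real.sqrt_eq_rpow, div_eq_mul_inv]
    exact mul_le_mul_of_nonneg_right (by exact_mod_cast hBQ) (by positivity)
  set L : ℕ := 2 * A * m + (n + 1)
  have hLu : 2 * n * u ^ 2 ≤ (2 : ℝ≥0) ^ L := by
    have hn2 : (n : ℝ≥0) ≤ 2 ^ n := by exact_mod_cast Nat.lt_two_pow_self.le
    calc 2 * n * u ^ 2 ≤ 2 * 2 ^ n * (2 ^ (A * m)) ^ 2 := by gcongr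
      _ = 2 ^ L := by
        simp only [L]
        ring
  have hn1 : (1 : ℝ≥0) ≤ n := by exact_mod_cast hn
  have hεsq : ε ^ 2 * u = Q ^ 2 := by
    simp only [ε]
    rw [mul_pow, ← NNReal.rpow_natCast (u ^ _), ← NNReal.rpow_mul, mul_assoc]
    norm_num
    rw [NNReal.rpow_neg_one, inv_mul_cancel₀ hu0.ne', mul_one]
  refine ⟨Q, u * Q, hk, fun ι _ J hJ f hf => ?_⟩
  have hsf := hk.scaledFamily (s := fun i => J i - m) (fun i j hij => hJ (by simpa using hij))
    (R := n + 2) (by linarith [Nat.cast_nonneg (α := ℝ) n]) (L := L) hclm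
    (by
      calc 2 * Q * (u * Q) = 2 * 1 * u * (ε ^ 2 * u) := by rw [hεsq]; ring
        _ ≤ 2 * n * u * (ε ^ 2 * u) := by gcongr
        _ = ε ^ 2 * (2 * n * u ^ 2) := by ring
        _ ≤ _ := by gcongr)
    (by
      calc n * (u * Q) = Q * (1 * n * (u * 1)) := by ring
        _ ≤ Q * (2 * n * (u * u)) := by
          gcongr
          norm_num
        _ = Q * (2 * n * u ^ 2) := by ring
        _ ≤ _ := by gcongr)
  refine (hsf.squareLp_le hn (by positivity) hε0 hεΛ hf hp).trans (le_of_eq ?_)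
  have hgain : ε ^ (1 - θ) * Q ^ θ = Q * ρ ^ m := by
    simp only [ε, ρ, u]
    rw [NNReal.mul_rpow, mul_right_comm, ← NNReal.rpow_add hQ.ne', sub_add_cancel, NNReal.rpow_one,
      ← NNReal.rpow_natCast, ← NNReal.rpow_mul, ← NNReal.rpow_mul, ← NNReal.rpow_mul]
    congr 2
    ring
  rw [hgain]
  simp only [L]
  push_cast
  rfl

lemma exists_hasSquareBound_osc_neg (hn : 1 ≤ n) {α : ℝ} (hα : 1 < α) {P : ℝ≥0} (hP : 0 < P)
    (h : ∀ u : ℝ≥0, IsProfile (oscProfile Ω α u 1) (u * P) (u * P)) {p : ℝ} (hp : 1 < p) :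
    ∃ C : ℕ → ℝ≥0, Summable C ∧ ∀ m : ℕ, ∃ Λ M,
      ∃ hk : IsProfile (oscPiece Ω α (-(m + 1 : ℕ))) Λ M,
        HasSquareBound (fun j => (hk.schur (j + (m + 1 : ℕ))).clm) p (C m) := by
  set ρ : ℝ≥0 := 2 ^ (-α)
  have hρ : ρ < 1 := NNReal.rpow_lt_one_of_one_lt_of_neg (by norm_num) (by linarith)
  refine ⟨fun m => 8 * (1 + (0 * m + (n + 1 : ℕ))) * (ρ * P * ρ ^ m),
    summable_linear_mul_geometric _ _ _ hρ, fun m => ?_⟩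
  set u : ℝ≥0 := ρ ^ (m + 1)
  have hu0 : 0 < u := pow_pos (NNReal.rpow_pos (by norm_num)) _
  have hpiece : oscPiece Ω α (-(m + 1 : ℕ)) = oscProfile Ω α u 1 := by
    have h1 : (-((m + 1 : ℕ) : ℤ)) < 0 := by omega
    rw [oscPiece, if_pos h1]
    congr 1
    simp only [u, ρ]
    push_cast
    rw [← Real.rpow_natCast, ← Real.rpow_mul (by norm_num)]
    congr 1
    push_cast
    ring
  have hk : IsProfile (oscPiece Ω α (-(m + 1 : ℕ))) (u * P) (u * P) := by
    rw [hpiece]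
    exact h u
  refine ⟨u * P, u * P, hk, fun ι _ J hJ f hf => ?_⟩
  have hn2 : (n : ℝ≥0) ≤ 2 ^ n := by exact_mod_cast Nat.lt_two_pow_self.le
  have hsf := hk.scaledFamily (s := fun i => J i + (m + 1 : ℕ)) (ε := u * P)
    (fun i j hij => hJ (by simpa using hij))
    (R := n + 2) (by linarith [Nat.cast_nonneg (α := ℝ) n]) (L := n + 1) (fun i => hk.norm_clm_le i)
    (by
      calc 2 * (u * P) * (u * P) = (u * P) ^ 2 * (2 * 1) := by ring
        _ ≤ (u * P) ^ 2 * (2 * 2 ^ n) := by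
          gcongr
          exact one_le_pow₀ (by norm_num)
        _ = _ := by ring)
    (by
      calc n * (u * P) = u * P * (1 * n) := by ring
        _ ≤ u * P * (2 * 2 ^ n) := by
          gcongr
          norm_num
        _ = _ := by ring)
  refine (hsf.squareLp_le hn (by positivity) (by positivity) le_rfl hf hp).trans (le_of_eq ?_)
  beta_reduce
  rw [← NNReal.rpow_add (by positivity), sub_add_cancel, NNReal.rpow_one, zero_mul, zero_add]
  simp only [u, pow_succ]
  rw [show ρ ^ m * ρ * P = ρ * P * ρ ^ m by ring]

end SummableFamilies

/-! ### Jumps of the truncated operators -/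

section TruncatedJump

variable {n : ℕ} {Ω : En n → ℝ}

lemma HasSquareBound.add {A B : ℤ → L2 n ℂ →L[ℂ] L2 n ℂ} {p : ℝ} (hp : 1 < p) {C D : ℝ≥0}
    (hA : HasSquareBound A p C) (hB : HasSquareBound B p D) :
    HasSquareBound (fun j => A j + B j) p (C + D) := fun ι _ J hJ f hf => by
  have h := squareLp_sum_le (Finset.univ : Finset Bool)
    (fun q i => if q then A (J i) else B (J i)) f hp
  simp only [Fintype.sum_bool, if_true, Bool.false_eq_true, if_false] at h
  refine h.trans ((add_le_add (hA ι J hJ f hf) (hB ι J hJ f hf)).trans (le_of_eq ?_))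
  push_cast
  ring

lemma summable_int_of_nat {C : ℤ → ℝ≥0} (h₁ : Summable fun m : ℕ => C m)
    (h₂ : Summable fun m : ℕ => C (-(m + 1))) : Summable C :=
  (h₁.hasSum.of_nat_of_neg_add_one h₂.hasSum).summable

lemma summable_natAbs {C : ℕ → ℝ≥0} (hC : Summable C) : Summable fun m : ℤ => C m.natAbs := by
  have h (m : ℕ) : (-((m : ℤ) + 1)).natAbs = m + 1 := by omega
  refine summable_int_of_nat ?_ ?_
  · simpa only [Int.natAbs_natCast] using hC
  · simpa only [h] using (NNReal.summable_nat_add_iff 1).2 hC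

lemma exists_oscKernel (hn : 1 ≤ n) (hΩ : IsAngular Ω) {α : ℝ} (hα : 1 < α) {p : ℝ} (hp : 1 < p)
    {P : ℝ≥0} (hP : 0 < P) (h₁ : ∀ u : ℝ≥0, 1 ≤ u → IsProfile (oscProfile Ω α u 0) P (u * P))
    (h₂ : ∀ u : ℝ≥0, IsProfile (oscProfile Ω α u 1) (u * P) (u * P)) :
    ∃ V : ℤ → ℤ → SchurKernel n,
      (∀ m i x y, (V m i).toFun x y = dilate (oscPiece Ω α m) i (x - y)) ∧
      ∃ C : ℤ → ℝ≥0, Summable C ∧ ∀ m, HasSquareBound (fun j => (V m (j - m)).clm) p (C m) := by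
  obtain ⟨C₁, hC₁, hV₁⟩ := exists_hasSquareBound_osc_nat hn hΩ hα h₁ hp
  obtain ⟨C₂, hC₂, hV₂⟩ := exists_hasSquareBound_osc_neg hn hα hP h₂ hp
  set C : ℤ → ℝ≥0 := fun m => if 0 ≤ m then C₁ m.toNat else C₂ (-m - 1).toNat
  have key : ∀ m : ℤ, ∃ Λ M, ∃ hk : IsProfile (oscPiece Ω α m) Λ M,
      HasSquareBound (fun j => (hk.schur (j - m)).clm) p (C m) := fun m => by
    rcases le_or_gt 0 m with hm | hm
    · obtain ⟨m, rfl⟩ := Int.eq_ofNat_of_zero_le hm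
      simpa [C] using hV₁ m
    · obtain ⟨q, rfl⟩ : ∃ q : ℕ, m = -(q + 1 : ℕ) := ⟨(-m - 1).toNat, by omega⟩
      obtain ⟨Λ, M, hk, h⟩ := hV₂ q
      refine ⟨Λ, M, hk, ?_⟩
      have hC : C (-(q + 1 : ℕ)) = C₂ q := by
        simp only [C]
        rw [if_neg (by omega)]
        congr 1
        omega
      rw [hC]
      simpa only [sub_neg_eq_add] using h
  choose Λ M hk hkb using key
  refine ⟨fun m i => (hk m).schur i, fun m i x y => (hk m).schur_toFun _ _ _, C,
    summable_int_of_nat ?_ ?_, hkb⟩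
  · simpa [C] using hC₁
  · refine hC₂.congr fun m => ?_
    simp only [C]
    rw [if_neg (by omega)]
    congr 1
    omega

/-- The error made when the operators at scales at most `2 ^ (-j)` are replaced by a dyadic
average. -/
def condError {k : En n → ℂ} {P : ℝ≥0} (hk : IsProfile k P P) (m j : ℤ) : L2 n ℂ →L[ℂ] L2 n ℂ :=
  if 0 ≤ m then (fineKernel hk m.toNat j).clm else (coarseKernel hk (-m).toNat j).clm

lemma condError_eq {k : En n → ℂ} {P : ℝ≥0} (hk : IsProfile k P P) (i j : ℤ) (f : L2 n ℂ) :
    condError hk (j - i) j f = (condKernel n j).clm ((hk.schur i).clm f) -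
      (if j < i then 0 else (hk.schur i).clm f) := by
  rcases lt_or_ge j i with h | h
  · rw [condError, if_neg (by omega), if_pos h, coarseKernel_clm, sub_zero,
      ContinuousLinearMap.comp_apply]
    congr 4
    omega
  · rw [condError, if_pos (by omega), if_neg (by omega), fineKernel_clm,
      ContinuousLinearMap.comp_apply, ContinuousLinearMap.sub_apply, ContinuousLinearMap.id_apply]
    have h1 : j - ((j - i).toNat : ℤ) = i := by omega
    rw [h1]

lemma exists_hasSquareBound_condError {k : En n → ℂ} {P : ℝ≥0} (hk : IsProfile k P P) (hP : 0 < P)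
    (hn : 1 ≤ n) {p : ℝ} (hp : 1 < p) : ∃ C : ℤ → ℝ≥0, Summable C ∧
      ∀ m, HasSquareBound (condError hk m) p (C m) := by
  obtain ⟨C, hC, h₁, h₂⟩ := exists_hasSquareBound_cond hk hP hn hp
  refine ⟨fun m => C m.natAbs, summable_natAbs hC, fun m => ?_⟩
  rcases le_or_gt 0 m with h | h
  · have e : condError hk m = fun j => (fineKernel hk m.natAbs j).clm := by
      funext j
      rw [condError, if_pos h, show m.natAbs = m.toNat by omega]
    rw [e]
    exact h₁ m.natAbs
  · have e : condError hk m = fun j => (coarseKernel hk m.natAbs j).clm := by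
      funext j
      rw [condError, if_neg (not_le.2 h), show m.natAbs = (-m).toNat by omega]
    rw [e]
    exact h₂ m.natAbs

lemma squareLp_scales_le {U : ℤ → ℤ → L2 n ℂ →L[ℂ] L2 n ℂ} {C : ℤ → ℝ≥0} (hC : Summable C) {p : ℝ}
    (hp : 1 < p) (hU : ∀ m, HasSquareBound (U m) p (C m)) (N : ℕ) {f : L2 n ℂ}
    (hf : Integrable (f : En n → ℂ)) :
    squareLp (fun j : Finset.Icc (-N : ℤ) N => ∑ i ∈ Finset.Icc (-N : ℤ) N, U (j - i) j) f p ≤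
      masterConst n (n + 2) p * (∑' m, C m : ℝ≥0) * eLpNorm f (ENNReal.ofReal p) volume := by
  set I := Finset.Icc (-N : ℤ) N
  set Q := Finset.Icc (-(2 * N) : ℤ) (2 * N)
  have hre : ∀ j : I, ∑ i ∈ I, U (j - i) j = ∑ m ∈ Q, if (j : ℤ) - m ∈ I then U m j else 0 := by
    intro j
    rw [← Finset.sum_filter]
    refine Finset.sum_bij' (fun i _ => (j : ℤ) - i) (fun m _ => (j : ℤ) - m) ?_ ?_ ?_ ?_ ?_
    · intro i hi
      have hj := j.2
      simp only [I, Q, Finset.mem_Icc, Finset.mem_filter] at hi hj ⊢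
      omega
    · intro m hm
      exact (Finset.mem_filter.1 hm).2
    · intro i _; ring
    · intro m _; ring
    · intro i _; rfl
  simp_rw [hre]
  refine (squareLp_sum_le Q (fun m (j : I) => if (j : ℤ) - m ∈ I then U m j else 0) f hp).trans ?_
  calc ∑ m ∈ Q, squareLp (fun j : I => if (j : ℤ) - m ∈ I then U m j else 0) f p
      ≤ ∑ m ∈ Q, masterConst n (n + 2) p * C m * eLpNorm f (ENNReal.ofReal p) volume := by
        refine Finset.sum_le_sum fun m _ => ?_
        refine (squareLp_mono (B := fun j : I => U m j) (by linarith) fun j => ?_).trans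
          (hU m I (fun j => (j : ℤ)) Subtype.val_injective f hf)
        by_cases h : (j : ℤ) - m ∈ I
        · right; rw [if_pos h]
        · left; rw [if_neg h]; simp
    _ = masterConst n (n + 2) p * (∑ m ∈ Q, C m : ℝ≥0) * eLpNorm f (ENNReal.ofReal p) volume := by
        rw [← Finset.sum_mul, ← Finset.mul_sum]
        push_cast
        rfl
    _ ≤ _ := by
        gcongr
        exact hC.sum_le_tsum _ fun _ _ => zero_le

lemma lintegral_rpow_half_rpow {A : En n → ℝ≥0∞} {p : ℝ} :
    (∫⁻ x, (A x ^ (1 / 2 : ℝ)) ^ p) ^ (1 / p) = (∫⁻ x, A x ^ (p / 2)) ^ (1 / p) := by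
  congr 1
  refine lintegral_congr fun x => ?_
  rw [← ENNReal.rpow_mul]
  congr 1
  ring

lemma sum_add_eq_sum_sub {E : Type*} [AddCommGroup E] (T : E →+ E) (I : Finset ℤ) (j : ℤ)
    {v k e : ℤ → E} (he : ∀ i, e i = T (k i) - if j < i then 0 else k i) :
    ∑ i ∈ I, (v i + e i) = ∑ i ∈ I, (v i + if j < i then k i else 0) -
      (∑ i ∈ I, k i - T (∑ i ∈ I, k i)) := by
  rw [map_sum, ← Finset.sum_sub_distrib, ← Finset.sum_sub_distrib]
  refine Finset.sum_congr rfl fun i _ => ?_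
  rw [he]
  split_ifs <;> abel

lemma coeFn_sum_sub_ae (I : Finset ℤ) (j : ℤ) {v k : ℤ → L2 n ℂ} {v' k' : ℤ → En n → ℂ}
    (hv : ∀ i, (v i : En n → ℂ) =ᵐ[volume] v' i) (hk : ∀ i, (k i : En n → ℂ) =ᵐ[volume] k' i)
    (g h : L2 n ℂ) {h' : En n → ℂ} (hh : (h : En n → ℂ) =ᵐ[volume] h') :
    ∀ᵐ x : En n, (∑ i ∈ I, (v i + if j < i then k i else 0) - (g - h) : L2 n ℂ) x =
      (∑ i ∈ I, (v' i x + if j < i then k' i x else 0)) - (g x - h' x) := by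
  have e3 : ∀ᵐ x : En n, ∀ i : ℤ, (v i + if j < i then k i else 0 : L2 n ℂ) x =
      v' i x + if j < i then k' i x else 0 := by
    rw [ae_all_iff]
    intro i
    split_ifs
    · filter_upwards [Lp.coeFn_add (v i) (k i), hv i, hk i] with x h1 h2 h3
      rw [h1, Pi.add_apply, h2, h3]
    · rw [add_zero]
      filter_upwards [hv i] with x h1
      rw [h1, add_zero]
  filter_upwards [e3, hh, Lp.coeFn_sub (∑ i ∈ I, (v i + if j < i then k i else 0)) (g - h),
    Lp.coeFn_sub g h, Lp.coeFn_finsetSum I (fun i => v i + if j < i then k i else 0)]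
    with x h3 h4 h5 h6 h7
  rw [h5, Pi.sub_apply, h6, Pi.sub_apply, h4, h7, Finset.sum_apply]
  congr 1
  exact Finset.sum_congr rfl fun i _ => h3 i

set_option maxHeartbeats 1000000 in
theorem exists_truncated_jump_bound (hn : 1 ≤ n) (hΩ : IsAngular Ω) {α : ℝ} (hα : 1 < α) {p : ℝ}
    (hp : 1 < p) : ∃ (V : ℤ → ℤ → SchurKernel n) (K : ℤ → SchurKernel n),
      (∀ m i x y, (V m i).toFun x y = dilate (oscPiece Ω α m) i (x - y)) ∧
      (∀ i x y, (K i).toFun x y = dilate (ringKernel Ω fun _ => 1) i (x - y)) ∧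
      ∃ C : ℝ≥0∞, C ≠ ∞ ∧ ∀ f : L2 n ℂ, Integrable (f : En n → ℂ) → ∀ μ : ℝ, 0 ≤ μ → ∀ N : ℕ,
        ∃ S : En n → ℝ≥0∞, AEMeasurable S ∧
          (∀ᵐ x, ENNReal.ofReal μ ^ (2 : ℝ) * jumpCount (4 * μ) (Icc (-N : ℤ) N) (fun j =>
            ∑ i ∈ Finset.Icc (-N : ℤ) N,
              ((V (j - i) i).op f x + if j < i then (K i).op f x else 0)) ≤ S x ^ (2 : ℝ)) ∧
          (∫⁻ x, S x ^ p) ^ (1 / p) ≤ C * eLpNorm f (ENNReal.ofReal p) volume := by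
  obtain ⟨P, hP, hk, h₁, h₂⟩ := exists_isProfile_osc hn hΩ hα
  obtain ⟨V, hV, C₁, hC₁, hVb⟩ := exists_oscKernel hn hΩ hα hp hP h₁ h₂
  obtain ⟨C₂, hC₂, hEb⟩ := exists_hasSquareBound_condError hk hP hn hp
  set mc := masterConst n (n + 2) p
  have hmc : mc ≠ ∞ := masterConst_ne_top n _ hp
  refine ⟨V, fun i => hk.schur i, hV, fun i x y => hk.schur_toFun _ _ _,
    mc * (mc * (128 * n * P : ℝ≥0)) + mc * (∑' m, (C₁ m + C₂ m) : ℝ≥0), ?_, ?_⟩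
  · finiteness
  intro f hf μ hμ N
  set I := Finset.Icc (-N : ℤ) N
  set U : ℤ → ℤ → L2 n ℂ →L[ℂ] L2 n ℂ := fun m j => (V m (j - m)).clm + condError hk m j
  have hU : ∀ m, HasSquareBound (U m) p (C₁ m + C₂ m) := fun m => (hVb m).add hp (hEb m)
  set g : L2 n ℂ := (∑ i ∈ I, (hk.schur i).clm) f with hg
  have hgae : (g : En n → ℂ) =ᵐ[volume] ∑ i ∈ I, ((hk.schur i).clm f : En n → ℂ) := by
    rw [hg, ContinuousLinearMap.sum_apply]
    exact Lp.coeFn_finsetSum I (fun i => (hk.schur i).clm f)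
  have hgi : Integrable (g : En n → ℂ) := by
    refine Integrable.congr ?_ hgae.symm
    exact integrable_finset_sum' _ fun i _ =>
      ((hk.schur i).integrable_op hf).congr ((hk.schur i).clm_ae f).symm
  obtain ⟨S₁, hS₁m, hS₁, hS₁b⟩ :=
    exists_dominating_condKernel_jump hn (R := n + 2) (by positivity) hgi hp hμ N
  set A : I → L2 n ℂ →L[ℂ] L2 n ℂ := fun j => ∑ i ∈ I, U (j - i) j
  set S₂ : En n → ℝ≥0∞ := fun x => (∑ j, ‖A j f x‖ₑ ^ (2 : ℝ)) ^ (1 / 2 : ℝ)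
  have hS₂m : AEMeasurable S₂ := (Finset.aemeasurable_fun_sum _ fun j _ =>
    ((Lp.aestronglyMeasurable _).enorm.pow_const _)).pow_const _
  refine ⟨S₁ + S₂, hS₁m.add hS₂m, ?_, ?_⟩
  · have hid : ∀ j : I, A j f = ∑ i ∈ I, ((V (j - i) i).clm f +
        if (j : ℤ) < i then (hk.schur i).clm f else 0) - (g - (condKernel n j).clm g) := by
      intro j
      have h := sum_add_eq_sum_sub ((condKernel n j).clm : L2 n ℂ →+ L2 n ℂ) I j
        (v := fun i => (V (j - i) i).clm f) (k := fun i => (hk.schur i).clm f)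
        (e := fun i => condError hk (j - i) j f) fun i => condError_eq hk i j f
      have hg' : g = ∑ i ∈ I, (hk.schur i).clm f := by rw [hg, ContinuousLinearMap.sum_apply]
      rw [hg']
      refine Eq.trans ?_ h
      rw [ContinuousLinearMap.sum_apply]
      refine Finset.sum_congr rfl fun i _ => ?_
      rw [ContinuousLinearMap.add_apply, sub_sub_cancel]
    have hae : ∀ᵐ x : En n, ∀ j : I, A j f x = (∑ i ∈ I, ((V (j - i) i).op f x +
        if (j : ℤ) < i then (hk.schur i).op f x else 0)) - (g x - (condKernel n j).op g x) := by
      rw [ae_all_iff]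
      intro j
      rw [hid]
      exact coeFn_sum_sub_ae I j (v := fun i => (V (j - i) i).clm f)
        (k := fun i => (hk.schur i).clm f) (fun i => (V (j - i) i).clm_ae f)
        (fun i => (hk.schur i).clm_ae f) g _ ((condKernel n j).clm_ae g)
    filter_upwards [hae, hS₁] with x hx hx₁
    have hcoe : (Icc (-N : ℤ) N) = ((I : Finset ℤ) : Set ℤ) := (Finset.coe_Icc _ _).symm
    rw [hcoe] at hx₁ ⊢
    refine (mul_jumpCount_le_of_perturb I _ (fun j => (condKernel n j).op g x) (g x) hμ).trans ?_
    have hsum : ∑ j ∈ I, ‖(∑ i ∈ I, ((V (j - i) i).op f x +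
        if (j : ℤ) < i then (hk.schur i).op f x else 0)) -
          (g x - (condKernel n j).op g x)‖ₑ ^ (2 : ℝ) = S₂ x ^ (2 : ℝ) := by
      rw [← Finset.sum_coe_sort]
      simp only [S₂]
      rw [← ENNReal.rpow_mul]
      norm_num
      refine Finset.sum_congr rfl fun j _ => ?_
      rw [hx j]
    rw [hsum]
    refine (add_le_add_left hx₁ _).trans ?_
    exact ENNReal.add_rpow_le_rpow_add _ _ one_le_two
  · refine (ENNReal.lintegral_Lp_add_le hS₁m hS₂m hp.le).trans ?_
    rw [add_mul]
    refine add_le_add ?_ ?_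
    · refine hS₁b.trans ?_
      rw [mul_assoc mc]
      refine mul_le_mul_right ?_ _
      exact hk.eLpNorm_sum_clm_le (contDiff_ringKernel hΩ contDiffOn_const) hP hn I hf hp
    · rw [lintegral_rpow_half_rpow]
      exact squareLp_scales_le (hC₁.add hC₂) hp hU N hf

end TruncatedJump

/-! ### Principal values -/

section PrincipalValue

variable {n : ℕ} {Ω : En n → ℝ}

lemma nullSingletonClass_volume (hn : 1 ≤ n) : NullSingletonClass (volume : Measure (En n)) := by
  have : Nonempty (Fin n) := ⟨⟨0, hn⟩⟩
  infer_instance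

lemma aestronglyMeasurable_czKernel (hn : 1 ≤ n) (hΩ : IsAngular Ω) :
    AEStronglyMeasurable (fun t : En n => (czKernel n Ω t : ℂ)) volume := by
  have := nullSingletonClass_volume hn
  have h : AEStronglyMeasurable Ω (volume.restrict ({0}ᶜ : Set (En n))) :=
    hΩ.contDiffOn.continuousOn.aestronglyMeasurable (measurableSet_singleton 0).compl
  rw [restrict_compl_singleton] at h
  refine Complex.continuous_ofReal.comp_aestronglyMeasurable ?_
  exact (h.aemeasurable.div (measurable_norm.pow_const n).aemeasurable).aestronglyMeasurable

lemma integrable_radial_majorant (hn : 1 ≤ n) :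
    Integrable fun t : En n => ‖t‖ / (1 + ‖t‖ ^ 2) * (‖t‖ ^ n)⁻¹ := by
  have : Nonempty (Fin n) := ⟨⟨0, hn⟩⟩
  refine (integrable_fun_norm_addHaar (volume : Measure (En n))
    (f := fun r : ℝ => r / (1 + r ^ 2) * (r ^ n)⁻¹)).2 ?_
  refine (integrable_inv_one_add_sq.integrableOn (s := Ioi 0)).congr_fun (fun r hr => ?_)
    measurableSet_Ioi
  obtain ⟨m, rfl⟩ := Nat.exists_eq_add_of_le hn
  have hr : 0 < r := hr
  have h1 : (1 + r ^ 2) ≠ 0 := by positivity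
  simp only [finrank_euclideanSpace, Fintype.card_fin, add_tsub_cancel_left, smul_eq_mul]
  field_simp
  ring

lemma norm_czKernel_le {W : ℝ} (hW : ∀ x, x ≠ 0 → |Ω x| ≤ W) {t : En n} (ht : t ≠ 0) :
    ‖(czKernel n Ω t : ℂ)‖ ≤ W * (‖t‖ ^ n)⁻¹ := by
  rw [Complex.norm_real, czKernel, norm_div, norm_pow, norm_norm, Real.norm_eq_abs, div_eq_mul_inv]
  exact mul_le_mul_of_nonneg_right (hW t ht) (by positivity)

/-- The radial part `c * cutoff ‖t‖` is removed from `w` so that its product with the kernel is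
integrable. -/
lemma integrable_regularized (hn : 1 ≤ n) (hΩ : IsAngular Ω) {w : En n → ℂ} (hw : Continuous w)
    {c : ℂ} {C : ℝ} (hC : ∀ t, ‖w t - c * cutoff ‖t‖‖ ≤ C * (‖t‖ / (1 + ‖t‖ ^ 2))) :
    Integrable fun t : En n => (w t - c * cutoff ‖t‖) * (czKernel n Ω t : ℂ) := by
  have := nullSingletonClass_volume hn
  obtain ⟨W, hW0, hW⟩ := hΩ.exists_bound
  refine ((integrable_radial_majorant hn).const_mul (C * W)).mono' ?_ ?_
  · refine Continuous.aestronglyMeasurable ?_ |>.mul (aestronglyMeasurable_czKernel hn hΩ)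
    exact hw.sub (continuous_const.mul (Complex.continuous_ofReal.comp
      (contDiff_cutoff.continuous.comp continuous_norm)))
  · filter_upwards [Measure.ae_ne volume (0 : En n)] with t ht
    rw [norm_mul]
    refine (mul_le_mul (hC t) (norm_czKernel_le hW ht) (norm_nonneg _)
      ((norm_nonneg _).trans (hC t))).trans (le_of_eq ?_)
    ring

lemma integrable_annular (hn : 1 ≤ n) (hΩ : IsAngular Ω) (c : ℂ) {η : ℝ → ℝ} (hη : Measurable η)
    (hη1 : ∀ r, |η r| ≤ 1) {δ : ℝ} (hδ : 0 < δ) (hηδ : ∀ r ≤ δ, η r = 0) :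
    Integrable fun t : En n => (c * cutoff ‖t‖ * η ‖t‖) * (czKernel n Ω t : ℂ) := by
  have := nullSingletonClass_volume hn
  obtain ⟨W, hW0, hW⟩ := hΩ.exists_bound
  have hb : Integrable ((closedBall (0 : En n) 2).indicator
      fun _ => ‖c‖ * (W * (δ ^ n)⁻¹)) :=
    (integrable_indicator_iff measurableSet_closedBall).2
      (integrableOn_const measure_closedBall_lt_top.ne)
  refine hb.mono' ?_ ?_
  · refine Measurable.aestronglyMeasurable ?_ |>.mul (aestronglyMeasurable_czKernel hn hΩ)
    have h1 : Measurable fun t : En n => (cutoff ‖t‖ : ℂ) :=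
      (Complex.continuous_ofReal.comp (contDiff_cutoff.continuous.comp continuous_norm)).measurable
    exact (h1.const_mul c).mul (Complex.measurable_ofReal.comp (hη.comp measurable_norm))
  · filter_upwards [Measure.ae_ne volume (0 : En n)] with t ht
    by_cases h2 : ‖t‖ ≤ 2
    · rw [indicator_of_mem (by simpa using h2)]
      rcases le_or_gt ‖t‖ δ with h | h
      · rw [hηδ _ h]
        simp only [Complex.ofReal_zero, mul_zero, zero_mul, norm_zero]
        positivity
      · rw [norm_mul, norm_mul, norm_mul, Complex.norm_real, Complex.norm_real]
        have h3 : ‖cutoff ‖t‖‖ ≤ 1 := by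
          rw [Real.norm_of_nonneg (cutoff_nonneg _)]; exact cutoff_le_one _
        have h4 : ‖(czKernel n Ω t : ℂ)‖ ≤ W * (δ ^ n)⁻¹ :=
          (norm_czKernel_le hW ht).trans (by gcongr)
        have h5 : ‖η ‖t‖‖ ≤ 1 := hη1 _
        have h6 : ‖c‖ * ‖cutoff ‖t‖‖ * ‖η ‖t‖‖ ≤ ‖c‖ * 1 * 1 := by gcongr
        rw [mul_one, mul_one] at h6
        gcongr
    · rw [indicator_of_notMem (by simpa using h2), cutoff_of_ge (not_le.1 h2).le]
      simp

lemma integral_weight_eq (hn : 1 ≤ n) (hΩ : IsAngular Ω) {w : En n → ℂ} (hw : Continuous w)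
    {c : ℂ} {C : ℝ} (hC : ∀ t, ‖w t - c * cutoff ‖t‖‖ ≤ C * (‖t‖ / (1 + ‖t‖ ^ 2)))
    {η : ℝ → ℝ} (hη : Measurable η)
    (hη1 : ∀ r, |η r| ≤ 1) {δ : ℝ} (hδ : 0 < δ) (hηδ : ∀ r ≤ δ, η r = 0) :
    ∫ t : En n, w t * η ‖t‖ * (czKernel n Ω t : ℂ) =
      ∫ t : En n, η ‖t‖ * ((w t - c * cutoff ‖t‖) * (czKernel n Ω t : ℂ)) := by
  have h1 := integrable_annular hn hΩ c hη hη1 hδ hηδ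
  have h2 : Integrable fun t : En n =>
      (η ‖t‖ : ℂ) * ((w t - c * cutoff ‖t‖) * (czKernel n Ω t : ℂ)) := by
    refine (integrable_regularized hn hΩ hw hC).bdd_mul (c := 1) ?_ ?_
    · exact (Complex.measurable_ofReal.comp (hη.comp measurable_norm)).aestronglyMeasurable
    · exact Eventually.of_forall fun t => by rw [Complex.norm_real]; exact hη1 _
  have h3 := integral_radial_mul_czKernel_eq_zero hn hΩ (G := fun r => c * cutoff r * η r) h1
  rw [← add_zero (∫ t : En n, (η ‖t‖ : ℂ) * _), ← h3, ← integral_add h2 h1]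
  refine integral_congr_ae (Eventually.of_forall fun t => ?_)
  ring

lemma tendsto_integral_weight (hn : 1 ≤ n) (hΩ : IsAngular Ω) {w : En n → ℂ} (hw : Continuous w)
    {c : ℂ} {C : ℝ} (hC : ∀ t, ‖w t - c * cutoff ‖t‖‖ ≤ C * (‖t‖ / (1 + ‖t‖ ^ 2)))
    {ι : Type*} {l : Filter ι} [l.IsCountablyGenerated] {η : ι → ℝ → ℝ} {δ : ι → ℝ}
    (hη : ∀ i, Measurable (η i)) (hη1 : ∀ i r, |η i r| ≤ 1) (hδ : ∀ᶠ i in l, 0 < δ i)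
    (hηδ : ∀ i, ∀ r ≤ δ i, η i r = 0) (hlim : ∀ r, 0 < r → Tendsto (fun i => η i r) l (𝓝 1)) :
    Tendsto (fun i => ∫ t : En n, w t * η i ‖t‖ * (czKernel n Ω t : ℂ)) l
      (𝓝 (∫ t : En n, (w t - c * cutoff ‖t‖) * (czKernel n Ω t : ℂ))) := by
  have := nullSingletonClass_volume hn
  have hW := integrable_regularized hn hΩ hw hC
  have h : Tendsto (fun i => ∫ t : En n, (η i ‖t‖ : ℂ) *
      ((w t - c * cutoff ‖t‖) * (czKernel n Ω t : ℂ))) l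
      (𝓝 (∫ t : En n, (w t - c * cutoff ‖t‖) * (czKernel n Ω t : ℂ))) := by
    refine tendsto_integral_filter_of_dominated_convergence _ ?_ ?_ hW.norm ?_
    · exact Eventually.of_forall fun i => (Complex.measurable_ofReal.comp
        ((hη i).comp measurable_norm)).aestronglyMeasurable.mul hW.aestronglyMeasurable
    · refine Eventually.of_forall fun i => Eventually.of_forall fun t => ?_
      rw [norm_mul _ (_ * _), Complex.norm_real]
      exact mul_le_of_le_one_left (norm_nonneg _) (hη1 i _)
    · filter_upwards [Measure.ae_ne volume (0 : En n)] with t ht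
      have h1 := (Complex.continuous_ofReal.tendsto 1).comp (hlim ‖t‖ (norm_pos_iff.2 ht))
      simpa using h1.mul_const ((w t - c * cutoff ‖t‖) * (czKernel n Ω t : ℂ))
  refine h.congr' ?_
  filter_upwards [hδ] with i hi
  exact (integral_weight_eq hn hΩ hw hC (hη i) (hη1 i) hi (hηδ i)).symm

lemma exists_regularized_bound (f : SchwartzMap (En n) ℂ) {α : ℝ} (hα : 1 < α) (u : ℝ) (x : En n) :
    ∃ C : ℝ, ∀ t : En n, ‖f (x - t) * osc α u ‖t‖ - f x * cutoff ‖t‖‖ ≤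
      C * (‖t‖ / (1 + ‖t‖ ^ 2)) := by
  obtain ⟨A, hA0, hA⟩ := f.decay 0 0
  obtain ⟨D, hD0, hD⟩ := f.decay 1 0
  obtain ⟨L, hL0, hL⟩ := f.decay 0 1
  simp only [pow_zero, one_mul, pow_one, norm_iteratedFDeriv_zero] at hA hD hL
  have hlip : ∀ t, ‖f (x - t) - f x‖ ≤ L * ‖t‖ := fun t => by
    have := Convex.norm_image_sub_le_of_norm_fderiv_le (𝕜 := ℝ) (f := f) (C := L) (s := univ)
      (fun y _ => f.differentiableAt) (fun y _ => by
        rw [← norm_iteratedFDeriv_one]; exact hL y) convex_univ (mem_univ x) (mem_univ (x - t))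
    simpa using this
  refine ⟨2 * (L + A * |u| + (A * ‖x‖ + D + 2 * A)), fun t => ?_⟩
  have hB : 0 ≤ A * ‖x‖ + D + 2 * A := by positivity
  have hE : 0 ≤ L + A * |u| := by positivity
  have ht0 := norm_nonneg t
  rw [← mul_div_assoc, le_div_iff₀ (by positivity)]
  rcases le_or_gt ‖t‖ 1 with h | h
  · rw [cutoff_of_le h, Complex.ofReal_one, mul_one]
    have e : f (x - t) * osc α u ‖t‖ - f x =
        (f (x - t) - f x) * osc α u ‖t‖ + f x * (osc α u ‖t‖ - 1) := by ring
    have h1 : ‖osc α u ‖t‖ - 1‖ ≤ |u| * ‖t‖ := by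
      refine (Real.norm_exp_I_mul_ofReal_sub_one_le).trans ?_
      rw [norm_mul, Real.norm_eq_abs, Real.norm_of_nonneg (by positivity)]
      refine mul_le_mul_of_nonneg_left ?_ (abs_nonneg _)
      calc ‖t‖ ^ α ≤ ‖t‖ ^ (1 : ℝ) := Real.rpow_le_rpow_of_exponent_ge' ht0 h zero_le_one hα.le
        _ = ‖t‖ := Real.rpow_one _
    have h2 : ‖f (x - t) * osc α u ‖t‖ - f x‖ ≤ (L + A * |u|) * ‖t‖ := by
      rw [e]
      refine (norm_add_le _ _).trans ?_
      rw [norm_mul, norm_mul, norm_osc, mul_one, add_mul, mul_assoc A]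
      exact add_le_add (hlip t) (mul_le_mul (hA x) h1 (norm_nonneg _) hA0.le)
    have h3 : 1 + ‖t‖ ^ 2 ≤ 2 := by nlinarith
    calc ‖f (x - t) * osc α u ‖t‖ - f x‖ * (1 + ‖t‖ ^ 2)
        ≤ ((L + A * |u|) * ‖t‖) * 2 := mul_le_mul h2 h3 (by positivity) (by positivity)
      _ ≤ _ := by nlinarith [mul_nonneg hB ht0]
  · have h1 : ‖f (x - t)‖ * ‖t‖ ≤ A * ‖x‖ + D := by
      have h4 : ‖t‖ ≤ ‖x‖ + ‖x - t‖ := by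
        have := norm_sub_le x (x - t)
        rwa [sub_sub_cancel] at this
      nlinarith [hA (x - t), hD (x - t), norm_nonneg (f (x - t)), norm_nonneg x]
    have h2 : ‖f x * cutoff ‖t‖‖ * ‖t‖ ≤ 2 * A := by
      rcases le_or_gt 2 ‖t‖ with h5 | h5
      · rw [cutoff_of_ge h5]
        simp only [Complex.ofReal_zero, mul_zero, norm_zero, zero_mul]
        positivity
      · rw [norm_mul, Complex.norm_real, Real.norm_of_nonneg (cutoff_nonneg _)]
        have h6 : ‖f x‖ * cutoff ‖t‖ ≤ A * 1 :=
          mul_le_mul (hA x) (cutoff_le_one _) (cutoff_nonneg _) hA0.le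
        nlinarith
    have h3 : ‖f (x - t) * osc α u ‖t‖ - f x * cutoff ‖t‖‖ * ‖t‖ ≤ A * ‖x‖ + D + 2 * A := by
      have h7 := norm_sub_le (f (x - t) * osc α u ‖t‖) (f x * cutoff ‖t‖)
      rw [norm_mul (f (x - t)), norm_osc, mul_one] at h7
      nlinarith
    set q := ‖f (x - t) * osc α u ‖t‖ - f x * cutoff ‖t‖‖
    have hq : 0 ≤ q := norm_nonneg _
    have h8 : 1 + ‖t‖ ^ 2 ≤ 2 * (‖t‖ * ‖t‖) := by nlinarith
    calc q * (1 + ‖t‖ ^ 2) ≤ q * (2 * (‖t‖ * ‖t‖)) := mul_le_mul_of_nonneg_left h8 hq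
      _ = 2 * (q * ‖t‖) * ‖t‖ := by ring
      _ ≤ 2 * (A * ‖x‖ + D + 2 * A) * ‖t‖ := by gcongr
      _ ≤ _ := by nlinarith [mul_nonneg hE ht0]

lemma continuous_mul_osc (f : SchwartzMap (En n) ℂ) {α : ℝ} (hα : 1 < α) (u : ℝ) (x : En n) :
    Continuous fun t : En n => f (x - t) * osc α u ‖t‖ := by
  refine (f.continuous.comp (continuous_const.sub continuous_id)).mul ?_
  unfold osc
  refine Complex.continuous_exp.comp (continuous_const.mul (Complex.continuous_ofReal.comp
    (continuous_const.mul (continuous_norm.rpow_const fun _ => Or.inr (by linarith)))))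

theorem tendsto_truncation_pvH (hn : 1 ≤ n) (hΩ : IsAngular Ω) (f : SchwartzMap (En n) ℂ) {α : ℝ}
    (hα : 1 < α) (u : ℝ) (x : En n) :
    Tendsto (fun N : ℕ => ∫ t : En n, f (x - t) * osc α u ‖t‖ *
      ((cutoff ((2 ^ N)⁻¹ * ‖t‖) - cutoff (2 ^ (N + 1) * ‖t‖) : ℝ) : ℂ) * (czKernel n Ω t : ℂ))
      atTop (𝓝 (pvH n α Ω f u x)) := by
  obtain ⟨C, hC⟩ := exists_regularized_bound f hα u x
  have hw := continuous_mul_osc f hα u x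
  have h1 : pvH n α Ω f u x = ∫ t : En n,
      (f (x - t) * osc α u ‖t‖ - f x * cutoff ‖t‖) * (czKernel n Ω t : ℂ) := by
    refine Tendsto.limUnder_eq ?_
    have h := tendsto_integral_weight hn hΩ hw hC (l := 𝓝[>] (0 : ℝ))
      (η := fun ε => (Ioi ε).indicator 1) (δ := id) (fun ε => measurable_one.indicator
        measurableSet_Ioi) (fun ε r => ?_) self_mem_nhdsWithin
      (fun ε r hr => indicator_of_notMem (by simpa using hr) _) fun r hr => ?_
    · refine h.congr fun ε => ?_
      rw [← integral_indicator (measurableSet_lt measurable_const measurable_norm)]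
      refine integral_congr_ae (Eventually.of_forall fun t => ?_)
      by_cases ht : ε < ‖t‖
      · have h2 : t ∈ {t : En n | ε < ‖t‖} := ht
        simp only [indicator_of_mem h2, indicator_of_mem (mem_Ioi.2 ht)]
        simp [osc, mul_assoc]
      · have h2 : t ∉ {t : En n | ε < ‖t‖} := ht
        simp [indicator_of_notMem h2, ht]
    · by_cases h : r ∈ Ioi ε
      · simp [indicator_of_mem h]
      · simp [indicator_of_notMem h]
    · refine tendsto_const_nhds.congr' ?_
      filter_upwards [mem_nhdsWithin_of_mem_nhds (Iio_mem_nhds hr)] with ε hε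
      have h9 : r ∈ Ioi ε := hε
      simp [indicator_of_mem h9]
  rw [h1]
  refine tendsto_integral_weight hn hΩ hw hC
    (η := fun N r => cutoff ((2 ^ N)⁻¹ * r) - cutoff (2 ^ (N + 1) * r))
    (δ := fun N => (2 ^ (N + 1))⁻¹) (fun N => ?_) (fun N r => ?_)
    (Eventually.of_forall fun N => by positivity) (fun N r hr => ?_) fun r hr => ?_
  · have hc := contDiff_cutoff.continuous
    exact ((hc.comp (continuous_const.mul continuous_id)).sub
      (hc.comp (continuous_const.mul continuous_id))).measurable
  · rw [abs_le]
    constructor <;> linarith [cutoff_nonneg ((2 ^ N)⁻¹ * r), cutoff_nonneg (2 ^ (N + 1) * r),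
      cutoff_le_one ((2 ^ N)⁻¹ * r), cutoff_le_one (2 ^ (N + 1) * r)]
  · have h2 : 2 ^ (N + 1) * r ≤ 1 := by
      have := mul_le_mul_of_nonneg_left hr (by positivity : (0 : ℝ) ≤ 2 ^ (N + 1))
      rwa [mul_inv_cancel₀ (by positivity)] at this
    have h3 : (2 ^ N : ℝ)⁻¹ * r ≤ 1 := by
      rcases le_or_gt r 0 with h0 | h0
      · exact (mul_nonpos_of_nonneg_of_nonpos (by positivity) h0).trans zero_le_one
      · have h4 : (2 ^ N : ℝ)⁻¹ ≤ 2 ^ (N + 1) :=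
          (inv_le_one_of_one_le₀ (one_le_pow₀ one_le_two)).trans (one_le_pow₀ one_le_two)
        nlinarith
    simp only [cutoff_of_le h2, cutoff_of_le h3, sub_self]
  · refine tendsto_const_nhds.congr' ?_
    have hp : Tendsto (fun N : ℕ => (2 : ℝ) ^ N) atTop atTop :=
      tendsto_pow_atTop_atTop_of_one_lt one_lt_two
    filter_upwards [hp.eventually_ge_atTop r, hp.eventually_ge_atTop r⁻¹] with N h5 h6
    rw [cutoff_of_le, cutoff_of_ge, sub_zero]
    · have h7 : 1 ≤ 2 ^ N * r := by
        have := mul_le_mul_of_nonneg_right h6 hr.le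
        rwa [inv_mul_cancel₀ hr.ne'] at this
      rw [pow_succ]
      linarith
    · rw [inv_mul_le_iff₀ (by positivity), mul_one]
      exact h5

end PrincipalValue

/-! ### The dyadic jump inequality -/

section DyadicJump

variable {n : ℕ} {Ω : En n → ℝ}

lemma dilate_ringKernel_one (hΩ : IsAngular Ω) (i : ℤ) (t : En n) :
    dilate (ringKernel Ω fun _ => 1) i t = (bump (2 ^ i * ‖t‖) : ℂ) * (czKernel n Ω t : ℂ) := by
  have h2 : (0 : ℝ) < 2 ^ i := by positivity
  have h3 := cubeDensity_pos n i
  have h1 : czKernel n Ω ((2 : ℝ) ^ i • t) = (cubeDensity n i)⁻¹ * czKernel n Ω t := by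
    rw [czKernel, czKernel, hΩ.homogeneous _ h2, norm_smul, Real.norm_of_nonneg h2.le, mul_pow,
      ← cubeDensity]
    rw [div_mul_eq_div_div, div_right_comm, inv_mul_eq_div]
  have h4 : (cubeDensity n i : ℂ) ≠ 0 := by exact_mod_cast h3.ne'
  rw [dilate, ringKernel, h1, norm_smul, Real.norm_of_nonneg h2.le]
  push_cast
  field_simp

lemma osc_scale (α : ℝ) (i j : ℤ) {r : ℝ} (hr : 0 ≤ r) :
    osc α (2 ^ (((j - i : ℤ) : ℝ) * α)) (2 ^ i * r) = osc α (2 ^ ((j : ℝ) * α)) r := by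
  have h : (2 : ℝ) ^ (((j - i : ℤ) : ℝ) * α) * (2 ^ i * r) ^ α = 2 ^ ((j : ℝ) * α) * r ^ α := by
    rw [Real.mul_rpow (by positivity) hr, ← mul_assoc, ← Real.rpow_intCast, ← Real.rpow_mul (by
      norm_num), ← Real.rpow_add (by norm_num)]
    congr 2
    push_cast
    ring
  rw [osc, osc, h]

lemma dilate_oscPiece_add (α : ℝ) (i j : ℤ) (t : En n) :
    (dilate (oscPiece Ω α (j - i)) i t +
      if j < i then dilate (ringKernel Ω fun _ => 1) i t else 0) =
      osc α (2 ^ ((j : ℝ) * α)) ‖t‖ * dilate (ringKernel Ω fun _ => 1) i t := by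
  have h2 : (0 : ℝ) < 2 ^ i := by positivity
  rw [dilate, dilate, oscPiece, oscProfile, ringKernel_eq, norm_smul, Real.norm_of_nonneg h2.le,
    osc_scale α i j (norm_nonneg t)]
  by_cases h : j < i
  · rw [if_pos h, if_pos (by omega)]
    push_cast
    ring
  · rw [if_neg h, if_neg (by omega)]
    push_cast
    ring

lemma integrable_dilate_mul {k : En n → ℂ} (hk : Continuous k) (hkc : HasCompactSupport k)
    {f : En n → ℂ} (hf : Continuous f) (i : ℤ) (x : En n) :
    Integrable fun t : En n => dilate k i t * f (x - t) := by
  have h2 : (2 : ℝ) ^ i ≠ 0 := by positivity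
  have hd : HasCompactSupport (dilate k i) := by
    have h : HasCompactSupport fun t : En n => k ((2 : ℝ) ^ i • t) := hkc.comp_smul h2
    exact h.mul_left
  refine Continuous.integrable_of_hasCompactSupport ?_ hd.mul_right
  exact (continuous_const.mul (hk.comp (continuous_const_smul ((2 : ℝ) ^ i)))).mul
    (hf.comp (continuous_const.sub continuous_id))

lemma SchurKernel.op_eq_of_dilate {κ : SchurKernel n} {k : En n → ℂ} {i : ℤ}
    (hκ : ∀ x y, κ.toFun x y = dilate k i (x - y)) (f : En n → ℂ) (x : En n) :
    κ.op f x = ∫ t, dilate k i t * f (x - t) := by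
  rw [SchurKernel.op, ← integral_sub_left_eq_self _ volume x]
  refine integral_congr_ae (Eventually.of_forall fun t => ?_)
  simp only [hκ, sub_sub_cancel]

lemma sum_op_eq_integral (hΩ : IsAngular Ω) {α : ℝ} (f : SchwartzMap (En n) ℂ)
    {V : ℤ → ℤ → SchurKernel n} {K : ℤ → SchurKernel n}
    (hV : ∀ m i x y, (V m i).toFun x y = dilate (oscPiece Ω α m) i (x - y))
    (hK : ∀ i x y, (K i).toFun x y = dilate (ringKernel Ω fun _ => 1) i (x - y))
    (N : ℕ) (j : ℤ) (x : En n) :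
    ∑ i ∈ Finset.Icc (-N : ℤ) N, ((V (j - i) i).op f x + if j < i then (K i).op f x else 0) =
      ∫ t : En n, f (x - t) * osc α (2 ^ ((j : ℝ) * α)) ‖t‖ *
        ((cutoff ((2 ^ N)⁻¹ * ‖t‖) - cutoff (2 ^ (N + 1) * ‖t‖) : ℝ) : ℂ) *
          (czKernel n Ω t : ℂ) := by
  have iV (i : ℤ) : Integrable fun t : En n => dilate (oscPiece Ω α (j - i)) i t * f (x - t) :=
    integrable_dilate_mul (contDiff_oscProfile hΩ _ _ _).continuous
      (hasCompactSupport_ringKernel Ω _) f.continuous i x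
  have iK (i : ℤ) : Integrable fun t : En n =>
      dilate (ringKernel Ω fun _ => 1) i t * f (x - t) :=
    integrable_dilate_mul (contDiff_ringKernel hΩ contDiffOn_const).continuous
      (hasCompactSupport_ringKernel Ω _) f.continuous i x
  have hpt (i : ℤ) (t : En n) : f (x - t) * osc α (2 ^ ((j : ℝ) * α)) ‖t‖ *
      (bump (2 ^ i * ‖t‖) : ℂ) * (czKernel n Ω t : ℂ) = (dilate (oscPiece Ω α (j - i)) i t +
        if j < i then dilate (ringKernel Ω fun _ => 1) i t else 0) * f (x - t) := by
    rw [dilate_oscPiece_add, dilate_ringKernel_one hΩ]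
    ring
  have hterm (i : ℤ) : ((V (j - i) i).op f x + if j < i then (K i).op f x else 0) =
      ∫ t : En n, f (x - t) * osc α (2 ^ ((j : ℝ) * α)) ‖t‖ * (bump (2 ^ i * ‖t‖) : ℂ) *
        (czKernel n Ω t : ℂ) := by
    simp only [hpt, (V (j - i) i).op_eq_of_dilate (hV (j - i) i), (K i).op_eq_of_dilate (hK i)]
    by_cases h : j < i
    · simp only [if_pos h, add_mul]
      rw [integral_add (iV i) (iK i)]
    · simp only [if_neg h, add_zero]
  have hInt (i : ℤ) : Integrable fun t : En n => f (x - t) * osc α (2 ^ ((j : ℝ) * α)) ‖t‖ *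
      (bump (2 ^ i * ‖t‖) : ℂ) * (czKernel n Ω t : ℂ) := by
    simp only [hpt]
    by_cases h : j < i
    · simp only [if_pos h, add_mul]
      exact (iV i).add (iK i)
    · simp only [if_neg h, add_zero]
      exact iV i
  simp only [hterm]
  rw [← integral_finsetSum _ fun i _ => hInt i]
  refine integral_congr_ae (Eventually.of_forall fun t => ?_)
  simp only
  rw [← sum_bump, ← Finset.sum_mul, ← Finset.mul_sum]
  push_cast
  rfl

lemma mul_jumpCount_le_liminf {lam : ℝ} {a : ℤ → ℂ} {b : ℕ → ℤ → ℂ}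
    (h : ∀ j, Tendsto (fun N => b N j) atTop (𝓝 (a j))) {c : ℝ≥0∞} {S : ℕ → ℝ≥0∞}
    (hS : ∀ N : ℕ, c * jumpCount lam (Icc (-N : ℤ) N) (b N) ≤ S N ^ (2 : ℝ)) :
    c * jumpCount lam univ a ≤ liminf S atTop ^ (2 : ℝ) := by
  simp only [jumpCount, ENNReal.mul_iSup]
  refine iSup_le fun m => iSup_le fun s => iSup_le fun t => iSup_le fun _ => iSup_le fun _ =>
    iSup_le fun hst => iSup_le fun hd => iSup_le fun hj => ?_
  rw [← ENNReal.rpow_inv_le_iff (by norm_num)]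
  have hmem (j : ℤ) : ∀ᶠ N : ℕ in atTop, j ∈ Icc (-N : ℤ) N := by
    filter_upwards [eventually_ge_atTop j.natAbs] with N hN
    rw [mem_Icc]
    omega
  refine le_liminf_of_le (by isBoundedDefault) ?_
  have hjump (i : Fin m) : ∀ᶠ N : ℕ in atTop, lam < ‖b N (t i) - b N (s i)‖ :=
    ((h (t i)).sub (h (s i))).norm.eventually_const_lt (hj i)
  filter_upwards [eventually_all.2 fun i => hmem (s i), eventually_all.2 fun i => hmem (t i),
    eventually_all.2 hjump] with N h1 h2 h3
  rw [ENNReal.rpow_inv_le_iff (by norm_num)]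
  exact (mul_le_mul_right (le_jumpCount h1 h2 hst hd h3) _).trans (hS N)

lemma jumpCount_eq_zero_or_one_le {ι : Type*} [LinearOrder ι] (lam : ℝ) (J : Set ι) (a : ι → ℂ) :
    jumpCount lam J a = 0 ∨ 1 ≤ jumpCount lam J a := by
  by_cases h : jumpCount lam J a = 0
  · exact Or.inl h
  refine Or.inr ?_
  by_contra! hlt
  refine h ?_
  rw [jumpCount]
  simp only [ENNReal.iSup_eq_zero]
  intro m s t hs ht hst hd hj
  have h1 := (le_jumpCount hs ht hst hd hj).trans_lt hlt
  have h2 : m < 1 := by exact_mod_cast h1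
  rw [Nat.lt_one_iff.1 h2, Nat.cast_zero]

lemma jumpCount_rpow_le {ι : Type*} [LinearOrder ι] (lam : ℝ) (J : Set ι) (a : ι → ℂ) {r : ℝ}
    (hr : 2 ≤ r) : jumpCount lam J a ^ (1 / r) ≤ jumpCount lam J a ^ (1 / 2 : ℝ) := by
  rcases jumpCount_eq_zero_or_one_le lam J a with h | h
  · rw [h, ENNReal.zero_rpow_of_pos (by positivity)]
    exact zero_le
  · exact ENNReal.rpow_le_rpow_of_exponent_le h (by gcongr)

lemma lintegral_liminf_rpow_le {S : ℕ → En n → ℝ≥0∞} (hS : ∀ N, AEMeasurable (S N)) {p : ℝ}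
    (hp : 0 < p) {B : ℝ≥0∞} (hB : ∀ N, (∫⁻ x, S N x ^ p) ^ (1 / p) ≤ B) :
    (∫⁻ x, liminf (fun N => S N x) atTop ^ p) ^ (1 / p) ≤ B := by
  rw [one_div, ENNReal.rpow_inv_le_iff hp]
  have h1 (x : En n) : liminf (fun N => S N x) atTop ^ p = liminf (fun N => S N x ^ p) atTop :=
    (ENNReal.monotone_rpow_of_nonneg hp.le).map_liminf_of_continuousAt _
      ENNReal.continuous_rpow_const.continuousAt
  simp only [h1]
  refine (lintegral_liminf_le' fun N => (hS N).pow_const p).trans ?_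
  refine (liminf_le_liminf (v := fun _ => B ^ p) (Eventually.of_forall fun N => ?_)).trans
    (liminf_const _).le
  have h2 := hB N
  rwa [one_div, ENNReal.rpow_inv_le_iff hp] at h2

end DyadicJump

theorem statement3 (n : ℕ) (hn : 1 ≤ n) (α : ℝ) (hα : 1 < α)
    (Ω : En n → ℝ) (hΩsmooth : ContDiffOn ℝ (⊤ : ℕ∞) Ω {x : En n | x ≠ 0})
    (hΩhom : ∀ c : ℝ, 0 < c → ∀ x : En n, Ω (c • x) = Ω x)
    (hΩmean : ∫ x : sphere (0 : En n) 1, Ω x ∂((volume : Measure (En n)).toSphere) = 0)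
    (p r : ℝ) (hp1 : 1 < p) (hr : 2 ≤ r) :
    ∃ C : ℝ≥0, ∀ f : SchwartzMap (En n) ℂ, ∀ lam : ℝ, 0 < lam →
      (∫⁻ x : En n,
          (ENNReal.ofReal lam *
            (jumpCount (lam / 3) Set.univ
                fun j : ℤ => pvH n α Ω f ((2 : ℝ) ^ ((j : ℝ) * α)) x) ^ (1 / r)) ^ p) ^ (1 / p) ≤
        C * eLpNorm (fun x => f x) (ENNReal.ofReal p) volume := by
  have hΩ : IsAngular Ω := ⟨hΩsmooth, hΩhom, hΩmean⟩
  have hp0 : 0 < p := by linarith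
  obtain ⟨V, K, hV, hK, C, hC, hbound⟩ := exists_truncated_jump_bound hn hΩ hα hp1
  have hC' : 12 * C ≠ ∞ := by finiteness
  refine ⟨(12 * C).toNNReal, fun f lam hlam => ?_⟩
  rw [ENNReal.coe_toNNReal hC', mul_assoc]
  set F : L2 n ℂ := f.toLp 2 volume
  have hF : (F : En n → ℂ) =ᵐ[volume] f := f.coeFn_toLp 2 volume
  have hFi : Integrable (F : En n → ℂ) := f.integrable.congr hF.symm
  set μ := lam / 12 with hμ
  have hμ0 : 0 ≤ μ := by positivity
  have h4μ : 4 * μ = lam / 3 := by rw [hμ]; ring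
  choose S hSm hSae hSb using hbound F hFi μ hμ0
  rw [h4μ] at hSae
  rw [eLpNorm_congr_ae hF] at hSb
  have hpt : ∀ᵐ x : En n, ENNReal.ofReal lam * (jumpCount (lam / 3) Set.univ
      fun j : ℤ => pvH n α Ω f ((2 : ℝ) ^ ((j : ℝ) * α)) x) ^ (1 / r) ≤
        12 * liminf (fun N => S N x) atTop := by
    filter_upwards [ae_all_iff.2 hSae] with x hx
    have hx' := mul_jumpCount_le_liminf (a := fun j : ℤ => pvH n α Ω f (2 ^ ((j : ℝ) * α)) x)
      (fun j => (tendsto_truncation_pvH hn hΩ f hα (2 ^ ((j : ℝ) * α)) x).congr fun N => by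
        rw [← sum_op_eq_integral hΩ f hV hK]) fun N => (by
          simpa only [SchurKernel.op_congr _ hF] using hx N)
    rw [← ENNReal.rpow_inv_le_iff (by norm_num), ENNReal.mul_rpow_of_nonneg _ _ (by norm_num),
      ENNReal.rpow_rpow_inv (by norm_num)] at hx'
    have hl : ENNReal.ofReal lam = 12 * ENNReal.ofReal μ := by
      rw [← ENNReal.ofReal_ofNat, ← ENNReal.ofReal_mul (by norm_num), hμ]
      congr 1
      ring
    rw [hl, mul_assoc]
    refine mul_le_mul_right (le_trans ?_ hx') _
    refine mul_le_mul_right ((jumpCount_rpow_le _ _ _ hr).trans_eq ?_) _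
    norm_num
  calc (∫⁻ x : En n, (ENNReal.ofReal lam * (jumpCount (lam / 3) Set.univ
        fun j : ℤ => pvH n α Ω f ((2 : ℝ) ^ ((j : ℝ) * α)) x) ^ (1 / r)) ^ p) ^ (1 / p)
      ≤ (∫⁻ x : En n, 12 ^ p * liminf (fun N => S N x) atTop ^ p) ^ (1 / p) := by
        refine ENNReal.rpow_le_rpow (lintegral_mono_ae ?_) (by positivity)
        filter_upwards [hpt] with x hx
        rw [← ENNReal.mul_rpow_of_nonneg _ _ hp0.le]
        exact ENNReal.rpow_le_rpow hx hp0.le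
    _ = 12 * (∫⁻ x : En n, liminf (fun N => S N x) atTop ^ p) ^ (1 / p) := by
        rw [lintegral_const_mul' _ _ (by finiteness), ENNReal.mul_rpow_of_nonneg _ _ (by positivity),
          one_div, ENNReal.rpow_rpow_inv hp0.ne']
    _ ≤ 12 * (C * eLpNorm (fun x => f x) (ENNReal.ofReal p) volume) :=
        mul_le_mul_right (lintegral_liminf_rpow_le hSm hp0 hSb) _

end
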